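/- Let θ ∈ ℝ and let L^1, L^2, L^3 be the three equally spaced rays with direction angles θ, θ + 2π/3 and θ + 4π/3. Let f be a transcendental meromorphic function on ℂ, and suppose there exist distinct values a_1, a_2, a_3 ∈ ℂ ∪ {∞} such that for each j ∈ {1,2,3} all but finitely many a_j-points of f lie on L^j. Then the order of f equals 3/2. -/

import Mathlib

open Complex Filter Set Topology

noncomputable section

/-- The open ray emanating from the origin with direction angle `θ`. -/
def Ray (θ : ℝ) : Set ℂ :=
  {z : ℂ | ∃ t : ℝ, 0 < t ∧ z = (t : ℂ) * Complex.exp ((θ : ℂ) * Complex.I)}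

/-- `f` is meromorphic on the open set `U` with pole set `P`. -/
def MeromOn (f : ℂ → ℂ) (P : Set ℂ) (U : Set ℂ) : Prop :=
  P ⊆ U ∧ AnalyticOnNhd ℂ f (U \ P) ∧
    (∀ p ∈ P, Tendsto (fun z => ‖f z‖) (𝓝[≠] p) atTop) ∧
    ∀ z ∈ U, ¬ AccPt z (𝓟 P)

/-- `f` (meromorphic on `ℂ` with pole set `P`) is a rational function. -/
def IsRationalFn (f : ℂ → ℂ) (P : Set ℂ) : Prop :=
  ∃ p q : Polynomial ℂ, q ≠ 0 ∧ ∀ z ∉ P, q.eval z ≠ 0 → f z = p.eval z / q.eval z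

/-- The set of `a`-points of a meromorphic function `f` with pole set `P`, where
`a : Option ℂ` is a point of the Riemann sphere (`Option.none` being `∞`). -/
def aPoints (f : ℂ → ℂ) (P : Set ℂ) : Option ℂ → Set ℂ
  | Option.some a => {z : ℂ | z ∉ P ∧ f z = a}
  | Option.none => P

/-- The order of the pole of `f` at `z`: the least `m` such that near `z` (punctured),
`f = h / (· - z)^m` with `h` analytic and nonvanishing at `z`. -/
def poleOrder (f : ℂ → ℂ) (z : ℂ) : ℕ :=
  sInf {m : ℕ | ∃ h : ℂ → ℂ, AnalyticAt ℂ h z ∧ h z ≠ 0 ∧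
    ∀ᶠ w in 𝓝[≠] z, f w = h w / (w - z) ^ m}

/-- The number of poles of `f` of modulus at most `t`, counted with multiplicity. -/
def nPoles (f : ℂ → ℂ) (P : Set ℂ) (t : ℝ) : ℝ :=
  ∑ᶠ z ∈ {z : ℂ | ‖z‖ ≤ t ∧ z ∈ P}, (poleOrder f z : ℝ)

/-- The integrated counting function `N(r, f)` of the poles of `f`. -/
def NPoles (f : ℂ → ℂ) (P : Set ℂ) (r : ℝ) : ℝ :=
  (∫ t in (0:ℝ)..r, (nPoles f P t - nPoles f P 0) / t) + nPoles f P 0 * Real.log r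

/-- The Nevanlinna proximity function `m(r, f)`. -/
def mProx (f : ℂ → ℂ) (r : ℝ) : ℝ :=
  (2 * Real.pi)⁻¹ *
    ∫ θ in (0:ℝ)..(2 * Real.pi), Real.log (max 1 ‖f ((r : ℂ) * Complex.exp ((θ : ℂ) * Complex.I))‖)

/-- The Nevanlinna characteristic `T(r, f) = m(r, f) + N(r, f)`. -/
def Tchar (f : ℂ → ℂ) (P : Set ℂ) (r : ℝ) : ℝ := mProx f r + NPoles f P r

/-- The order `ρ(f) = limsup_{r → ∞} log T(r, f) / log r` of a meromorphic function. -/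
def meromOrder (f : ℂ → ℂ) (P : Set ℂ) : EReal :=
  Filter.limsup (fun r : ℝ => ((Real.log (Tchar f P r) / Real.log r : ℝ) : EReal)) Filter.atTop

/-! ### Section 1 -/

/-- analytic logarithm on convex open sets -/
lemma exists_log_convex {U : Set ℂ} (hU : IsOpen U) (hc : Convex ℝ U) (hne : U.Nonempty)
    {g : ℂ → ℂ} (hg : DifferentiableOn ℂ g U) (h0 : ∀ z ∈ U, g z ≠ 0) :
    ∃ V : ℂ → ℂ, DifferentiableOn ℂ V U ∧ ∀ z ∈ U, cexp (V z) = g z := by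
  have hsc : IsSimplyConnected U := by
    have : ContractibleSpace U := hc.contractibleSpace hne
    have : SimplyConnectedSpace U := inferInstance
    exact this
  obtain ⟨V, hVc, hV⟩ := exists_continuousOn_eqOn_exp_comp hsc hU hg.continuousOn
    (by rintro ⟨z, hz, h⟩; exact h0 z hz h)
  refine ⟨V, ?_, fun z hz => hV hz⟩
  intro z hz
  apply DifferentiableAt.differentiableWithinAt
  have hVz : ContinuousAt V z := hVc.continuousAt (hU.mem_nhds hz)
  have hgz : DifferentiableAt ℂ g z := hg.differentiableAt (hU.mem_nhds hz)
  have hev : ∀ᶠ w in 𝓝 z, V w = V z + Complex.log (g w / g z) := by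
    have h1 : ∀ᶠ w in 𝓝 z, ‖V w - V z‖ < 1 := by
      have := hVz.sub (continuousAt_const (y := V z))
      have h2 := this.norm
      apply h2.eventually_lt_const
      simp
    filter_upwards [h1, hU.mem_nhds hz] with w hw hwU
    have e1 : cexp (V w) = g w := hV hwU
    have e2 : cexp (V z) = g z := hV hz
    rw [← e1, ← e2, ← Complex.exp_sub, Complex.log_exp]
    · ring
    · have := (abs_le.1 (Complex.abs_im_le_norm (V w - V z))).1
      linarith [Real.pi_gt_three]
    · have := (abs_le.1 (Complex.abs_im_le_norm (V w - V z))).2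
      linarith [Real.pi_gt_three]
  have : DifferentiableAt ℂ (fun w => V z + Complex.log (g w / g z)) z := by
    apply DifferentiableAt.const_add
    apply DifferentiableAt.clog
    · exact hgz.div_const _
    · rw [div_self (h0 z hz)]; exact Complex.one_mem_slitPlane
  exact this.congr_of_eventuallyEq hev

/-- Bloch's theorem -/
lemma bloch {h : ℂ → ℂ} {z₀ : ℂ} {d B : ℝ} (hd : 0 < d) (hB : 0 < B)
    (hh : DifferentiableOn ℂ h (Metric.ball z₀ d))
    (hom : ∀ w : ℂ, ∃ w', ‖w' - w‖ < B ∧ w' ∉ h '' Metric.ball z₀ d) :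
    ‖deriv h z₀‖ ≤ 64 * B / d := by
  have key : ∀ ρ : ℝ, 0 < ρ → ρ < d → ‖deriv h z₀‖ ≤ 64 * B / ρ := by
    intro ρ hρ hρd
    have hsub : Metric.closedBall z₀ ρ ⊆ Metric.ball z₀ d := Metric.closedBall_subset_ball hρd
    have hdh : DifferentiableOn ℂ (deriv h) (Metric.ball z₀ d) := hh.deriv Metric.isOpen_ball
    have hcont : ContinuousOn (fun z => (ρ - dist z z₀) * ‖deriv h z‖) (Metric.closedBall z₀ ρ) := by
      apply ContinuousOn.mul
      · fun_prop
      · exact (hdh.continuousOn.mono hsub).norm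
    obtain ⟨z₁, hz₁, hmax⟩ := (isCompact_closedBall z₀ ρ).exists_isMaxOn
      ⟨z₀, Metric.mem_closedBall_self hρ.le⟩ hcont
    set M := ‖deriv h z₁‖ with hM
    have h0 : ρ * ‖deriv h z₀‖ ≤ (ρ - dist z₁ z₀) * M := by
      have := hmax (Metric.mem_closedBall_self hρ.le)
      simpa using this
    by_contra hcon
    push Not at hcon
    rw [div_lt_iff₀ hρ] at hcon
    have hpos : 0 < (ρ - dist z₁ z₀) * M := by nlinarith
    have hz1' : dist z₁ z₀ ≤ ρ := hz₁
    have hMpos : 0 < M := by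
      rcases lt_or_eq_of_le (norm_nonneg (deriv h z₁)) with h | h
      · exact h
      · rw [hM, ← h] at hpos; simp at hpos
    have hρ1 : 0 < ρ - dist z₁ z₀ := by
      by_contra hneg; push Not at hneg; nlinarith
    set r := (ρ - dist z₁ z₀) / 2 with hr
    have hrpos : 0 < r := by positivity
    have hballsub : Metric.ball z₁ r ⊆ Metric.closedBall z₀ ρ := by
      intro z hz
      have := dist_triangle z z₁ z₀
      have hz' : dist z z₁ < r := hz
      show dist z z₀ ≤ ρ
      linarith
    have hbound : ∀ z ∈ Metric.ball z₁ r, ‖deriv h z‖ ≤ 2 * M := by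
      intro z hz
      have hm := hmax (hballsub hz)
      have hz' : dist z z₁ < r := hz
      have ht := dist_triangle z z₁ z₀
      have h3 : r ≤ ρ - dist z z₀ := by linarith
      have hm' : (ρ - dist z z₀) * ‖deriv h z‖ ≤ 2 * r * M := by
        have : (ρ - dist z z₀) * ‖deriv h z‖ ≤ (ρ - dist z₁ z₀) * M := hm
        have e : ρ - dist z₁ z₀ = 2 * r := by rw [hr]; ring
        rwa [e] at this
      have h4 : r * ‖deriv h z‖ ≤ r * (2 * M) := by
        have := mul_le_mul_of_nonneg_right h3 (norm_nonneg (deriv h z))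
        linarith
      exact le_of_mul_le_mul_left h4 hrpos
    have hsub1 : Metric.ball z₁ r ⊆ Metric.ball z₀ d := hballsub.trans hsub
    have hdiffb : ∀ z ∈ Metric.ball z₁ r, ‖deriv h z - deriv h z₁‖ ≤ 4 * M / r * dist z z₁ := by
      intro z hz
      have := Complex.dist_le_div_mul_dist_of_mapsTo_ball (R₂ := 4 * M) (hdh.mono hsub1) (by
        intro w hw
        rw [mem_closedBall_iff_norm]
        calc ‖deriv h w - deriv h z₁‖ ≤ ‖deriv h w‖ + ‖deriv h z₁‖ := norm_sub_le _ _
          _ ≤ 2 * M + M := add_le_add (hbound w hw) le_rfl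
          _ ≤ 4 * M := by linarith) hz
      rwa [dist_eq_norm] at this
    set t := r / 8 with ht
    have htpos : 0 < t := by positivity
    have htr : t < r := by rw [ht]; linarith
    have hlow : ∀ z ∈ Metric.sphere z₁ t, M * t / 2 ≤ ‖h z - h z₁‖ := by
      intro z hz
      have hz' : ‖z - z₁‖ = t := by rwa [mem_sphere_iff_norm] at hz
      have hmv := Convex.norm_image_sub_le_of_norm_hasDerivWithin_le
        (f := fun w => h w - deriv h z₁ * w) (f' := fun w => deriv h w - deriv h z₁)
        (s := Metric.closedBall z₁ t) (x := z₁) (y := z) (C := M / 2) (by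
          intro w hw
          have hw' : w ∈ Metric.ball z₀ d := hsub1 (Metric.closedBall_subset_ball htr hw)
          have := (hh.differentiableAt (Metric.isOpen_ball.mem_nhds hw')).hasDerivAt
          have h5 := this.sub ((hasDerivAt_id w).const_mul (deriv h z₁))
          simp only [mul_one, id] at h5
          exact h5.hasDerivWithinAt) (by
          intro w hw
          have := hdiffb w (Metric.closedBall_subset_ball htr hw)
          have hw' : dist w z₁ ≤ t := hw
          calc _ ≤ 4 * M / r * dist w z₁ := this
            _ ≤ 4 * M / r * t := by gcongr
            _ = M / 2 := by rw [ht]; field_simp; norm_num) (convex_closedBall _ _)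
          (Metric.mem_closedBall_self htpos.le) (by
            rw [mem_closedBall_iff_norm]; exact hz'.le)
      have e : h z - h z₁ = deriv h z₁ * (z - z₁) +
          ((h z - deriv h z₁ * z) - (h z₁ - deriv h z₁ * z₁)) := by ring
      rw [e]
      have h6 := norm_sub_norm_le (deriv h z₁ * (z - z₁))
        (-((h z - deriv h z₁ * z) - (h z₁ - deriv h z₁ * z₁)))
      rw [sub_neg_eq_add, norm_neg, norm_mul, hz'] at h6
      rw [hz'] at hmv
      have : M * t / 2 = M * t - M/2 * t := by ring
      rw [this]
      linarith
    have hne : ∃ᶠ z in 𝓝 z₁, h z ≠ h z₁ := by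
      intro hc
      simp only [not_not] at hc
      have : deriv h z₁ = 0 := by
        have : h =ᶠ[𝓝 z₁] fun _ => h z₁ := hc
        rw [this.deriv_eq]; simp
      rw [hM, this] at hMpos; simp at hMpos
    have hcb : Metric.closedBall z₁ t ⊆ Metric.ball z₀ d :=
      (Metric.closedBall_subset_ball htr).trans hsub1
    have hcov := DiffContOnCl.ball_subset_image_closedBall (f := h) (z₀ := z₁) (r := t)
      (ε := M * t / 2) (by
        apply DifferentiableOn.diffContOnCl
        rw [closure_ball _ htpos.ne']
        exact hh.mono hcb) htpos hlow hne
    obtain ⟨w', hw', hw'2⟩ := hom (h z₁)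
    apply hw'2
    apply Set.image_mono hcb
    apply hcov
    rw [mem_ball_iff_norm]
    have : 64 * B < 2 * r * M := by
      have e : ρ - dist z₁ z₀ = 2 * r := by rw [hr]; ring
      rw [e] at h0; nlinarith
    have e2 : M * t / 2 / 2 = (2 * r * M) / 64 := by rw [ht]; ring
    rw [e2]; linarith
  have hlim : Tendsto (fun ρ : ℝ => 64 * B / ρ) (𝓝[<] d) (𝓝 (64 * B / d)) := by
    have : ContinuousAt (fun ρ : ℝ => 64 * B / ρ) d := by
      apply ContinuousAt.div <;> first | fun_prop | exact hd.ne'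
    exact this.tendsto.mono_left nhdsWithin_le_nhds
  apply ge_of_tendsto hlim
  have : Ioo 0 d ∈ 𝓝[<] d := Ioo_mem_nhdsLT hd
  filter_upwards [this] with ρ hρ
  exact key ρ hρ.1 hρ.2

/-- every real number is within 2 of a point where cosh is an odd integer -/
lemma exists_cosh_odd (x : ℝ) : ∃ x' : ℝ, |x' - x| ≤ 2 ∧ ∃ n : ℤ, Real.cosh x' = 2 * n + 1 := by
  have pos : ∀ x : ℝ, 0 ≤ x → ∃ x' : ℝ, |x' - x| ≤ 2 ∧ ∃ n : ℤ, Real.cosh x' = 2 * n + 1 := by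
    intro x hx
    have hs1 : 1 ≤ Real.sinh 1 := Real.self_le_sinh_iff.2 (by norm_num)
    have hs2 : 1 ≤ Real.sinh (x + 1) := hs1.trans (Real.sinh_le_sinh.2 (by linarith))
    have hgap : Real.cosh (x + 2) - Real.cosh x ≥ 2 := by
      have e1 : Real.cosh (x + 2) = Real.cosh (x + 1) * Real.cosh 1 + Real.sinh (x + 1) * Real.sinh 1 := by
        rw [← Real.cosh_add]; ring_nf
      have e2 : Real.cosh x = Real.cosh (x + 1) * Real.cosh 1 - Real.sinh (x + 1) * Real.sinh 1 := by
        rw [← Real.cosh_sub]; ring_nf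
      nlinarith
    set n : ℤ := ⌈(Real.cosh x - 1) / 2⌉
    have h1 : (Real.cosh x - 1) / 2 ≤ n := Int.le_ceil _
    have h2 : (n : ℝ) < (Real.cosh x - 1) / 2 + 1 := Int.ceil_lt_add_one _
    have := intermediate_value_Icc (by linarith : x ≤ x + 2) Real.continuous_cosh.continuousOn
    obtain ⟨x', hx', he⟩ := this (show (2 * n + 1 : ℝ) ∈ Icc (Real.cosh x) (Real.cosh (x+2)) from
      ⟨by linarith, by linarith⟩)
    refine ⟨x', ?_, n, he⟩
    rw [abs_le]; constructor <;> linarith [hx'.1, hx'.2]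
  rcases le_total 0 x with h | h
  · exact pos x h
  · obtain ⟨x', h1, n, h2⟩ := pos (-x) (by linarith)
    refine ⟨-x', ?_, n, by rw [Real.cosh_neg]; exact h2⟩
    rw [abs_le] at h1 ⊢; constructor <;> linarith [h1.1, h1.2]

lemma exists_omit (w : ℂ) : ∃ w' : ℂ, ‖w' - w‖ < 5 ∧ ∃ n : ℤ, Complex.cosh w' = 2 * n + 1 := by
  obtain ⟨x', hx', n, hn⟩ := exists_cosh_odd w.re
  set m : ℤ := round (w.im / Real.pi)
  have hm : |w.im / Real.pi - m| ≤ 1/2 := abs_sub_round _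
  have hm' : |(m : ℝ) * Real.pi - w.im| ≤ 2 := by
    have hp := Real.pi_pos
    have : (m : ℝ) * Real.pi - w.im = -((w.im / Real.pi - m) * Real.pi) := by field_simp; ring
    rw [this, abs_neg, abs_mul, abs_of_pos hp]
    nlinarith [Real.pi_lt_four]
  refine ⟨x' + m * Real.pi * I, ?_, ?_⟩
  · have := Complex.norm_le_abs_re_add_abs_im ((x' + m * Real.pi * I : ℂ) - w)
    simp at this
    have e : ‖(x' + m * Real.pi * I : ℂ) - w‖ ≤ 2 + 2 := this.trans (add_le_add hx' hm')
    linarith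
  · have hc : Complex.cosh (x' + m * Real.pi * I) = (-1) ^ m * Complex.cosh x' := by
      have hcos : Complex.cos (m * Real.pi) = (-1) ^ m := by
        have := Real.cos_int_mul_pi m
        have h2 : ((Real.cos (m * Real.pi) : ℝ) : ℂ) = (((-1 : ℝ) ^ m : ℝ) : ℂ) := by rw [this]
        push_cast at h2
        exact h2
      rw [Complex.cosh_add, Complex.cosh_mul_I, Complex.sinh_mul_I, Complex.sin_int_mul_pi, hcos]
      ring
    have hx : Complex.cosh x' = 2 * n + 1 := by
      rw [← Complex.ofReal_cosh, hn]; push_cast; ring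
    rw [hc, hx]
    rcases Int.even_or_odd m with h | h
    · exact ⟨n, by rw [h.neg_one_zpow]; ring⟩
    · exact ⟨-n - 1, by rw [h.neg_one_zpow]; push_cast; ring⟩

/-- Landau type estimate: an analytic function omitting `2πiℤ` -/
lemma landau {V : ℂ → ℂ} {z₀ : ℂ} {d : ℝ} (hd : 0 < d)
    (hV : DifferentiableOn ℂ V (Metric.ball z₀ d))
    (hom : ∀ z ∈ Metric.ball z₀ d, cexp (V z) ≠ 1) :
    ‖deriv V z₀‖ ≤ 6000 * Real.sqrt (1 + (V z₀).re ^ 2) / d := by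
  have hpi := Real.pi_pos
  have hpic : (Real.pi : ℂ) ≠ 0 := by exact_mod_cast hpi.ne'
  have hz₀ : z₀ ∈ Metric.ball z₀ d := Metric.mem_ball_self hd
  -- normalise
  set n : ℤ := round ((V z₀).im / (2 * Real.pi))
  have hn : |(V z₀).im / (2 * Real.pi) - n| ≤ 1/2 := abs_sub_round _
  have hn' : |(V z₀).im - n * (2 * Real.pi)| ≤ Real.pi := by
    have : (V z₀).im - n * (2 * Real.pi) = ((V z₀).im / (2 * Real.pi) - n) * (2 * Real.pi) := by
      field_simp
    rw [this, abs_mul, abs_of_pos (by positivity : 0 < 2 * Real.pi)]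
    nlinarith
  set W : ℂ → ℂ := fun z => V z - n * (2 * Real.pi * I)
  have hW : DifferentiableOn ℂ W (Metric.ball z₀ d) := hV.sub_const _
  have hWe : ∀ z, cexp (W z) = cexp (V z) := by
    intro z
    have := Complex.exp_periodic.sub_int_mul_eq (x := V z) n
    exact this
  set K : ℂ → ℂ := fun z => W z / (Real.pi * I) - 1
  have hK : DifferentiableOn ℂ K (Metric.ball z₀ d) := (hW.div_const _).sub_const _
  have hKom : ∀ z ∈ Metric.ball z₀ d, ∀ j : ℤ, K z ≠ 2 * j + 1 := by
    intro z hz j hj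
    apply hom z hz
    rw [← hWe]
    have : W z = (j + 1 : ℤ) * (2 * Real.pi * I) := by
      have e : W z = (K z + 1) * (Real.pi * I) := by
        simp only [K]; field_simp; ring
      rw [e, hj]; push_cast; ring
    rw [this, Complex.exp_int_mul_two_pi_mul_I]
  have hconv := convex_ball z₀ d
  obtain ⟨l, hl, hle⟩ := exists_log_convex Metric.isOpen_ball hconv ⟨z₀, hz₀⟩
    (g := fun z => K z ^ 2 - 1) ((hK.pow 2).sub_const _) (by
      intro z hz h
      have : (K z - 1) * (K z + 1) = 0 := by linear_combination h
      rcases mul_eq_zero.1 this with h1 | h1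
      · apply hKom z hz 0; push_cast; linear_combination h1
      · apply hKom z hz (-1); push_cast; linear_combination h1)
  set c : ℂ → ℂ := fun z => cexp (l z / 2)
  have hc : DifferentiableOn ℂ c (Metric.ball z₀ d) := (hl.div_const _).cexp
  have hc2 : ∀ z ∈ Metric.ball z₀ d, c z ^ 2 = K z ^ 2 - 1 := by
    intro z hz
    rw [← hle z hz]; simp only [c]; rw [← Complex.exp_nat_mul]; congr 1; push_cast; ring
  have hprod : ∀ z ∈ Metric.ball z₀ d, (K z + c z) * (K z - c z) = 1 := by
    intro z hz; linear_combination - (hc2 z hz)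
  obtain ⟨H, hH, hHe⟩ := exists_log_convex Metric.isOpen_ball hconv ⟨z₀, hz₀⟩
    (g := fun z => K z + c z) (hK.add hc) (by
      intro z hz h
      have := hprod z hz
      rw [h] at this; simp at this)
  have hcosh : ∀ z ∈ Metric.ball z₀ d, Complex.cosh (H z) = K z := by
    intro z hz
    have h1 := hprod z hz
    have h2 : cexp (-H z) = K z - c z := by
      rw [Complex.exp_neg, hHe z hz]
      exact (eq_inv_of_mul_eq_one_right h1).symm
    rw [Complex.cosh, hHe z hz, h2]; ring
  have hbl := bloch (B := 5) hd (by norm_num) hH (by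
    intro w
    obtain ⟨w', h1, j, h2⟩ := exists_omit w
    refine ⟨w', h1, ?_⟩
    rintro ⟨z, hz, rfl⟩
    exact hKom z hz j ((hcosh z hz).symm.trans h2))
  have hVW : V =ᶠ[𝓝 z₀] fun z => (Complex.cosh (H z) + 1) * (Real.pi * I) + n * (2 * Real.pi * I) := by
    filter_upwards [Metric.isOpen_ball.mem_nhds hz₀] with z hz
    rw [hcosh z hz]
    simp only [K, W]; field_simp; ring
  have hHd := (hH.differentiableAt (Metric.isOpen_ball.mem_nhds hz₀)).hasDerivAt
  have hder : deriv V z₀ = Complex.sinh (H z₀) * deriv H z₀ * (Real.pi * I) := by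
    rw [hVW.deriv_eq]
    exact (((hHd.ccosh.add_const 1).mul_const _).add_const _).deriv
  have hKn : ‖K z₀‖ ≤ (|(V z₀).re| + Real.pi) / Real.pi + 1 := by
    have h1 : ‖W z₀‖ ≤ |(V z₀).re| + Real.pi := by
      have := Complex.norm_le_abs_re_add_abs_im (W z₀)
      have e1 : (W z₀).re = (V z₀).re := by simp [W]
      have e2 : (W z₀).im = (V z₀).im - n * (2 * Real.pi) := by simp [W]
      rw [e1, e2] at this
      linarith
    calc ‖K z₀‖ ≤ ‖W z₀ / (Real.pi * I)‖ + ‖(1:ℂ)‖ := norm_sub_le _ _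
      _ = ‖W z₀‖ / Real.pi + 1 := by
        rw [norm_div, norm_mul, Complex.norm_I, Complex.norm_real, Real.norm_of_nonneg hpi.le]; simp
      _ ≤ _ := by gcongr
  have hsinh : ‖Complex.sinh (H z₀)‖ ≤ ‖K z₀‖ + 1 := by
    have h1 : Complex.sinh (H z₀) ^ 2 = K z₀ ^ 2 - 1 := by
      rw [← hcosh z₀ hz₀]; have := Complex.cosh_sq (H z₀); linear_combination -this
    have h2 : ‖Complex.sinh (H z₀)‖ ^ 2 ≤ (‖K z₀‖ + 1) ^ 2 := by
      rw [← norm_pow, h1]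
      calc ‖K z₀ ^ 2 - 1‖ ≤ ‖K z₀ ^ 2‖ + ‖(1:ℂ)‖ := norm_sub_le _ _
        _ = ‖K z₀‖ ^ 2 + 1 := by simp
        _ ≤ _ := by nlinarith [norm_nonneg (K z₀)]
    exact le_of_sq_le_sq h2 (by positivity)
  have hfin : ‖deriv V z₀‖ ≤ ((|(V z₀).re| + 3 * Real.pi)) * (64 * 5 / d) := by
    rw [hder, norm_mul, norm_mul, norm_mul, Complex.norm_I, Complex.norm_real,
      Real.norm_of_nonneg hpi.le, mul_one]
    have h3 : ‖Complex.sinh (H z₀)‖ ≤ (|(V z₀).re| + Real.pi) / Real.pi + 1 + 1 := by linarith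
    calc ‖Complex.sinh (H z₀)‖ * ‖deriv H z₀‖ * Real.pi
        ≤ ((|(V z₀).re| + Real.pi) / Real.pi + 1 + 1) * (64 * 5 / d) * Real.pi := by gcongr
      _ = _ := by field_simp; ring
  have hs1 : 1 ≤ Real.sqrt (1 + (V z₀).re ^ 2) := by
    rw [Real.one_le_sqrt]; nlinarith [sq_nonneg (V z₀).re]
  have hs2 : |(V z₀).re| ≤ Real.sqrt (1 + (V z₀).re ^ 2) := by
    apply Real.abs_le_sqrt; linarith
  calc ‖deriv V z₀‖ ≤ _ := hfin
    _ ≤ (Real.sqrt (1 + (V z₀).re ^ 2) + 12 * Real.sqrt (1 + (V z₀).re ^ 2)) * (64 * 5 / d) := by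
      have : 3 * Real.pi ≤ 12 * Real.sqrt (1 + (V z₀).re ^ 2) := by nlinarith [Real.pi_lt_four]
      gcongr
    _ = 4160 * Real.sqrt (1 + (V z₀).re ^ 2) / d := by ring
    _ ≤ _ := by gcongr; norm_num

/-! ### Section 2 -/

/-- height of the `k`-th line -/
def Lk (k : ℤ) : ℝ := 2 * Real.pi * k / 3
/-- height of the center of the `k`-th strip -/
def ck (k : ℤ) : ℝ := 2 * Real.pi * k / 3 + Real.pi / 3
def Dk (s₀ : ℝ) (k : ℤ) : Set ℂ := {ζ | s₀ < ζ.re ∧ |ζ.im - Lk k| < 2 * Real.pi / 3}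
def Sk (s₀ : ℝ) (k : ℤ) : Set ℂ := {ζ | s₀ < ζ.re ∧ Lk k < ζ.im ∧ ζ.im < Lk (k + 1)}
def gg (v : ℂ) : ℝ := Real.sqrt (1 + v.re ^ 2)

structure LogData (V : ℤ → ℂ → ℂ) (s₀ : ℝ) : Prop where
  diff : ∀ k, DifferentiableOn ℂ (V k) (Dk s₀ k)
  rel : ∀ k, ∀ ζ ∈ Sk s₀ k, cexp (V k ζ) + cexp (-V (k + 1) ζ) = 1
  per : ∀ k ζ, V (k + 3) (ζ + 2 * Real.pi * I) = V k ζ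

lemma Lk_succ (k : ℤ) : Lk (k + 1) = Lk k + 2 * Real.pi / 3 := by
  simp only [Lk]; push_cast; ring

lemma ck_eq (k : ℤ) : ck k = Lk k + Real.pi / 3 := rfl
lemma ck_eq' (k : ℤ) : ck k = Lk (k + 1) - Real.pi / 3 := by rw [Lk_succ, ck_eq]; ring

lemma isOpen_Dk (s₀ : ℝ) (k : ℤ) : IsOpen (Dk s₀ k) := by
  apply IsOpen.inter
  · exact isOpen_lt continuous_const Complex.continuous_re
  · exact isOpen_lt ((Complex.continuous_im.sub continuous_const).abs) continuous_const

lemma isOpen_Sk (s₀ : ℝ) (k : ℤ) : IsOpen (Sk s₀ k) := by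
  apply IsOpen.inter
  · exact isOpen_lt continuous_const Complex.continuous_re
  · apply IsOpen.inter
    · exact isOpen_lt continuous_const Complex.continuous_im
    · exact isOpen_lt Complex.continuous_im continuous_const

lemma Sk_subset_Dk (s₀ : ℝ) (k : ℤ) : Sk s₀ k ⊆ Dk s₀ k := by
  rintro ζ ⟨h1, h2, h3⟩
  rw [Lk_succ] at h3
  exact ⟨h1, by rw [abs_lt]; constructor <;> linarith [Real.pi_pos]⟩

lemma Sk_subset_Dk' (s₀ : ℝ) (k : ℤ) : Sk s₀ k ⊆ Dk s₀ (k + 1) := by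
  rintro ζ ⟨h1, h2, h3⟩
  rw [Lk_succ] at h3
  exact ⟨h1, by rw [Lk_succ, abs_lt]; constructor <;> linarith [Real.pi_pos]⟩

lemma one_le_gg (v : ℂ) : 1 ≤ gg v := by
  rw [gg, Real.one_le_sqrt]; nlinarith [sq_nonneg v.re]
lemma gg_pos (v : ℂ) : 0 < gg v := lt_of_lt_of_le one_pos (one_le_gg v)
lemma abs_re_le_gg (v : ℂ) : |v.re| ≤ gg v := by
  apply Real.abs_le_sqrt; linarith
lemma gg_le (v : ℂ) : gg v ≤ 1 + |v.re| := by
  rw [gg, Real.sqrt_le_left (by positivity)]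
  nlinarith [sq_abs v.re, abs_nonneg v.re]

lemma gg_le_of_arsinh {v w : ℂ} {K : ℝ} (h : |Real.arsinh w.re - Real.arsinh v.re| ≤ K) :
    gg w ≤ gg v * Real.exp K := by
  have e : ∀ v : ℂ, gg v = Real.cosh (Real.arsinh v.re) := fun v => (Real.cosh_arsinh _).symm
  rw [e, e, Real.cosh_eq, Real.cosh_eq]
  set a := Real.arsinh w.re
  set b := Real.arsinh v.re
  have h1 := abs_le.1 h
  have h2 : Real.exp a ≤ Real.exp b * Real.exp K := by
    rw [← Real.exp_add]; apply Real.exp_le_exp.2; linarith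
  have h3 : Real.exp (-a) ≤ Real.exp (-b) * Real.exp K := by
    rw [← Real.exp_add]; apply Real.exp_le_exp.2; linarith
  nlinarith

lemma hasDerivAt_arsinh_re {V : ℂ → ℂ} {ζ u : ℂ} {t : ℝ}
    (h : DifferentiableAt ℂ V (ζ + t * u)) :
    HasDerivAt (fun t : ℝ => Real.arsinh (V (ζ + t * u)).re)
      ((gg (V (ζ + t * u)))⁻¹ * (deriv V (ζ + t * u) * u).re) t := by
  have h1 : HasDerivAt (fun t : ℝ => ζ + (t : ℂ) * u) u t := by
    have : HasDerivAt (fun t : ℝ => (t : ℂ)) 1 t := by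
      simpa using (hasDerivAt_id t).ofReal_comp
    simpa using (this.mul_const u).const_add ζ
  have h2 : HasDerivAt (fun t : ℝ => V (ζ + (t : ℂ) * u)) (deriv V (ζ + t * u) * u) t :=
    HasDerivAt.comp_of_eq t h.hasDerivAt h1 rfl
  have h3 : HasDerivAt (fun t : ℝ => (V (ζ + (t : ℂ) * u)).re) (deriv V (ζ + t * u) * u).re t :=
    (Complex.reCLM.hasFDerivAt.comp_hasDerivAt t h2)
  exact (Real.hasDerivAt_arsinh _).comp t h3

lemma abs_deriv_arsinh_le {V : ℂ → ℂ} {ζ u : ℂ} {K : ℝ} (h : ‖deriv V ζ‖ ≤ K * gg (V ζ)) :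
    |(gg (V ζ))⁻¹ * (deriv V ζ * u).re| ≤ K * ‖u‖ := by
  have hg := gg_pos (V ζ)
  rw [abs_mul, abs_of_pos (inv_pos.2 hg), inv_mul_le_iff₀ hg]
  calc |(deriv V ζ * u).re| ≤ ‖deriv V ζ * u‖ := Complex.abs_re_le_norm _
    _ = ‖deriv V ζ‖ * ‖u‖ := norm_mul _ _
    _ ≤ K * gg (V ζ) * ‖u‖ := by gcongr
    _ = _ := by ring

lemma gg_lip {V : ℂ → ℂ} {S : Set ℂ} {K : ℝ} (hS : IsOpen S) (hc : Convex ℝ S)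
    (hV : DifferentiableOn ℂ V S) (hb : ∀ ζ ∈ S, ‖deriv V ζ‖ ≤ K * gg (V ζ))
    {a b : ℂ} (ha : a ∈ S) (hb' : b ∈ S) : gg (V b) ≤ gg (V a) * Real.exp (K * ‖b - a‖) := by
  apply gg_le_of_arsinh
  have hseg : ∀ t ∈ Icc (0:ℝ) 1, a + t * (b - a) ∈ S := by
    intro t ht
    have := hc.add_smul_sub_mem ha hb' ht
    simpa using this
  have := Convex.norm_image_sub_le_of_norm_hasDerivWithin_le
    (f := fun t : ℝ => Real.arsinh (V (a + t * (b - a))).re)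
    (f' := fun t : ℝ => (gg (V (a + t * (b - a))))⁻¹ * (deriv V (a + t * (b - a)) * (b - a)).re)
    (s := Icc (0:ℝ) 1) (x := 0) (y := 1) (C := K * ‖b - a‖)
    (fun t ht => (hasDerivAt_arsinh_re (hV.differentiableAt (hS.mem_nhds (hseg t ht)))).hasDerivWithinAt)
    (fun t ht => abs_deriv_arsinh_le (hb _ (hseg t ht))) (convex_Icc 0 1) (by simp) (by simp)
  simpa using this

lemma gg_radial {V : ℂ → ℂ} {S : Set ℂ} {ζ₀ u : ℂ} {c t : ℝ} (hS : IsOpen S)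
    (hV : DifferentiableOn ℂ V S) (hom : ∀ ζ ∈ S, cexp (V ζ) ≠ 1) (hu : ‖u‖ = 1)
    (hball : ∀ t ∈ Ioc 0 c, Metric.ball (ζ₀ + t * u) t ⊆ S) (ht : t ∈ Ioc 0 c) :
    gg (V (ζ₀ + t * u)) ≤ gg (V (ζ₀ + c * u)) * (c / t) ^ 6000 := by
  have ht0 := ht.1
  have hc0 : 0 < c := ht0.trans_le ht.2
  have hmem : ∀ t ∈ Ioc 0 c, ζ₀ + t * u ∈ S := fun t ht => hball t ht (Metric.mem_ball_self ht.1)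
  have hd : ∀ τ ∈ Ioc 0 c, HasDerivAt (fun t : ℝ => Real.arsinh (V (ζ₀ + t * u)).re)
      ((gg (V (ζ₀ + τ * u)))⁻¹ * (deriv V (ζ₀ + τ * u) * u).re) τ := fun τ hτ =>
    hasDerivAt_arsinh_re (hV.differentiableAt (hS.mem_nhds (hmem τ hτ)))
  have hb : ∀ τ ∈ Ioc 0 c, |(gg (V (ζ₀ + τ * u)))⁻¹ * (deriv V (ζ₀ + τ * u) * u).re| ≤ 6000 / τ := by
    intro τ hτ
    have := landau hτ.1 (hV.mono (hball τ hτ)) (fun z hz => hom z (hball τ hτ hz))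
    have h2 := abs_deriv_arsinh_le (V := V) (u := u) (K := 6000 / τ) (ζ := ζ₀ + τ * u) (by
      rw [gg]; calc _ ≤ _ := this
        _ = _ := by ring)
    rwa [hu, mul_one] at h2
  have hlog : ∀ τ ∈ Ioc 0 c, HasDerivAt (fun t : ℝ => 6000 * Real.log t) (6000 / τ) τ := by
    intro τ hτ
    have := (Real.hasDerivAt_log hτ.1.ne').const_mul 6000
    simpa [div_eq_mul_inv] using this
  have hsub : Icc t c ⊆ Ioc 0 c := fun x hx => ⟨ht0.trans_le hx.1, hx.2⟩
  have mono1 : MonotoneOn (fun t : ℝ => Real.arsinh (V (ζ₀ + t * u)).re + 6000 * Real.log t) (Icc t c) := by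
    apply monotoneOn_of_deriv_nonneg (convex_Icc t c)
    · exact fun x hx => ((hd x (hsub hx)).add (hlog x (hsub hx))).continuousAt.continuousWithinAt
    · exact fun x hx => ((hd x (hsub (interior_subset hx))).add
        (hlog x (hsub (interior_subset hx)))).differentiableAt.differentiableWithinAt
    · intro x hx
      have hx' := hsub (interior_subset hx)
      rw [((hd x hx').fun_add (hlog x hx')).deriv]
      linarith [(abs_le.1 (hb x hx')).1]
  have mono2 : MonotoneOn (fun t : ℝ => 6000 * Real.log t - Real.arsinh (V (ζ₀ + t * u)).re) (Icc t c) := by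
    apply monotoneOn_of_deriv_nonneg (convex_Icc t c)
    · exact fun x hx => ((hlog x (hsub hx)).sub (hd x (hsub hx))).continuousAt.continuousWithinAt
    · exact fun x hx => ((hlog x (hsub (interior_subset hx))).sub
        (hd x (hsub (interior_subset hx)))).differentiableAt.differentiableWithinAt
    · intro x hx
      have hx' := hsub (interior_subset hx)
      rw [((hlog x hx').fun_sub (hd x hx')).deriv]
      linarith [(abs_le.1 (hb x hx')).2]
  have m1 := mono1 (left_mem_Icc.2 ht.2) (right_mem_Icc.2 ht.2) ht.2
  have m2 := mono2 (left_mem_Icc.2 ht.2) (right_mem_Icc.2 ht.2) ht.2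
  simp only at m1 m2
  have e : (c / t) ^ 6000 = Real.exp (6000 * Real.log c - 6000 * Real.log t) := by
    have hct : 0 < c / t := by positivity
    rw [← mul_sub, ← Real.log_div hc0.ne' ht0.ne', mul_comm]
    rw [show Real.log (c/t) * 6000 = ((6000:ℕ):ℝ) * Real.log (c/t) by push_cast; ring]
    rw [Real.exp_nat_mul, Real.exp_log hct]
  rw [e]
  apply gg_le_of_arsinh
  rw [abs_le]; constructor <;> linarith

/-- the growth function -/
def mm (V : ℤ → ℂ → ℂ) (s : ℝ) : ℝ :=
  (gg (V 0 (s + ck 0 * I)) + gg (V 1 (s + ck 0 * I))) +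
  (gg (V 1 (s + ck 1 * I)) + gg (V 2 (s + ck 1 * I))) +
  (gg (V 2 (s + ck 2 * I)) + gg (V 3 (s + ck 2 * I)))

namespace LogData
variable {V : ℤ → ℂ → ℂ} {s₀ : ℝ}

lemma per_int (h : LogData V s₀) (k n : ℤ) (ζ : ℂ) :
    V (k + 3 * n) (ζ + n * (2 * Real.pi * I)) = V k ζ := by
  induction n using Int.induction_on with
  | zero => simp
  | succ n ih =>
    rw [← ih, ← h.per (k + 3 * n)]
    congr 1
    · ring
    · push_cast; ring
  | pred n ih =>
    rw [← ih]
    have := h.per (k + 3 * (-n - 1)) (ζ + (((-n - 1 : ℤ)) : ℂ) * (2 * Real.pi * I))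
    rw [← this]
    congr 1
    · ring
    · push_cast; ring

lemma mod3 (k : ℤ) : ∃ j n : ℤ, (j = 0 ∨ j = 1 ∨ j = 2) ∧ k = j + 3 * n :=
  ⟨k % 3, k / 3, by omega, by omega⟩

lemma gk_le_mm (h : LogData V s₀) (k : ℤ) (s : ℝ) : gg (V k (s + ck k * I)) ≤ mm V s := by
  obtain ⟨j, n, hj, rfl⟩ := mod3 k
  have e : (s : ℂ) + ck (j + 3 * n) * I = (s + ck j * I) + n * (2 * Real.pi * I) := by
    simp only [ck]; push_cast; ring
  rw [e, h.per_int]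
  have g1 := gg_pos (V 0 (s + ck 0 * I))
  have g2 := gg_pos (V 1 (s + ck 0 * I))
  have g3 := gg_pos (V 1 (s + ck 1 * I))
  have g4 := gg_pos (V 2 (s + ck 1 * I))
  have g5 := gg_pos (V 2 (s + ck 2 * I))
  have g6 := gg_pos (V 3 (s + ck 2 * I))
  unfold mm
  rcases hj with rfl | rfl | rfl <;> linarith

lemma gk1_le_mm (h : LogData V s₀) (k : ℤ) (s : ℝ) : gg (V (k + 1) (s + ck k * I)) ≤ mm V s := by
  obtain ⟨j, n, hj, rfl⟩ := mod3 k
  have e : (s : ℂ) + ck (j + 3 * n) * I = (s + ck j * I) + n * (2 * Real.pi * I) := by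
    simp only [ck]; push_cast; ring
  rw [e, show j + 3 * n + 1 = (j + 1) + 3 * n by ring, h.per_int]
  have g1 := gg_pos (V 0 (s + ck 0 * I))
  have g2 := gg_pos (V 1 (s + ck 0 * I))
  have g3 := gg_pos (V 1 (s + ck 1 * I))
  have g4 := gg_pos (V 2 (s + ck 1 * I))
  have g5 := gg_pos (V 2 (s + ck 2 * I))
  have g6 := gg_pos (V 3 (s + ck 2 * I))
  unfold mm
  rcases hj with rfl | rfl | rfl
  · rw [show (0:ℤ) + 1 = 1 by norm_num]; linarith
  · rw [show (1:ℤ) + 1 = 2 by norm_num]; linarith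
  · rw [show (2:ℤ) + 1 = 3 by norm_num]; linarith

lemma six_le_mm (V : ℤ → ℂ → ℂ) (s : ℝ) : 6 ≤ mm V s := by
  have g1 := one_le_gg (V 0 (s + ck 0 * I))
  have g2 := one_le_gg (V 1 (s + ck 0 * I))
  have g3 := one_le_gg (V 1 (s + ck 1 * I))
  have g4 := one_le_gg (V 2 (s + ck 1 * I))
  have g5 := one_le_gg (V 2 (s + ck 2 * I))
  have g6 := one_le_gg (V 3 (s + ck 2 * I))
  unfold mm; linarith

lemma om (h : LogData V s₀) (k : ℤ) {ζ : ℂ} (hζ : ζ ∈ Sk s₀ k) : cexp (V k ζ) ≠ 1 := by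
  intro he
  have := h.rel k ζ hζ
  rw [he] at this
  exact Complex.exp_ne_zero (-V (k+1) ζ) (by linear_combination this)

lemma om' (h : LogData V s₀) (k : ℤ) {ζ : ℂ} (hζ : ζ ∈ Sk s₀ k) : cexp (V (k + 1) ζ) ≠ 1 := by
  intro he
  have := h.rel k ζ hζ
  rw [Complex.exp_neg, he] at this
  exact Complex.exp_ne_zero (V k ζ) (by simpa using this)

/-- shrunken strips -/
def Skd (s₀ : ℝ) (k : ℤ) (d : ℝ) : Set ℂ :=
  {ζ | s₀ + d < ζ.re ∧ Lk k + d < ζ.im ∧ ζ.im < Lk (k + 1) - d}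

lemma isOpen_Skd (s₀ : ℝ) (k : ℤ) (d : ℝ) : IsOpen (Skd s₀ k d) := by
  apply IsOpen.inter
  · exact isOpen_lt continuous_const Complex.continuous_re
  · apply IsOpen.inter
    · exact isOpen_lt continuous_const Complex.continuous_im
    · exact isOpen_lt Complex.continuous_im continuous_const

lemma convex_Skd (s₀ : ℝ) (k : ℤ) (d : ℝ) : Convex ℝ (Skd s₀ k d) := by
  have : Skd s₀ k d = Complex.reCLM ⁻¹' Ioi (s₀ + d) ∩ Complex.imCLM ⁻¹' Ioo (Lk k + d) (Lk (k+1) - d) := by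
    ext; simp [Skd]
  rw [this]
  exact ((convex_Ioi _).is_linear_preimage Complex.reCLM.isLinear).inter
    ((convex_Ioo _ _).is_linear_preimage Complex.imCLM.isLinear)

lemma ball_subset_Sk {k : ℤ} {d : ℝ} {ζ : ℂ} (h1 : s₀ + d ≤ ζ.re) (h2 : Lk k + d ≤ ζ.im)
    (h3 : ζ.im ≤ Lk (k + 1) - d) : Metric.ball ζ d ⊆ Sk s₀ k := by
  intro z hz
  rw [mem_ball_iff_norm] at hz
  have hr := abs_lt.1 ((Complex.abs_re_le_norm (z - ζ)).trans_lt hz)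
  have hi := abs_lt.1 ((Complex.abs_im_le_norm (z - ζ)).trans_lt hz)
  simp only [sub_re, sub_im] at hr hi
  exact ⟨by linarith, by linarith, by linarith⟩

lemma deriv_le (h : LogData V s₀) {k : ℤ} {d : ℝ} (hd : 0 < d) {ζ : ℂ} (hb : Metric.ball ζ d ⊆ Sk s₀ k) :
    ‖deriv (V k) ζ‖ ≤ 6000 / d * gg (V k ζ) := by
  have := landau hd (((h.diff k).mono (Sk_subset_Dk s₀ k)).mono hb) (fun z hz => h.om k (hb hz))
  rw [gg]; calc _ ≤ _ := this
    _ = _ := by ring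

lemma deriv_le' (h : LogData V s₀) {k : ℤ} {d : ℝ} (hd : 0 < d) {ζ : ℂ} (hb : Metric.ball ζ d ⊆ Sk s₀ k) :
    ‖deriv (V (k + 1)) ζ‖ ≤ 6000 / d * gg (V (k + 1) ζ) := by
  have := landau hd (((h.diff (k + 1)).mono (Sk_subset_Dk' s₀ k)).mono hb) (fun z hz => h.om' k (hb hz))
  rw [gg]; calc _ ≤ _ := this
    _ = _ := by ring

lemma Skd_sub {k : ℤ} {d : ℝ} (hd : 0 < d) : Skd s₀ k d ⊆ Sk s₀ k := fun ζ hζ =>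
  ⟨by linarith [hζ.1], by linarith [hζ.2.1], by linarith [hζ.2.2]⟩

lemma gg_lip_k (h : LogData V s₀) {k : ℤ} {d : ℝ} (hd : 0 < d) {a b : ℂ} (ha : a ∈ Skd s₀ k d)
    (hb : b ∈ Skd s₀ k d) : gg (V k b) ≤ gg (V k a) * Real.exp (6000 / d * ‖b - a‖) :=
  gg_lip (isOpen_Skd s₀ k d) (convex_Skd s₀ k d)
    ((h.diff k).mono ((Skd_sub hd).trans (Sk_subset_Dk s₀ k)))
    (fun _ hζ => h.deriv_le hd (ball_subset_Sk hζ.1.le hζ.2.1.le hζ.2.2.le)) ha hb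

lemma gg_lip_k' (h : LogData V s₀) {k : ℤ} {d : ℝ} (hd : 0 < d) {a b : ℂ} (ha : a ∈ Skd s₀ k d)
    (hb : b ∈ Skd s₀ k d) : gg (V (k + 1) b) ≤ gg (V (k + 1) a) * Real.exp (6000 / d * ‖b - a‖) :=
  gg_lip (isOpen_Skd s₀ k d) (convex_Skd s₀ k d)
    ((h.diff (k + 1)).mono ((Skd_sub hd).trans (Sk_subset_Dk' s₀ k)))
    (fun _ hζ => h.deriv_le' hd (ball_subset_Sk hζ.1.le hζ.2.1.le hζ.2.2.le)) ha hb

lemma cen_mem {k : ℤ} {s : ℝ} (hs : s₀ + 2 ≤ s) : (s + ck k * I : ℂ) ∈ Skd s₀ k 1 := by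
  have := Real.pi_gt_three
  refine ⟨?_, ?_, ?_⟩
  · simp; linarith
  · simp [ck_eq]; linarith
  · simp [ck_eq']; linarith

lemma mm_le (h : LogData V s₀) {s t : ℝ} (hs : s₀ + 2 ≤ s) (ht : s₀ + 2 ≤ t) :
    mm V t ≤ mm V s * Real.exp (6000 * |t - s|) := by
  have hn : ∀ k, ‖((t + ck k * I : ℂ)) - (s + ck k * I)‖ = |t - s| := by
    intro k
    rw [show ((t + ck k * I : ℂ)) - (s + ck k * I) = ((t - s : ℝ) : ℂ) by push_cast; ring,
      Complex.norm_real, Real.norm_eq_abs]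
  have A : ∀ k : ℤ, gg (V k (t + ck k * I)) ≤ gg (V k (s + ck k * I)) * Real.exp (6000 * |t - s|) := by
    intro k
    have := h.gg_lip_k one_pos (cen_mem (k := k) hs) (cen_mem (k := k) ht)
    rwa [hn, div_one] at this
  have B : ∀ k : ℤ, gg (V (k + 1) (t + ck k * I)) ≤
      gg (V (k + 1) (s + ck k * I)) * Real.exp (6000 * |t - s|) := by
    intro k
    have := h.gg_lip_k' one_pos (cen_mem (k := k) hs) (cen_mem (k := k) ht)
    rwa [hn, div_one] at this
  have a0 := A 0
  have a1 := A 1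
  have a2 := A 2
  have b0 := B 0
  have b1 := B 1
  have b2 := B 2
  rw [show (0:ℤ) + 1 = 1 by norm_num] at b0
  rw [show (1:ℤ) + 1 = 2 by norm_num] at b1
  rw [show (2:ℤ) + 1 = 3 by norm_num] at b2
  unfold mm
  linarith

/-- bound in the upper side of line `k` -/
lemma near_above (h : LogData V s₀) (k : ℤ) {s τ : ℝ} (hs : s₀ + 2 ≤ s) (hτ : 0 < τ) (hτ' : τ ≤ 1) :
    ‖deriv (V k) (s + (Lk k + τ) * I)‖ ≤ 6000 * 2 ^ 6000 * mm V s / τ ^ 6001 := by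
  have hp3 := Real.pi_gt_three
  have hp4 := Real.pi_lt_four
  have hball : ∀ t ∈ Ioc (0:ℝ) (Real.pi / 3), Metric.ball ((s + Lk k * I : ℂ) + t * I) t ⊆ Sk s₀ k := by
    intro t ht
    apply ball_subset_Sk
    · simp; linarith [ht.2]
    · simp
    · simp [Lk_succ]; linarith [ht.2]
  have h1 := gg_radial (isOpen_Sk s₀ k) ((h.diff k).mono (Sk_subset_Dk s₀ k)) (fun ζ hζ => h.om k hζ)
    (by simp) hball (t := τ) ⟨hτ, by linarith⟩
  have hb := hball τ ⟨hτ, by linarith⟩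
  have h2 := h.deriv_le hτ hb
  have e1 : (s + Lk k * I : ℂ) + τ * I = s + (Lk k + τ) * I := by ring
  have e2 : (s + Lk k * I : ℂ) + (Real.pi / 3 : ℝ) * I = s + ck k * I := by
    rw [ck_eq]; push_cast; ring
  rw [e1] at h1 h2
  rw [e2] at h1
  have h3 := h.gk_le_mm k s
  have h4 : (Real.pi / 3 / τ) ^ 6000 ≤ (2 / τ) ^ 6000 := by
    apply pow_le_pow_left₀ (by positivity)
    gcongr; linarith
  calc _ ≤ _ := h2
    _ ≤ 6000 / τ * (mm V s * (2 / τ) ^ 6000) := by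
      gcongr
      exact h1.trans (mul_le_mul h3 h4 (by positivity) (by linarith [six_le_mm V s]))
    _ = _ := by rw [div_pow, pow_succ τ 6000]; field_simp

lemma near_below (h : LogData V s₀) (k : ℤ) {s τ : ℝ} (hs : s₀ + 2 ≤ s) (hτ : 0 < τ) (hτ' : τ ≤ 1) :
    ‖deriv (V (k + 1)) (s + (Lk (k + 1) - τ) * I)‖ ≤ 6000 * 2 ^ 6000 * mm V s / τ ^ 6001 := by
  have hp3 := Real.pi_gt_three
  have hp4 := Real.pi_lt_four
  have hball : ∀ t ∈ Ioc (0:ℝ) (Real.pi / 3),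
      Metric.ball ((s + Lk (k + 1) * I : ℂ) + t * (-I)) t ⊆ Sk s₀ k := by
    intro t ht
    apply ball_subset_Sk
    · simp; linarith [ht.2]
    · simp [Lk_succ]; linarith [ht.2]
    · simp
  have h1 := gg_radial (isOpen_Sk s₀ k) ((h.diff (k + 1)).mono (Sk_subset_Dk' s₀ k))
    (fun ζ hζ => h.om' k hζ) (by simp) hball (t := τ) ⟨hτ, by linarith⟩
  have hb := hball τ ⟨hτ, by linarith⟩
  have h2 := h.deriv_le' hτ hb
  have e1 : (s + Lk (k + 1) * I : ℂ) + τ * (-I) = s + (Lk (k + 1) - τ) * I := by ring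
  have e2 : (s + Lk (k + 1) * I : ℂ) + (Real.pi / 3 : ℝ) * (-I) = s + ck k * I := by
    rw [ck_eq']; push_cast; ring
  rw [e1] at h1 h2
  rw [e2] at h1
  have h3 := h.gk1_le_mm k s
  have h4 : (Real.pi / 3 / τ) ^ 6000 ≤ (2 / τ) ^ 6000 := by
    apply pow_le_pow_left₀ (by positivity)
    gcongr; linarith
  calc _ ≤ _ := h2
    _ ≤ 6000 / τ * (mm V s * (2 / τ) ^ 6000) := by
      gcongr
      exact h1.trans (mul_le_mul h3 h4 (by positivity) (by linarith [six_le_mm V s]))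
    _ = _ := by rw [div_pow, pow_succ τ 6000]; field_simp


/-- crossing line `k` -/
lemma cross (h : LogData V s₀) : ∃ C : ℝ, 0 < C ∧ ∀ (k : ℤ) (s : ℝ) (z : ℂ), s₀ + 3 ≤ s →
    ‖z - (s + Lk k * I)‖ ≤ 1 / 2 → ‖deriv (V k) z‖ ≤ C * mm V s := by
  set A : ℝ := 6000 * 2 ^ 6000 * Real.exp 6000 with hA
  refine ⟨A * 2 ^ 6001 * (4 / 3) ^ 6001, by positivity, ?_⟩
  intro k s z hs hz
  have hp3 := Real.pi_gt_three
  set x : ℂ := s + Lk k * I with hx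
  have hm0 : 0 < mm V s := by linarith [six_le_mm V s]
  have hsub : Metric.closedBall x 1 ⊆ Dk s₀ k := by
    intro w hw
    rw [mem_closedBall_iff_norm] at hw
    have hr := abs_le.1 ((Complex.abs_re_le_norm (w - x)).trans hw)
    have hi := ((Complex.abs_im_le_norm (w - x)).trans hw)
    simp [hx] at hr hi
    exact ⟨by linarith, by linarith⟩
  have hdd : DifferentiableOn ℂ (deriv (V k)) (Dk s₀ k) := (h.diff k).deriv (isOpen_Dk s₀ k)
  have hcirc : ∀ w ∈ Metric.sphere x 1,
      ‖((w - x) ^ 2 - 1) ^ 6001 * deriv (V k) w‖ ≤ A * 2 ^ 6001 * mm V s := by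
    intro w hw
    rw [mem_sphere_iff_norm] at hw
    have hr := abs_le.1 ((Complex.abs_re_le_norm (w - x)).trans hw.le)
    have hi := ((Complex.abs_im_le_norm (w - x)).trans hw.le)
    have hsq : (w - x).re ^ 2 + (w - x).im ^ 2 = 1 := by
      have := Complex.sq_norm (w - x)
      rw [hw, Complex.normSq_apply] at this; nlinarith
    set τ := (w - x).im with hτ
    have hnorm : ‖(w - x) ^ 2 - 1‖ = 2 * |τ| := by
      have e : (w - x) ^ 2 - 1 = 2 * τ * I * (w - x) := by
        apply Complex.ext
        · have h7 := hsq
          rw [hτ, sub_re, sub_im] at h7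
          rw [hτ]; simp [sq]; nlinarith
        · simp [sq]; rw [hτ]; simp; ring
      rw [e]; simp [hw]
    have hwe : w = (w.re : ℂ) + (Lk k + τ) * I := by
      apply Complex.ext
      · simp
      · simp [hτ, hx]
    have hre : |w.re - s| ≤ 1 := by
      have : (w - x).re = w.re - s := by simp [hx]
      rw [this] at hr; exact abs_le.2 hr
    have hs2 : s₀ + 2 ≤ w.re := by linarith [(abs_le.1 hre).1]
    have hmw : mm V w.re ≤ mm V s * Real.exp 6000 := by
      refine (h.mm_le (s := s) (by linarith) hs2).trans ?_
      exact mul_le_mul_of_nonneg_left (Real.exp_le_exp.2 (by linarith)) hm0.le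
    rw [norm_mul, norm_pow, hnorm]
    rcases lt_trichotomy τ 0 with h0 | h0 | h0
    · have := h.near_below (k - 1) hs2 (τ := -τ) (by linarith) (by linarith [(abs_le.1 hi).1])
      rw [show k - 1 + 1 = k by ring] at this
      rw [show ((w.re : ℂ) + (Lk k - (-τ : ℝ)) * I) = w by rw [hwe]; push_cast; simp] at this
      rw [abs_of_neg h0]
      calc _ ≤ (2 * -τ) ^ 6001 * (6000 * 2 ^ 6000 * (mm V s * Real.exp 6000) / (-τ) ^ 6001) := by
            have hneg : 0 < -τ := by linarith
            generalize -τ = τ' at *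
            exact mul_le_mul_of_nonneg_left (this.trans (by gcongr)) (by positivity)
        _ = (2 ^ 6001 * (-τ) ^ 6001) * (6000 * 2 ^ 6000 * (mm V s * Real.exp 6000) / (-τ) ^ 6001) := by
            rw [mul_pow]
        _ = A * 2 ^ 6001 * mm V s := by
            have : (-τ) ^ 6001 ≠ 0 := (pow_pos (by linarith) _).ne'
            rw [hA]
            generalize (-τ) ^ 6001 = T at *
            generalize (2:ℝ) ^ 6001 = T1 at *
            generalize (2:ℝ) ^ 6000 = T2 at *
            field_simp
    · rw [h0]; simp; positivity
    · have := h.near_above k hs2 (τ := τ) h0 (by linarith [(abs_le.1 hi).2])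
      rw [← hwe] at this
      rw [abs_of_pos h0]
      calc _ ≤ (2 * τ) ^ 6001 * (6000 * 2 ^ 6000 * (mm V s * Real.exp 6000) / τ ^ 6001) := by
            gcongr; exact this.trans (by gcongr)
        _ = (2 ^ 6001 * τ ^ 6001) * (6000 * 2 ^ 6000 * (mm V s * Real.exp 6000) / τ ^ 6001) := by
            rw [mul_pow]
        _ = A * 2 ^ 6001 * mm V s := by
            have : τ ^ 6001 ≠ 0 := (pow_pos h0 _).ne'
            rw [hA]
            generalize τ ^ 6001 = T at *
            generalize (2:ℝ) ^ 6001 = T1 at *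
            generalize (2:ℝ) ^ 6000 = T2 at *
            field_simp
  have hmax := Complex.norm_le_of_forall_mem_frontier_norm_le (U := Metric.ball x 1)
    (f := fun w => ((w - x) ^ 2 - 1) ^ 6001 * deriv (V k) w) Metric.isBounded_ball (by
      apply DifferentiableOn.diffContOnCl
      rw [closure_ball _ one_ne_zero]
      exact DifferentiableOn.mul (by fun_prop) (hdd.mono hsub)) (C := A * 2 ^ 6001 * mm V s) (by
      rw [frontier_ball _ one_ne_zero]; exact hcirc) (z := z) (by
      apply subset_closure; rw [mem_ball_iff_norm]; linarith)
  rw [norm_mul, norm_pow] at hmax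
  have hlow : 3 / 4 ≤ ‖(z - x) ^ 2 - 1‖ := by
    have := norm_sub_norm_le (1:ℂ) ((z - x) ^ 2)
    rw [norm_sub_rev, norm_pow, norm_one] at this
    nlinarith [norm_nonneg (z - x)]
  have h1 : (3 / 4 : ℝ) ^ 6001 * ‖deriv (V k) z‖ ≤ A * 2 ^ 6001 * mm V s :=
    le_trans (mul_le_mul_of_nonneg_right (pow_le_pow_left₀ (by norm_num) hlow _) (norm_nonneg _)) hmax
  have h2 : (4 / 3 : ℝ) ^ 6001 * (3 / 4 : ℝ) ^ 6001 = 1 := by rw [← mul_pow]; norm_num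
  calc ‖deriv (V k) z‖ = (4 / 3 : ℝ) ^ 6001 * ((3 / 4 : ℝ) ^ 6001 * ‖deriv (V k) z‖) := by
        rw [← mul_assoc, h2, one_mul]
    _ ≤ (4 / 3 : ℝ) ^ 6001 * (A * 2 ^ 6001 * mm V s) := by gcongr
    _ = _ := by
      generalize (4 / 3 : ℝ) ^ 6001 = T
      generalize (2 : ℝ) ^ 6001 = T
      ring

/-- Bounds in `D_k` away from its two edges -/
lemma deriv_bound (h : LogData V s₀) (δ : ℝ) (hδ : 0 < δ) : ∃ C : ℝ, 0 < C ∧ ∀ (k : ℤ) (ζ : ℂ),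
    s₀ + 3 ≤ ζ.re → |ζ.im - Lk k| ≤ 2 * Real.pi / 3 - δ → ‖deriv (V k) ζ‖ ≤ C * mm V ζ.re := by
  obtain ⟨C, hC, hcr⟩ := h.cross
  have hp3 := Real.pi_gt_three
  have hp4 := Real.pi_lt_four
  set d := min (δ / 2) (1 / 4) with hd
  have hd0 : 0 < d := by positivity
  have hd1 : d ≤ δ / 2 := min_le_left _ _
  have hd2 : d ≤ 1 / 4 := min_le_right _ _
  set B := 6000 / d * Real.exp (6000 / d * 2) with hB
  have hB0 : 0 < B := by positivity
  refine ⟨C + B, by positivity, ?_⟩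
  intro k ζ hre him
  have hm0 : 0 < mm V ζ.re := by linarith [six_le_mm V ζ.re]
  have hcd : ∀ k, (ζ.re + ck k * I : ℂ) ∈ Skd s₀ k d := by
    intro k
    refine ⟨?_, ?_, ?_⟩
    · simp; linarith
    · simp [ck_eq]; linarith
    · simp [ck_eq']; linarith
  have hdist : ∀ k, |ζ.im - ck k| ≤ 2 → ‖ζ - (ζ.re + ck k * I : ℂ)‖ ≤ 2 := by
    intro k hk
    have : ζ - (ζ.re + ck k * I : ℂ) = ((ζ.im - ck k : ℝ) : ℂ) * I := by
      apply Complex.ext <;> simp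
    rw [this, norm_mul, Complex.norm_I, Complex.norm_real, mul_one]; exact hk
  by_cases hnear : |ζ.im - Lk k| ≤ 1 / 2
  · have := hcr k ζ.re ζ hre (by
      have : ζ - (ζ.re + Lk k * I : ℂ) = ((ζ.im - Lk k : ℝ) : ℂ) * I := by
        apply Complex.ext <;> simp
      rw [this, norm_mul, Complex.norm_I, Complex.norm_real, mul_one]; exact hnear)
    exact this.trans (by nlinarith)
  · push Not at hnear
    have hb := abs_le.1 him
    rcases lt_abs.1 hnear with h1 | h1
    · have hmem : ζ ∈ Skd s₀ k d := ⟨by linarith, by linarith, by rw [Lk_succ]; linarith⟩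
      have h2 := h.deriv_le hd0 (ball_subset_Sk hmem.1.le hmem.2.1.le hmem.2.2.le)
      have h3 := h.gg_lip_k hd0 (hcd k) hmem
      have h4 := h.gk_le_mm k ζ.re
      have h5 : ‖ζ - (ζ.re + ck k * I : ℂ)‖ ≤ 2 := hdist k (by rw [ck_eq, abs_le]; constructor <;> linarith)
      have h6 : gg (V k ζ) ≤ mm V ζ.re * Real.exp (6000 / d * 2) := by
        refine h3.trans ?_
        gcongr
      calc _ ≤ _ := h2
        _ ≤ 6000 / d * (mm V ζ.re * Real.exp (6000 / d * 2)) := by gcongr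
        _ = B * mm V ζ.re := by rw [hB]; ring
        _ ≤ _ := by nlinarith
    · obtain ⟨j, rfl⟩ : ∃ j, k = j + 1 := ⟨k - 1, by ring⟩
      have hL := Lk_succ j
      have hmem : ζ ∈ Skd s₀ j d := ⟨by linarith, by linarith, by linarith⟩
      have h2 := h.deriv_le' hd0 (ball_subset_Sk hmem.1.le hmem.2.1.le hmem.2.2.le)
      have h3 := h.gg_lip_k' hd0 (hcd j) hmem
      have h4 := h.gk1_le_mm j ζ.re
      have h5 : ‖ζ - (ζ.re + ck j * I : ℂ)‖ ≤ 2 := hdist j (by rw [ck_eq', abs_le]; constructor <;> linarith)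
      have h6 : gg (V (j + 1) ζ) ≤ mm V ζ.re * Real.exp (6000 / d * 2) := by
        refine h3.trans ?_
        gcongr
      calc _ ≤ _ := h2
        _ ≤ 6000 / d * (mm V ζ.re * Real.exp (6000 / d * 2)) := by gcongr
        _ = B * mm V ζ.re := by rw [hB]; ring
        _ ≤ _ := by nlinarith

lemma val_diff_bound (h : LogData V s₀) (δ : ℝ) (hδ : 0 < δ) : ∃ C : ℝ, 0 < C ∧ ∀ (k : ℤ) (ζ : ℂ),
    s₀ + 3 ≤ ζ.re → |ζ.im - Lk k| ≤ 2 * Real.pi / 3 - δ →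
    ‖V k ζ - V k (ζ.re + ck k * I)‖ ≤ C * mm V ζ.re := by
  set δ' := min δ 1 with hδ'
  have hδ0 : 0 < δ' := by positivity
  obtain ⟨C, hC, hb⟩ := h.deriv_bound δ' hδ0
  have hp3 := Real.pi_gt_three
  have hp4 := Real.pi_lt_four
  refine ⟨C * 6, by positivity, ?_⟩
  intro k ζ hre him
  have hm0 : 0 < mm V ζ.re := by linarith [six_le_mm V ζ.re]
  have hd1 : δ' ≤ δ := min_le_left _ _
  have hd2 : δ' ≤ 1 := min_le_right _ _
  set S : Set ℂ := {w | w.re = ζ.re ∧ |w.im - Lk k| ≤ 2 * Real.pi / 3 - δ'} with hS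
  have hconv : Convex ℝ S := by
    have : S = Complex.reCLM ⁻¹' {ζ.re} ∩ Complex.imCLM ⁻¹' Icc (Lk k - (2 * Real.pi / 3 - δ')) (Lk k + (2 * Real.pi / 3 - δ')) := by
      ext w
      simp only [hS, mem_ofPred_eq, mem_inter_iff, mem_preimage, mem_singleton_iff, reCLM_apply, imCLM_apply, mem_Icc, abs_le]
      constructor
      · rintro ⟨h1, h2, h3⟩; exact ⟨h1, by linarith, by linarith⟩
      · rintro ⟨h1, h2, h3⟩; exact ⟨h1, by linarith, by linarith⟩
    rw [this]
    exact ((convex_singleton _).is_linear_preimage Complex.reCLM.isLinear).inter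
      ((convex_Icc _ _).is_linear_preimage Complex.imCLM.isLinear)
  have hmv := Convex.norm_image_sub_le_of_norm_deriv_le (f := V k) (s := S)
    (x := (ζ.re + ck k * I : ℂ)) (y := ζ) (C := C * mm V ζ.re) (by
      intro w hw
      exact (h.diff k).differentiableAt ((isOpen_Dk s₀ k).mem_nhds ⟨by rw [hw.1]; linarith, by linarith [hw.2]⟩))
    (by
      intro w hw
      have := hb k w (by rw [hw.1]; exact hre) hw.2
      rwa [hw.1] at this) hconv ⟨by simp, by simp [ck_eq]; rw [abs_of_pos (by linarith)]; linarith⟩ ⟨rfl, by linarith⟩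
  refine hmv.trans ?_
  have hdist : ‖ζ - (ζ.re + ck k * I : ℂ)‖ ≤ 6 := by
    have : ζ - (ζ.re + ck k * I : ℂ) = ((ζ.im - ck k : ℝ) : ℂ) * I := by
      apply Complex.ext <;> simp
    rw [this, norm_mul, Complex.norm_I, Complex.norm_real, mul_one, Real.norm_eq_abs, ck_eq]
    have := abs_le.1 him
    rw [abs_le]; constructor <;> linarith
  calc _ ≤ C * mm V ζ.re * 6 := by gcongr
    _ = _ := by ring

lemma val_bound (h : LogData V s₀) (δ : ℝ) (hδ : 0 < δ) : ∃ C : ℝ, 0 < C ∧ ∀ (k : ℤ) (ζ : ℂ),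
    s₀ + 3 ≤ ζ.re → |ζ.im - Lk k| ≤ 2 * Real.pi / 3 - δ → |(V k ζ).re| ≤ C * mm V ζ.re := by
  obtain ⟨C, hC, hb⟩ := h.val_diff_bound δ hδ
  refine ⟨C + 1, by positivity, fun k ζ h1 h2 => ?_⟩
  have h3 := (Complex.abs_re_le_norm _).trans (hb k ζ h1 h2)
  have h4 := (abs_re_le_gg _).trans (h.gk_le_mm k ζ.re)
  rw [sub_re] at h3
  have := abs_sub_abs_le_abs_sub (V k ζ).re (V k (ζ.re + ck k * I)).re
  linarith

end LogData

/-! ### Section 3 - A -/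

/-- Harnack on the disc -/
lemma harnack_disc {g : ℂ → ℂ} (hg : DifferentiableOn ℂ g (Metric.ball 0 1))
    (hpos : ∀ z ∈ Metric.ball (0:ℂ) 1, 0 < (g z).re) {p : ℂ} (hp : ‖p‖ < 1) :
    (g 0).re * ((1 - ‖p‖) / (1 + ‖p‖)) ≤ (g p).re := by
  have h0 : (0:ℂ) ∈ Metric.ball (0:ℂ) 1 := Metric.mem_ball_self one_pos
  have hpm : p ∈ Metric.ball (0:ℂ) 1 := by simpa using hp
  set q : ℂ → ℂ := fun z => (g z - g 0) / (g z + (starRingEnd ℂ) (g 0)) with hq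
  have hden : ∀ z ∈ Metric.ball (0:ℂ) 1, g z + (starRingEnd ℂ) (g 0) ≠ 0 := by
    intro z hz h
    have := congrArg Complex.re h
    simp at this
    linarith [hpos z hz, hpos 0 h0]
  have hsq : ∀ z : ℂ, ‖g z - g 0‖ ^ 2 = ((g z).re - (g 0).re) ^ 2 + ((g z).im - (g 0).im) ^ 2 := by
    intro z; rw [Complex.sq_norm, Complex.normSq_apply]; simp; ring
  have hsq2 : ∀ z : ℂ, ‖g z + (starRingEnd ℂ) (g 0)‖ ^ 2 =
      ((g z).re + (g 0).re) ^ 2 + ((g z).im - (g 0).im) ^ 2 := by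
    intro z; rw [Complex.sq_norm, Complex.normSq_apply]; simp; ring
  have hle : ‖q p‖ ≤ ‖p‖ := by
    apply Complex.norm_le_norm_of_mapsTo_ball (R := 1)
    · exact DifferentiableOn.div (hg.sub_const _) (hg.add_const _) hden
    · intro z hz
      rw [mem_closedBall_zero_iff, hq]
      simp only
      rw [norm_div, div_le_one (norm_pos_iff.2 (hden z hz))]
      apply le_of_sq_le_sq _ (norm_nonneg _)
      rw [hsq, hsq2]
      nlinarith [hpos z hz, hpos 0 h0]
    · simp [hq]
    · exact hp
  rw [hq] at hle
  simp only at hle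
  rw [norm_div, div_le_iff₀ (norm_pos_iff.2 (hden p hpm))] at hle
  have h2 : ‖g p - g 0‖ ^ 2 ≤ ‖p‖ ^ 2 * ‖g p + (starRingEnd ℂ) (g 0)‖ ^ 2 := by
    rw [← mul_pow]; exact pow_le_pow_left₀ (norm_nonneg _) hle 2
  rw [hsq, hsq2] at h2
  set x := (g p).re
  set x0 := (g 0).re
  set r := ‖p‖
  have hr0 : 0 ≤ r := norm_nonneg _
  have hx := hpos p hpm
  have hx0 := hpos 0 h0
  have h3 : (x - x0) ^ 2 ≤ (r * (x + x0)) ^ 2 := by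
    have : r ^ 2 * ((g p).im - (g 0).im) ^ 2 ≤ ((g p).im - (g 0).im) ^ 2 := by
      have : r ^ 2 ≤ 1 := by nlinarith
      nlinarith [sq_nonneg ((g p).im - (g 0).im)]
    nlinarith
  have h4 := abs_le_of_sq_le_sq' h3 (by positivity)
  rw [← mul_div_assoc, div_le_iff₀ (by positivity)]
  linarith [h4.1]

/-- Harnack on the strip of half-width `w` about height `y₀` -/
lemma harnack_strip {h : ℂ → ℂ} {y₀ w : ℝ} (hw : 0 < w)
    (hh : DifferentiableOn ℂ h {ζ | |ζ.im - y₀| < w})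
    (hpos : ∀ ζ : ℂ, |ζ.im - y₀| < w → 0 < (h ζ).re) (s : ℝ) :
    (h (y₀ * I)).re * Real.exp (-(Real.pi / (2 * w)) * |s|) ≤ (h (s + y₀ * I)).re := by
  have hpi := Real.pi_pos
  set a : ℝ := 2 * w / Real.pi with ha
  have ha0 : 0 < a := by positivity
  set φ : ℂ → ℂ := fun p => a * Complex.log ((1 + p) / (1 - p)) + y₀ * I with hφ
  have hre : ∀ p ∈ Metric.ball (0:ℂ) 1, 0 < ((1 + p) / (1 - p)).re := by
    intro p hp
    have hp' : ‖p‖ < 1 := by simpa using hp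
    have hne : (1 - p) ≠ 0 := by
      intro h; have : p = 1 := by linear_combination -h
      rw [this] at hp'; simp at hp'
    rw [Complex.div_re, ← add_div]
    apply div_pos _ (Complex.normSq_pos.2 hne)
    have : ‖p‖ ^ 2 < 1 := by nlinarith [norm_nonneg p]
    rw [Complex.sq_norm, Complex.normSq_apply] at this
    simp; nlinarith
  have hmap : ∀ p ∈ Metric.ball (0:ℂ) 1, |(φ p).im - y₀| < w := by
    intro p hp
    have h1 : (φ p).im - y₀ = a * ((1 + p) / (1 - p)).arg := by simp [hφ, Complex.log_im]
    rw [h1, abs_mul, abs_of_pos ha0]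
    have := Complex.abs_arg_lt_pi_div_two_iff.2 (Or.inl (hre p hp))
    calc a * |((1 + p) / (1 - p)).arg| < a * (Real.pi / 2) := by gcongr
      _ = w := by rw [ha]; field_simp
  have hφd : DifferentiableOn ℂ φ (Metric.ball 0 1) := by
    intro p hp
    have hp' : ‖p‖ < 1 := by simpa using hp
    have hne : (1 - p) ≠ 0 := by
      intro h; have : p = 1 := by linear_combination -h
      rw [this] at hp'; simp at hp'
    apply DifferentiableAt.differentiableWithinAt
    apply DifferentiableAt.add_const
    apply DifferentiableAt.const_mul
    apply DifferentiableAt.clog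
    · exact DifferentiableAt.div (by fun_prop) (by fun_prop) hne
    · exact Or.inl (hre p hp)
  set e := Real.exp (s / a) with he
  have he0 : 0 < e := Real.exp_pos _
  set p : ℝ := (e - 1) / (e + 1) with hp
  have hpabs : |p| < 1 := by
    rw [hp, abs_div, abs_of_pos (by linarith : 0 < e + 1), div_lt_one (by linarith), abs_lt]
    constructor <;> linarith
  have hφp : φ p = s + y₀ * I := by
    have h1 : (1 + (p:ℂ)) / (1 - p) = (e : ℂ) := by
      have : (1 + p) / (1 - p) = e := by
        have : e + 1 ≠ 0 := by positivity
        rw [hp]; field_simp; ring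
      rw [← this]; push_cast; ring
    rw [hφ]
    simp only
    rw [h1, he, ← Complex.ofReal_log he0.le, Real.log_exp]
    push_cast
    have hac : (a:ℂ) ≠ 0 := by exact_mod_cast ha0.ne'
    field_simp
  have hφ0 : φ 0 = y₀ * I := by simp [hφ]
  have hd := harnack_disc (g := h ∘ φ) (hh.comp hφd (fun p hp => hmap p hp))
    (fun z hz => hpos _ (hmap z hz)) (p := p) (by simpa using hpabs)
  simp only [Function.comp, hφ0, hφp] at hd
  have hratio : (1 - ‖(p:ℂ)‖) / (1 + ‖(p:ℂ)‖) = Real.exp (-(Real.pi / (2 * w)) * |s|) := by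
    have e1 : Real.pi / (2 * w) = 1 / a := by rw [ha]; field_simp
    rw [e1, Complex.norm_real, Real.norm_eq_abs]
    rcases le_total 0 s with hs | hs
    · have : 1 ≤ e := Real.one_le_exp (by positivity)
      have hp0 : 0 ≤ p := div_nonneg (by linarith) (by linarith)
      rw [abs_of_nonneg hp0, abs_of_nonneg hs]
      have : Real.exp (-(1 / a) * s) = e⁻¹ := by rw [he, ← Real.exp_neg]; congr 1; ring
      rw [this, hp]
      field_simp; ring_nf
      exact mul_inv_cancel₀ he0.ne'
    · have : e ≤ 1 := by rw [he]; apply Real.exp_le_one_iff.2; exact div_nonpos_of_nonpos_of_nonneg hs ha0.le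
      have hp0 : p ≤ 0 := div_nonpos_of_nonpos_of_nonneg (by linarith) (by linarith)
      rw [abs_of_nonpos hp0, abs_of_nonpos hs]
      have : Real.exp (-(1 / a) * -s) = e := by rw [he]; congr 1; ring
      rw [this, hp]
      field_simp; ring_nf
  rwa [hratio] at hd

lemma re_zero_of_nonneg {S : Set ℂ} (hS : IsOpen S) (hc : IsPreconnected S) {h : ℂ → ℂ}
    (hh : DifferentiableOn ℂ h S) (hnn : ∀ z ∈ S, 0 ≤ (h z).re) {z₀ : ℂ} (hz₀ : z₀ ∈ S)
    (h0 : (h z₀).re = 0) : ∀ z ∈ S, (h z).re = 0 := by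
  intro z hz
  have := Complex.norm_eqOn_of_isPreconnected_of_isMaxOn (f := fun z => cexp (-h z)) hc hS
    (hh.neg.cexp) hz₀ (by
      intro w hw
      simp only [Function.comp, Complex.norm_exp, mem_ofPred_eq]
      apply Real.exp_le_exp.2
      simp [h0, hnn w hw]) hz
  simp only [Function.comp, Complex.norm_exp, Function.const] at this
  have := Real.exp_injective this
  simp [h0] at this
  exact this

lemma const_of_re_zero_near {S : Set ℂ} (hS : IsOpen S) (hc : IsPreconnected S) {h : ℂ → ℂ}
    (hh : DifferentiableOn ℂ h S) {z₀ : ℂ} (hz₀ : z₀ ∈ S)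
    (h0 : ∀ᶠ z in 𝓝 z₀, (h z).re = 0) : ∃ c : ℂ, c.re = 0 ∧ ∀ z ∈ S, h z = c := by
  obtain ⟨r, hr, hb⟩ := Metric.eventually_nhds_iff_ball.1 (h0.and (hS.mem_nhds hz₀))
  have han : AnalyticOnNhd ℂ h S := hh.analyticOnNhd hS
  obtain ⟨c, hcc⟩ := AnalyticOnNhd.eq_const_of_re_eq_const (U := Metric.ball z₀ r) (c₀ := 0)
    (han.mono (fun z hz => (hb z hz).2)) (fun z hz => (hb z hz).1) Metric.isOpen_ball
    ((convex_ball z₀ r).isConnected ⟨z₀, Metric.mem_ball_self hr⟩)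
  have := AnalyticOnNhd.eqOn_of_preconnected_of_eventuallyEq han (g := fun _ => c)
    (fun z _ => analyticAt_const) hc hz₀ (by
      filter_upwards [Metric.isOpen_ball.mem_nhds (Metric.mem_ball_self hr)] with z hz
      exact hcc z hz)
  refine ⟨c, ?_, fun z hz => this hz⟩
  rw [← hcc z₀ (Metric.mem_ball_self hr)]
  exact (hb z₀ (Metric.mem_ball_self hr)).1

lemma montelU {U : Set ℂ} (𝓤 : Ultrafilter ℕ) (f : ℕ → ℂ → ℂ)
    (hf : ∀ z ∈ U, ∃ r > 0, Metric.ball z r ⊆ U ∧ ∃ M : ℝ, ∀ᶠ n in (𝓤 : Filter ℕ),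
      DifferentiableOn ℂ (f n) (Metric.ball z r) ∧ ∀ w ∈ Metric.ball z r, ‖f n w‖ ≤ M) :
    ∃ g : ℂ → ℂ, DifferentiableOn ℂ g U ∧ TendstoLocallyUniformlyOn f g 𝓤 U ∧
      ∀ z ∈ U, Tendsto (fun n => deriv (f n) z) 𝓤 (𝓝 (deriv g z)) := by
  have hpt : ∀ z : ℂ, ∃ c : ℂ, z ∈ U → Tendsto (fun n => f n z) 𝓤 (𝓝 c) := by
    intro z
    by_cases hz : z ∈ U
    · obtain ⟨r, hr, -, M, hM⟩ := hf z hz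
      have hmem : Metric.closedBall (0:ℂ) M ∈ (𝓤.map (fun n => f n z)) := by
        have : ∀ᶠ n in (𝓤 : Filter ℕ), f n z ∈ Metric.closedBall (0:ℂ) M := by
          filter_upwards [hM] with n hn
          simpa using hn.2 z (Metric.mem_ball_self hr)
        exact this
      obtain ⟨c, -, hc⟩ := (isCompact_closedBall (0:ℂ) M).ultrafilter_le_nhds' _ hmem
      exact ⟨c, fun _ => hc⟩
    · exact ⟨0, fun h => absurd h hz⟩
  choose g hg using hpt
  have hLU : TendstoLocallyUniformlyOn f g 𝓤 U := by
    rw [Metric.tendstoLocallyUniformlyOn_iff]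
    intro ε hε x hx
    obtain ⟨r, hr, hbU, M, hM⟩ := hf x hx
    set M' := max M 1
    have hM'0 : 0 < M' := lt_of_lt_of_le one_pos (le_max_right _ _)
    have hlip : ∀ᶠ n in (𝓤 : Filter ℕ), ∀ w ∈ Metric.ball x r, dist (f n w) (f n x) ≤ 2 * M' / r * dist w x := by
      filter_upwards [hM] with n hn w hw
      apply Complex.dist_le_div_mul_dist_of_mapsTo_ball hn.1 _ hw
      intro y hy
      rw [mem_closedBall_iff_norm]
      have h1 := hn.2 y hy
      have h2 := hn.2 x (Metric.mem_ball_self hr)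
      have h3 : M ≤ M' := le_max_left _ _
      calc _ ≤ ‖f n y‖ + ‖f n x‖ := norm_sub_le _ _
        _ ≤ 2 * M' := by linarith
    have hglip : ∀ w ∈ Metric.ball x r, dist (g w) (g x) ≤ 2 * M' / r * dist w x := by
      intro w hw
      have ht : Tendsto (fun n => dist (f n w) (f n x)) 𝓤 (𝓝 (dist (g w) (g x))) :=
        (hg w (hbU hw)).dist (hg x hx)
      apply le_of_tendsto ht
      filter_upwards [hlip] with n hn using hn w hw
    set η := min r (ε * r / (8 * M')) with hη
    have hη0 : 0 < η := by positivity
    refine ⟨Metric.ball x η, mem_nhdsWithin_of_mem_nhds (Metric.ball_mem_nhds x hη0), ?_⟩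
    have hx' : ∀ᶠ n in (𝓤 : Filter ℕ), dist (f n x) (g x) < ε / 4 :=
      (hg x hx).eventually (Metric.ball_mem_nhds _ (by positivity))
    filter_upwards [hlip, hx'] with n h1 h2 y hy
    have hy1 : dist y x < η := hy
    have hyr : y ∈ Metric.ball x r := lt_of_lt_of_le hy1 (min_le_left _ _)
    have hb : 2 * M' / r * dist y x ≤ ε / 4 := by
      calc 2 * M' / r * dist y x ≤ 2 * M' / r * (ε * r / (8 * M')) := by
            gcongr; exact hy1.le.trans (min_le_right _ _)
        _ = ε / 4 := by field_simp; norm_num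
    have t1 := dist_triangle (g y) (g x) (f n y)
    have t2 := dist_triangle (g x) (f n x) (f n y)
    have a1 := hglip y hyr
    have a2 := h1 y hyr
    rw [dist_comm (f n x) (g x)] at h2
    rw [dist_comm (f n y)] at a2
    linarith
  have hloc : ∀ z ∈ U, ∃ r > 0, Metric.ball z r ⊆ U ∧
      (∀ᶠ n in (𝓤 : Filter ℕ), DifferentiableOn ℂ (f n) (Metric.ball z r)) := by
    intro z hz
    obtain ⟨r, hr, hb, M, hM⟩ := hf z hz
    exact ⟨r, hr, hb, hM.mono fun n hn => hn.1⟩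
  refine ⟨g, ?_, hLU, ?_⟩
  · intro z hz
    obtain ⟨r, hr, hb, hd⟩ := hloc z hz
    have := (hLU.mono hb).differentiableOn hd Metric.isOpen_ball
    exact (this.differentiableAt (Metric.ball_mem_nhds z hr)).differentiableWithinAt
  · intro z hz
    obtain ⟨r, hr, hb, hd⟩ := hloc z hz
    have := (hLU.mono hb).deriv hd Metric.isOpen_ball
    exact this.tendsto_at (Metric.mem_ball_self hr)

/-- Polya peaks -/
lemma peaks {m : ℝ → ℝ} {a σ₁ σ₂' σ₂ : ℝ} (hm : ContinuousOn m (Ici a)) (hm0 : ∀ s, 0 < m s)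
    (h1 : 0 < σ₁) (h12 : σ₁ ≤ σ₂) (h2 : σ₂' < σ₂)
    (hub : ∀ C : ℝ, ∃ s ≥ a, C * Real.exp (σ₁ * s) < m s)
    (hb : ∃ C : ℝ, ∀ s ≥ a, m s ≤ C * Real.exp (σ₂' * s)) (N : ℝ) :
    ∃ S ≥ a, N ≤ S ∧ N ≤ m S ∧ ∀ s ≥ a, m s ≤ max (Real.exp (σ₁ * (s - S))) (Real.exp (σ₂ * (s - S))) * m S := by
  set u : ℝ → ℝ := fun s => m s * Real.exp (-σ₁ * s) with hu
  have huc : ContinuousOn u (Ici a) := hm.mul (by fun_prop)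
  set w : ℝ → ℝ := fun s => m s * Real.exp (-σ₂ * s) with hw
  have hwc : ContinuousOn w (Ici a) := hm.mul (by fun_prop)
  obtain ⟨C, hC⟩ := hb
  have hua : 0 < u a := mul_pos (hm0 a) (Real.exp_pos _)
  -- choose N'
  obtain ⟨N', hN'1, hN'2, hN'3⟩ : ∃ N' ≥ a, N ≤ N' ∧ ∀ s ≥ N', N ≤ u a * Real.exp (σ₁ * s) := by
    have ht : Tendsto (fun s : ℝ => u a * Real.exp (σ₁ * s)) atTop atTop :=
      (Real.tendsto_exp_atTop.comp (tendsto_id.const_mul_atTop h1)).const_mul_atTop hua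
    obtain ⟨N1, hN1⟩ := eventually_atTop.1 (ht.eventually_ge_atTop N)
    exact ⟨max a (max N N1), le_max_left _ _, (le_max_left _ _).trans (le_max_right _ _),
      fun s hs => hN1 s (((le_max_right _ _).trans (le_max_right _ _)).trans hs)⟩
  obtain ⟨b, hbm, hbmax⟩ := isCompact_Icc.exists_isMaxOn (nonempty_Icc.2 hN'1) (huc.mono Icc_subset_Ici_self)
  obtain ⟨t, hta, ht⟩ := hub (u b)
  have hut : u b < u t := by
    have : u b * Real.exp (σ₁ * t) * Real.exp (-σ₁ * t) < m t * Real.exp (-σ₁ * t) :=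
      mul_lt_mul_of_pos_right ht (Real.exp_pos _)
    rwa [mul_assoc, ← Real.exp_add, neg_mul, add_neg_cancel, Real.exp_zero, mul_one, ← neg_mul] at this
  have hN't : N' < t := by
    by_contra hcon
    push Not at hcon
    have h9 : u t ≤ u b := hbmax (show t ∈ Icc a N' from ⟨hta, hcon⟩)
    exact absurd h9 (not_le.2 hut)
  obtain ⟨R, hR, hRmax⟩ := isCompact_Icc.exists_isMaxOn (nonempty_Icc.2 hta) (huc.mono Icc_subset_Ici_self)
  have hRN : N' ≤ R := by
    by_contra hcon
    push Not at hcon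
    have h3 : u t ≤ u R := hRmax (right_mem_Icc.2 hta)
    have h4 : u R ≤ u b := hbmax (show R ∈ Icc a N' from ⟨hR.1, hcon.le⟩)
    linarith
  -- w tends to zero
  have hwt : Tendsto w atTop (𝓝 0) := by
    have hz : Tendsto (fun s : ℝ => C * Real.exp (-((σ₂ - σ₂') * s))) atTop (𝓝 (C * 0)) := by
      apply Tendsto.const_mul
      exact Real.tendsto_exp_neg_atTop_nhds_zero.comp (tendsto_id.const_mul_atTop (by linarith))
    rw [mul_zero] at hz
    refine squeeze_zero' (Eventually.of_forall fun s => (mul_pos (hm0 s) (Real.exp_pos _)).le) ?_ hz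
    filter_upwards [eventually_ge_atTop a] with s hs
    calc w s ≤ C * Real.exp (σ₂' * s) * Real.exp (-σ₂ * s) :=
          mul_le_mul_of_nonneg_right (hC s hs) (Real.exp_pos _).le
      _ = _ := by rw [mul_assoc, ← Real.exp_add]; congr 2; ring
  have hwR : 0 < w R := mul_pos (hm0 R) (Real.exp_pos _)
  obtain ⟨T, hT⟩ := eventually_atTop.1 (hwt.eventually_lt_const hwR)
  set T' := max T R
  obtain ⟨S, hS, hSmax⟩ := isCompact_Icc.exists_isMaxOn (nonempty_Icc.2 (le_max_right T R : R ≤ T'))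
    (hwc.mono (fun x hx => hR.1.trans hx.1))
  have hSall : ∀ s ≥ R, w s ≤ w S := by
    intro s hs
    rcases le_total s T' with h | h
    · exact hSmax ⟨hs, h⟩
    · exact ((hT s ((le_max_left _ _).trans h)).le).trans (hSmax (left_mem_Icc.2 (le_max_right T R)))
  have hRS : R ≤ S := hS.1
  have hmR : ∀ s ∈ Icc a R, m s ≤ m R * Real.exp (σ₁ * (s - R)) := by
    intro s hs
    have h3 : u s ≤ u R := hRmax (show s ∈ Icc a t from ⟨hs.1, hs.2.trans hR.2⟩)
    have h4 := mul_le_mul_of_nonneg_right h3 (Real.exp_pos (σ₁ * s)).le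
    simp only [hu] at h4
    rw [mul_assoc, mul_assoc, ← Real.exp_add, ← Real.exp_add] at h4
    rw [show -σ₁ * s + σ₁ * s = 0 by ring, Real.exp_zero, mul_one] at h4
    rwa [show -σ₁ * R + σ₁ * s = σ₁ * (s - R) by ring] at h4
  have hmS : ∀ s ≥ R, m s ≤ m S * Real.exp (σ₂ * (s - S)) := by
    intro s hs
    have h4 := mul_le_mul_of_nonneg_right (hSall s hs) (Real.exp_pos (σ₂ * s)).le
    simp only [hw] at h4
    rw [mul_assoc, mul_assoc, ← Real.exp_add, ← Real.exp_add] at h4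
    rw [show -σ₂ * s + σ₂ * s = 0 by ring, Real.exp_zero, mul_one] at h4
    rwa [show -σ₂ * S + σ₂ * s = σ₂ * (s - S) by ring] at h4
  have hmRS := hmS R le_rfl
  refine ⟨S, hR.1.trans hRS, by linarith, ?_, ?_⟩
  · have h3 : u a ≤ u R := hRmax (left_mem_Icc.2 hta)
    have h4 : N ≤ u R * Real.exp (σ₁ * R) := (hN'3 R hRN).trans (by gcongr)
    have h5 : u R * Real.exp (σ₁ * R) = m R := by
      simp only [hu]; rw [mul_assoc, ← Real.exp_add]; rw [show -σ₁ * R + σ₁ * R = 0 by ring]; simp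
    rw [h5] at h4
    refine h4.trans (hmRS.trans ?_)
    apply mul_le_of_le_one_right (hm0 S).le
    apply Real.exp_le_one_iff.2
    nlinarith
  · intro s hs
    rw [mul_comm]
    rcases le_total s R with h | h
    · calc m s ≤ m R * Real.exp (σ₁ * (s - R)) := hmR s ⟨hs, h⟩
        _ ≤ m S * Real.exp (σ₂ * (R - S)) * Real.exp (σ₁ * (s - R)) := by gcongr
        _ ≤ m S * Real.exp (σ₁ * (R - S)) * Real.exp (σ₁ * (s - R)) := by
          have : Real.exp (σ₂ * (R - S)) ≤ Real.exp (σ₁ * (R - S)) := Real.exp_le_exp.2 (by nlinarith)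
          have := hm0 S
          gcongr
        _ = m S * Real.exp (σ₁ * (s - S)) := by rw [mul_assoc, ← Real.exp_add]; congr 2; ring
        _ ≤ _ := mul_le_mul_of_nonneg_left (le_max_left _ _) (hm0 S).le
    · exact (hmS s h).trans (mul_le_mul_of_nonneg_left (le_max_right _ _) (hm0 S).le)

/-- Liouville for periodic functions -/
lemma per_liouville {A : ℂ → ℂ} (hA : Differentiable ℂ A) (hper : ∀ ζ, A (ζ + 2 * Real.pi * I) = A ζ)
    {C a b : ℝ} (ha : 0 < a) (hab : a ≤ b) (hb : b < 1)
    (hgr : ∀ ζ, ‖A ζ‖ ≤ C * max (Real.exp (a * ζ.re)) (Real.exp (b * ζ.re))) : ∀ ζ, A ζ = 0 := by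
  have hpi := Real.pi_pos
  have h2pi : (0:ℝ) < 2 * Real.pi := by positivity
  have hC0 : 0 ≤ C := by
    have := (norm_nonneg _).trans (hgr 0)
    simpa using this
  set f : ℂ → ℂ := fun w => A (I * w) with hf
  have hfd : Differentiable ℂ f := hA.comp (by fun_prop)
  have hfp : Function.Periodic f ((2 * Real.pi : ℝ) : ℂ) := by
    intro w; simp only [hf]; rw [← hper (I * w)]; congr 1; push_cast; ring
  set B := Function.Periodic.cuspFunction (2 * Real.pi) f with hB
  have hBq : ∀ q : ℂ, q ≠ 0 → B q = A (Complex.log q) := by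
    intro q hq
    rw [hB, Function.Periodic.cuspFunction_eq_of_nonzero _ _ hq]
    simp only [hf, Function.Periodic.invQParam]
    congr 1
    push_cast
    field_simp
  have hBn : ∀ q : ℂ, q ≠ 0 → ‖B q‖ ≤ C * max (‖q‖ ^ a) (‖q‖ ^ b) := by
    intro q hq
    rw [hBq q hq]
    have := hgr (Complex.log q)
    rw [Complex.log_re] at this
    rw [Real.rpow_def_of_pos (norm_pos_iff.2 hq), Real.rpow_def_of_pos (norm_pos_iff.2 hq), mul_comm _ a, mul_comm _ b]
    exact this
  have hbd : ∀ q : ℂ, q ≠ 0 → ‖q‖ ≤ 1 → ‖B q‖ ≤ C * ‖q‖ ^ a := by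
    intro q hq hq1
    have := hBn q hq
    rwa [max_eq_left (Real.rpow_le_rpow_of_exponent_ge (norm_pos_iff.2 hq) hq1 hab)] at this
  have hz : Filter.ZeroAtFilter (comap im atTop) f := by
    have key : ∀ᶠ w in comap im atTop, ‖f w‖ ≤ C * Real.exp (-(a * w.im)) := by
      have : ∀ᶠ w : ℂ in comap im atTop, 0 ≤ w.im := (tendsto_comap).eventually (eventually_ge_atTop 0)
      filter_upwards [this] with w hw
      have h1 := hgr (I * w)
      simp only [mul_re, I_re, zero_mul, I_im, one_mul, zero_sub] at h1
      rw [max_eq_left (Real.exp_le_exp.2 (by nlinarith))] at h1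
      rwa [mul_neg] at h1
    refine squeeze_zero_norm' key ?_
    have : Tendsto (fun y : ℝ => C * Real.exp (-(a * y))) atTop (𝓝 (C * 0)) := by
      apply Tendsto.const_mul
      exact Real.tendsto_exp_neg_atTop_nhds_zero.comp (tendsto_id.const_mul_atTop ha)
    rw [mul_zero] at this
    exact this.comp tendsto_comap
  have hB0 : B 0 = 0 := Function.Periodic.cuspFunction_zero_of_zero_at_inf h2pi hz
  have hBd : Differentiable ℂ B := by
    intro q
    by_cases hq : q = 0
    · rw [hq]
      exact Function.Periodic.differentiableAt_cuspFunction_zero h2pi hfp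
        (Eventually.of_forall fun w => hfd w) hz.boundedAtFilter
    · have := Function.Periodic.differentiableAt_cuspFunction (h := 2 * Real.pi) h2pi.ne' hfp
        (hfd (Function.Periodic.invQParam (2 * Real.pi) q))
      rwa [Function.Periodic.qParam_right_inv h2pi.ne' hq] at this
  have hderiv : ∀ c, deriv B c = 0 := by
    intro c
    have hbound : ∀ R : ℝ, 1 + ‖c‖ ≤ R → ‖deriv B c‖ ≤ C * (2 * R) ^ b / R := by
      intro R hR
      have hc0 := norm_nonneg c
      have hRpos : 0 < R := by linarith
      apply Complex.norm_deriv_le_of_forall_mem_sphere_norm_le hRpos hBd.diffContOnCl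
      intro z hz
      rw [mem_sphere_iff_norm] at hz
      have hz1 : ‖z‖ ≤ 2 * R := by
        calc ‖z‖ = ‖(z - c) + c‖ := by ring_nf
          _ ≤ ‖z - c‖ + ‖c‖ := norm_add_le _ _
          _ ≤ 2 * R := by linarith
      have hz2 : 1 ≤ ‖z‖ := by
        have := norm_sub_norm_le (z - c) (-c)
        rw [norm_neg, sub_neg_eq_add, sub_add_cancel] at this
        linarith
      have := hBn z (norm_pos_iff.1 (by linarith))
      rw [max_eq_right (Real.rpow_le_rpow_of_exponent_le hz2 hab)] at this
      refine this.trans ?_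
      gcongr
      linarith
    have hlim : Tendsto (fun R : ℝ => C * (2 * R) ^ b / R) atTop (𝓝 0) := by
      have h1 : Tendsto (fun R : ℝ => (C * 2 ^ b) * R ^ (-(1 - b))) atTop (𝓝 ((C * 2 ^ b) * 0)) :=
        (tendsto_rpow_neg_atTop (by linarith)).const_mul _
      rw [mul_zero] at h1
      refine h1.congr' ?_
      filter_upwards [eventually_gt_atTop 0] with R hR
      rw [Real.mul_rpow (by norm_num) hR.le, neg_sub, Real.rpow_sub hR, Real.rpow_one]; ring
    have := ge_of_tendsto hlim (eventually_atTop.2 ⟨1 + ‖c‖, hbound⟩)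
    exact norm_le_zero_iff.1 this
  have hBz : ∀ q, B q = 0 := by
    intro q
    rw [is_const_of_deriv_eq_zero hBd hderiv q 0, hB0]
  intro ζ
  have := Function.Periodic.eq_cuspFunction (h := 2 * Real.pi) h2pi.ne' hfp (-I * ζ)
  rw [← hB, hBz] at this
  rw [hf] at this
  simp only at this
  rw [← mul_assoc, mul_neg, I_mul_I, neg_neg, one_mul] at this
  exact this.symm

/-! ### Section 3 - B -/

def Dinf (k : ℤ) : Set ℂ := {ζ | |ζ.im - Lk k| < 2 * Real.pi / 3}
def Sinf (k : ℤ) : Set ℂ := {ζ | |ζ.im - ck k| < Real.pi / 3}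

/-- limit objects of blow-ups -/
structure LimData (η : ℤ → ℂ → ℂ) (σ₁ σ₂ : ℝ) : Prop where
  diff : ∀ k, DifferentiableOn ℂ (η k) (Dinf k)
  t1 : ∀ k, ∀ ζ ∈ Sinf k, (η k ζ).re ≤ max 0 (-(η (k + 1) ζ).re)
  t2 : ∀ k, ∀ ζ ∈ Sinf k, -(η (k + 1) ζ).re ≤ max 0 (η k ζ).re
  t3 : ∀ k, ∀ ζ ∈ Sinf k, 0 ≤ max (η k ζ).re (-(η (k + 1) ζ).re)
  per : ∀ k, ∀ ζ ∈ Dinf k, η (k + 3) (ζ + 2 * Real.pi * I) = η k ζ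
  grv : ∀ δ > 0, ∃ C, ∀ k ζ, |ζ.im - Lk k| ≤ 2 * Real.pi / 3 - δ →
    |(η k ζ).re| ≤ C * max (Real.exp (σ₁ * ζ.re)) (Real.exp (σ₂ * ζ.re))
  grd : ∀ δ > 0, ∃ C, ∀ k ζ, |ζ.im - Lk k| ≤ 2 * Real.pi / 3 - δ →
    ‖deriv (η k) ζ‖ ≤ C * max (Real.exp (σ₁ * ζ.re)) (Real.exp (σ₂ * ζ.re))
  nz : ∃ k ζ, ζ ∈ Sinf k ∧ ((η k ζ).re ≠ 0 ∨ (η (k + 1) ζ).re ≠ 0)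
  crossing : ∀ k, (∀ ζ ∈ Dinf (k + 1), (η (k + 1) ζ).re = 0) → (∀ ζ ∈ Sinf k, (η k ζ).re < 0) →
    ¬ (∀ ζ ∈ Sinf (k + 1), (η (k + 2) ζ).re = 0)

lemma Dinf_convex (k : ℤ) : Convex ℝ (Dinf k) := by
  have : Dinf k = Complex.imLm ⁻¹' (Metric.ball (Lk k) (2 * Real.pi / 3)) := by
    ext ζ; simp [Dinf, Real.dist_eq]
  rw [this]
  exact (convex_ball _ _).linear_preimage _

lemma Sinf_convex (k : ℤ) : Convex ℝ (Sinf k) := by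
  have : Sinf k = Complex.imLm ⁻¹' (Metric.ball (ck k) (Real.pi / 3)) := by
    ext ζ; simp [Sinf, Real.dist_eq]
  rw [this]
  exact (convex_ball _ _).linear_preimage _

lemma isOpen_Dinf (k : ℤ) : IsOpen (Dinf k) :=
  isOpen_lt ((Complex.continuous_im.sub continuous_const).abs) continuous_const
lemma isOpen_Sinf (k : ℤ) : IsOpen (Sinf k) :=
  isOpen_lt ((Complex.continuous_im.sub continuous_const).abs) continuous_const

lemma Sinf_sub (k : ℤ) : Sinf k ⊆ Dinf k := by
  intro ζ hζ
  simp only [Sinf, Dinf, mem_ofPred_eq, ck_eq, abs_lt] at *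
  constructor <;> linarith [Real.pi_pos]
lemma Sinf_sub' (k : ℤ) : Sinf k ⊆ Dinf (k + 1) := by
  intro ζ hζ
  simp only [Sinf, Dinf, mem_ofPred_eq, ck_eq', abs_lt] at *
  constructor <;> linarith [Real.pi_pos]
lemma Sinf_sub'' (k : ℤ) : Sinf (k - 1) ⊆ Dinf k := by
  have := Sinf_sub' (k - 1); rwa [sub_add_cancel] at this

lemma cen_mem_Sinf (k : ℤ) (s : ℝ) : (s + ck k * I : ℂ) ∈ Sinf k := by
  simp [Sinf, Real.pi_pos]

/-- a nonnegative function in a strip growing too slowly at `-∞` vanishes -/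
lemma strip_zero {h : ℂ → ℂ} {y₀ w σ₁ σ₂ C : ℝ} (hw : 0 < w)
    (hh : DifferentiableOn ℂ h {ζ | |ζ.im - y₀| < w})
    (hnn : ∀ ζ : ℂ, |ζ.im - y₀| < w → 0 ≤ (h ζ).re)
    (hσ : Real.pi / (2 * w) < σ₁) (h12 : σ₁ ≤ σ₂)
    (hgr : ∀ s : ℝ, (h (s + y₀ * I)).re ≤ C * max (Real.exp (σ₁ * s)) (Real.exp (σ₂ * s))) :
    ∀ ζ : ℂ, |ζ.im - y₀| < w → (h ζ).re = 0 := by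
  by_contra hcon
  push Not at hcon
  obtain ⟨ζ₀, hζ₀, hne⟩ := hcon
  have hopen : IsOpen {ζ : ℂ | |ζ.im - y₀| < w} :=
    isOpen_lt ((Complex.continuous_im.sub continuous_const).abs) continuous_const
  have hconv : Convex ℝ {ζ : ℂ | |ζ.im - y₀| < w} := by
    have : {ζ : ℂ | |ζ.im - y₀| < w} = Complex.imLm ⁻¹' (Metric.ball y₀ w) := by
      ext ζ; simp [Real.dist_eq]
    rw [this]
    exact (convex_ball _ _).linear_preimage _
  have hpos : ∀ ζ : ℂ, |ζ.im - y₀| < w → 0 < (h ζ).re := by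
    intro ζ hζ
    rcases (hnn ζ hζ).lt_or_eq with h1 | h1
    · exact h1
    · exact absurd (re_zero_of_nonneg hopen hconv.isPreconnected hh hnn (z₀ := ζ) hζ h1.symm ζ₀ hζ₀) hne
  set τ := Real.pi / (2 * w) with hτ
  have hτ0 : 0 < τ := by have := Real.pi_pos; positivity
  have h0 : 0 < (h (y₀ * I)).re := hpos _ (by simpa using hw)
  have key : ∀ t : ℝ, 0 ≤ t → (h (y₀ * I)).re ≤ C * Real.exp (-(σ₁ - τ) * t) := by
    intro t ht
    have h1 := harnack_strip hw hh hpos (-t)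
    have h2 := hgr (-t)
    have h3 : max (Real.exp (σ₁ * (-t))) (Real.exp (σ₂ * (-t))) = Real.exp (σ₁ * (-t)) := by
      apply max_eq_left; apply Real.exp_le_exp.2; nlinarith
    rw [h3] at h2
    rw [abs_neg, abs_of_nonneg ht] at h1
    have h4 := h1.trans h2
    have e1 : Real.exp (-(σ₁ - τ) * t) = Real.exp (σ₁ * (-t)) * Real.exp (τ * t) := by
      rw [← Real.exp_add]; congr 1; ring
    have e2 : Real.exp (-τ * t) * Real.exp (τ * t) = 1 := by
      rw [← Real.exp_add]; simp
    calc (h (y₀ * I)).re = ((h (y₀ * I)).re * Real.exp (-τ * t)) * Real.exp (τ * t) := by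
          rw [mul_assoc, e2, mul_one]
      _ ≤ (C * Real.exp (σ₁ * (-t))) * Real.exp (τ * t) :=
          mul_le_mul_of_nonneg_right h4 (Real.exp_pos _).le
      _ = _ := by rw [e1]; ring
  have hlim : Tendsto (fun t : ℝ => C * Real.exp (-(σ₁ - τ) * t)) atTop (𝓝 (C * 0)) := by
    apply Tendsto.const_mul
    apply Real.tendsto_exp_atBot.comp
    apply Tendsto.const_mul_atTop_of_neg (by linarith) tendsto_id
  rw [mul_zero] at hlim
  have := ge_of_tendsto hlim (by filter_upwards [eventually_ge_atTop 0] with t ht using key t ht)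
  linarith

namespace LimData
variable {η : ℤ → ℂ → ℂ} {σ₁ σ₂ : ℝ}

lemma modes (h : LimData η σ₁ σ₂) (k : ℤ) :
    (∀ ζ ∈ Sinf k, (η k ζ).re = -(η (k + 1) ζ).re ∧ 0 ≤ (η k ζ).re) ∨
    (∀ ζ ∈ Sinf k, (η (k + 1) ζ).re = 0 ∧ (η k ζ).re ≤ 0) ∨
    (∀ ζ ∈ Sinf k, (η k ζ).re = 0 ∧ 0 ≤ (η (k + 1) ζ).re) := by
  have hd1 : DifferentiableOn ℂ (η k) (Sinf k) := (h.diff k).mono (Sinf_sub k)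
  have hd2 : DifferentiableOn ℂ (η (k+1)) (Sinf k) := (h.diff (k+1)).mono (Sinf_sub' k)
  have hS := isOpen_Sinf k
  have hc := (Sinf_convex k).isPreconnected
  have c1 : ∀ ζ ∈ Sinf k, ContinuousAt (fun z => (η k z).re) ζ := fun ζ hζ =>
    Complex.continuous_re.continuousAt.comp ((hd1.differentiableAt (hS.mem_nhds hζ)).continuousAt)
  have c2 : ∀ ζ ∈ Sinf k, ContinuousAt (fun z => (η (k+1) z).re) ζ := fun ζ hζ =>
    Complex.continuous_re.continuousAt.comp ((hd2.differentiableAt (hS.mem_nhds hζ)).continuousAt)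
  have hA : (∃ ζ ∈ Sinf k, 0 < (η k ζ).re ∨ (η (k+1) ζ).re < 0) →
      (∀ ζ ∈ Sinf k, (η k ζ).re = -(η (k + 1) ζ).re ∧ 0 ≤ (η k ζ).re) := by
    rintro ⟨ζ, hζ, hh⟩
    have hev : ∀ᶠ z in 𝓝 ζ, 0 < (η k z).re ∨ (η (k+1) z).re < 0 := by
      rcases hh with hh | hh
      · filter_upwards [(c1 ζ hζ).eventually_const_lt hh] with z hz using Or.inl hz
      · filter_upwards [(c2 ζ hζ).eventually_lt_const hh] with z hz using Or.inr hz
    obtain ⟨c, hc0, hcc⟩ := const_of_re_zero_near hS hc (hd1.add hd2) hζ (by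
      filter_upwards [hev, hS.mem_nhds hζ] with z hz hzS
      have a1 := h.t1 k z hzS
      have a2 := h.t2 k z hzS
      simp only [Pi.add_apply, add_re]
      rcases le_max_iff.1 a1 with b1 | b1 <;> rcases le_max_iff.1 a2 with b2 | b2 <;>
        rcases hz with hz | hz <;> linarith)
    intro z hz
    have e := congrArg Complex.re (hcc z hz)
    simp only [Pi.add_apply, add_re, hc0] at e
    have a3 := h.t3 k z hz
    have e' : (η k z).re = -(η (k + 1) z).re := by linarith
    refine ⟨e', ?_⟩
    rwa [← e', max_self] at a3
  by_cases hA' : ∃ ζ ∈ Sinf k, 0 < (η k ζ).re ∨ (η (k+1) ζ).re < 0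
  · exact Or.inl (hA hA')
  push Not at hA'
  by_cases hB' : ∃ ζ ∈ Sinf k, (η k ζ).re < 0
  · right; left
    obtain ⟨ζ, hζ, hh⟩ := hB'
    obtain ⟨c, hc0, hcc⟩ := const_of_re_zero_near hS hc hd2 hζ (by
      filter_upwards [(c1 ζ hζ).eventually_lt_const hh, hS.mem_nhds hζ] with z hz hzS
      have a3 := h.t3 k z hzS
      have := (hA' z hzS).2
      rcases le_max_iff.1 a3 with b | b <;> linarith)
    intro z hz
    exact ⟨by rw [hcc z hz, hc0], (hA' z hz).1⟩
  push Not at hB'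
  right; right
  intro z hz
  exact ⟨le_antisymm (hA' z hz).1 (hB' z hz), (hA' z hz).2⟩

lemma zero_ext (h : LimData η σ₁ σ₂) (k j : ℤ) (hj : Sinf j ⊆ Dinf k)
    (h0 : ∀ ζ ∈ Sinf j, (η k ζ).re = 0) : ∀ ζ ∈ Dinf k, (η k ζ).re = 0 := by
  obtain ⟨c, hc0, hcc⟩ := const_of_re_zero_near (isOpen_Dinf k) (Dinf_convex k).isPreconnected
    (h.diff k) (hj (cen_mem_Sinf j 0)) (by
      filter_upwards [(isOpen_Sinf j).mem_nhds (cen_mem_Sinf j 0)] with z hz using h0 z hz)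
  intro ζ hζ
  rw [hcc ζ hζ, hc0]

theorem b1 (h : LimData η σ₁ σ₂) (h1 : 3 / 2 < σ₁) (h12 : σ₁ ≤ σ₂) : False := by
  have hpi := Real.pi_pos
  have hpi' : Real.pi / (2 * (Real.pi / 3)) = 3 / 2 := by field_simp
  obtain ⟨C, hC⟩ := h.grv (Real.pi / 3) (by positivity)
  have g1 : ∀ k, ∀ s : ℝ, |(η k (s + ck k * I)).re| ≤ C * max (Real.exp (σ₁ * s)) (Real.exp (σ₂ * s)) := by
    intro k s
    have := hC k (s + ck k * I) (by
      simp only [ck_eq]; simp [abs_of_pos (show 0 < Real.pi / 3 by positivity)]; linarith)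
    simpa using this
  have g2 : ∀ k, ∀ s : ℝ, |(η (k+1) (s + ck k * I)).re| ≤ C * max (Real.exp (σ₁ * s)) (Real.exp (σ₂ * s)) := by
    intro k s
    have := hC (k+1) (s + ck k * I) (by
      simp only [ck_eq']; simp [abs_of_pos (show 0 < Real.pi / 3 by positivity)]; linarith)
    simpa using this
  have hd1 : ∀ k, DifferentiableOn ℂ (η k) (Sinf k) := fun k => (h.diff k).mono (Sinf_sub k)
  have hd2 : ∀ k, DifferentiableOn ℂ (η (k+1)) (Sinf k) := fun k => (h.diff (k+1)).mono (Sinf_sub' k)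
  have P : ∀ (k : ℤ) (g : ℂ → ℂ), DifferentiableOn ℂ g (Sinf k) →
      (∀ s : ℝ, |(g (s + ck k * I)).re| ≤ C * max (Real.exp (σ₁ * s)) (Real.exp (σ₂ * s))) →
      (∀ ζ ∈ Sinf k, 0 ≤ (g ζ).re) → ∀ ζ ∈ Sinf k, (g ζ).re = 0 := by
    intro k g hg hb hn
    exact strip_zero (by positivity) hg hn (by rw [hpi']; exact h1) h12
      (fun s => (le_abs_self _).trans (hb s))
  have Pn : ∀ (k : ℤ) (g : ℂ → ℂ), DifferentiableOn ℂ g (Sinf k) →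
      (∀ s : ℝ, |(g (s + ck k * I)).re| ≤ C * max (Real.exp (σ₁ * s)) (Real.exp (σ₂ * s))) →
      (∀ ζ ∈ Sinf k, (g ζ).re ≤ 0) → ∀ ζ ∈ Sinf k, (g ζ).re = 0 := by
    intro k g hg hb hn ζ hζ
    have := P k (fun z => - g z) hg.neg (by simpa using hb) (by simpa using hn) ζ hζ
    simpa using this
  obtain ⟨k, ζ, hζ, hne⟩ := h.nz
  rcases h.modes k with m | m | m
  · have a := P k _ (hd1 k) (g1 k) (fun z hz => (m z hz).2) ζ hζ
    have b := (m ζ hζ).1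
    rw [a] at b
    rcases hne with hne | hne
    · exact hne a
    · exact hne (by linarith)
  · have a := Pn k _ (hd1 k) (g1 k) (fun z hz => (m z hz).2) ζ hζ
    rcases hne with hne | hne
    · exact hne a
    · exact hne (m ζ hζ).1
  · have a := P k _ (hd2 k) (g2 k) (fun z hz => (m z hz).2) ζ hζ
    rcases hne with hne | hne
    · exact hne (m ζ hζ).1
    · exact hne a

lemma nonneg_ext (h : LimData η σ₁ σ₂) (k : ℤ) (s : ℝ) (h1 : ∀ ζ ∈ Sinf k, 0 ≤ s * (η k ζ).re)
    (h2 : ∀ ζ ∈ Sinf (k - 1), 0 ≤ s * (η k ζ).re) : ∀ ζ ∈ Dinf k, 0 ≤ s * (η k ζ).re := by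
  have hpi := Real.pi_pos
  have e1 : ck (k - 1) = Lk k - Real.pi / 3 := by rw [ck_eq']; simp
  intro ζ hζ
  have hζ' := abs_lt.1 (show |ζ.im - Lk k| < _ from hζ)
  rcases lt_trichotomy ζ.im (Lk k) with hl | hl | hl
  · apply h2
    simp only [Sinf, mem_ofPred_eq, e1, abs_lt]
    constructor <;> linarith
  · have hc : ContinuousAt (fun z => s * (η k z).re) ζ :=
      continuousAt_const.mul (Complex.continuous_re.continuousAt.comp
        (((h.diff k).differentiableAt ((isOpen_Dinf k).mem_nhds hζ)).continuousAt))
    have ht : Tendsto (fun t : ℝ => ζ + t * I) (𝓝[>] 0) (𝓝 ζ) := by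
      have : ContinuousAt (fun t : ℝ => ζ + t * I) 0 := by fun_prop
      have := this.tendsto
      simp only [ofReal_zero, zero_mul, add_zero] at this
      exact this.mono_left nhdsWithin_le_nhds
    refine ge_of_tendsto (hc.tendsto.comp ht) ?_
    filter_upwards [Ioo_mem_nhdsGT (show (0:ℝ) < 1 by norm_num)] with t ht
    apply h1
    simp only [Sinf, mem_ofPred_eq, ck_eq, abs_lt]
    simp
    constructor <;> linarith [ht.1, ht.2, Real.pi_gt_three]
  · apply h1
    simp only [Sinf, mem_ofPred_eq, ck_eq, abs_lt]
    constructor <;> linarith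

/-- all modes alternate: contradiction -/
lemma alt_false (h : LimData η σ₁ σ₂) (h1 : 3 / 4 < σ₁) (h12 : σ₁ ≤ σ₂) (h2 : σ₂ < 3 / 2)
    (hA : ∀ k, ∀ ζ ∈ Sinf k, (η k ζ).re = -(η (k + 1) ζ).re)
    (hne : ∀ k, ¬ ∀ ζ ∈ Dinf k, (η k ζ).re = 0) : False := by
  have hpi := Real.pi_pos
  have hd' : ∀ k, DifferentiableOn ℂ (deriv (η k)) (Dinf k) := fun k => (h.diff k).deriv (isOpen_Dinf k)
  -- adjacent derivatives
  have adj : ∀ k, ∀ ζ ∈ Sinf k, deriv (η (k + 1)) ζ = - deriv (η k) ζ := by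
    intro k ζ hζ
    obtain ⟨c, hc0, hcc⟩ := const_of_re_zero_near (isOpen_Sinf k) (Sinf_convex k).isPreconnected
      (((h.diff k).mono (Sinf_sub k)).add ((h.diff (k+1)).mono (Sinf_sub' k))) (cen_mem_Sinf k 0) (by
        filter_upwards [(isOpen_Sinf k).mem_nhds (cen_mem_Sinf k 0)] with z hz
        simp only [Pi.add_apply, add_re, hA k z hz]; ring)
    have d1 := (h.diff k).differentiableAt ((isOpen_Dinf k).mem_nhds (Sinf_sub k hζ))
    have d2 := (h.diff (k+1)).differentiableAt ((isOpen_Dinf (k+1)).mem_nhds (Sinf_sub' k hζ))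
    have e : deriv (η k + η (k+1)) ζ = 0 := by
      have : (η k + η (k+1)) =ᶠ[𝓝 ζ] fun _ => c := by
        filter_upwards [(isOpen_Sinf k).mem_nhds hζ] with z hz using hcc z hz
      rw [this.deriv_eq]; simp
    rw [deriv_add d1 d2] at e
    linear_combination e
  set κ : ℂ → ℤ := fun ζ => ⌊ζ.im / (2 * Real.pi / 3) + 1 / 2⌋ with hκ
  have κb : ∀ ζ : ℂ, |ζ.im - Lk (κ ζ)| ≤ Real.pi / 3 := by
    intro ζ
    have f1 := Int.floor_le (ζ.im / (2 * Real.pi / 3) + 1 / 2)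
    have f2 := Int.lt_floor_add_one (ζ.im / (2 * Real.pi / 3) + 1 / 2)
    have e : ζ.im = (ζ.im / (2 * Real.pi / 3)) * (2 * Real.pi / 3) := by field_simp
    rw [abs_le, Lk]
    set q := ζ.im / (2 * Real.pi / 3)
    rw [e]
    change ((κ ζ : ℤ) : ℝ) ≤ _ at f1
    change _ < ((κ ζ : ℤ) : ℝ) + 1 at f2
    constructor <;> nlinarith
  set e : ℂ → ℂ := fun ζ => (-1 : ℂ) ^ (κ ζ) * deriv (η (κ ζ)) ζ with he
  have heq : ∀ j, ∀ ζ ∈ Dinf j, e ζ = (-1 : ℂ) ^ j * deriv (η j) ζ := by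
    intro j ζ hζ
    have b1 := abs_le.1 (κb ζ)
    have b2 := abs_lt.1 (show |ζ.im - Lk j| < _ from hζ)
    simp only [he]
    generalize κ ζ = i at *
    rcases lt_trichotomy i j with hij | hij | hij
    · have : j = i + 1 := by
        have : (j : ℝ) < i + 2 := by
          simp only [Lk] at b1 b2
          by_contra hcon
          push Not at hcon
          nlinarith
        have : j < i + 2 := by exact_mod_cast this
        omega
      subst this
      rw [adj i ζ, zpow_add_one₀ (by norm_num)]
      · ring
      · simp only [Sinf, mem_ofPred_eq, ck_eq, abs_lt]
        rw [Lk_succ] at b2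
        constructor <;> linarith
    · rw [hij]
    · have : i = j + 1 := by
        have : (i : ℝ) < j + 2 := by
          simp only [Lk] at b1 b2
          by_contra hcon
          push Not at hcon
          nlinarith
        have : i < j + 2 := by exact_mod_cast this
        omega
      subst this
      rw [adj j ζ, zpow_add_one₀ (by norm_num)]
      · ring
      · simp only [Sinf, mem_ofPred_eq, ck_eq, abs_lt]
        rw [Lk_succ] at b1
        constructor <;> linarith
  have κD : ∀ ζ, ζ ∈ Dinf (κ ζ) := fun ζ => lt_of_le_of_lt (κb ζ) (by linarith)
  have hed : Differentiable ℂ e := by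
    intro ζ
    have : e =ᶠ[𝓝 ζ] fun z => (-1 : ℂ) ^ (κ ζ) * deriv (η (κ ζ)) z := by
      filter_upwards [(isOpen_Dinf (κ ζ)).mem_nhds (κD ζ)] with z hz using heq _ z hz
    apply DifferentiableAt.congr_of_eventuallyEq _ this
    exact (((hd' _).differentiableAt ((isOpen_Dinf (κ ζ)).mem_nhds (κD ζ)))).const_mul _
  have heper : ∀ ζ, e (ζ + 2 * Real.pi * I) = - e ζ := by
    intro ζ
    have hm : ζ + 2 * Real.pi * I ∈ Dinf (κ ζ + 3) := by
      have := κD ζ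
      simp only [Dinf, mem_ofPred_eq, Lk] at this ⊢
      have e1 : (ζ + 2 * Real.pi * I).im - 2 * Real.pi * ((κ ζ + 3 : ℤ) : ℝ) / 3 = ζ.im - 2 * Real.pi * (κ ζ) / 3 := by
        simp; ring
      rw [e1]; exact this
    rw [heq _ _ hm, heq _ _ (κD ζ)]
    have : deriv (η (κ ζ + 3)) (ζ + 2 * Real.pi * I) = deriv (η (κ ζ)) ζ := by
      rw [← deriv_comp_add_const]
      apply Filter.EventuallyEq.deriv_eq
      filter_upwards [(isOpen_Dinf (κ ζ)).mem_nhds (κD ζ)] with z hz using h.per _ z hz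
    rw [this, zpow_add₀ (by norm_num)]
    norm_num
  obtain ⟨C, hC⟩ := h.grd (Real.pi / 3) (by positivity)
  have hegr : ∀ ζ, ‖e ζ‖ ≤ C * max (Real.exp (σ₁ * ζ.re)) (Real.exp (σ₂ * ζ.re)) := by
    intro ζ
    have := hC (κ ζ) ζ (by linarith [κb ζ])
    simpa [he] using this
  have hz := per_liouville (A := fun ζ => e ζ * cexp (-ζ / 2)) (C := C) (a := σ₁ - 1 / 2) (b := σ₂ - 1 / 2)
    (hed.mul (by fun_prop)) (by
      intro ζ
      simp only [heper]
      rw [show -(ζ + 2 * Real.pi * I) / 2 = -ζ / 2 + -(Real.pi * I) by ring, Complex.exp_add,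
        Complex.exp_neg (Real.pi * I), Complex.exp_pi_mul_I]
      norm_num) (by linarith) (by linarith) (by linarith) (by
      intro ζ
      have h3 := hegr ζ
      rw [norm_mul, Complex.norm_exp]
      have e1 : (-ζ / 2).re = - ζ.re / 2 := by simp
      rw [e1]
      have e2 : ∀ σ : ℝ, Real.exp ((σ - 1 / 2) * ζ.re) = Real.exp (σ * ζ.re) * Real.exp (- ζ.re / 2) := by
        intro σ; rw [← Real.exp_add]; congr 1; ring
      rw [e2, e2, ← max_mul_of_nonneg _ _ (Real.exp_pos _).le, ← mul_assoc]
      exact mul_le_mul_of_nonneg_right h3 (Real.exp_pos _).le)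
  have hez : ∀ ζ, e ζ = 0 := by
    intro ζ
    have := hz ζ
    simp only [mul_eq_zero, Complex.exp_ne_zero, or_false] at this
    exact this
  apply hne 0
  have hder : ∀ ζ ∈ Dinf 0, deriv (η 0) ζ = 0 := by
    intro ζ hζ
    have := heq 0 ζ hζ
    rw [hez] at this
    simpa using this.symm
  have hconst : ∀ ζ ∈ Dinf 0, ∀ ξ ∈ Dinf 0, η 0 ζ = η 0 ξ := by
    intro ζ hζ ξ hξ
    exact (isOpen_Dinf 0).is_const_of_deriv_eq_zero (Dinf_convex 0).isPreconnected (h.diff 0) hder hζ hξ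
  intro ζ hζ
  obtain ⟨C', hC'⟩ := h.grv (Real.pi / 3) (by positivity)
  have key : ∀ t : ℝ, 0 ≤ t → |(η 0 ζ).re| ≤ C' * Real.exp (-σ₁ * t) := by
    intro t ht
    have m1 : ((-t : ℝ) : ℂ) ∈ Dinf 0 := by
      simp [Dinf, Lk, hpi]
    rw [hconst ζ hζ _ m1]
    have := hC' 0 ((-t : ℝ) : ℂ) (by simp [Lk]; linarith)
    rw [ofReal_re, max_eq_left (Real.exp_le_exp.2 (by nlinarith))] at this
    rwa [show σ₁ * -t = -σ₁ * t by ring] at this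
  have hlim : Tendsto (fun t : ℝ => C' * Real.exp (-σ₁ * t)) atTop (𝓝 (C' * 0)) := by
    apply Tendsto.const_mul
    apply Real.tendsto_exp_atBot.comp
    apply Tendsto.const_mul_atTop_of_neg (by linarith) tendsto_id
  rw [mul_zero] at hlim
  have := ge_of_tendsto hlim (by filter_upwards [eventually_ge_atTop 0] with t ht using key t ht)
  exact abs_eq_zero.1 (le_antisymm this (abs_nonneg _))

theorem b2 (h : LimData η σ₁ σ₂) (h1 : 3 / 4 < σ₁) (h12 : σ₁ ≤ σ₂) (h2 : σ₂ < 3 / 2) : False := by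
  have hpi := Real.pi_pos
  have hpi' : Real.pi / (2 * (2 * Real.pi / 3)) = 3 / 4 := by field_simp; norm_num
  obtain ⟨C, hC⟩ := h.grv (Real.pi / 3) (by positivity)
  have sd : ∀ (k : ℤ) (s : ℝ), (s = 1 ∨ s = -1) → (∀ ζ ∈ Sinf k, 0 ≤ s * (η k ζ).re) →
      (∀ ζ ∈ Sinf (k-1), 0 ≤ s * (η k ζ).re) → ∀ ζ ∈ Dinf k, (η k ζ).re = 0 := by
    intro k s hs m1 m2 ζ hζ
    have m3 := h.nonneg_ext k s m1 m2
    have := strip_zero (h := fun z => s * η k z) (y₀ := Lk k) (w := 2 * Real.pi / 3) (σ₁ := σ₁) (σ₂ := σ₂) (C := C)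
      (by positivity) ((h.diff k).const_mul _) (by intro z hz; simpa using m3 z hz)
      (by rw [hpi']; exact h1) h12 (by
        intro t
        have := hC k (t + Lk k * I) (by simp; linarith)
        simp only [add_re, ofReal_re, mul_re, I_re, mul_zero, ofReal_im, I_im, mul_one, sub_self, add_zero, zero_mul, sub_zero] at this ⊢
        refine le_trans ?_ this
        rcases hs with rfl | rfl
        · simpa using le_abs_self _
        · simpa using neg_le_abs _) ζ hζ
    rcases hs with rfl | rfl <;> simpa using this
  -- nonvanishing index
  have hex : ∃ k, ¬ ∀ ζ ∈ Dinf k, (η k ζ).re = 0 := by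
    obtain ⟨k, ζ, hζ, hne⟩ := h.nz
    rcases hne with hne | hne
    · exact ⟨k, fun hh => hne (hh ζ (Sinf_sub k hζ))⟩
    · exact ⟨k + 1, fun hh => hne (hh ζ (Sinf_sub' k hζ))⟩
  have step : ∀ k, (¬ ∀ ζ ∈ Dinf k, (η k ζ).re = 0) →
      (∀ ζ ∈ Sinf k, (η k ζ).re = -(η (k + 1) ζ).re) ∧
      (∀ ζ ∈ Sinf (k-1), (η (k-1) ζ).re = -(η k ζ).re) := by
    intro k hk
    have nzU : ¬ ∀ ζ ∈ Sinf k, (η k ζ).re = 0 := fun hh => hk (h.zero_ext k k (Sinf_sub k) hh)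
    have nzL : ¬ ∀ ζ ∈ Sinf (k-1), (η k ζ).re = 0 := fun hh => hk (h.zero_ext k (k-1) (Sinf_sub'' k) hh)
    have mL := h.modes (k - 1)
    rw [sub_add_cancel] at mL
    rcases h.modes k with m | m | m
    · rcases mL with l | l | l
      · exact ⟨fun z hz => (m z hz).1, fun z hz => (l z hz).1⟩
      · exact absurd (fun z hz => (l z hz).1) nzL
      · exact absurd (sd k 1 (Or.inl rfl) (fun z hz => by simpa using (m z hz).2)
          (fun z hz => by simpa using (l z hz).2)) hk
    · rcases mL with l | l | l
      · refine absurd (sd k (-1) (Or.inr rfl) (fun z hz => by simpa using (m z hz).2)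
          (fun z hz => ?_)) hk
        have := l z hz
        linarith
      · exact absurd (fun z hz => (l z hz).1) nzL
      · exfalso
        refine h.crossing k (h.zero_ext (k+1) k (Sinf_sub' k) (fun z hz => (m z hz).1)) ?_ ?_
        · intro z hz
          rcases (m z hz).2.lt_or_eq with q | q
          · exact q
          · exfalso
            apply nzU
            have := re_zero_of_nonneg (h := fun z => - η k z) (isOpen_Sinf k) (Sinf_convex k).isPreconnected
              ((h.diff k).mono (Sinf_sub k)).neg (fun z hz => by simpa using (m z hz).2) hz (by simpa using q)
            intro w hw
            simpa using this w hw
        · have z1 := h.zero_ext (k-1) (k-1) (Sinf_sub (k-1)) (fun z hz => (l z hz).1)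
          intro z hz
          have hz' : z - 2 * Real.pi * I ∈ Dinf (k - 1) := by
            have := Sinf_sub' (k+1) hz
            simp only [Dinf, mem_ofPred_eq, Lk] at this ⊢
            have e1 : (z - 2 * Real.pi * I).im - 2 * Real.pi * ((k - 1 : ℤ) : ℝ) / 3 = z.im - 2 * Real.pi * ((k + 1 + 1 : ℤ) : ℝ) / 3 := by
              simp; ring
            rw [e1]; exact this
          have := h.per (k - 1) _ hz'
          rw [show k - 1 + 3 = k + 2 by ring, sub_add_cancel] at this
          rw [this]
          exact z1 _ hz'
    · exact absurd (fun z hz => (m z hz).1) nzU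
  obtain ⟨k₀, hk₀⟩ := hex
  have all : ∀ k, ¬ ∀ ζ ∈ Dinf k, (η k ζ).re = 0 := by
    intro k
    induction k using Int.inductionOn' (b := k₀) with
    | zero => exact hk₀
    | succ k _ ih =>
      intro hh
      apply ih
      apply h.zero_ext k k (Sinf_sub k)
      intro z hz
      rw [(step k ih).1 z hz, hh z (Sinf_sub' k hz), neg_zero]
    | pred k _ ih =>
      intro hh
      apply ih
      apply h.zero_ext k (k-1) (Sinf_sub'' k)
      intro z hz
      have := (step k ih).2 z hz
      rw [hh z (Sinf_sub (k-1) hz)] at this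
      linarith
  exact h.alt_false h1 h12 h2 (fun k => (step k (all k)).1) all

end LimData

/-! ### Section 3 - C -/

/-- rescaled functions -/
def ff (V : ℤ → ℂ → ℂ) (S : ℝ) (k : ℤ) (ζ : ℂ) : ℂ :=
  (V k (ζ + S) - (V k (S + ck k * I)).im * I) / (mm V S : ℂ)

lemma ff_re (V : ℤ → ℂ → ℂ) (S : ℝ) (k : ℤ) (ζ : ℂ) : (ff V S k ζ).re = (V k (ζ + S)).re / mm V S := by
  simp [ff, Complex.div_ofReal_re]

lemma mm_pos (V : ℤ → ℂ → ℂ) (S : ℝ) : 0 < mm V S := by linarith [LogData.six_le_mm V S]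

lemma exp_rel {a b : ℂ} (h : cexp a + cexp b = 1) :
    a.re ≤ Real.log 2 + max 0 b.re ∧ b.re ≤ Real.log 2 + max 0 a.re ∧ 0 ≤ Real.log 2 + max a.re b.re := by
  have key : ∀ a b : ℂ, cexp a + cexp b = 1 → a.re ≤ Real.log 2 + max 0 b.re := by
    intro a b h
    have e : cexp a = 1 - cexp b := by linear_combination h
    have h1 : Real.exp a.re ≤ 1 + Real.exp b.re := by
      rw [← Complex.norm_exp, ← Complex.norm_exp, e]
      exact (norm_sub_le _ _).trans (by simp)
    have h2 : 1 + Real.exp b.re ≤ 2 * Real.exp (max 0 b.re) := by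
      have a1 : (1:ℝ) ≤ Real.exp (max 0 b.re) := Real.one_le_exp (le_max_left _ _)
      have a2 : Real.exp b.re ≤ Real.exp (max 0 b.re) := Real.exp_le_exp.2 (le_max_right _ _)
      linarith
    have h3 : 2 * Real.exp (max 0 b.re) = Real.exp (Real.log 2 + max 0 b.re) := by
      rw [Real.exp_add, Real.exp_log (by norm_num)]
    rw [← Real.exp_le_exp, ← h3]; linarith
  refine ⟨key a b h, key b a (by rw [add_comm]; exact h), ?_⟩
  have h1 : (1:ℝ) ≤ Real.exp a.re + Real.exp b.re := by
    rw [← Complex.norm_exp, ← Complex.norm_exp]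
    calc (1:ℝ) = ‖cexp a + cexp b‖ := by rw [h]; simp
      _ ≤ _ := norm_add_le _ _
  have a1 : Real.exp a.re ≤ Real.exp (max a.re b.re) := Real.exp_le_exp.2 (le_max_left _ _)
  have a2 : Real.exp b.re ≤ Real.exp (max a.re b.re) := Real.exp_le_exp.2 (le_max_right _ _)
  have h3 : 2 * Real.exp (max a.re b.re) = Real.exp (Real.log 2 + max a.re b.re) := by
    rw [Real.exp_add, Real.exp_log (by norm_num)]
  have : Real.exp 0 ≤ Real.exp (Real.log 2 + max a.re b.re) := by rw [← h3, Real.exp_zero]; linarith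
  exact Real.exp_le_exp.1 this

namespace LogData
variable {V : ℤ → ℂ → ℂ} {s₀ : ℝ}

lemma mem_Dk_shift {k : ℤ} {ζ : ℂ} {S : ℝ} (hζ : ζ ∈ Dinf k) (hS : s₀ < ζ.re + S) : ζ + S ∈ Dk s₀ k := by
  refine ⟨by simpa using hS, ?_⟩
  have : |ζ.im - Lk k| < _ := hζ
  simpa using this

lemma mem_Sk_shift {k : ℤ} {ζ : ℂ} {S : ℝ} (hζ : ζ ∈ Sinf k) (hS : s₀ < ζ.re + S) : ζ + S ∈ Sk s₀ k := by
  have : |ζ.im - ck k| < _ := hζ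
  rw [abs_lt] at this
  refine ⟨by simpa using hS, ?_, ?_⟩
  · rw [ck_eq] at this; simp; linarith
  · rw [ck_eq'] at this; simp; linarith

lemma ff_diff (h : LogData V s₀) {k : ℤ} {ζ : ℂ} {S : ℝ} (hζ : ζ ∈ Dinf k) (hS : s₀ < ζ.re + S) :
    HasDerivAt (ff V S k) (deriv (V k) (ζ + S) / (mm V S : ℂ)) ζ := by
  have h1 := ((h.diff k).differentiableAt ((isOpen_Dk s₀ k).mem_nhds (mem_Dk_shift hζ hS))).hasDerivAt
  have h2 := HasDerivAt.comp_add_const ζ (S:ℂ) h1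
  exact (h2.sub_const _).div_const _

lemma ff_bound (h : LogData V s₀) {δ R : ℝ} (hδ : 0 < δ) (hδ' : δ ≤ Real.pi / 3) (hR : 0 ≤ R) :
    ∃ M : ℝ, ∀ (k : ℤ) (S : ℝ) (ζ : ℂ), s₀ + 3 + R ≤ S → |ζ.re| ≤ R →
      |ζ.im - Lk k| ≤ 2 * Real.pi / 3 - δ → ‖ff V S k ζ‖ ≤ M := by
  obtain ⟨C, hC, hb⟩ := h.deriv_bound δ hδ
  have hpi := Real.pi_pos
  refine ⟨C * Real.exp (6000 * R) * (R + 2 * Real.pi) + 1, fun k S ζ hS hre him => ?_⟩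
  have hm := mm_pos V S
  set T : Set ℂ := {z | |z.re| ≤ R ∧ |z.im - Lk k| ≤ 2 * Real.pi / 3 - δ} with hT
  have hTc : Convex ℝ T := by
    have : T = (Complex.reLm ⁻¹' (Metric.closedBall 0 R)) ∩ (Complex.imLm ⁻¹' (Metric.closedBall (Lk k) (2 * Real.pi / 3 - δ))) := by
      ext z; simp [hT, Real.dist_eq]
    rw [this]
    exact ((convex_closedBall _ _).linear_preimage _).inter ((convex_closedBall _ _).linear_preimage _)
  have hc : (ck k * I : ℂ) ∈ T := by
    refine ⟨by simpa using hR, ?_⟩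
    simp [ck_eq, abs_of_pos (show 0 < Real.pi / 3 by positivity)]; linarith
  have hd : ∀ z ∈ T, HasDerivAt (ff V S k) (deriv (V k) (z + S) / (mm V S : ℂ)) z := by
    intro z hz
    apply h.ff_diff
    · exact lt_of_le_of_lt hz.2 (by linarith)
    · have := abs_le.1 hz.1; linarith
  have hbd : ∀ z ∈ T, ‖deriv (V k) (z + S) / (mm V S : ℂ)‖ ≤ C * Real.exp (6000 * R) := by
    intro z hz
    have h0 := abs_le.1 hz.1
    have h1 := hb k (z + S) (by simp; linarith) (by simpa using hz.2)
    have h2 := h.mm_le (s := S) (t := (z + S : ℂ).re) (by linarith) (by simp; linarith)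
    have h3 : mm V S * Real.exp (6000 * |(z + S : ℂ).re - S|) ≤ mm V S * Real.exp (6000 * R) := by
      apply mul_le_mul_of_nonneg_left _ hm.le
      apply Real.exp_le_exp.2
      have : |(z + S : ℂ).re - S| ≤ R := by simpa using hz.1
      linarith
    rw [norm_div, Complex.norm_real, Real.norm_of_nonneg hm.le, div_le_iff₀ hm]
    calc _ ≤ C * mm V (z + S : ℂ).re := h1
      _ ≤ C * (mm V S * Real.exp (6000 * R)) := mul_le_mul_of_nonneg_left (h2.trans h3) hC.le
      _ = _ := by ring
  have h1 := hTc.norm_image_sub_le_of_norm_hasDerivWithin_le (fun z hz => (hd z hz).hasDerivWithinAt) hbd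
    hc (show ζ ∈ T from ⟨hre, him⟩)
  have h2 : ‖ζ - ck k * I‖ ≤ R + 2 * Real.pi := by
    refine (Complex.norm_le_abs_re_add_abs_im _).trans ?_
    have h3 := abs_le.1 him
    have : |(ζ - ck k * I).im| ≤ 2 * Real.pi := by
      simp only [sub_im, mul_im, ofReal_re, I_im, mul_one, ofReal_im, I_re, mul_zero, add_zero, ck_eq]
      rw [abs_le]; constructor <;> linarith
    have : |(ζ - ck k * I).re| ≤ R := by simpa using hre
    linarith
  have h3 : ‖ff V S k (ck k * I)‖ ≤ 1 := by
    have e : V k (ck k * I + S) - (V k (S + ck k * I)).im * I = ((V k (S + ck k * I)).re : ℂ) := by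
      rw [add_comm (ck k * I : ℂ)]
      apply Complex.ext <;> simp
    rw [ff, e, norm_div, Complex.norm_real, Complex.norm_real, Real.norm_of_nonneg hm.le, div_le_one hm]
    exact (abs_re_le_gg _).trans (h.gk_le_mm k S)
  have h4 : ‖ff V S k ζ‖ ≤ ‖ff V S k ζ - ff V S k (ck k * I)‖ + ‖ff V S k (ck k * I)‖ := by
    simpa using norm_add_le (ff V S k ζ - ff V S k (ck k * I)) (ff V S k (ck k * I))
  have h5 : C * Real.exp (6000 * R) * ‖ζ - ck k * I‖ ≤ C * Real.exp (6000 * R) * (R + 2 * Real.pi) :=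
    mul_le_mul_of_nonneg_left h2 (by positivity)
  linarith

end LogData

lemma four_prod {a b c d x B : ℝ} (ha : 0 ≤ a) (hb : 0 ≤ b) (hc : 0 ≤ c) (hd : 0 ≤ d)
    (ha' : a ≤ B) (hb' : b ≤ B) (hc' : c ≤ B) (hd' : d ≤ B)
    (hx : a ≤ x ∨ b ≤ x ∨ c ≤ x ∨ d ≤ x) : a * b * c * d ≤ x * B ^ 3 := by
  have hB : 0 ≤ B := ha.trans ha'
  rcases hx with hx | hx | hx | hx
  · have hx0 := ha.trans hx
    calc a * b * c * d ≤ x * B * B * B := by gcongr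
      _ = _ := by ring
  · have hx0 := hb.trans hx
    calc a * b * c * d ≤ B * x * B * B := by gcongr
      _ = _ := by ring
  · have hx0 := hc.trans hx
    calc a * b * c * d ≤ B * B * x * B := by gcongr
      _ = _ := by ring
  · have hx0 := hd.trans hx
    calc a * b * c * d ≤ B * B * B * x := by gcongr
      _ = _ := by ring

/-- max principle with four-fold symmetrization -/
lemma four_max {G : ℂ → ℂ} {z : ℂ} {x B : ℝ} (hG : DifferentiableOn ℂ G (Metric.closedBall z (1/2)))
    (hB : ∀ w ∈ Metric.closedBall z (1/2), ‖G w‖ ≤ B)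
    (hx : ∀ w ∈ Metric.closedBall z (1/2), w.im ≤ z.im - 35/100 → ‖G w‖ ≤ x) :
    ‖G z‖ ^ 4 ≤ x * B ^ 3 := by
  set P : ℂ → ℂ := fun w => G (z + w) * G (z + I * w) * G (z + -w) * G (z + -(I * w)) with hP
  have mem : ∀ u : ℂ, ‖u‖ ≤ 1/2 → z + u ∈ Metric.closedBall z (1/2) := by
    intro u hu; simpa [Metric.mem_closedBall, dist_eq_norm] using hu
  have hd : ∀ g : ℂ → ℂ, Differentiable ℂ g → (∀ w, ‖g w‖ = ‖w‖) →
      DifferentiableOn ℂ (fun w => G (z + g w)) (Metric.closedBall 0 (1/2)) := by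
    intro g hg hn
    apply hG.comp ((differentiable_const z).add hg).differentiableOn
    intro w hw
    exact mem _ (by rw [hn]; simpa using hw)
  have hPd : DifferentiableOn ℂ P (Metric.closedBall 0 (1/2)) :=
    (((hd (fun w => w) differentiable_id (fun w => rfl)).mul
      (hd (fun w => I * w) (by fun_prop) (by simp))).mul (hd (fun w => -w) (by fun_prop) (by simp))).mul
      (hd (fun w => -(I * w)) (by fun_prop) (by simp))
  have := Complex.norm_le_of_forall_mem_frontier_norm_le (f := P) (U := Metric.ball 0 (1/2)) (C := x * B ^ 3) Metric.isBounded_ball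
    (DifferentiableOn.diffContOnCl (by rw [closure_ball _ (by norm_num)]; exact hPd)) (by
      intro w hw
      rw [frontier_ball _ (by norm_num)] at hw
      have hw' : ‖w‖ = 1/2 := by simpa using hw
      have n1 : ‖I * w‖ = 1/2 := by simp [hw']
      have n2 : ‖-w‖ = 1/2 := by simp [hw']
      have n3 : ‖-(I * w)‖ = 1/2 := by simp [hw']
      simp only [hP, norm_mul]
      apply four_prod (norm_nonneg _) (norm_nonneg _) (norm_nonneg _) (norm_nonneg _)
        (hB _ (mem _ hw'.le)) (hB _ (mem _ n1.le)) (hB _ (mem _ n2.le)) (hB _ (mem _ n3.le))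
      have hsq : w.re ^ 2 + w.im ^ 2 = 1/4 := by
        have := Complex.sq_norm w
        rw [hw', Complex.normSq_apply] at this
        nlinarith
      have hcases : w.im ≤ -35/100 ∨ w.re ≤ -35/100 ∨ 35/100 ≤ w.im ∨ 35/100 ≤ w.re := by
        by_contra hcon
        push Not at hcon
        nlinarith [hcon.1, hcon.2.1, hcon.2.2.1, hcon.2.2.2]
      rcases hcases with c | c | c | c
      · left; exact hx _ (mem _ hw'.le) (by simp; linarith)
      · right; left; exact hx _ (mem _ n1.le) (by simp; linarith)
      · right; right; left; exact hx _ (mem _ n2.le) (by simp; linarith)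
      · right; right; right; exact hx _ (mem _ n3.le) (by simp; linarith))
    (z := 0) (subset_closure (Metric.mem_ball_self (by norm_num)))
  have e : P 0 = G z ^ 4 := by simp [hP]; ring
  rwa [e, norm_pow] at this

/-! ### Section 3 - D -/

namespace LogData
variable {V : ℤ → ℂ → ℂ} {s₀ : ℝ}

theorem exists_lim (h : LogData V s₀) {σ₁ σ₂ : ℝ} (S : ℕ → ℝ) (hS : ∀ n : ℕ, (n : ℝ) ≤ S n)
    (hSm : ∀ n : ℕ, (n : ℝ) ≤ mm V (S n))
    (hpk : ∀ n, ∀ s ≥ s₀ + 3, mm V s ≤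
      max (Real.exp (σ₁ * (s - S n))) (Real.exp (σ₂ * (s - S n))) * mm V (S n)) :
    ∃ η, LimData η σ₁ σ₂ := by
  have hpi := Real.pi_pos
  set 𝓤 : Ultrafilter ℕ := hyperfilter ℕ with h𝓤
  have hle : (𝓤 : Filter ℕ) ≤ atTop := Nat.hyperfilter_le_atTop
  have hSt : Tendsto S 𝓤 atTop :=
    (tendsto_atTop_mono hS tendsto_natCast_atTop_atTop).mono_left hle
  have hmt : Tendsto (fun n => mm V (S n)) 𝓤 atTop :=
    (tendsto_atTop_mono hSm tendsto_natCast_atTop_atTop).mono_left hle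
  have hm0 : ∀ n, 0 < mm V (S n) := fun n => mm_pos V (S n)
  have mont : ∀ k, ∃ g : ℂ → ℂ, DifferentiableOn ℂ g (Dinf k) ∧
      TendstoLocallyUniformlyOn (fun n => ff V (S n) k) g 𝓤 (Dinf k) ∧
      ∀ z ∈ Dinf k, Tendsto (fun n => deriv (ff V (S n) k) z) 𝓤 (𝓝 (deriv g z)) := by
    intro k
    apply montelU
    intro z hz
    have hz' : |z.im - Lk k| < 2 * Real.pi / 3 := hz
    set δ := min ((2 * Real.pi / 3 - |z.im - Lk k|) / 2) (Real.pi / 3) with hδ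
    have hδ0 : 0 < δ := lt_min (by linarith) (by linarith)
    have hδ1 : δ ≤ (2 * Real.pi / 3 - |z.im - Lk k|) / 2 := min_le_left _ _
    obtain ⟨M, hM⟩ := h.ff_bound hδ0 (min_le_right _ _) (R := |z.re| + δ) (by positivity)
    have hball : ∀ w ∈ Metric.ball z δ, |w.re| ≤ |z.re| + δ ∧ |w.im - Lk k| ≤ 2 * Real.pi / 3 - δ := by
      intro w hw
      have hd : ‖w - z‖ < δ := by simpa [dist_eq_norm] using hw
      have h1 := (Complex.abs_re_le_norm (w - z)).trans hd.le
      have h2 := (Complex.abs_im_le_norm (w - z)).trans hd.le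
      rw [sub_re] at h1
      rw [sub_im] at h2
      constructor
      · have := abs_sub_abs_le_abs_sub w.re z.re; linarith
      · have := abs_add_le (w.im - z.im) (z.im - Lk k)
        rw [sub_add_sub_cancel] at this
        linarith
    refine ⟨δ, hδ0, fun w hw => lt_of_le_of_lt (hball w hw).2 (by linarith), M, ?_⟩
    filter_upwards [hSt.eventually_ge_atTop (s₀ + 3 + (|z.re| + δ))] with n hn
    refine ⟨fun w hw => ?_, fun w hw => hM k (S n) w hn (hball w hw).1 (hball w hw).2⟩
    apply DifferentiableAt.differentiableWithinAt
    apply (h.ff_diff (k := k) _ _).differentiableAt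
    · exact lt_of_le_of_lt (hball w hw).2 (by linarith)
    · have := abs_le.1 (hball w hw).1; linarith
  choose η hη1 hη2 hη3 using mont
  have hpt : ∀ k, ∀ ζ ∈ Dinf k, Tendsto (fun n => ff V (S n) k ζ) 𝓤 (𝓝 (η k ζ)) := fun k ζ hζ =>
    (hη2 k).tendsto_at hζ
  have hre : ∀ k, ∀ ζ ∈ Dinf k, Tendsto (fun n => (V k (ζ + S n)).re / mm V (S n)) 𝓤 (𝓝 (η k ζ).re) := by
    intro k ζ hζ
    have := (Complex.continuous_re.tendsto _).comp (hpt k ζ hζ)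
    simpa [Function.comp_def, ff_re] using this
  have hlog : Tendsto (fun n => Real.log 2 / mm V (S n)) 𝓤 (𝓝 0) := hmt.const_div_atTop _
  have hbig : ∀ (x : ℝ) , ∀ᶠ n in (𝓤 : Filter ℕ), x < S n := fun x => hSt.eventually_gt_atTop x
  have hneg : ∀ k, ∀ ζ ∈ Dinf k, Tendsto (fun n => -(V k (ζ + S n)).re / mm V (S n)) 𝓤 (𝓝 (-(η k ζ).re)) := by
    intro k ζ hζ
    have := (hre k ζ hζ).neg
    simpa [neg_div] using this
  have hrel : ∀ k, ∀ ζ ∈ Sinf k, ∀ᶠ n in (𝓤 : Filter ℕ),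
      cexp (V k (ζ + S n)) + cexp (-V (k+1) (ζ + S n)) = 1 := by
    intro k ζ hζ
    filter_upwards [hbig (s₀ - ζ.re)] with n hn
    exact h.rel k _ (mem_Sk_shift hζ (by linarith))
  have maxdiv : ∀ (a b m : ℝ), 0 < m → max a b / m = max (a / m) (b / m) := fun a b m hm =>
    (max_div_div_right hm.le a b).symm
  refine ⟨η, ⟨hη1, ?_, ?_, ?_, ?_, ?_, ?_, ?_, ?_⟩⟩
  · intro k ζ hζ
    have l := hre k ζ (Sinf_sub k hζ)
    have r := hlog.add ((tendsto_const_nhds (x := (0:ℝ))).max (hneg (k+1) ζ (Sinf_sub' k hζ)))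
    rw [zero_add] at r
    refine le_of_tendsto_of_tendsto l r ?_
    filter_upwards [hrel k ζ hζ] with n hn
    have := (exp_rel hn).1
    have e := div_le_div_of_nonneg_right this (hm0 n).le
    rw [add_div, maxdiv _ _ _ (hm0 n), zero_div, neg_re] at e
    exact e
  · intro k ζ hζ
    have l := hneg (k+1) ζ (Sinf_sub' k hζ)
    have r := hlog.add ((tendsto_const_nhds (x := (0:ℝ))).max (hre k ζ (Sinf_sub k hζ)))
    rw [zero_add] at r
    refine le_of_tendsto_of_tendsto l r ?_
    filter_upwards [hrel k ζ hζ] with n hn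
    have := (exp_rel hn).2.1
    have e := div_le_div_of_nonneg_right this (hm0 n).le
    rw [add_div, maxdiv _ _ _ (hm0 n), zero_div, neg_re] at e
    exact e
  · intro k ζ hζ
    have r := hlog.add ((hre k ζ (Sinf_sub k hζ)).max (hneg (k+1) ζ (Sinf_sub' k hζ)))
    rw [zero_add] at r
    refine ge_of_tendsto r ?_
    filter_upwards [hrel k ζ hζ] with n hn
    have := (exp_rel hn).2.2
    have e := div_nonneg this (hm0 n).le
    rw [add_div, maxdiv _ _ _ (hm0 n), neg_re] at e
    exact e
  · intro k ζ hζ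
    have hζ' : ζ + 2 * Real.pi * I ∈ Dinf (k + 3) := by
      simp only [Dinf, mem_ofPred_eq, Lk] at hζ ⊢
      have e1 : (ζ + 2 * Real.pi * I).im - 2 * Real.pi * ((k + 3 : ℤ) : ℝ) / 3 = ζ.im - 2 * Real.pi * k / 3 := by
        simp; ring
      rw [e1]; exact hζ
    refine tendsto_nhds_unique (hpt _ _ hζ') ?_
    have : (fun n => ff V (S n) (k+3) (ζ + 2 * Real.pi * I)) = fun n => ff V (S n) k ζ := by
      funext n
      simp only [ff]
      have e1 : ζ + 2 * Real.pi * I + S n = (ζ + S n) + 2 * Real.pi * I := by ring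
      have e2 : (S n : ℂ) + ck (k+3) * I = (S n + ck k * I) + 2 * Real.pi * I := by
        simp only [ck]; push_cast; ring
      rw [e1, e2, h.per, h.per]
    rw [this]
    exact hpt k ζ hζ
  · intro δ hδ
    obtain ⟨C, hC, hb⟩ := h.val_bound δ hδ
    refine ⟨C, fun k ζ hζ => ?_⟩
    have hζD : ζ ∈ Dinf k := lt_of_le_of_lt hζ (by linarith)
    refine le_of_tendsto (hre k ζ hζD).abs ?_
    filter_upwards [hbig (s₀ + 3 - ζ.re)] with n hn
    have h1 := hb k (ζ + S n) (by simp; linarith) (by simpa using hζ)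
    have h2 := hpk n (ζ + S n : ℂ).re (by simp; linarith)
    have e : (ζ + S n : ℂ).re - S n = ζ.re := by simp
    rw [e] at h2
    rw [abs_div, abs_of_pos (hm0 n), div_le_iff₀ (hm0 n), mul_assoc]
    exact h1.trans (mul_le_mul_of_nonneg_left h2 hC.le)
  · intro δ hδ
    obtain ⟨C, hC, hb⟩ := h.deriv_bound δ hδ
    refine ⟨C, fun k ζ hζ => ?_⟩
    have hζD : ζ ∈ Dinf k := lt_of_le_of_lt hζ (by linarith)
    refine le_of_tendsto (hη3 k ζ hζD).norm ?_
    filter_upwards [hbig (s₀ + 3 - ζ.re)] with n hn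
    have h1 := hb k (ζ + S n) (by simp; linarith) (by simpa using hζ)
    have h2 := hpk n (ζ + S n : ℂ).re (by simp; linarith)
    have e : (ζ + S n : ℂ).re - S n = ζ.re := by simp
    rw [e] at h2
    rw [(h.ff_diff hζD (by linarith)).deriv, norm_div, Complex.norm_real, Real.norm_of_nonneg (hm0 n).le,
      div_le_iff₀ (hm0 n), mul_assoc]
    exact h1.trans (mul_le_mul_of_nonneg_left h2 hC.le)
  · by_contra hcon
    push Not at hcon
    have z1 : ∀ k, Tendsto (fun n => gg (V k (S n + ck k * I)) / mm V (S n)) 𝓤 (𝓝 0) ∧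
        Tendsto (fun n => gg (V (k+1) (S n + ck k * I)) / mm V (S n)) 𝓤 (𝓝 0) := by
      intro k
      have hm := cen_mem_Sinf k 0
      simp only [ofReal_zero, zero_add] at hm
      have aux : ∀ j, (ck k * I : ℂ) ∈ Dinf j → (η j (ck k * I)).re = 0 →
          Tendsto (fun n => gg (V j (S n + ck k * I)) / mm V (S n)) 𝓤 (𝓝 0) := by
        intro j hj h0
        have a := (hre j _ hj).abs
        rw [h0, abs_zero] at a
        have b := (hmt.const_div_atTop (1:ℝ)).add a
        rw [zero_add] at b
        refine squeeze_zero (fun n => div_nonneg (gg_pos _).le (hm0 n).le) (fun n => ?_) b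
        rw [abs_div, abs_of_pos (hm0 n), ← add_div]
        apply div_le_div_of_nonneg_right _ (hm0 n).le
        rw [add_comm (S n : ℂ)]
        exact gg_le _
      exact ⟨aux k (Sinf_sub k hm) (hcon k _ hm).1, aux (k+1) (Sinf_sub' k hm) (hcon k _ hm).2⟩
    have t := ((z1 0).1.add (z1 0).2).add ((z1 1).1.add (z1 1).2) |>.add ((z1 2).1.add (z1 2).2)
    have e : (fun n => (gg (V 0 (S n + ck 0 * I)) / mm V (S n) + gg (V (0+1) (S n + ck 0 * I)) / mm V (S n)) +
        (gg (V 1 (S n + ck 1 * I)) / mm V (S n) + gg (V (1+1) (S n + ck 1 * I)) / mm V (S n)) +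
        (gg (V 2 (S n + ck 2 * I)) / mm V (S n) + gg (V (2+1) (S n + ck 2 * I)) / mm V (S n))) = fun _ => (1:ℝ) := by
      funext n
      simp only [← add_div]
      have : mm V (S n) ≠ 0 := (hm0 n).ne'
      rw [div_eq_one_iff_eq this]
      rfl
    rw [e] at t
    have := tendsto_nhds_unique t tendsto_const_nhds
    norm_num at this
  · intro k hz1 hlt hz2
    set z : ℂ := (Lk (k+1) + 1/10 : ℝ) * I with hz
    have hzim : z.im = Lk (k+1) + 1/10 := by simp [hz]
    have hpi3 := Real.pi_gt_three
    set K1 := Metric.closedBall z (1/2) with hK1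
    have hK1im : ∀ w ∈ K1, |w.im - z.im| ≤ 1/2 ∧ |w.re| ≤ 1/2 := by
      intro w hw
      have : ‖w - z‖ ≤ 1/2 := by simpa [hK1, dist_eq_norm] using hw
      have h1 := (Complex.abs_im_le_norm (w - z)).trans this
      have h2 := (Complex.abs_re_le_norm (w - z)).trans this
      rw [sub_im] at h1
      have : z.re = 0 := by simp [hz]
      rw [sub_re, this, sub_zero] at h2
      exact ⟨h1, h2⟩
    have hK1D : K1 ⊆ Dinf (k+1) := by
      intro w hw
      have h1 := abs_le.1 (hK1im w hw).1
      simp only [Dinf, mem_ofPred_eq, abs_lt]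
      constructor <;> linarith
    set K2 := K1 ∩ {w : ℂ | w.im ≤ z.im - 35/100} with hK2
    have hK2S : K2 ⊆ Sinf k := by
      rintro w ⟨hw, hw2⟩
      have h1 := abs_le.1 (hK1im w hw).1
      have hw2' : w.im ≤ z.im - 35/100 := hw2
      simp only [Sinf, mem_ofPred_eq, abs_lt, ck_eq']
      constructor <;> linarith
    have hK1c : IsCompact K1 := isCompact_closedBall _ _
    have hK2c : IsCompact K2 := hK1c.inter_right (isClosed_le Complex.continuous_im continuous_const)
    have hzS : z ∈ Sinf (k+1) := by
      simp only [Sinf, mem_ofPred_eq, abs_lt, ck_eq]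
      constructor <;> linarith
    obtain ⟨c, hc0, hc⟩ : ∃ c > 0, ∀ w ∈ K2, (η k w).re ≤ -c := by
      rcases K2.eq_empty_or_nonempty with he | hne
      · exact ⟨1, one_pos, by simp [he]⟩
      · obtain ⟨w, hw, hmax⟩ := hK2c.exists_isMaxOn hne
          (Complex.continuous_re.comp_continuousOn ((hη1 k).continuousOn.mono (hK2S.trans (Sinf_sub k))))
        refine ⟨-(η k w).re, by linarith [hlt w (hK2S hw)], fun u hu => ?_⟩
        have : (η k u).re ≤ (η k w).re := hmax hu
        linarith
    have u2 := (tendstoLocallyUniformlyOn_iff_forall_isCompact (isOpen_Dinf k)).1 (hη2 k) K2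
      (hK2S.trans (Sinf_sub k)) hK2c
    have u1 := (tendstoLocallyUniformlyOn_iff_forall_isCompact (isOpen_Dinf (k+1))).1 (hη2 (k+1)) K1 hK1D hK1c
    have v1 := Metric.tendstoUniformlyOn_iff.1 u1 (c/100) (by positivity)
    have v2 := Metric.tendstoUniformlyOn_iff.1 u2 (c/2) (by positivity)
    have w1 := hre (k+1) z (Sinf_sub (k+1) hzS)
    have w2 := hre (k+1+1) z (Sinf_sub' (k+1) hzS)
    rw [hz1 z (Sinf_sub (k+1) hzS)] at w1
    rw [show k+1+1 = k+2 by ring, hz2 z hzS] at w2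
    have w1' := w1.eventually_lt_const (show 0 < c/100 by positivity)
    have w2' := w2.eventually_lt_const (show 0 < c/100 by positivity)
    have : ∀ᶠ n in (𝓤 : Filter ℕ), False := by
      filter_upwards [v1, v2, w1', w2', hbig (s₀ + 1 - z.re), hbig (s₀ + 1),
        hmt.eventually_gt_atTop (100 / c)] with n a1 a2 a3 a4 a5 a6 a7
      set m := mm V (S n) with hm
      have hmp : 0 < m := hm0 n
      rw [div_lt_iff₀ hmp] at a3 a4
      rw [div_lt_iff₀ hc0] at a7
      set G : ℂ → ℂ := fun w => 1 - cexp (-V (k+1) (w + S n)) with hG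
      have key := four_max (G := G) (z := z) (x := Real.exp (-(c/2) * m)) (B := 2 * Real.exp (c / 100 * m)) (by
          intro w hw
          have hb := abs_le.1 (hK1im w hw).2
          have := mem_Dk_shift (s₀ := s₀) (S := S n) (hK1D hw) (by linarith)
          have d := (h.diff (k+1)).differentiableAt ((isOpen_Dk s₀ (k+1)).mem_nhds this)
          apply DifferentiableAt.differentiableWithinAt
          have d2 : DifferentiableAt ℂ (fun w : ℂ => V (k+1) (w + S n)) w :=
            DifferentiableAt.comp w (f := fun w : ℂ => w + S n) d (by fun_prop)
          exact (differentiableAt_const _).sub d2.neg.cexp) (by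
          intro w hw
          have b := a1 w hw
          rw [dist_eq_norm] at b
          have b2 := (Complex.abs_re_le_norm _).trans b.le
          rw [sub_re, hz1 w (hK1D hw), ff_re, zero_sub, abs_neg] at b2
          have b3 := (abs_le.1 b2).1
          rw [← hm, le_div_iff₀ hmp] at b3
          have b4 : ‖cexp (-V (k+1) (w + S n))‖ ≤ Real.exp (c / 100 * m) := by
            rw [Complex.norm_exp, neg_re]; apply Real.exp_le_exp.2; linarith
          have b5 : 1 ≤ Real.exp (c / 100 * m) := Real.one_le_exp (by positivity)
          calc ‖G w‖ ≤ ‖(1:ℂ)‖ + ‖cexp (-V (k+1) (w + S n))‖ := norm_sub_le _ _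
            _ ≤ _ := by rw [norm_one]; linarith) (by
          intro w hw hwim
          have hw2 : w ∈ K2 := ⟨hw, hwim⟩
          have b := a2 w hw2
          rw [dist_eq_norm, norm_sub_rev] at b
          have b2 := (Complex.abs_re_le_norm _).trans b.le
          rw [sub_re, ff_re] at b2
          have b3 := (abs_le.1 b2).2
          have b4 := hc w hw2
          have b5 : (V k (w + S n)).re / m ≤ -(c/2) := by linarith
          rw [div_le_iff₀ hmp] at b5
          have hb := abs_le.1 (hK1im w hw).2
          have r := h.rel k _ (mem_Sk_shift (S := S n) (hK2S hw2) (by linarith))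
          have : G w = cexp (V k (w + S n)) := by simp only [hG]; linear_combination - r
          rw [this, Complex.norm_exp]
          exact Real.exp_le_exp.2 b5)
      have r := h.rel (k+1) _ (mem_Sk_shift (S := S n) hzS (by linarith))
      rw [show k+1+1 = k+2 by ring] at r
      have eG : G z = - cexp (-V (k+1) (z + S n) - V (k+2) (z + S n)) := by
        simp only [hG]
        rw [sub_eq_add_neg (-V (k+1) (z + S n)), Complex.exp_add, show cexp (-V (k+2) (z + S n)) = 1 - cexp (V (k+1) (z + S n)) by linear_combination r,
          Complex.exp_neg]
        field_simp [Complex.exp_ne_zero]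
        ring
      have nG : Real.exp (-(c/50) * m) ≤ ‖G z‖ := by
        rw [eG, norm_neg, Complex.norm_exp]
        apply Real.exp_le_exp.2
        simp only [sub_re, neg_re]
        linarith
      have l1 : Real.exp (-(c/50) * m) ^ 4 ≤ Real.exp (-(c/2) * m) * (2 * Real.exp (c / 100 * m)) ^ 3 :=
        (pow_le_pow_left₀ (Real.exp_pos _).le nG 4).trans key
      have l2 : Real.exp (-(c/50) * m) ^ 4 = Real.exp (-(4*c/50) * m) := by
        rw [← Real.exp_nat_mul]; congr 1; push_cast; ring
      have l3 : Real.exp (-(c/2) * m) * (2 * Real.exp (c / 100 * m)) ^ 3 = 8 * Real.exp (-(47*c/100) * m) := by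
        rw [mul_pow, ← Real.exp_nat_mul, mul_left_comm, ← Real.exp_add]; congr 1
        · norm_num
        · congr 1; push_cast; ring
      have l4 : Real.exp (-(4*c/50) * m) = Real.exp (-(47*c/100) * m) * Real.exp (39 * c / 100 * m) := by
        rw [← Real.exp_add]; congr 1; ring
      rw [l2, l3, l4, mul_comm (8:ℝ)] at l1
      have l5 := le_of_mul_le_mul_left l1 (Real.exp_pos _)
      have l6 := Real.add_one_le_exp (39 * c / 100 * m)
      nlinarith
    exact (NeBot.ne inferInstance) (Filter.eventually_false_iff_eq_bot.1 this)

lemma mm_cont (h : LogData V s₀) : ContinuousOn (mm V) (Ici (s₀ + 3)) := by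
  have aux : ∀ j k : ℤ, (ck k * I : ℂ) ∈ Dinf j → ContinuousOn (fun s : ℝ => gg (V j (s + ck k * I))) (Ici (s₀ + 3)) := by
    intro j k hj s hs
    have hs' : s₀ + 3 ≤ s := hs
    apply ContinuousAt.continuousWithinAt
    have hm : (s + ck k * I : ℂ) ∈ Dk s₀ j := by
      rw [add_comm]
      exact mem_Dk_shift hj (by simp; linarith)
    have c1 := ((h.diff j).differentiableAt ((isOpen_Dk s₀ j).mem_nhds hm)).continuousAt
    have c2 : ContinuousAt (fun s : ℝ => V j (s + ck k * I)) s :=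
      ContinuousAt.comp (f := fun s : ℝ => (s + ck k * I : ℂ)) c1 (by fun_prop)
    unfold gg
    exact (continuousAt_const.add ((Complex.continuous_re.continuousAt.comp c2).pow 2)).sqrt
  have m : ∀ k : ℤ, (ck k * I : ℂ) ∈ Sinf k := fun k => by simpa using cen_mem_Sinf k 0
  unfold mm
  exact (((aux 0 0 (Sinf_sub 0 (m 0))).add (aux 1 0 (Sinf_sub' 0 (m 0)))).add
    ((aux 1 1 (Sinf_sub 1 (m 1))).add (aux 2 1 (Sinf_sub' 1 (m 1))))).add
    ((aux 2 2 (Sinf_sub 2 (m 2))).add (aux 3 2 (Sinf_sub' 2 (m 2))))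

lemma lim_of_growth (h : LogData V s₀) {σ₁ σ₂' σ₂ : ℝ} (h1 : 0 < σ₁) (h12 : σ₁ ≤ σ₂) (h2 : σ₂' < σ₂)
    (hub : ∀ C : ℝ, ∃ s ≥ s₀ + 3, C * Real.exp (σ₁ * s) < mm V s)
    (hb : ∃ C : ℝ, ∀ s ≥ s₀ + 3, mm V s ≤ C * Real.exp (σ₂' * s)) : ∃ η, LimData η σ₁ σ₂ := by
  have := fun n : ℕ => peaks h.mm_cont (mm_pos V) h1 h12 h2 hub hb (n : ℝ)
  choose S h3 h4 h5 h6 using this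
  exact h.exists_lim S h4 h5 h6

theorem growth1 (h : LogData V s₀) {σ : ℝ} (hσ : 3 / 2 < σ) :
    ∃ C : ℝ, ∀ s ≥ s₀ + 3, mm V s ≤ C * Real.exp (σ * s) := by
  by_contra hcon
  push Not at hcon
  obtain ⟨η, hη⟩ := h.lim_of_growth (σ₁ := σ) (σ₂' := 6000) (σ₂ := max σ 6001) (by linarith) (le_max_left _ _)
    (lt_of_lt_of_le (by norm_num) (le_max_right _ _)) hcon (by
      refine ⟨mm V (s₀ + 3) * Real.exp (-(6000 * (s₀ + 3))), fun s hs => ?_⟩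
      have := h.mm_le (s := s₀ + 3) (t := s) (by linarith) (by linarith)
      rw [abs_of_nonneg (by linarith)] at this
      rw [mul_assoc, ← Real.exp_add]
      convert this using 3
      ring)
  exact hη.b1 hσ (le_max_left _ _)

theorem growth2 (h : LogData V s₀) {σ : ℝ} (hσ : σ < 3 / 2)
    (hb : ∃ C : ℝ, ∀ s ≥ s₀ + 3, mm V s ≤ C * Real.exp (σ * s)) :
    ∃ C : ℝ, ∀ s ≥ s₀ + 3, mm V s ≤ C * Real.exp (7 / 8 * s) := by
  by_contra hcon
  push Not at hcon
  obtain ⟨η, hη⟩ := h.lim_of_growth (σ₁ := 7/8) (σ₂' := σ) (σ₂ := max (7/8) ((σ + 3/2)/2)) (by norm_num) (le_max_left _ _)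
    (lt_of_lt_of_le (by linarith) (le_max_right _ _)) hcon hb
  exact hη.b2 (by norm_num) (le_max_left _ _) (max_lt (by norm_num) (by linarith))

end LogData

/-! ### Section 4 -/

lemma MeromOn.isClosed {f : ℂ → ℂ} {P : Set ℂ} (hf : MeromOn f P univ) : IsClosed P := by
  rw [isClosed_iff_accPt]
  intro a ha
  exact absurd ha (hf.2.2.2 a trivial)

lemma MeromOn.eventually_notMem {f : ℂ → ℂ} {P : Set ℂ} (hf : MeromOn f P univ) (z : ℂ) :
    ∀ᶠ w in 𝓝[≠] z, w ∉ P := by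
  have h := hf.2.2.2 z trivial
  rw [accPt_iff_frequently_nhdsNE] at h
  simpa using h

lemma MeromOn.analyticAt {f : ℂ → ℂ} {P : Set ℂ} (hf : MeromOn f P univ) {z : ℂ} (hz : z ∉ P) :
    AnalyticAt ℂ f z := hf.2.1 z ⟨trivial, hz⟩

lemma MeromOn.meromorphicAt {f : ℂ → ℂ} {P : Set ℂ} (hf : MeromOn f P univ) (z : ℂ) :
    MeromorphicAt f z := by
  by_cases hz : z ∈ P
  · have ht := hf.2.2.1 z hz
    have h0 : Tendsto (fun w => (f w)⁻¹) (𝓝[≠] z) (𝓝 0) := by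
      rw [tendsto_zero_iff_norm_tendsto_zero]
      simp only [norm_inv]
      exact ht.inv_tendsto_atTop
    set h : ℂ → ℂ := Function.update (fun w => (f w)⁻¹) z 0 with hh
    have hcont : ContinuousAt h z := by
      rw [continuousAt_update_same]
      exact h0
    have hne : ∀ᶠ w in 𝓝[≠] z, f w ≠ 0 := by
      filter_upwards [ht.eventually_gt_atTop 0] with w hw
      exact norm_pos_iff.1 hw
    have hd : ∀ᶠ w in 𝓝[≠] z, DifferentiableAt ℂ h w := by
      filter_upwards [hne, hf.eventually_notMem z, self_mem_nhdsWithin] with w h1 h2 h3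
      have : (fun w => (f w)⁻¹) =ᶠ[𝓝 w] h := by
        filter_upwards [isOpen_compl_singleton.mem_nhds h3] with x hx
        rw [hh, Function.update_of_ne hx]
      exact (((hf.analyticAt h2).differentiableAt).inv h1).congr_of_eventuallyEq this.symm
    have ha := Complex.analyticAt_of_differentiable_on_punctured_nhds_of_continuousAt hd hcont
    refine ha.meromorphicAt.inv.congr ?_
    filter_upwards [self_mem_nhdsWithin] with w hw
    rw [Pi.inv_apply, hh, Function.update_of_ne hw, inv_inv]
  · exact (hf.analyticAt hz).meromorphicAt

lemma MeromOn.order_neg {f : ℂ → ℂ} {P : Set ℂ} (hf : MeromOn f P univ) {z : ℂ} (hz : z ∈ P) :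
    meromorphicOrderAt f z < 0 := by
  rw [← tendsto_cobounded_iff_meromorphicOrderAt_neg (hf.meromorphicAt z),
    ← tendsto_norm_atTop_iff_cobounded]
  exact hf.2.2.1 z hz

/-- The linear form attached to a point of the sphere. -/
def lin : Option ℂ → ℂ → ℂ
  | Option.some a, x => x - a
  | Option.none, _ => 1

lemma MeromOn.lin_mero {f : ℂ → ℂ} {P : Set ℂ} (hf : MeromOn f P univ) (a : Option ℂ) (z : ℂ) :
    MeromorphicAt (fun w => lin a (f w)) z := by
  cases a with
  | none => exact MeromorphicAt.const 1 z
  | some a => exact (hf.meromorphicAt z).sub (MeromorphicAt.const a z)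

lemma MeromOn.lin_ne_top {f : ℂ → ℂ} {P : Set ℂ} (hf : MeromOn f P univ)
    (htr : ¬ IsRationalFn f P) (a : Option ℂ) (z : ℂ) :
    meromorphicOrderAt (fun w => lin a (f w)) z ≠ ⊤ := by
  classical
  cases a with
  | none => 
    simp only [lin]
    rw [meromorphicOrderAt_const]; simp
  | some a =>
    intro h
    apply htr
    have hm : MeromorphicOn (fun w => lin (some a) (f w)) univ := fun w _ => hf.lin_mero _ w
    have hall : ∀ w, meromorphicOrderAt (fun w => lin (some a) (f w)) w = ⊤ := by
      intro w
      by_contra hw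
      exact hm.meromorphicOrderAt_ne_top_of_isPreconnected isPreconnected_univ
        (mem_univ w) (mem_univ z) hw h
    refine ⟨Polynomial.C a, 1, one_ne_zero, ?_⟩
    intro w hw _
    have h1 := meromorphicOrderAt_eq_top_iff.1 (hall w)
    have hc := (hf.analyticAt hw).continuousAt
    have h2 : Tendsto f (𝓝[≠] w) (𝓝 (f w)) := hc.tendsto.mono_left nhdsWithin_le_nhds
    have h3 : Tendsto f (𝓝[≠] w) (𝓝 a) := by
      refine tendsto_const_nhds.congr' ?_
      filter_upwards [h1] with x hx
      exact (sub_eq_zero.1 hx).symm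
    simpa using tendsto_nhds_unique h2 h3

lemma MeromOn.mem_aPoints {f : ℂ → ℂ} {P : Set ℂ} (hf : MeromOn f P univ) (a b : Option ℂ) (z : ℂ)
    (h : meromorphicOrderAt (fun w => lin b (f w)) z < meromorphicOrderAt (fun w => lin a (f w)) z) :
    z ∈ aPoints f P a := by
  classical
  have hnone : meromorphicOrderAt (fun w => lin none (f w)) z = 0 := by
    simp only [lin]; rw [meromorphicOrderAt_const]; simp
  by_cases hz : z ∈ P
  · have hsome : ∀ c, meromorphicOrderAt (fun w => lin (some c) (f w)) z = meromorphicOrderAt f z := by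
      intro c
      have : (fun w => lin (some c) (f w)) = f + (fun _ => -c) := by
        ext w; simp [lin, sub_eq_add_neg]
      rw [this]
      refine meromorphicOrderAt_add_eq_left_of_lt (MeromorphicAt.const _ _) ?_
      refine (hf.order_neg hz).trans_le ?_
      exact analyticAt_const.meromorphicOrderAt_nonneg
    have hneg := hf.order_neg hz
    cases a with
    | none => exact hz
    | some a =>
      exfalso
      rw [hsome] at h
      cases b with
      | none => rw [hnone] at h; exact absurd h (not_lt.2 hneg.le)
      | some b => rw [hsome] at h; exact lt_irrefl _ h
  · have han := hf.analyticAt hz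
    have hpos : 0 < meromorphicOrderAt (fun w => lin a (f w)) z := by
      refine lt_of_le_of_lt ?_ h
      cases b with
      | none => exact hnone.ge
      | some b => exact (han.sub analyticAt_const).meromorphicOrderAt_nonneg
    cases a with
    | none => rw [hnone] at hpos; exact absurd hpos (lt_irrefl _)
    | some a =>
      refine ⟨hz, ?_⟩
      have h1 := tendsto_zero_of_meromorphicOrderAt_pos hpos
      have h2 : Tendsto (fun w => lin (some a) (f w)) (𝓝[≠] z) (𝓝 (f z - a)) :=
        (han.continuousAt.sub continuousAt_const).tendsto.mono_left nhdsWithin_le_nhds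
      exact sub_eq_zero.1 (tendsto_nhds_unique h2 h1)

lemma lin_relation (a b c : Option ℂ) (h12 : a ≠ b) (h13 : a ≠ c) (h23 : b ≠ c) :
    ∃ x y z : ℂ, x ≠ 0 ∧ y ≠ 0 ∧ z ≠ 0 ∧ ∀ t, x * lin a t + y * lin b t + z * lin c t = 0 := by
  have hs : ∀ u v : ℂ, some u ≠ some v → u - v ≠ 0 := fun u v h =>
    sub_ne_zero.2 fun h' => h (by rw [h'])
  cases a with
  | none =>
    cases b with
    | none => exact absurd rfl h12
    | some b =>
      cases c with
      | none => exact absurd rfl h13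
      | some c => exact ⟨b - c, 1, -1, hs _ _ h23, one_ne_zero, by norm_num, fun t => by simp [lin]⟩
  | some a =>
    cases b with
    | none =>
      cases c with
      | none => exact absurd rfl h23
      | some c => exact ⟨1, a - c, -1, one_ne_zero, hs _ _ h13, by norm_num, fun t => by simp [lin]⟩
    | some b =>
      cases c with
      | none => exact ⟨1, -1, a - b, one_ne_zero, by norm_num, hs _ _ h12, fun t => by simp [lin]⟩
      | some c =>
        exact ⟨b - c, c - a, a - b, hs _ _ h23, hs _ _ h13.symm, hs _ _ h12,
          fun t => by simp only [lin]; ring⟩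

structure Tri (θ : ℝ) (U : ℤ → ℂ → ℂ) (R₀ : ℝ) : Prop where
  one_le : 1 ≤ R₀
  nf : ∀ k z, MeromorphicNFAt (U k) z
  ne_top : ∀ k z, meromorphicOrderAt (U k) z ≠ ⊤
  per : ∀ k, U (k + 3) = U k
  rel : ∀ k z, ∀ᶠ w in 𝓝[≠] z, U k w + (U (k + 1) w)⁻¹ = 1
  zer : ∀ k z, R₀ < ‖z‖ → 0 < meromorphicOrderAt (U k) z → z ∈ Ray (θ + Lk (k + 1))
  pol : ∀ k z, R₀ < ‖z‖ → meromorphicOrderAt (U k) z < 0 → z ∈ Ray (θ + Lk (k + 2))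

lemma Ray_add (θ : ℝ) (n : ℤ) : Ray (θ + 2 * Real.pi * n) = Ray θ := by
  have : Complex.exp (((θ + 2 * Real.pi * n : ℝ) : ℂ) * I) = Complex.exp ((θ : ℂ) * I) := by
    rw [Complex.exp_eq_exp_iff_exists_int]
    exact ⟨n, by push_cast; ring⟩
  unfold Ray
  rw [this]

/-- From `f` to the triple of functions. The last clauses record the Möbius dependence. -/
theorem exists_Tri (θ : ℝ) (f : ℂ → ℂ) (P : Set ℂ)
    (hf : MeromOn f P Set.univ) (htrans : ¬ IsRationalFn f P)
    (a₁ a₂ a₃ : Option ℂ) (h12 : a₁ ≠ a₂) (h13 : a₁ ≠ a₃) (h23 : a₂ ≠ a₃)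
    (h1 : (aPoints f P a₁ \ Ray θ).Finite)
    (h2 : (aPoints f P a₂ \ Ray (θ + 2 * Real.pi / 3)).Finite)
    (h3 : (aPoints f P a₃ \ Ray (θ + 4 * Real.pi / 3)).Finite) :
    ∃ U R₀, Tri θ U R₀ ∧ ∀ k, ∃ a b : Option ℂ, ∃ c : ℂ, c ≠ 0 ∧ a ≠ b ∧ ∀ z, ∀ᶠ w in 𝓝[≠] z,
      U k w = c * lin a (f w) / lin b (f w) := by
  obtain ⟨x, y, z, hx, hy, hz, hrel⟩ := lin_relation a₁ a₂ a₃ h12 h13 h23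
  let aa : ℤ → Option ℂ := fun k => if k % 3 = 0 then a₁ else if k % 3 = 1 then a₂ else a₃
  let cc : ℤ → ℂ := fun k => if k % 3 = 0 then x else if k % 3 = 1 then y else z
  have hcc : ∀ k, cc k ≠ 0 := by
    intro k; simp only [cc]; split_ifs <;> assumption
  have haa3 : ∀ k, aa (k + 3) = aa k := by intro k; simp [aa]
  have hcc3 : ∀ k, cc (k + 3) = cc k := by intro k; simp [cc]
  have A0 : ∀ k, k % 3 = 0 → aa k = a₁ ∧ cc k = x := fun k h => by simp only [aa, cc, if_pos h, and_self]
  have A1 : ∀ k, k % 3 = 1 → aa k = a₂ ∧ cc k = y := fun k h => by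
    have h0 : ¬ k % 3 = 0 := by omega
    simp only [aa, cc, if_neg h0, if_pos h, and_self]
  have A2 : ∀ k, k % 3 = 2 → aa k = a₃ ∧ cc k = z := fun k h => by
    have h0 : ¬ k % 3 = 0 := by omega
    have h1 : ¬ k % 3 = 1 := by omega
    simp only [aa, cc, if_neg h0, if_neg h1, and_self]
  have haane : ∀ k, aa k ≠ aa (k + 1) := by
    intro k
    have : k % 3 = 0 ∨ k % 3 = 1 ∨ k % 3 = 2 := by omega
    rcases this with h | h | h
    · have h' : (k + 1) % 3 = 1 := by omega
      rw [(A0 _ h).1, (A1 _ h').1]; exact h12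
    · have h' : (k + 1) % 3 = 2 := by omega
      rw [(A1 _ h).1, (A2 _ h').1]; exact h23
    · have h' : (k + 1) % 3 = 0 := by omega
      rw [(A2 _ h).1, (A0 _ h').1]; exact h13.symm
  have hrel' : ∀ k t, cc k * lin (aa k) t + cc (k + 1) * lin (aa (k + 1)) t
      + cc (k + 2) * lin (aa (k + 2)) t = 0 := by
    intro k t
    have : k % 3 = 0 ∨ k % 3 = 1 ∨ k % 3 = 2 := by omega
    rcases this with h | h | h
    · have h' : (k + 1) % 3 = 1 := by omega
      have h'' : (k + 2) % 3 = 2 := by omega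
      rw [(A0 _ h).1, (A0 _ h).2, (A1 _ h').1, (A1 _ h').2, (A2 _ h'').1, (A2 _ h'').2]; exact hrel t
    · have h' : (k + 1) % 3 = 2 := by omega
      have h'' : (k + 2) % 3 = 0 := by omega
      rw [(A1 _ h).1, (A1 _ h).2, (A2 _ h').1, (A2 _ h').2, (A0 _ h'').1, (A0 _ h'').2]; linear_combination hrel t
    · have h' : (k + 1) % 3 = 0 := by omega
      have h'' : (k + 2) % 3 = 1 := by omega
      rw [(A2 _ h).1, (A2 _ h).2, (A0 _ h').1, (A0 _ h').2, (A1 _ h'').1, (A1 _ h'').2]; linear_combination hrel t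
  have hfin : ∀ k, (aPoints f P (aa k) \ Ray (θ + Lk k)).Finite := by
    intro k
    have hdm := Int.emod_add_mul_ediv k 3
    have : k % 3 = 0 ∨ k % 3 = 1 ∨ k % 3 = 2 := by omega
    rcases this with h | h | h
    · have hR : θ + Lk k = θ + 2 * Real.pi * (k / 3 : ℤ) := by
        rw [h] at hdm
        have : (k : ℝ) = 3 * (k / 3 : ℤ) := by exact_mod_cast (by omega : k = 3 * (k / 3))
        unfold Lk; rw [this]; ring
      rw [hR, Ray_add, (A0 _ h).1]; exact h1
    · have hR : θ + Lk k = (θ + 2 * Real.pi / 3) + 2 * Real.pi * (k / 3 : ℤ) := by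
        have : (k : ℝ) = 1 + 3 * (k / 3 : ℤ) := by exact_mod_cast (by omega : k = 1 + 3 * (k / 3))
        unfold Lk; rw [this]; ring
      rw [hR, Ray_add, (A1 _ h).1]; exact h2
    · have hR : θ + Lk k = (θ + 4 * Real.pi / 3) + 2 * Real.pi * (k / 3 : ℤ) := by
        have : (k : ℝ) = 2 + 3 * (k / 3 : ℤ) := by exact_mod_cast (by omega : k = 2 + 3 * (k / 3))
        unfold Lk; rw [this]; ring
      rw [hR, Ray_add, (A2 _ h).1]; exact h3
  have hbd : ∃ R₀, 1 ≤ R₀ ∧ ∀ k z, R₀ < ‖z‖ → z ∈ aPoints f P (aa k) → z ∈ Ray (θ + Lk k) := by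
    have hb : Bornology.IsBounded (⋃ k ∈ ({0, 1, 2} : Set ℤ), (aPoints f P (aa k) \ Ray (θ + Lk k))) := by
      refine Set.Finite.isBounded (Set.Finite.biUnion (by simp) fun k _ => hfin k)
    obtain ⟨R, hR⟩ := hb.exists_norm_le
    refine ⟨max R 1, le_max_right _ _, ?_⟩
    intro k z hz hza
    have hk : aa k = aa (k % 3) := by simp only [aa, Int.emod_emod_of_dvd k (dvd_refl (3:ℤ))]
    have hL : Ray (θ + Lk k) = Ray (θ + Lk (k % 3)) := by
      rw [← Ray_add (θ + Lk (k % 3)) (k / 3)]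
      congr 1
      have : (k : ℝ) = (k % 3 : ℤ) + 3 * (k / 3 : ℤ) := by
        exact_mod_cast (Int.emod_add_mul_ediv k 3).symm
      unfold Lk
      rw [this]; push_cast; ring_nf
    by_contra hcon
    rw [hL] at hcon
    rw [hk] at hza
    have := hR z (by
      refine mem_biUnion (x := k % 3) ?_ ⟨hza, hcon⟩
      have : k % 3 = 0 ∨ k % 3 = 1 ∨ k % 3 = 2 := by omega
      simpa using this)
    exact absurd hz (not_lt.2 (this.trans (le_max_left _ _)))
  obtain ⟨R₀, hR1, hR⟩ := hbd
  let w : ℤ → ℂ → ℂ := fun k t => cc k * lin (aa k) (f t)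
  have hwm : ∀ k z, MeromorphicAt (w k) z := fun k z =>
    (MeromorphicAt.const (cc k) z).mul (hf.lin_mero (aa k) z)
  have hword : ∀ k z, meromorphicOrderAt (w k) z = meromorphicOrderAt (fun t => lin (aa k) (f t)) z := by
    intro k z
    exact meromorphicOrderAt_mul_of_ne_zero (g := fun _ => cc k) analyticAt_const (hcc k)
  have hwtop : ∀ k z, meromorphicOrderAt (w k) z ≠ ⊤ := fun k z => by
    rw [hword]; exact hf.lin_ne_top htrans _ z
  let g : ℤ → ℂ → ℂ := fun k => (fun _ => (-1 : ℂ)) * (w (k + 1) / w (k + 2))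
  have hgm : ∀ k z, MeromorphicAt (g k) z := fun k z =>
    (MeromorphicAt.const (-1) z).mul ((hwm _ z).div (hwm _ z))
  have hgon : ∀ k, MeromorphicOn (g k) univ := fun k z _ => hgm k z
  have hgord : ∀ k z, meromorphicOrderAt (g k) z
      = meromorphicOrderAt (w (k + 1)) z - meromorphicOrderAt (w (k + 2)) z := by
    intro k z
    have : meromorphicOrderAt (g k) z = meromorphicOrderAt (w (k + 1) / w (k + 2)) z :=
      meromorphicOrderAt_mul_of_ne_zero (g := fun _ => (-1 : ℂ)) analyticAt_const (by norm_num)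
    rw [this, meromorphicOrderAt_div (hwm _ z) (hwm _ z)]
  have hUg : ∀ k z, toMeromorphicNFOn (g k) univ =ᶠ[𝓝[≠] z] g k := fun k z =>
    (hgon k).toMeromorphicNFOn_eq_self_on_nhdsNE (mem_univ z)
  have hUord : ∀ k z, meromorphicOrderAt (toMeromorphicNFOn (g k) univ) z
      = meromorphicOrderAt (w (k + 1)) z - meromorphicOrderAt (w (k + 2)) z := fun k z => by
    rw [meromorphicOrderAt_congr (hUg k z), hgord]
  have hwne : ∀ k z, ∀ᶠ t in 𝓝[≠] z, w k t ≠ 0 := fun k z =>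
    (meromorphicOrderAt_ne_top_iff_eventually_ne_zero (hwm k z)).1 (hwtop k z)
  refine ⟨fun k => toMeromorphicNFOn (g k) univ, R₀, ⟨hR1, ?_, ?_, ?_, ?_, ?_, ?_⟩, ?_⟩
  · intro k z
    exact meromorphicNFOn_toMeromorphicNFOn (g k) univ (mem_univ z)
  · intro k z
    rw [hUord]
    have h1 := hwtop (k + 1) z
    have h2 := hwtop (k + 2) z
    lift meromorphicOrderAt (w (k + 1)) z to ℤ using h1 with m
    lift meromorphicOrderAt (w (k + 2)) z to ℤ using h2 with n
    exact_mod_cast WithTop.coe_ne_top (a := m - n)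
  · intro k
    have e1 : aa (k + 3 + 1) = aa (k + 1) := by rw [← haa3 (k + 1)]; ring_nf
    have e2 : aa (k + 3 + 2) = aa (k + 2) := by rw [← haa3 (k + 2)]; ring_nf
    have e3 : cc (k + 3 + 1) = cc (k + 1) := by rw [← hcc3 (k + 1)]; ring_nf
    have e4 : cc (k + 3 + 2) = cc (k + 2) := by rw [← hcc3 (k + 2)]; ring_nf
    have : g (k + 3) = g k := by
      simp only [g, w, e1, e2, e3, e4]
    simp only [this]
  · intro k z
    filter_upwards [hUg k z, hUg (k + 1) z, hwne (k + 1) z, hwne (k + 2) z] with t ht1 ht2 h1 h2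
    rw [ht1, ht2]
    have e0 : w (k + 1 + 2) t = w k t := by
      have := haa3 k; have := hcc3 k
      have e : k + 1 + 2 = k + 3 := by ring
      simp only [w, e, haa3, hcc3]
    have e1 : k + 1 + 1 = k + 2 := by ring
    have hr := hrel' k (f t)
    have hr' : w k t = - w (k + 1) t - w (k + 2) t := by
      simp only [w]; linear_combination hr
    simp only [g, Pi.mul_apply, Pi.div_apply, e0, e1]
    rw [mul_inv, inv_div, hr']
    field_simp
    ring
  · intro k z hz hpos
    rw [hUord] at hpos
    refine hR (k + 1) z hz (hf.mem_aPoints _ (aa (k + 2)) z ?_)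
    rw [← hword, ← hword]
    have h1 := hwtop (k + 1) z
    have h2 := hwtop (k + 2) z
    lift meromorphicOrderAt (w (k + 1)) z to ℤ using h1 with m
    lift meromorphicOrderAt (w (k + 2)) z to ℤ using h2 with n
    norm_cast at hpos ⊢
    omega
  · intro k z hz hpos
    rw [hUord] at hpos
    refine hR (k + 2) z hz (hf.mem_aPoints _ (aa (k + 1)) z ?_)
    rw [← hword, ← hword]
    have h1 := hwtop (k + 1) z
    have h2 := hwtop (k + 2) z
    lift meromorphicOrderAt (w (k + 1)) z to ℤ using h1 with m
    lift meromorphicOrderAt (w (k + 2)) z to ℤ using h2 with n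
    norm_cast at hpos ⊢
    omega
  · intro k
    refine ⟨aa (k + 1), aa (k + 2), -cc (k + 1) / cc (k + 2), ?_, ?_, ?_⟩
    · exact div_ne_zero (neg_ne_zero.2 (hcc _)) (hcc _)
    · have := haane (k + 1)
      rwa [show k + 1 + 1 = k + 2 by ring] at this
    · intro z
      filter_upwards [hUg k z] with t ht
      rw [ht]
      simp only [g, w, Pi.mul_apply, Pi.div_apply]
      have := hcc (k + 2)
      rw [neg_div, mul_div_mul_comm]; ring

/-! ### Section 5 -/

/-- exponential coordinates, rotated by `θ`. -/
def ex (θ : ℝ) (ζ : ℂ) : ℂ := cexp (ζ + θ * I)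

lemma norm_ex (θ : ℝ) (ζ : ℂ) : ‖ex θ ζ‖ = Real.exp ζ.re := by
  simp [ex, Complex.norm_exp]

lemma ex_add (θ : ℝ) (ζ : ℂ) (n : ℤ) : ex θ (ζ + n * (2 * Real.pi * I)) = ex θ ζ := by
  unfold ex
  rw [Complex.exp_eq_exp_iff_exists_int]
  exact ⟨n, by ring⟩

lemma ex_ray {θ α : ℝ} {ζ : ℂ} (h : ex θ ζ ∈ Ray (θ + α)) : ∃ n : ℤ, ζ.im = α + 2 * Real.pi * n := by
  obtain ⟨t, ht, h⟩ := h
  have e : (t : ℂ) = cexp (Real.log t) := by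
    rw [← Complex.ofReal_exp, Real.exp_log ht]
  rw [e, ← Complex.exp_add, ex, Complex.exp_eq_exp_iff_exists_int] at h
  obtain ⟨n, hn⟩ := h
  refine ⟨n, ?_⟩
  have := congrArg Complex.im hn
  simp at this
  linarith

lemma ex_differentiable (θ : ℝ) : Differentiable ℂ (ex θ) := by
  unfold ex; fun_prop

lemma ex_exists (θ : ℝ) {z : ℂ} (hz : z ≠ 0) (a : ℝ) :
    ∃ ζ : ℂ, ex θ ζ = z ∧ a < ζ.im ∧ ζ.im ≤ a + 2 * Real.pi ∧ ζ.re = Real.log ‖z‖ := by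
  set y := toIocMod Real.two_pi_pos a (z.arg - θ) with hy
  have hmem := toIocMod_mem_Ioc Real.two_pi_pos a (z.arg - θ)
  refine ⟨Real.log ‖z‖ + y * I, ?_, by simpa using hmem.1, by simpa using hmem.2, by simp⟩
  have h1 : z.arg - θ - y = toIocDiv Real.two_pi_pos a (z.arg - θ) • (2 * Real.pi) := by
    rw [hy]; rw [← self_sub_toIocMod]
  unfold ex
  have e : z = cexp (Real.log ‖z‖ + z.arg * I) := by
    rw [Complex.exp_add, ← Complex.ofReal_exp, Real.exp_log (norm_pos_iff.2 hz)]
    exact (Complex.norm_mul_exp_arg_mul_I z).symm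
  conv_rhs => rw [e]
  rw [Complex.exp_eq_exp_iff_exists_int]
  refine ⟨-toIocDiv Real.two_pi_pos a (z.arg - θ), ?_⟩
  have h2 : (z.arg : ℂ) - θ - y = (toIocDiv Real.two_pi_pos a (z.arg - θ) : ℤ) * (2 * Real.pi) := by
    have := congrArg (fun x : ℝ => (x : ℂ)) h1
    simpa using this
  push_cast
  linear_combination -I * h2

namespace Tri
variable {θ : ℝ} {U : ℤ → ℂ → ℂ} {R₀ : ℝ}

lemma mero (h : Tri θ U R₀) (k : ℤ) (z : ℂ) : MeromorphicAt (U k) z := (h.nf k z).meromorphicAt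

lemma analyticAt (h : Tri θ U R₀) {k : ℤ} {z : ℂ} (hz : 0 ≤ meromorphicOrderAt (U k) z) :
    AnalyticAt ℂ (U k) z := (h.nf k z).meromorphicOrderAt_nonneg_iff_analyticAt.1 hz

lemma ne_zero (h : Tri θ U R₀) {k : ℤ} {z : ℂ} (hz : meromorphicOrderAt (U k) z = 0) :
    U k z ≠ 0 := (h.nf k z).meromorphicOrderAt_eq_zero_iff.1 hz

lemma analyticAt_inv (h : Tri θ U R₀) {k : ℤ} {z : ℂ} (hz : meromorphicOrderAt (U k) z ≤ 0) :
    AnalyticAt ℂ (U k)⁻¹ z := by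
  have h1 : MeromorphicNFAt (U k)⁻¹ z := (h.nf k z).inv
  refine h1.meromorphicOrderAt_nonneg_iff_analyticAt.1 ?_
  rw [meromorphicOrderAt_inv]
  have := h.ne_top k z
  lift meromorphicOrderAt (U k) z to ℤ using this with m
  norm_cast at hz ⊢
  omega

lemma rel_at (h : Tri θ U R₀) {k : ℤ} {z : ℂ} (h1 : 0 ≤ meromorphicOrderAt (U k) z)
    (h2 : meromorphicOrderAt (U (k + 1)) z ≤ 0) : U k z + (U (k + 1) z)⁻¹ = 1 := by
  have c1 := (h.analyticAt h1).continuousAt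
  have c2 := (h.analyticAt_inv h2).continuousAt
  have t1 : Tendsto (fun w => U k w + (U (k + 1))⁻¹ w) (𝓝[≠] z) (𝓝 (U k z + (U (k + 1))⁻¹ z)) :=
    (c1.add c2).tendsto.mono_left nhdsWithin_le_nhds
  have t2 : Tendsto (fun w => U k w + (U (k + 1))⁻¹ w) (𝓝[≠] z) (𝓝 1) := by
    refine tendsto_const_nhds.congr' ?_
    filter_upwards [h.rel k z] with w hw
    simpa using hw.symm
  exact tendsto_nhds_unique t1 t2

/-- the order of `U k` is nonnegative iff that of `U (k+1)` is nonpositive. -/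
lemma ord_iff (h : Tri θ U R₀) {k : ℤ} {z : ℂ} (h2 : meromorphicOrderAt (U (k + 1)) z ≤ 0) :
    0 ≤ meromorphicOrderAt (U k) z := by
  have h3 : U k =ᶠ[𝓝[≠] z] (fun w => 1 - (U (k + 1))⁻¹ w) := by
    filter_upwards [h.rel k z] with w hw
    simp only [Pi.inv_apply]; linear_combination hw
  rw [meromorphicOrderAt_congr h3]
  exact (analyticAt_const.sub (h.analyticAt_inv h2)).meromorphicOrderAt_nonneg

lemma ord_iff' (h : Tri θ U R₀) {k : ℤ} {z : ℂ} (h2 : 0 ≤ meromorphicOrderAt (U k) z) :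
    meromorphicOrderAt (U (k + 1)) z ≤ 0 := by
  have h3 : (U (k + 1))⁻¹ =ᶠ[𝓝[≠] z] (fun w => 1 - U k w) := by
    filter_upwards [h.rel k z] with w hw
    simp only [Pi.inv_apply]; linear_combination hw
  have h4 : 0 ≤ meromorphicOrderAt (U (k + 1))⁻¹ z := by
    rw [meromorphicOrderAt_congr h3]
    exact (analyticAt_const.sub (h.analyticAt h2)).meromorphicOrderAt_nonneg
  rw [meromorphicOrderAt_inv] at h4
  have := h.ne_top (k + 1) z
  lift meromorphicOrderAt (U (k + 1)) z to ℤ using this with m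
  norm_cast at h4 ⊢
  omega

lemma per_int (h : Tri θ U R₀) (k n : ℤ) : U (k + 3 * n) = U k := by
  induction n using Int.induction_on with
  | zero => simp
  | succ i ih => rw [show k + 3 * ((i : ℤ) + 1) = (k + 3 * i) + 3 by ring, h.per, ih]
  | pred i ih =>
    rw [← ih, ← h.per]; congr 1; ring

lemma ord_zero (h : Tri θ U R₀) {k : ℤ} {ζ : ℂ} (hζ : ζ ∈ Dk (Real.log R₀) k) :
    meromorphicOrderAt (U k) (ex θ ζ) = 0 := by
  have hR : R₀ < ‖ex θ ζ‖ := by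
    rw [norm_ex, ← Real.log_lt_iff_lt_exp (by linarith [h.one_le])]
    exact hζ.1
  have him : |ζ.im - Lk k| < 2 * Real.pi / 3 := hζ.2
  rw [abs_lt] at him
  have hp := Real.pi_pos
  apply le_antisymm
  · by_contra hc
    push Not at hc
    obtain ⟨n, hn⟩ := ex_ray (h.zer k _ hR hc)
    rw [Lk_succ] at hn
    have a1 : (2 * Real.pi) * n < 2 * Real.pi * 0 := by linarith
    have a2 : (2 * Real.pi) * (-1) < 2 * Real.pi * n := by linarith
    have b1 := lt_of_mul_lt_mul_left a1 (by positivity)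
    have b2 := lt_of_mul_lt_mul_left a2 (by positivity)
    have b3 : n < 0 := by exact_mod_cast b1
    have b4 : -1 < n := by exact_mod_cast b2
    omega
  · by_contra hc
    push Not at hc
    obtain ⟨n, hn⟩ := ex_ray (h.pol k _ hR hc)
    rw [show k + 2 = k + 1 + 1 by ring, Lk_succ, Lk_succ] at hn
    have a1 : (2 * Real.pi) * n < 2 * Real.pi * 0 := by linarith
    have a2 : (2 * Real.pi) * (-1) < 2 * Real.pi * n := by linarith
    have b1 := lt_of_mul_lt_mul_left a1 (by positivity)
    have b2 := lt_of_mul_lt_mul_left a2 (by positivity)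
    have b3 : n < 0 := by exact_mod_cast b1
    have b4 : -1 < n := by exact_mod_cast b2
    omega

lemma convex_Dk (s₀ : ℝ) (k : ℤ) : Convex ℝ (Dk s₀ k) := by
  intro x hx y hy a b ha hb hab
  have hx2 : |x.im - Lk k| < 2 * Real.pi / 3 := hx.2
  have hy2 : |y.im - Lk k| < 2 * Real.pi / 3 := hy.2
  rw [abs_lt] at hx2 hy2
  have hx1 : s₀ < x.re := hx.1
  have hy1 : s₀ < y.re := hy.1
  have hb' : b = 1 - a := by linarith
  subst hb'
  rcases ha.eq_or_lt with h0 | h0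
  · subst h0; simpa using hy
  have e1 : (a • x + (1 - a) • y).re = a * x.re + (1 - a) * y.re := by simp
  have e2 : (a • x + (1 - a) • y).im = a * x.im + (1 - a) * y.im := by simp
  refine ⟨?_, ?_⟩
  · show s₀ < (a • x + (1 - a) • y).re
    rw [e1]; nlinarith
  · show |(a • x + (1 - a) • y).im - Lk k| < 2 * Real.pi / 3
    rw [e2, abs_lt]; constructor <;> nlinarith

theorem exists_log (h : Tri θ U R₀) : ∃ V, LogData V (Real.log R₀) ∧
    ∀ k, ∀ ζ ∈ Dk (Real.log R₀) k, cexp (V k ζ) = U k (ex θ ζ) := by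
  set s₀ := Real.log R₀ with hs
  have hex : ∀ k : ℤ, ∃ W : ℂ → ℂ, DifferentiableOn ℂ W (Dk s₀ k) ∧
      ∀ ζ ∈ Dk s₀ k, cexp (W ζ) = U k (ex θ ζ) := by
    intro k
    refine exists_log_convex (isOpen_Dk s₀ k) (convex_Dk s₀ k) ⟨⟨s₀ + 1, Lk k⟩, ?_⟩ ?_ ?_
    · refine ⟨by simp, ?_⟩
      show |Lk k - Lk k| < _
      simp; positivity
    · intro ζ hζ
      have := (h.analyticAt (h.ord_zero hζ).ge).differentiableAt
      exact (this.comp ζ (ex_differentiable θ ζ)).differentiableWithinAt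
    · intro ζ hζ
      exact h.ne_zero (h.ord_zero hζ)
  choose W hW1 hW2 using hex
  let V : ℤ → ℂ → ℂ := fun k ζ => W (k % 3) (ζ - (k / 3 : ℤ) * (2 * Real.pi * I))
  have hL : ∀ k : ℤ, Lk k = Lk (k % 3) + (k / 3 : ℤ) * (2 * Real.pi) := by
    intro k
    have : (k : ℝ) = (k % 3 : ℤ) + 3 * (k / 3 : ℤ) := by
      exact_mod_cast (Int.emod_add_mul_ediv k 3).symm
    unfold Lk
    rw [this]; ring_nf
  have hmem : ∀ k ζ, ζ ∈ Dk s₀ k → ζ - (k / 3 : ℤ) * (2 * Real.pi * I) ∈ Dk s₀ (k % 3) := by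
    intro k ζ hζ
    have h2 : |ζ.im - Lk k| < 2 * Real.pi / 3 := hζ.2
    refine ⟨?_, ?_⟩
    · have : s₀ < ζ.re := hζ.1
      simpa using this
    · show |(ζ - (k / 3 : ℤ) * (2 * Real.pi * I)).im - Lk (k % 3)| < 2 * Real.pi / 3
      rw [hL k] at h2
      have e : (ζ - (k / 3 : ℤ) * (2 * Real.pi * I)).im = ζ.im - (k / 3 : ℤ) * (2 * Real.pi) := by
        simp
      rw [e]
      convert h2 using 2
      ring
  have hV : ∀ k, ∀ ζ ∈ Dk s₀ k, cexp (V k ζ) = U k (ex θ ζ) := by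
    intro k ζ hζ
    have e1 : U k = U (k % 3) := by
      rw [← h.per_int (k % 3) (k / 3), Int.emod_add_mul_ediv]
    have e2 : ex θ (ζ - (k / 3 : ℤ) * (2 * Real.pi * I)) = ex θ ζ := by
      have := ex_add θ ζ (-(k / 3 : ℤ))
      rw [← this]; congr 1; push_cast; ring
    simp only [V]
    rw [hW2 _ _ (hmem k ζ hζ), e2, e1]
  refine ⟨V, ⟨?_, ?_, ?_⟩, hV⟩
  · intro k
    exact (hW1 (k % 3)).comp ((differentiable_id.sub_const _).differentiableOn) (hmem k)
  · intro k ζ hζ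
    have m1 := Sk_subset_Dk _ _ hζ
    have m2 := Sk_subset_Dk' _ _ hζ
    rw [Complex.exp_neg, hV _ _ m1, hV _ _ m2]
    exact h.rel_at (h.ord_zero m1).ge (h.ord_zero m2).le
  · intro k ζ
    simp only [V]
    have e1 : (k + 3) % 3 = k % 3 := by omega
    have e2 : (k + 3) / 3 = k / 3 + 1 := by omega
    rw [e1, e2]; congr 1; push_cast; ring

theorem vb (h : Tri θ U R₀) {V : ℤ → ℂ → ℂ} (hL : LogData V (Real.log R₀))
    (hV : ∀ k, ∀ ζ ∈ Dk (Real.log R₀) k, cexp (V k ζ) = U k (ex θ ζ)) {δ : ℝ} (hδ : 0 < δ) :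
    ∃ C > 0, ∀ k ζ, Real.log R₀ + 3 ≤ ζ.re → |ζ.im - Lk k| ≤ 2 * Real.pi / 3 - δ →
      meromorphicOrderAt (U k) (ex θ ζ) = 0 ∧
      ‖U k (ex θ ζ)‖ ≤ Real.exp (C * mm V ζ.re) ∧ ‖(U k (ex θ ζ))⁻¹‖ ≤ Real.exp (C * mm V ζ.re) := by
  obtain ⟨C, hC, hb⟩ := hL.val_bound δ hδ
  refine ⟨C, hC, fun k ζ h1 h2 => ?_⟩
  have hD : ζ ∈ Dk (Real.log R₀) k := ⟨by linarith, show |ζ.im - Lk k| < _ by linarith⟩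
  have := abs_le.1 (hb k ζ h1 h2)
  refine ⟨h.ord_zero hD, ?_, ?_⟩
  · rw [← hV k ζ hD, Complex.norm_exp]
    exact Real.exp_le_exp.2 this.2
  · rw [← hV k ζ hD, ← Complex.exp_neg, Complex.norm_exp]
    refine Real.exp_le_exp.2 ?_
    rw [Complex.neg_re]; linarith

theorem ub (h : Tri θ U R₀) {V : ℤ → ℂ → ℂ} (hL : LogData V (Real.log R₀))
    (hV : ∀ k, ∀ ζ ∈ Dk (Real.log R₀) k, cexp (V k ζ) = U k (ex θ ζ)) {δ : ℝ} (hδ : 0 < δ) :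
    ∃ C > 0, ∀ k ζ, Real.log R₀ + 3 ≤ ζ.re →
      (Lk k - 2 * Real.pi / 3 + δ ≤ ζ.im → ζ.im ≤ Lk k + 4 * Real.pi / 3 - δ →
        0 ≤ meromorphicOrderAt (U k) (ex θ ζ) ∧ ‖U k (ex θ ζ)‖ ≤ Real.exp (C * mm V ζ.re)) ∧
      (Lk k - 4 * Real.pi / 3 + δ ≤ ζ.im → ζ.im ≤ Lk k + 2 * Real.pi / 3 - δ →
        meromorphicOrderAt (U k) (ex θ ζ) ≤ 0 ∧ ‖(U k (ex θ ζ))⁻¹‖ ≤ Real.exp (C * mm V ζ.re)) := by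
  have hp := Real.pi_gt_three
  obtain ⟨C, hC, hb⟩ := h.vb hL hV (δ := min δ 1) (lt_min hδ one_pos)
  have m1 := min_le_left δ 1
  have m2 := min_le_right δ 1
  refine ⟨C + 1, by linarith, fun k ζ h1 => ⟨fun h2 h3 => ?_, fun h2 h3 => ?_⟩⟩
  · have hm := LogData.six_le_mm V ζ.re
    by_cases hc : ζ.im ≤ Lk k + 2 * Real.pi / 3 - min δ 1
    · obtain ⟨a, b, c⟩ := hb k ζ h1 (abs_le.2 ⟨by linarith, by linarith⟩)
      exact ⟨a.ge, b.trans (Real.exp_le_exp.2 (by nlinarith))⟩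
    · push Not at hc
      obtain ⟨a, b, c⟩ := hb (k + 1) ζ h1 (by rw [Lk_succ]; exact abs_le.2 ⟨by linarith, by linarith⟩)
      have ho := h.ord_iff a.le
      refine ⟨ho, ?_⟩
      have hr := h.rel_at ho a.le
      have : U k (ex θ ζ) = 1 - (U (k + 1) (ex θ ζ))⁻¹ := by linear_combination hr
      rw [this]
      calc ‖1 - (U (k + 1) (ex θ ζ))⁻¹‖ ≤ 1 + Real.exp (C * mm V ζ.re) := by
            refine (norm_sub_le _ _).trans ?_
            rw [norm_one]; linarith
        _ ≤ Real.exp (C * mm V ζ.re) * Real.exp 1 := by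
            have e1 : 1 ≤ Real.exp (C * mm V ζ.re) := Real.one_le_exp (by nlinarith)
            have e2 : 2 ≤ Real.exp 1 := by linarith [Real.add_one_le_exp (1:ℝ)]
            nlinarith
        _ ≤ _ := by
            rw [← Real.exp_add]; exact Real.exp_le_exp.2 (by nlinarith)
  · have hm := LogData.six_le_mm V ζ.re
    by_cases hc : Lk k - 2 * Real.pi / 3 + min δ 1 ≤ ζ.im
    · obtain ⟨a, b, c⟩ := hb k ζ h1 (abs_le.2 ⟨by linarith, by linarith⟩)
      exact ⟨a.le, c.trans (Real.exp_le_exp.2 (by nlinarith))⟩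
    · push Not at hc
      have hLk : Lk k = Lk (k - 1) + 2 * Real.pi / 3 := by
        have := Lk_succ (k - 1)
        rwa [sub_add_cancel] at this
      obtain ⟨a, b, c⟩ := hb (k - 1) ζ h1 (abs_le.2 ⟨by linarith, by linarith⟩)
      have ho := h.ord_iff' a.ge
      have hr := h.rel_at a.ge ho
      rw [sub_add_cancel] at ho hr
      refine ⟨ho, ?_⟩
      have : (U k (ex θ ζ))⁻¹ = 1 - U (k - 1) (ex θ ζ) := by linear_combination hr
      rw [this]
      calc ‖1 - U (k - 1) (ex θ ζ)‖ ≤ 1 + Real.exp (C * mm V ζ.re) := by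
            refine (norm_sub_le _ _).trans ?_
            rw [norm_one]; linarith
        _ ≤ Real.exp (C * mm V ζ.re) * Real.exp 1 := by
            have e1 : 1 ≤ Real.exp (C * mm V ζ.re) := Real.one_le_exp (by nlinarith)
            have e2 : 2 ≤ Real.exp 1 := by linarith [Real.add_one_le_exp (1:ℝ)]
            nlinarith
        _ ≤ _ := by
            rw [← Real.exp_add]; exact Real.exp_le_exp.2 (by nlinarith)

end Tri

/-! ### Section 6 - A -/

/-- finite product of powers -/
def rr (s : Finset ℂ) (n : ℂ → ℤ) (z : ℂ) : ℂ := ∏ u ∈ s, (z - u) ^ (-n u)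

lemma rr_eq (s : Finset ℂ) (n : ℂ → ℤ) :
    rr s n = ∏ᶠ u, (fun x : ℂ => x - u) ^ (if u ∈ s then -n u else 0) := by
  classical
  have : (fun u : ℂ => (fun x : ℂ => x - u) ^ (if u ∈ s then -n u else 0)).mulSupport ⊆ s := by
    intro u hu
    by_contra hc
    apply hu
    have hc' : u ∉ s := hc
    simp [hc']
  rw [finprod_eq_prod_of_mulSupport_subset _ this]
  ext z
  rw [Finset.prod_apply, rr]
  refine Finset.prod_congr rfl fun u hu => ?_
  simp [hu]

lemma rr_order (s : Finset ℂ) (n : ℂ → ℤ) (z : ℂ) :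
    meromorphicOrderAt (rr s n) z = ((if z ∈ s then -n z else 0 : ℤ) : WithTop ℤ) := by
  classical
  rw [rr_eq]
  refine Function.FactorizedRational.meromorphicOrderAt_eq _ ?_
  refine s.finite_toSet.subset fun u hu => ?_
  by_contra hc
  apply hu
  exact if_neg hc

lemma rr_mero (s : Finset ℂ) (n : ℂ → ℤ) (z : ℂ) : MeromorphicAt (rr s n) z := by
  rw [rr_eq]
  exact (Function.FactorizedRational.meromorphicNFOn_univ _ (mem_univ z)).meromorphicAt

lemma rr_ne_zero {s : Finset ℂ} (n : ℂ → ℤ) {z : ℂ} (hz : z ∉ s) : rr s n z ≠ 0 := by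
  refine Finset.prod_ne_zero_iff.2 fun u hu => zpow_ne_zero _ (sub_ne_zero.2 ?_)
  rintro rfl; exact hz hu

lemma rr_hasDerivAt {s : Finset ℂ} (n : ℂ → ℤ) {z : ℂ} (hz : z ∉ s) :
    HasDerivAt (rr s n) (rr s n z * ∑ u ∈ s, (-n u : ℂ) / (z - u)) z := by
  classical
  have h : ∀ u ∈ s, HasDerivAt (fun w : ℂ => (w - u) ^ (-n u)) (((-n u : ℤ) : ℂ) * (z - u) ^ (-n u - 1) * 1) z := by
    intro u hu
    have hne : z - u ≠ 0 := sub_ne_zero.2 (by rintro rfl; exact hz hu)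
    exact (hasDerivAt_zpow (-n u) (z - u) (Or.inl hne)).comp z ((hasDerivAt_id z).sub_const u)
  have h2 := HasDerivAt.fun_finsetProd h
  have e : (fun x => ∏ i ∈ s, (x - i) ^ (-n i)) = rr s n := rfl
  rw [e] at h2
  refine h2.congr_deriv ?_
  rw [Finset.mul_sum]
  refine Finset.sum_congr rfl fun u hu => ?_
  have hne : z - u ≠ 0 := sub_ne_zero.2 (by rintro rfl; exact hz hu)
  rw [rr, ← Finset.mul_prod_erase s _ hu, zpow_sub_one₀ hne, smul_eq_mul]
  push_cast
  field_simp

lemma rr_analyticAt {s : Finset ℂ} (n : ℂ → ℤ) {z : ℂ} (hz : z ∉ s) : AnalyticAt ℂ (rr s n) z := by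
  have : rr s n = fun w => ∏ u ∈ s, (w - u) ^ (-n u) := rfl
  rw [this]
  refine Finset.analyticAt_fun_prod _ fun u hu => ?_
  refine AnalyticAt.fun_zpow (by fun_prop) (sub_ne_zero.2 ?_)
  rintro rfl; exact hz hu

lemma rr_bound (s : Finset ℂ) (n : ℂ → ℤ) : ∃ C > 0, ∃ R ≥ 1, ∀ z : ℂ, R ≤ ‖z‖ →
    z ∉ s ∧ ‖rr s n z‖ ≤ C * ‖z‖ ^ (-∑ u ∈ s, n u) := by
  obtain ⟨M, hM⟩ := s.finite_toSet.isBounded.exists_norm_le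
  refine ⟨∏ u ∈ s, (2 : ℝ) ^ |n u|, Finset.prod_pos fun u _ => by positivity, max 1 (2 * M + 1),
    le_max_left _ _, fun z hz => ?_⟩
  have hz1 : 1 ≤ ‖z‖ := (le_max_left _ _).trans hz
  have hz2 : 2 * M + 1 ≤ ‖z‖ := (le_max_right _ _).trans hz
  have hz0 : ‖z‖ ≠ 0 := by linarith
  constructor
  · intro h
    have := hM z h
    have := norm_nonneg z
    linarith
  · have e : ‖z‖ ^ (-∑ u ∈ s, n u) = ∏ u ∈ s, ‖z‖ ^ (-n u) := by
      rw [← Finset.sum_neg_distrib]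
      classical
      induction s using Finset.induction_on with
      | empty => simp
      | insert a s ha ih => 
        rw [Finset.sum_insert ha, Finset.prod_insert ha, zpow_add₀ hz0, ih]
        intro u hu; exact hM u (by simp [Finset.mem_coe.1 hu])
    rw [e, rr, norm_prod, ← Finset.prod_mul_distrib]
    refine Finset.prod_le_prod (fun _ _ => norm_nonneg _) fun u hu => ?_
    have hu' := hM u hu
    have l1 : ‖z‖ / 2 ≤ ‖z - u‖ := by
      have := norm_sub_norm_le z u; linarith
    have l2 : ‖z - u‖ ≤ 2 * ‖z‖ := by
      have := norm_sub_le z u; linarith [norm_nonneg u]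
    have l0 : 0 < ‖z - u‖ := by linarith
    rw [norm_zpow]
    rcases le_total 0 (n u) with hn | hn
    · rw [abs_of_nonneg hn, zpow_neg, zpow_neg]
      lift n u to ℕ using hn with m
      rw [zpow_natCast, zpow_natCast, zpow_natCast, ← inv_pow, ← inv_pow, ← mul_pow]
      refine pow_le_pow_left₀ (by positivity) ?_ m
      rw [inv_le_comm₀ l0 (by positivity), mul_inv, inv_inv]
      linarith
    · rw [abs_of_nonpos hn]
      have hn' : 0 ≤ -n u := by omega
      lift -n u to ℕ using hn' with m
      rw [zpow_natCast, zpow_natCast, zpow_natCast, ← mul_pow]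
      exact pow_le_pow_left₀ (by positivity) l2 m

/-- remove finitely many zeros and poles -/
lemma extract {F : ℂ → ℂ} (hF : ∀ z, MeromorphicAt F z) (ht : ∀ z, meromorphicOrderAt F z ≠ ⊤)
    (s : Finset ℂ) : ∃ φ : ℂ → ℂ, (∀ z, MeromorphicNFAt φ z) ∧
      (∀ z ∈ s, meromorphicOrderAt φ z = 0) ∧
      (∀ z ∉ s, meromorphicOrderAt φ z = meromorphicOrderAt F z) ∧
      (∀ z, φ =ᶠ[𝓝[≠] z] fun w => F w * rr s (fun u => (meromorphicOrderAt F u).untop₀) w) ∧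
      (∀ z ∉ s, MeromorphicNFAt F z →
        φ =ᶠ[𝓝 z] fun w => F w * rr s (fun u => (meromorphicOrderAt F u).untop₀) w) := by
  set n : ℂ → ℤ := fun u => (meromorphicOrderAt F u).untop₀ with hn
  set G : ℂ → ℂ := F * rr s n with hG
  have hGm : MeromorphicOn G univ := fun z _ => (hF z).mul (rr_mero s n z)
  have hGo : ∀ z, meromorphicOrderAt G z
      = meromorphicOrderAt F z + ((if z ∈ s then -n z else 0 : ℤ) : WithTop ℤ) := fun z => by
    rw [hG, meromorphicOrderAt_mul (hF z) (rr_mero s n z), rr_order]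
  have hev : ∀ z, toMeromorphicNFOn G univ =ᶠ[𝓝[≠] z] G := fun z =>
    hGm.toMeromorphicNFOn_eq_self_on_nhdsNE (mem_univ z)
  have hnf : ∀ z, MeromorphicNFAt (toMeromorphicNFOn G univ) z := fun z =>
    meromorphicNFOn_toMeromorphicNFOn G univ (mem_univ z)
  refine ⟨toMeromorphicNFOn G univ, hnf, ?_, ?_, hev, ?_⟩
  · intro z hz
    rw [meromorphicOrderAt_congr (hev z), hGo, if_pos hz]
    have h1 : (n z : WithTop ℤ) = meromorphicOrderAt F z := by
      simp only [hn]; exact WithTop.coe_untop₀_of_ne_top (ht z)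
    rw [← h1]
    norm_cast
    ring
  · intro z hz
    rw [meromorphicOrderAt_congr (hev z), hGo, if_neg hz]
    simp
  · intro z hz hFz
    have hGz : MeromorphicNFAt G z := by
      rw [hG]
      exact (meromorphicNFAt_mul_iff_left (rr_analyticAt n hz) (rr_ne_zero n hz)).2 hFz
    exact ((hnf z).eventuallyEq_nhdsNE_iff_eventuallyEq_nhds hGz).1 (hev z)

/-! ### Section 6 - B -/

lemma HP_le {φ : ℂ → ℂ} (h1 : ∀ w : ℂ, 0 ≤ w.im → AnalyticAt ℂ φ w)
    (h2 : ∀ w : ℂ, w.im ≤ 0 → AnalyticAt ℂ (fun x => (φ x)⁻¹) w) (h0 : ∀ x : ℝ, φ x ≠ 0) {C : ℝ} (hC : 0 ≤ C)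
    (b1 : ∀ w : ℂ, 0 ≤ w.im → ‖φ w‖ ≤ Real.exp (C * (1 + ‖w‖ ^ (7/8:ℝ))))
    (b2 : ∀ w : ℂ, w.im ≤ 0 → ‖(φ w)⁻¹‖ ≤ Real.exp (C * (1 + ‖w‖ ^ (7/8:ℝ)))) 
    (w : ℂ) (hw : 0 ≤ w.im) (hw0 : w ≠ 0) : ‖φ w‖ * ‖(φ (starRingEnd ℂ w))⁻¹‖ ≤ 1 := by
  set F : ℂ → ℂ := fun w => φ w * starRingEnd ℂ ((φ (starRingEnd ℂ w))⁻¹) with hF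
  have hFn : ∀ w, ‖F w‖ = ‖φ w‖ * ‖(φ (starRingEnd ℂ w))⁻¹‖ := fun w => by
    simp only [hF]; rw [norm_mul, RCLike.norm_conj]
  have hFd : ∀ w : ℂ, 0 ≤ w.im → DifferentiableAt ℂ F w := by
    intro w hw
    refine (h1 w hw).differentiableAt.mul ?_
    have := (h2 (starRingEnd ℂ w) (by simpa using hw)).differentiableAt.conj_conj
    simpa [Function.comp_def] using this
  have him : ∀ ζ : ℂ, 0 ≤ ζ.im → ζ.im ≤ Real.pi → 0 ≤ (cexp ζ).im := by
    intro ζ ha hb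
    rw [Complex.exp_im]
    exact mul_nonneg (Real.exp_pos _).le (Real.sin_nonneg_of_nonneg_of_le_pi ha hb)
  have hcl : closure (im ⁻¹' Ioo 0 Real.pi) ⊆ im ⁻¹' Icc 0 Real.pi := by
    refine closure_minimal (preimage_mono Ioo_subset_Icc_self) (isClosed_Icc.preimage continuous_im)
  have hedge : ∀ ζ : ℂ, (cexp ζ).im = 0 → ‖F (cexp ζ)‖ ≤ 1 := by
    intro ζ h
    have e : starRingEnd ℂ (cexp ζ) = cexp ζ := Complex.conj_eq_iff_im.2 h
    have e2 : cexp ζ = ((cexp ζ).re : ℂ) := (Complex.conj_eq_iff_re.1 e).symm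
    rw [hFn, e, norm_inv, mul_inv_cancel₀]
    rw [e2]; exact norm_ne_zero_iff.2 (h0 _)
  have hreal : w = cexp (Complex.log w) := (Complex.exp_log hw0).symm
  rw [← hFn, hreal]
  refine PhragmenLindelof.horizontal_strip (a := 0) (b := Real.pi) (f := fun ζ => F (cexp ζ)) (C := 1) (z := Complex.log w) ?_ ?_ ?_ ?_ ?_ ?_
  · refine DifferentiableOn.diffContOnCl fun ζ hζ => ?_
    have := hcl hζ
    exact ((hFd _ (him ζ this.1 this.2)).comp ζ Complex.differentiable_exp.differentiableAt).differentiableWithinAt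
  · refine ⟨7/8, ?_, 4 * C, ?_⟩
    · rw [sub_zero, div_self Real.pi_ne_zero]; norm_num
    · refine Asymptotics.IsBigO.of_bound 1 ?_
      refine eventually_inf_principal.2 (Eventually.of_forall fun ζ hζ => ?_)
      rw [one_mul, hFn]
      have hi := him ζ hζ.1.le hζ.2.le
      have e1 := b1 _ hi
      have e2 := b2 ((starRingEnd ℂ) (cexp ζ)) (by simpa using hi)
      rw [RCLike.norm_conj, ] at e2
      have e3 : ‖cexp ζ‖ ^ (7/8:ℝ) = Real.exp (7/8 * ζ.re) := by
        rw [Complex.norm_exp, ← Real.exp_mul]; ring_nf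
      rw [e3] at e1 e2
      calc _ ≤ _ := mul_le_mul e1 e2 (norm_nonneg _) (Real.exp_pos _).le
        _ ≤ _ := by
          rw [← Real.exp_add, Real.norm_of_nonneg (Real.exp_pos _).le]
          apply Real.exp_le_exp.2
          have t1 : Real.exp (7/8 * ζ.re) ≤ Real.exp (7/8 * |ζ.re|) := 
            Real.exp_le_exp.2 (by linarith [le_abs_self ζ.re])
          have t2 : 1 ≤ Real.exp (7/8 * |ζ.re|) := Real.one_le_exp (by positivity)
          nlinarith
  · intro ζ h
    exact hedge ζ (by rw [Complex.exp_im, h]; simp)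
  · intro ζ h
    exact hedge ζ (by rw [Complex.exp_im, h]; simp)
  · rw [Complex.log_im]; exact Complex.arg_nonneg_iff.2 hw
  · rw [Complex.log_im]; exact Complex.arg_le_pi w

lemma HP {φ : ℂ → ℂ} (h1 : ∀ w : ℂ, 0 ≤ w.im → AnalyticAt ℂ φ w)
    (h2 : ∀ w : ℂ, w.im ≤ 0 → AnalyticAt ℂ (fun x => (φ x)⁻¹) w) (h0 : ∀ x : ℝ, φ x ≠ 0) {C : ℝ} (hC : 0 ≤ C)
    (b1 : ∀ w : ℂ, 0 ≤ w.im → ‖φ w‖ ≤ Real.exp (C * (1 + ‖w‖ ^ (7/8:ℝ))))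
    (b2 : ∀ w : ℂ, w.im ≤ 0 → ‖(φ w)⁻¹‖ ≤ Real.exp (C * (1 + ‖w‖ ^ (7/8:ℝ)))) 
    (x : ℝ) : 0 ≤ (deriv φ x / φ x).im := by
  have hd : HasDerivAt φ (deriv φ x) (x:ℂ) := (h1 x (by simp)).differentiableAt.hasDerivAt
  have hl : ∀ ε : ℝ, HasDerivAt (fun y : ℝ => φ (x + ε * y * I)) (deriv φ x * (ε * I)) 0 := by
    intro ε
    have a1 : HasDerivAt (fun y : ℝ => (x:ℂ) + ε * y * I) (ε * I) (0:ℝ) := by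
      have := (((Complex.ofRealCLM.hasDerivAt (x := 0)).const_mul (ε:ℂ)).mul_const I).const_add (x:ℂ)
      simpa using this
    have hd' : HasDerivAt φ (deriv φ x) ((x:ℂ) + ε * (0:ℝ) * I) := by simpa using hd
    exact hd'.comp (0:ℝ) a1
  have hn : ∀ ε : ℝ, HasDerivAt (fun y : ℝ => ‖φ (x + ε * y * I)‖ ^ 2) 
      (2 * inner ℝ (φ x) (deriv φ x * (ε * I))) 0 := by
    intro ε
    have := (hl ε).norm_sq
    simpa using this
  have hh := (hn 1).sub (hn (-1))
  have hle : ∀ᶠ y : ℝ in 𝓝[>] (0:ℝ), ‖φ (x + ((1:ℝ):ℂ) * y * I)‖ ^ 2 - ‖φ (x + ((-1:ℝ):ℂ) * y * I)‖ ^ 2 ≤ 0 := by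
    have hne : ∀ᶠ y : ℝ in 𝓝[>] (0:ℝ), φ (x + ((-1:ℝ):ℂ) * y * I) ≠ 0 := by
      have : ContinuousAt (fun y : ℝ => φ (x + ((-1:ℝ):ℂ) * y * I)) 0 := (hl (-1)).continuousAt
      refine (this.eventually_ne ?_).filter_mono nhdsWithin_le_nhds
      simpa using h0 x
    filter_upwards [hne, self_mem_nhdsWithin] with y hy hy0
    have hy0' : (0:ℝ) < y := hy0
    have := HP_le h1 h2 h0 hC b1 b2 (x + ((1:ℝ):ℂ) * y * I) (by simp [hy0'.le]) (by
      intro h; have := congrArg Complex.im h; simp at this; linarith)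
    have e : starRingEnd ℂ ((x:ℂ) + ((1:ℝ):ℂ) * y * I) = x + ((-1:ℝ):ℂ) * y * I := by
      simp
    rw [e, norm_inv, ← div_eq_mul_inv, div_le_one (norm_pos_iff.2 hy)] at this
    have := pow_le_pow_left₀ (norm_nonneg _) this 2
    linarith
  have key : 2 * inner ℝ (φ x) (deriv φ x * ((1:ℝ) * I)) - 2 * inner ℝ (φ x) (deriv φ x * ((-1:ℝ) * I)) ≤ 0 := by
    have ht := hh.hasDerivWithinAt (s := Ioi 0)
    rw [hasDerivWithinAt_iff_tendsto_slope' (by simp)] at ht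
    refine le_of_tendsto ht ?_
    filter_upwards [hle, self_mem_nhdsWithin] with y hy hy0
    have hy0' : (0:ℝ) < y := hy0
    rw [slope_def_field]
    refine div_nonpos_of_nonpos_of_nonneg ?_ (by linarith)
    simpa using hy
  have e2 : (deriv φ x / φ x).im = (deriv φ x * starRingEnd ℂ (φ x)).im / Complex.normSq (φ x) := by
    rw [div_eq_mul_inv, Complex.inv_def, ← mul_assoc, Complex.im_mul_ofReal]; rfl
  rw [e2]
  refine div_nonneg ?_ (Complex.normSq_nonneg _)
  simp only [Complex.inner] at key
  simp at key ⊢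
  linarith

/-! ### Section 6 - C -/

def SmallG (θ : ℝ) (U : ℤ → ℂ → ℂ) (s₁ : ℝ) : Prop :=
  0 ≤ s₁ ∧ ∀ δ > 0, ∃ C > 0, ∀ k ζ, s₁ ≤ ζ.re →
      (Lk k - 2 * Real.pi / 3 + δ ≤ ζ.im → ζ.im ≤ Lk k + 4 * Real.pi / 3 - δ →
        0 ≤ meromorphicOrderAt (U k) (ex θ ζ) ∧
        ‖U k (ex θ ζ)‖ ≤ Real.exp (C * Real.exp (7/8 * ζ.re))) ∧
      (Lk k - 4 * Real.pi / 3 + δ ≤ ζ.im → ζ.im ≤ Lk k + 2 * Real.pi / 3 - δ →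
        meromorphicOrderAt (U k) (ex θ ζ) ≤ 0 ∧
        ‖(U k (ex θ ζ))⁻¹‖ ≤ Real.exp (C * Real.exp (7/8 * ζ.re)))

lemma Tri.smallG {θ : ℝ} {U : ℤ → ℂ → ℂ} {R₀ : ℝ} (h : Tri θ U R₀) {V : ℤ → ℂ → ℂ}
    (hL : LogData V (Real.log R₀))
    (hV : ∀ k, ∀ ζ ∈ Dk (Real.log R₀) k, cexp (V k ζ) = U k (ex θ ζ))
    (hg : ∃ C, ∀ s ≥ Real.log R₀ + 3, mm V s ≤ C * Real.exp (7/8 * s)) :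
    SmallG θ U (Real.log R₀ + 3) := by
  refine ⟨by linarith [Real.log_nonneg h.one_le], fun δ hδ => ?_⟩
  obtain ⟨C, hC, hb⟩ := h.ub hL hV hδ
  obtain ⟨C', hC'⟩ := hg
  refine ⟨C * (|C'| + 1), by positivity, fun k ζ hζ => ?_⟩
  have hm : Real.exp (C * mm V ζ.re) ≤ Real.exp (C * (|C'| + 1) * Real.exp (7/8 * ζ.re)) := by
    apply Real.exp_le_exp.2
    rw [mul_assoc]
    refine mul_le_mul_of_nonneg_left ((hC' _ hζ).trans ?_) hC.le
    exact mul_le_mul_of_nonneg_right (by linarith [le_abs_self C']) (Real.exp_pos _).le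
  obtain ⟨b1, b2⟩ := hb k ζ hζ
  exact ⟨fun x y => ⟨(b1 x y).1, (b1 x y).2.trans hm⟩, fun x y => ⟨(b2 x y).1, (b2 x y).2.trans hm⟩⟩

lemma exp_log_rpow {w : ℂ} (hw : w ≠ 0) : Real.exp (7/8 * Real.log ‖w‖) = ‖w‖ ^ (7/8:ℝ) := by
  rw [Real.rpow_def_of_pos (norm_pos_iff.2 hw), mul_comm]

lemma SmallG.zub {θ : ℝ} {U : ℤ → ℂ → ℂ} {s₁ : ℝ} (h : SmallG θ U s₁) {δ : ℝ} (hδ : 0 < δ) :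
    ∃ C > 0, ∀ k (ψ : ℝ) (w : ℂ), |ψ| ≤ Real.pi / 3 - δ → Real.exp s₁ ≤ ‖w‖ →
      (0 ≤ w.im → 0 ≤ meromorphicOrderAt (U k) (cexp ((θ + Lk k + ψ : ℝ) * I) * w) ∧
        ‖U k (cexp ((θ + Lk k + ψ : ℝ) * I) * w)‖ ≤ Real.exp (C * ‖w‖ ^ (7/8 : ℝ))) ∧
      (w.im ≤ 0 → meromorphicOrderAt (U k) (cexp ((θ + Lk k + ψ : ℝ) * I) * w) ≤ 0 ∧
        ‖(U k (cexp ((θ + Lk k + ψ : ℝ) * I) * w))⁻¹‖ ≤ Real.exp (C * ‖w‖ ^ (7/8 : ℝ))) := by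
  obtain ⟨C, hC, hb⟩ := h.2 δ hδ
  refine ⟨C, hC, fun k ψ w hψ hw => ?_⟩
  have hw0 : w ≠ 0 := by
    rintro rfl; simp at hw; exact absurd hw (not_le.2 (Real.exp_pos _))
  have hw1 : s₁ ≤ Real.log ‖w‖ := (Real.le_log_iff_exp_le (norm_pos_iff.2 hw0)).2 hw
  rw [abs_le] at hψ
  have key : ∀ a : ℝ, w = ‖w‖ * cexp (a * I) →
      ex θ (Real.log ‖w‖ + (Lk k + ψ + a : ℝ) * I) = cexp ((θ + Lk k + ψ : ℝ) * I) * w := by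
    intro a ha
    have e : ((‖w‖ : ℝ) : ℂ) = cexp (Real.log ‖w‖) := by
      rw [← Complex.ofReal_exp, Real.exp_log (norm_pos_iff.2 hw0)]
    conv_rhs => rw [ha, e]
    rw [ex, ← Complex.exp_add, ← Complex.exp_add]
    congr 1; push_cast; ring
  constructor
  · intro hi
    have e := key w.arg (Complex.norm_mul_exp_arg_mul_I w).symm
    have h0 := Complex.arg_nonneg_iff.2 hi
    have h1 := Complex.arg_le_pi w
    have := (hb k (Real.log ‖w‖ + (Lk k + ψ + w.arg : ℝ) * I) (by simpa using hw1)).1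
      (by simp; linarith) (by simp; linarith)
    rw [e] at this
    simpa [exp_log_rpow hw0] using this
  · intro hi
    have h0 : 0 ≤ (starRingEnd ℂ w).arg := Complex.arg_nonneg_iff.2 (by simpa using hi)
    have h1 := Complex.arg_le_pi (starRingEnd ℂ w)
    have e := key (-(starRingEnd ℂ w).arg) (by
      have := congrArg (starRingEnd ℂ) (Complex.norm_mul_exp_arg_mul_I (starRingEnd ℂ w))
      rw [map_mul, ← Complex.exp_conj] at this
      simpa using this.symm)
    have := (hb k (Real.log ‖w‖ + (Lk k + ψ + (-(starRingEnd ℂ w).arg) : ℝ) * I) (by simpa using hw1)).2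
      (by simp only [add_im, ofReal_im, mul_im, ofReal_re, I_im, I_re]; linarith) (by simp only [add_im, ofReal_im, mul_im, ofReal_re, I_im, I_re]; linarith)
    rw [e] at this
    simpa [exp_log_rpow hw0] using this

lemma finite_ord {F : ℂ → ℂ} (hF : ∀ z, MeromorphicAt F z) (ht : ∀ z, meromorphicOrderAt F z ≠ ⊤)
    (ρ : ℝ) : {z | ‖z‖ ≤ ρ ∧ meromorphicOrderAt F z ≠ 0}.Finite := by
  have hm : MeromorphicOn F (Metric.closedBall 0 ρ) := fun z _ => hF z
  refine ((MeromorphicOn.divisor F (Metric.closedBall 0 ρ)).finiteSupport (isCompact_closedBall 0 ρ)).subset ?_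
  rintro z ⟨hz, ho⟩
  rw [Function.mem_support, MeromorphicOn.divisor_apply hm (by simpa using hz)]
  intro h
  rw [WithTop.untop₀_eq_zero] at h
  rcases h with h | h
  · exact ho h
  · exact ht z h

lemma pow_absorb (N : ℤ) {x : ℝ} (hx : 1 ≤ x) : x ^ N ≤ Real.exp (2 * |(N:ℝ)| * x ^ (7/8:ℝ)) := by
  have h0 : 0 < x := by linarith
  have h1 := Real.log_le_rpow_div h0.le (show (0:ℝ) < 7/8 by norm_num)
  have h2 : 0 ≤ Real.log x := Real.log_nonneg hx
  rw [← Real.rpow_intCast, Real.rpow_def_of_pos h0]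
  apply Real.exp_le_exp.2
  have h3 : 0 ≤ x ^ (7/8:ℝ) := by positivity
  have h4 := le_abs_self (N:ℝ)
  have h5 := abs_nonneg (N:ℝ)
  calc Real.log x * N ≤ Real.log x * |(N:ℝ)| := mul_le_mul_of_nonneg_left h4 h2
    _ ≤ (2 * x ^ (7/8:ℝ)) * |(N:ℝ)| := by
      refine mul_le_mul_of_nonneg_right (h1.trans ?_) h5
      rw [div_le_iff₀ (by norm_num)]; linarith
    _ = _ := by ring

lemma growth_aux {S : Set ℂ} (hS : IsClosed S) {φ : ℂ → ℂ} (hφ : ∀ z ∈ S, ContinuousAt φ z)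
    {C₁ C₂ R : ℝ} (N : ℤ) (hR : 1 ≤ R) (hb : ∀ z ∈ S, R ≤ ‖z‖ →
      ‖φ z‖ ≤ Real.exp (C₁ * ‖z‖ ^ (7/8:ℝ)) * (C₂ * ‖z‖ ^ N)) :
    ∃ C ≥ 0, ∀ z ∈ S, ‖φ z‖ ≤ Real.exp (C * (1 + ‖z‖ ^ (7/8:ℝ))) := by
  have hK : IsCompact (S ∩ Metric.closedBall 0 R) := (isCompact_closedBall 0 R).inter_left hS
  obtain ⟨M, hM⟩ := hK.exists_bound_of_continuousOn (f := φ) fun z hz => (hφ z hz.1).continuousWithinAt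
  refine ⟨|M| + |C₁| + |C₂| + 2 * |(N:ℝ)|, by positivity, fun z hz => ?_⟩
  have h3 : 0 ≤ ‖z‖ ^ (7/8:ℝ) := by positivity
  have hle : ∀ x : ℝ, x ≤ Real.exp |x| := fun x => (le_abs_self x).trans
    ((by linarith : |x| ≤ |x| + 1).trans (Real.add_one_le_exp _))
  rcases le_total ‖z‖ R with h | h
  · refine (hM z ⟨hz, by simpa using h⟩).trans ((hle M).trans (Real.exp_le_exp.2 ?_))
    have : 0 ≤ |C₁| + |C₂| + 2 * |(N:ℝ)| := by positivity
    nlinarith [abs_nonneg M]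
  · refine (hb z hz h).trans ?_
    have h1 := pow_absorb N (hR.trans h)
    have hN : 0 ≤ ‖z‖ ^ N := by positivity
    calc _ ≤ Real.exp (C₁ * ‖z‖ ^ (7/8:ℝ)) * (Real.exp |C₂| * Real.exp (2 * |(N:ℝ)| * ‖z‖ ^ (7/8:ℝ))) := by
          refine mul_le_mul_of_nonneg_left ?_ (Real.exp_pos _).le
          exact mul_le_mul (hle C₂) h1 hN (Real.exp_pos _).le
      _ ≤ _ := by
          rw [← Real.exp_add, ← Real.exp_add]
          apply Real.exp_le_exp.2
          have a1 : C₁ * ‖z‖ ^ (7/8:ℝ) ≤ |C₁| * ‖z‖ ^ (7/8:ℝ) := mul_le_mul_of_nonneg_right (le_abs_self _) h3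
          have a2 : 0 ≤ |M| * (1 + ‖z‖ ^ (7/8:ℝ)) := by positivity
          have a3 : 0 ≤ |C₂| * ‖z‖ ^ (7/8:ℝ) := by positivity
          have a4 := abs_nonneg C₁
          have a5 := abs_nonneg (N:ℝ)
          nlinarith

/-! ### Section 6 - D -/

namespace Tri
variable {θ : ℝ} {U : ℤ → ℂ → ℂ} {R₀ : ℝ}

lemma hp (h : Tri θ U R₀) {s₁ : ℝ} (hs : SmallG θ U s₁) {δ : ℝ} (hδ : 0 < δ) (k : ℤ) (s : Finset ℂ)
    (hE : ∀ z, ‖z‖ ≤ Real.exp s₁ → meromorphicOrderAt (U k) z ≠ 0 → z ∈ s) {ψ : ℝ}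
    (hψ : |ψ| ≤ Real.pi / 3 - δ) (x : ℝ) {c z : ℂ} (hc : c = cexp ((θ + Lk k + ψ : ℝ) * I))
    (hz : z = c * x) (hzs : z ∉ s) :
    (c * ∑ u ∈ s, ((meromorphicOrderAt (U k) u).untop₀ : ℂ) / (z - u)).im
      ≤ (c * (deriv (U k) z / U k z)).im := by
  obtain ⟨φ, hnf, hord0, hord, -, heq⟩ := extract (h.mero k) (h.ne_top k) s
  set n : ℂ → ℤ := fun u => (meromorphicOrderAt (U k) u).untop₀ with hn
  obtain ⟨C, hC, hzub⟩ := hs.zub hδ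
  have hcn : ‖c‖ = 1 := by rw [hc, Complex.norm_exp_ofReal_mul_I]
  have hc0 : c ≠ 0 := by rw [← norm_pos_iff, hcn]; norm_num
  have hup : ∀ w : ℂ, 0 ≤ w.im → 0 ≤ meromorphicOrderAt φ (c * w) := by
    intro w hw
    by_cases hm : c * w ∈ s
    · rw [hord0 _ hm]
    · rw [hord _ hm]
      rcases le_total ‖w‖ (Real.exp s₁) with hl | hl
      · by_contra hcon
        exact hm (hE _ (by rw [norm_mul, hcn, one_mul]; exact hl) (fun h0 => hcon h0.ge))
      · rw [hc]; exact ((hzub k ψ w hψ hl).1 hw).1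
  have hlo : ∀ w : ℂ, w.im ≤ 0 → meromorphicOrderAt φ (c * w) ≤ 0 := by
    intro w hw
    by_cases hm : c * w ∈ s
    · rw [hord0 _ hm]
    · rw [hord _ hm]
      rcases le_total ‖w‖ (Real.exp s₁) with hl | hl
      · by_contra hcon
        exact hm (hE _ (by rw [norm_mul, hcn, one_mul]; exact hl) (fun h0 => hcon h0.le))
      · rw [hc]; exact ((hzub k ψ w hψ hl).2 hw).1
  have hmulan : ∀ w, AnalyticAt ℂ (fun w : ℂ => c * w) w := fun w => by fun_prop
  have han : ∀ w : ℂ, 0 ≤ w.im → AnalyticAt ℂ (fun w => φ (c * w)) w := fun w hw =>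
    AnalyticAt.fun_comp ((hnf _).meromorphicOrderAt_nonneg_iff_analyticAt.1 (hup w hw)) (hmulan w)
  have han' : ∀ w : ℂ, w.im ≤ 0 → AnalyticAt ℂ (fun w => (φ (c * w))⁻¹) w := fun w hw => by
    have h1 : MeromorphicNFAt φ⁻¹ (c * w) := (hnf _).inv
    have h2 : AnalyticAt ℂ φ⁻¹ (c * w) := by
      refine h1.meromorphicOrderAt_nonneg_iff_analyticAt.1 ?_
      rw [meromorphicOrderAt_inv]
      have := hlo w hw
      generalize meromorphicOrderAt φ (c * w) = o at this
      cases o with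
      | top => simp at this
      | coe o => norm_cast at this ⊢; omega
    exact AnalyticAt.fun_comp (g := φ⁻¹) h2 (hmulan w)
  have hne : ∀ x : ℝ, φ (c * x) ≠ 0 := fun x =>
    (hnf _).meromorphicOrderAt_eq_zero_iff.1 (le_antisymm (hlo _ (by simp)) (hup _ (by simp)))
  have heqf : ∀ z ∉ s, φ z = U k z * rr s n z := fun z hz => (heq z hz (h.nf k z)).eq_of_nhds
  obtain ⟨A, hA, R, hR, hrb⟩ := rr_bound s n
  obtain ⟨A', hA', R', hR', hrb'⟩ := rr_bound s (fun u => -n u)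
  have hinv : ∀ z, (rr s n z)⁻¹ = rr s (fun u => -n u) z := by
    intro z; simp [rr, ← Finset.prod_inv_distrib, zpow_neg]
  obtain ⟨C1, hC1, g1⟩ := growth_aux (S := {w : ℂ | 0 ≤ w.im}) (isClosed_le continuous_const continuous_im)
    (fun z hz => (han z hz).continuousAt) (C₁ := C) (C₂ := A) (R := max R (Real.exp s₁)) (-∑ u ∈ s, n u)
    (hR.le.trans (le_max_left _ _)) (by
      intro w hw hl
      have hcw : ‖c * w‖ = ‖w‖ := by rw [norm_mul, hcn, one_mul]
      have h1 := hrb (c * w) (by rw [hcw]; exact (le_max_left _ _).trans hl)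
      rw [heqf _ h1.1, norm_mul]
      rw [hcw] at h1
      refine mul_le_mul ?_ h1.2 (norm_nonneg _) (Real.exp_pos _).le
      rw [hc]; exact ((hzub k ψ w hψ ((le_max_right _ _).trans hl)).1 hw).2)
  obtain ⟨C2, hC2, g2⟩ := growth_aux (S := {w : ℂ | w.im ≤ 0}) (isClosed_le continuous_im continuous_const)
    (fun z hz => (han' z hz).continuousAt) (C₁ := C) (C₂ := A') (R := max R' (Real.exp s₁)) (-∑ u ∈ s, -n u)
    (hR'.le.trans (le_max_left _ _)) (by
      intro w hw hl
      have hcw : ‖c * w‖ = ‖w‖ := by rw [norm_mul, hcn, one_mul]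
      have h1 := hrb' (c * w) (by rw [hcw]; exact (le_max_left _ _).trans hl)
      rw [heqf _ h1.1, mul_inv, hinv, norm_mul]
      rw [hcw] at h1
      refine mul_le_mul ?_ h1.2 (norm_nonneg _) (Real.exp_pos _).le
      rw [hc]; exact ((hzub k ψ w hψ ((le_max_right _ _).trans hl)).2 hw).2)
  have hmono : ∀ (a b : ℝ) (w : ℂ), a ≤ b → Real.exp (a * (1 + ‖w‖ ^ (7/8:ℝ))) ≤ Real.exp (b * (1 + ‖w‖ ^ (7/8:ℝ))) := by
    intro a b w hab
    exact Real.exp_le_exp.2 (mul_le_mul_of_nonneg_right hab (by positivity))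
  have hfin := HP han han' hne (C := C1 + C2) (by positivity)
    (fun w hw => (g1 w hw).trans (hmono _ _ w (by linarith)))
    (fun w hw => (g2 w hw).trans (hmono _ _ w (by linarith))) x
  have hordz : meromorphicOrderAt (U k) z = 0 := by
    rw [← hord z hzs, hz]
    exact le_antisymm (hlo _ (by simp)) (hup _ (by simp))
  have hUd : HasDerivAt (U k) (deriv (U k) z) z := (h.analyticAt hordz.ge).differentiableAt.hasDerivAt
  have hU0 := h.ne_zero hordz
  have hφd : HasDerivAt φ (deriv (U k) z * rr s n z + U k z * (rr s n z * ∑ u ∈ s, (-n u : ℂ) / (z - u))) z :=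
    (hUd.mul (rr_hasDerivAt n hzs)).congr_of_eventuallyEq (heq z hzs (h.nf k z))
  rw [hz] at hφd
  have hcd := hφd.comp (x:ℂ) ((hasDerivAt_id (x:ℂ)).const_mul c)
  have e1 : deriv (fun w => φ (c * w)) x = (deriv (U k) z * rr s n z + U k z * (rr s n z * ∑ u ∈ s, (-n u : ℂ) / (z - u))) * c := by
    have := hcd.deriv
    rw [← hz] at this
    simpa [Function.comp_def] using this
  rw [e1, ← hz, heqf z hzs] at hfin
  have hrr := rr_ne_zero n hzs
  have e2 : (deriv (U k) z * rr s n z + U k z * (rr s n z * ∑ u ∈ s, (-n u : ℂ) / (z - u))) * c / (U k z * rr s n z)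
      = c * (deriv (U k) z / U k z) - c * ∑ u ∈ s, (n u : ℂ) / (z - u) := by
    have : ∑ u ∈ s, (-n u : ℂ) / (z - u) = - ∑ u ∈ s, (n u : ℂ) / (z - u) := by
      rw [← Finset.sum_neg_distrib]; simp [neg_div]
    rw [this]
    field_simp
    ring
  rw [e2, Complex.sub_im] at hfin
  linarith

end Tri

/-! ### Section 6 - E -/

namespace Tri
variable {θ : ℝ} {U : ℤ → ℂ → ℂ} {R₀ : ℝ}

lemma ray_im {α γ t : ℝ} : (((t : ℂ) * cexp ((α:ℝ) * I)) * starRingEnd ℂ (cexp ((γ:ℝ) * I))).im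
    = t * Real.sin (α - γ) := by
  rw [← Complex.exp_conj, mul_assoc, ← Complex.exp_add, Complex.im_ofReal_mul]
  have : (α:ℂ) * I + (starRingEnd ℂ) ((γ:ℂ) * I) = ((α - γ : ℝ) : ℂ) * I := by
    simp; ring
  rw [this, Complex.exp_ofReal_mul_I_im]

lemma im_term {c z u : ℂ} {x : ℝ} (hz : z = c * x) (n : ℤ) :
    (c * ((n:ℂ) / (z - u))).im = n * (u * starRingEnd ℂ c).im / Complex.normSq (z - u) := by
  have h1 : c * ((n:ℂ) / (z - u)) = ((n:ℝ):ℂ) * (c * starRingEnd ℂ (z - u) * ((Complex.normSq (z - u))⁻¹ : ℝ)) := by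
    rw [div_eq_mul_inv, Complex.inv_def]; push_cast; ring
  rw [h1, Complex.im_ofReal_mul, Complex.im_mul_ofReal]
  have h2 : (c * starRingEnd ℂ (z - u)).im = (u * starRingEnd ℂ c).im := by
    rw [hz]; simp; ring
  rw [h2]; ring

lemma sin_ge {δ x : ℝ} (hδ : 0 < δ) (h1 : δ ≤ x) (h2 : x ≤ Real.pi - δ) : Real.sin δ ≤ Real.sin x := by
  rcases le_total x (Real.pi / 2) with h | h
  · exact Real.sin_le_sin_of_le_of_le_pi_div_two (by linarith) h h1
  · rw [← Real.sin_pi_sub x]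
    exact Real.sin_le_sin_of_le_of_le_pi_div_two (by linarith) (by linarith) (by linarith)

theorem lemP (h : Tri θ U R₀) {s₁ : ℝ} (hs : SmallG θ U s₁) {δ : ℝ} (hδ : 0 < δ) (hδ1 : δ < 1) (k : ℤ)
    (hinf : {z | meromorphicOrderAt (U k) z ≠ 0}.Infinite) :
    ∃ R, Real.exp s₁ ≤ R ∧ ∀ ψ x : ℝ, ∀ z, |ψ| ≤ Real.pi / 3 - δ → R ≤ |x| →
      z = cexp ((θ + Lk k + ψ : ℝ) * I) * x →
      meromorphicOrderAt (U k) z = 0 ∧ 1 / |x| ≤ ‖z * (deriv (U k) z / U k z)‖ := by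
  classical
  have hsin : 0 < Real.sin δ := Real.sin_pos_of_pos_of_lt_pi hδ (by linarith [Real.pi_gt_three])
  set n : ℂ → ℤ := fun u => (meromorphicOrderAt (U k) u).untop₀ with hn
  have hfin := finite_ord (h.mero k) (h.ne_top k)
  set s := (hfin (Real.exp s₁)).toFinset with hsdef
  set K := 4 * ∑ u ∈ s, |(n u : ℝ)| * ‖u‖ with hK
  have hK0 : 0 ≤ K := by positivity
  obtain ⟨β, hβ1, hβ2⟩ := (hinf.sdiff (hfin (max (max (Real.exp s₁) R₀) (4 * (K + 1) / Real.sin δ)))).nonempty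
  have hβ0 : meromorphicOrderAt (U k) β ≠ 0 := hβ1
  have hβl : max (max (Real.exp s₁) R₀) (4 * (K + 1) / Real.sin δ) < ‖β‖ := by
    by_contra hc
    exact hβ2 ⟨not_lt.1 hc, hβ0⟩
  have l1 : Real.exp s₁ < ‖β‖ := ((le_max_left _ _).trans (le_max_left _ _)).trans_lt hβl
  have l2 : R₀ < ‖β‖ := ((le_max_right _ _).trans (le_max_left _ _)).trans_lt hβl
  have l3 : 4 * (K + 1) / Real.sin δ < ‖β‖ := (le_max_right _ _).trans_lt hβl
  have hβs : β ∉ s := by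
    rw [hsdef, Set.Finite.mem_toFinset]
    intro hc; exact absurd hc.1 (not_le.2 l1)
  have hnβ : (n β : WithTop ℤ) = meromorphicOrderAt (U k) β := WithTop.coe_untop₀_of_ne_top (h.ne_top k β)
  obtain ⟨C, hC, hzub⟩ := hs.zub hδ
  refine ⟨2 * ‖β‖ + 1, by linarith [norm_nonneg β], fun ψ x z hψ hx hz => ?_⟩
  set c := cexp ((θ + Lk k + ψ : ℝ) * I) with hc
  have hcn : ‖c‖ = 1 := by rw [hc, Complex.norm_exp_ofReal_mul_I]
  have hzn : ‖z‖ = |x| := by rw [hz, norm_mul, hcn, one_mul, Complex.norm_real, Real.norm_eq_abs]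
  have hx0 : 0 < |x| := by linarith [norm_nonneg β]
  constructor
  · have := hzub k ψ x hψ (by rw [Complex.norm_real, Real.norm_eq_abs]; linarith [norm_nonneg β])
    rw [hz, hc]
    exact le_antisymm (this.2 (by simp)).1 (this.1 (by simp)).1
  have hzs : z ∉ insert β s := by
    intro hm
    rcases Finset.mem_insert.1 hm with hm | hm
    · rw [hm] at hzn; linarith [norm_nonneg β]
    · rw [hsdef, Set.Finite.mem_toFinset] at hm
      have : ‖z‖ ≤ _ := hm.1
      linarith [norm_nonneg β]
  have hmain := h.hp hs hδ k (insert β s) (fun w hw ho => Finset.mem_insert_of_mem (by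
    rw [hsdef, Set.Finite.mem_toFinset]; exact ⟨hw, ho⟩)) hψ x hc hz hzs
  rw [Finset.sum_insert hβs, mul_add, Complex.add_im, Finset.mul_sum, Complex.im_sum] at hmain
  change (c * ((n β : ℂ) / (z - β))).im + ∑ u ∈ s, (c * ((n u : ℂ) / (z - u))).im ≤ _ at hmain
  rw [abs_le] at hψ
  have hx2 : 0 < x ^ 2 := by rw [← sq_abs]; positivity
  have hpos : ‖β‖ * Real.sin δ ≤ n β * (β * starRingEnd ℂ c).im := by
    rcases lt_or_gt_of_ne hβ0 with ho | ho
    · obtain ⟨t, ht, hb⟩ := h.pol k β l2 ho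
      have hn1 : n β ≤ -1 := by
        rw [← hnβ] at ho; norm_cast at ho; omega
      have hbn : ‖β‖ = t := by rw [hb, norm_mul, Complex.norm_exp_ofReal_mul_I, Complex.norm_real, Real.norm_of_nonneg ht.le, mul_one]
      have e : (β * starRingEnd ℂ c).im = t * Real.sin (θ + Lk (k + 2) - (θ + Lk k + ψ)) := by
        rw [hb, hc]; exact ray_im
      have e2 : Real.sin (θ + Lk (k + 2) - (θ + Lk k + ψ)) = - Real.sin (Real.pi / 3 - ψ) := by
        rw [← Real.sin_add_pi]; congr 1; simp only [Lk]; push_cast; ring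
      have := sin_ge (x := Real.pi / 3 - ψ) hδ (by linarith) (by linarith)
      have hn1' : (n β : ℝ) ≤ -1 := by exact_mod_cast hn1
      rw [e, e2, hbn]
      have h3 : t * Real.sin δ ≤ t * Real.sin (Real.pi / 3 - ψ) := by gcongr
      have h4 : 0 < t * Real.sin δ := by positivity
      nlinarith
    · obtain ⟨t, ht, hb⟩ := h.zer k β l2 ho
      have hn1 : 1 ≤ n β := by
        have ho' : 0 < meromorphicOrderAt (U k) β := ho
        rw [← hnβ] at ho'; norm_cast at ho'
      have hbn : ‖β‖ = t := by rw [hb, norm_mul, Complex.norm_exp_ofReal_mul_I, Complex.norm_real, Real.norm_of_nonneg ht.le, mul_one]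
      have e : (β * starRingEnd ℂ c).im = t * Real.sin (θ + Lk (k + 1) - (θ + Lk k + ψ)) := by
        rw [hb, hc]; exact ray_im
      have e2 : θ + Lk (k + 1) - (θ + Lk k + ψ) = 2 * Real.pi / 3 - ψ := by
        simp only [Lk]; push_cast; ring
      have := sin_ge (x := 2 * Real.pi / 3 - ψ) hδ (by linarith) (by linarith)
      have hn1' : (1:ℝ) ≤ n β := by exact_mod_cast hn1
      rw [e, e2, hbn]
      have h3 : t * Real.sin δ ≤ t * Real.sin (2 * Real.pi / 3 - ψ) := by gcongr
      have h4 : 0 < t * Real.sin δ := by positivity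
      nlinarith
  have t1 : ‖β‖ * Real.sin δ / (4 * x ^ 2) ≤ (c * ((n β : ℂ) / (z - β))).im := by
    rw [im_term hz]
    have hb0 : 0 < ‖z - β‖ := norm_pos_iff.2 (sub_ne_zero.2 fun e => hzs (by simp [e]))
    have hb1 : ‖z - β‖ ≤ 2 * |x| := by
      have := norm_sub_le z β; linarith [norm_nonneg β]
    have hb2 : Complex.normSq (z - β) ≤ 4 * x ^ 2 := by
      rw [Complex.normSq_eq_norm_sq, ← sq_abs x]; nlinarith
    refine div_le_div₀ ((by positivity : 0 ≤ ‖β‖ * Real.sin δ).trans hpos) hpos ?_ hb2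
    rw [Complex.normSq_eq_norm_sq]; positivity
  have t2 : ∀ u ∈ s, -(4 * (|(n u : ℝ)| * ‖u‖) / x ^ 2) ≤ (c * ((n u : ℂ) / (z - u))).im := by
    intro u hu
    have hu' : ‖u‖ ≤ Real.exp s₁ := by
      rw [hsdef, Set.Finite.mem_toFinset] at hu; exact hu.1
    have hb1 : |x| / 2 ≤ ‖z - u‖ := by
      have := norm_sub_norm_le z u; linarith
    rw [im_term hz]
    refine (abs_le.1 ?_).1
    have hns : x ^ 2 / 4 ≤ Complex.normSq (z - u) := by
      rw [Complex.normSq_eq_norm_sq, ← sq_abs x]; nlinarith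
    have hm : |(u * starRingEnd ℂ c).im| ≤ ‖u‖ := by
      refine (Complex.abs_im_le_norm _).trans ?_
      rw [norm_mul, RCLike.norm_conj, hcn, mul_one]
    rw [abs_div, abs_mul, abs_of_nonneg (Complex.normSq_nonneg (z - u))]
    calc _ ≤ |(n u : ℝ)| * ‖u‖ / (x ^ 2 / 4) :=
          div_le_div₀ (by positivity) (mul_le_mul_of_nonneg_left hm (abs_nonneg _)) (by positivity) hns
      _ = _ := by field_simp
  have t3 : -(K / x ^ 2) ≤ ∑ u ∈ s, (c * ((n u : ℂ) / (z - u))).im := by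
    refine le_trans (le_of_eq ?_) (Finset.sum_le_sum t2)
    rw [Finset.sum_neg_distrib, hK, Finset.mul_sum, Finset.sum_div]
  have t4 : 1 / x ^ 2 ≤ (c * (deriv (U k) z / U k z)).im := by
    refine le_trans ?_ ((add_le_add t1 t3).trans hmain)
    rw [div_lt_iff₀ hsin] at l3
    have : ‖β‖ * Real.sin δ / (4 * x ^ 2) + -(K / x ^ 2) = (‖β‖ * Real.sin δ / 4 - K) / x ^ 2 := by
      field_simp
      ring
    rw [this]
    exact div_le_div_of_nonneg_right (by linarith) hx2.le
  have t5 : 1 / x ^ 2 ≤ ‖deriv (U k) z / U k z‖ := by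
    have := (le_abs_self _).trans (Complex.abs_im_le_norm (c * (deriv (U k) z / U k z)))
    rw [norm_mul c, hcn, one_mul] at this
    exact t4.trans this
  rw [norm_mul, hzn]
  calc 1 / |x| = |x| * (1 / x ^ 2) := by rw [← sq_abs]; field_simp
    _ ≤ _ := mul_le_mul_of_nonneg_left t5 hx0.le

end Tri

/-! ### Section 6 - F -/

/-- reciprocal of the logarithmic derivative -/
def QQ (F : ℂ → ℂ) (z : ℂ) : ℂ := (z * logDeriv F z)⁻¹

namespace Tri
variable {θ : ℝ} {U : ℤ → ℂ → ℂ} {R₀ : ℝ}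

theorem lemP' (h : Tri θ U R₀) {s₁ : ℝ} (hs : SmallG θ U s₁) {δ : ℝ} (hδ : 0 < δ) (hδ1 : δ < 1) (k : ℤ)
    (hinf : {z | meromorphicOrderAt (U k) z ≠ 0}.Infinite) :
    ∃ R, ∀ ζ : ℂ, ∀ n : ℤ, R ≤ ‖ex θ ζ‖ → |ζ.im - Lk k - Real.pi * n| ≤ Real.pi / 3 - δ →
      AnalyticAt ℂ (QQ (U k)) (ex θ ζ) ∧ QQ (U k) (ex θ ζ) ≠ 0 ∧ ‖QQ (U k) (ex θ ζ)‖ ≤ ‖ex θ ζ‖ := by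
  obtain ⟨R, hR, hb⟩ := h.lemP hs hδ hδ1 k hinf
  refine ⟨R, fun ζ n hζ him => ?_⟩
  have hxa : |Real.exp ζ.re * (-1) ^ n| = ‖ex θ ζ‖ := by
    rw [norm_ex, abs_mul, abs_zpow, abs_neg, abs_one, one_zpow, mul_one, abs_of_pos (Real.exp_pos _)]
  have hpi : cexp (n * (Real.pi * I)) = (-1) ^ n := by rw [Complex.exp_int_mul, Complex.exp_pi_mul_I]
  have e : ex θ ζ = cexp ((θ + Lk k + (ζ.im - Lk k - Real.pi * n) : ℝ) * I) * ((Real.exp ζ.re * (-1) ^ n : ℝ) : ℂ) := by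
    push_cast
    rw [← hpi, ← Complex.exp_add, ← Complex.exp_add, ex]
    congr 1
    conv_lhs => rw [← Complex.re_add_im ζ]
    ring
  obtain ⟨h1, h2⟩ := hb _ (Real.exp ζ.re * (-1) ^ n) _ him (by rw [hxa]; exact hζ) e
  rw [hxa] at h2
  change 1 / ‖ex θ ζ‖ ≤ ‖ex θ ζ * logDeriv (U k) (ex θ ζ)‖ at h2
  have hpos : 0 < ‖ex θ ζ‖ := by rw [norm_ex]; exact Real.exp_pos _
  have hpos2 : 0 < ‖ex θ ζ * logDeriv (U k) (ex θ ζ)‖ := lt_of_lt_of_le (by positivity) h2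
  refine ⟨?_, inv_ne_zero (norm_pos_iff.1 hpos2), ?_⟩
  · have ha := h.analyticAt h1.ge
    refine AnalyticAt.fun_inv ?_ (norm_pos_iff.1 hpos2)
    exact analyticAt_id.mul (ha.deriv.div ha (h.ne_zero h1))
  · rw [QQ, norm_inv, inv_le_comm₀ hpos2 hpos, ← one_div]; exact h2

lemma QQ_mero (h : Tri θ U R₀) (k : ℤ) (z : ℂ) : MeromorphicAt (QQ (U k)) z :=
  ((MeromorphicAt.id z).mul (h.mero k z).logDeriv).inv

lemma ev_zero (h : Tri θ U R₀) (k : ℤ) (z : ℂ) : ∀ᶠ w in 𝓝[≠] z, AnalyticAt ℂ (U k) w ∧ U k w ≠ 0 := by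
  filter_upwards [(h.mero k z).eventually_analyticAt, 
    (meromorphicOrderAt_ne_top_iff_eventually_ne_zero (h.mero k z)).1 (h.ne_top k z)] with w h1 h2
  exact ⟨h1, h2⟩

lemma QQ_rel (h : Tri θ U R₀) (k : ℤ) (z : ℂ) : ∀ᶠ w in 𝓝[≠] z,
    QQ (U k) w = QQ (U (k + 1)) w * (U (k + 1) w - 1) := by
  filter_upwards [h.ev_zero k z, h.ev_zero (k + 1) z, h.rel k z,
    eventually_eventually_nhdsWithin.2 (h.rel k z), self_mem_nhdsWithin] with w h1 h2 h3 h4 hw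
  have h5 : U k =ᶠ[𝓝 w] fun v => 1 - (U (k + 1) v)⁻¹ := by
    rw [isOpen_compl_singleton.nhdsWithin_eq hw] at h4
    filter_upwards [h4] with v hv
    linear_combination hv
  have h6 : deriv (U k) w = deriv (U (k + 1)) w / (U (k + 1) w) ^ 2 := by
    rw [h5.deriv_eq]
    have := ((h2.1.differentiableAt.hasDerivAt.inv h2.2).const_sub 1).deriv
    simp only [Pi.inv_apply] at this
    rw [this]; ring
  have h7 : U k w = (U (k + 1) w - 1) / U (k + 1) w := by
    rw [h5.eq_of_nhds]; field_simp [h2.2]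
  have h8 : U (k + 1) w - 1 ≠ 0 := by
    intro h0; rw [h0, zero_div] at h7; exact h1.2 h7
  have h9 := h2.2
  have h10 : w * logDeriv (U k) w = w * logDeriv (U (k + 1)) w / (U (k + 1) w - 1) := by
    rw [logDeriv_apply, logDeriv_apply, h6, h7]
    field_simp
  rw [QQ, QQ, h10, inv_div, div_eq_mul_inv, mul_comm]

lemma rel3 (h : Tri θ U R₀) (z : ℂ) : ∀ᶠ w in 𝓝[≠] z,
    QQ (U 0) w = QQ (U 1) w * (U 1 w - 1) ∧ QQ (U 0) w = -(QQ (U (-1)) w * U 1 w) ∧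
    QQ (U 0) w = -(QQ (U 1) w * (U (-1) w)⁻¹) ∧ QQ (U 0) w = QQ (U (-1)) w * ((U (-1) w)⁻¹ - 1) := by
  have e2 : U 2 = U (-1) := by have := h.per (-1); norm_num at this; exact this
  have r1 := h.QQ_rel 0 z
  have r2 := h.QQ_rel (-1) z
  have r3 := h.rel 0 z
  have r4 := h.rel 1 z
  norm_num at r1 r2 r3 r4
  rw [e2] at r4
  filter_upwards [r1, r2, r3, r4, h.ev_zero 0 z, h.ev_zero 1 z] with w a1 a2 a3 a4 a5 a6
  have b1 : U 1 w - 1 = - (U (-1) w)⁻¹ := by linear_combination a4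
  have b2 : U 0 w - 1 = - (U 1 w)⁻¹ := by linear_combination a3
  have b3 : QQ (U 0) w = -(QQ (U (-1)) w * U 1 w) := by
    rw [a2, b2]; field_simp [a6.2]
  refine ⟨a1, b3, ?_, ?_⟩
  · rw [a1, b1]; ring
  · rw [b3]; linear_combination (-QQ (U (-1)) w) * b1

end Tri

/-! ### Section 6 - G -/

namespace Tri
variable {θ : ℝ} {U : ℤ → ℂ → ℂ} {R₀ : ℝ}

theorem Qlim (h : Tri θ U R₀) {s₁ : ℝ} (hs : SmallG θ U s₁)
    (hinf : ∀ k, {z | meromorphicOrderAt (U k) z ≠ 0}.Infinite) :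
    ∃ C > 0, ∃ R ≥ 1, ∀ ζ : ℂ, R ≤ ‖ex θ ζ‖ → -Real.pi ≤ ζ.im → ζ.im ≤ Real.pi →
      ∃ v, Tendsto (QQ (U 0)) (𝓝[≠] (ex θ ζ)) (𝓝 v) ∧
        ‖v‖ ≤ ‖ex θ ζ‖ * Real.exp (C * ‖ex θ ζ‖ ^ (7/8:ℝ)) ∧
        (|ζ.im| ≤ Real.pi / 4 ∨ 3 * Real.pi / 4 ≤ |ζ.im| → ‖v‖ ≤ ‖ex θ ζ‖) ∧
        (|ζ.im| ≤ Real.pi / 4 → v ≠ 0) := by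
  have hpi := Real.pi_pos
  have hδ : 0 < Real.pi / 12 := by positivity
  have hδ1 : Real.pi / 12 < 1 := by linarith [Real.pi_lt_four]
  have hp0 := h.lemP' hs hδ hδ1 0 (hinf 0)
  have hp1 := h.lemP' hs hδ hδ1 1 (hinf 1)
  have hp2 := h.lemP' hs hδ hδ1 (-1) (hinf (-1))
  obtain ⟨r0, p0⟩ := hp0
  obtain ⟨r1, p1⟩ := hp1
  obtain ⟨r2, p2⟩ := hp2
  obtain ⟨C, hC, hb⟩ := hs.2 _ hδ
  have L0 : Lk 0 = 0 := by simp [Lk]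
  have L1 : Lk 1 = 2 * Real.pi / 3 := by simp [Lk]
  have L2 : Lk (-1) = -(2 * Real.pi / 3) := by simp [Lk]; ring
  refine ⟨C + 1, by linarith, max 1 (max (Real.exp s₁) (max r0 (max r1 r2))), le_max_left _ _, fun ζ hζ hm1 hm2 => ?_⟩
  set z := ex θ ζ with hz
  have q1 : 1 ≤ ‖z‖ := (le_max_left _ _).trans hζ
  have q' := (le_max_right _ _).trans hζ
  have q2 : Real.exp s₁ ≤ ‖z‖ := (le_max_left _ _).trans q'
  have q'' := (le_max_right _ _).trans q'
  have q3 : r0 ≤ ‖z‖ := (le_max_left _ _).trans q''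
  have q''' := (le_max_right _ _).trans q''
  have q4 : r1 ≤ ‖z‖ := (le_max_left _ _).trans q'''
  have q5 : r2 ≤ ‖z‖ := (le_max_right _ _).trans q'''
  have hre : s₁ ≤ ζ.re := by
    rw [hz, norm_ex] at q2; exact Real.exp_le_exp.1 q2
  have hY : Real.exp (7/8 * ζ.re) = ‖z‖ ^ (7/8:ℝ) := by
    rw [hz, norm_ex, ← Real.exp_mul]; ring_nf
  have hY1 : 1 ≤ ‖z‖ ^ (7/8:ℝ) := Real.one_le_rpow q1 (by norm_num)
  set Y := ‖z‖ ^ (7/8:ℝ) with hYd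
  have hzn : 0 ≤ ‖z‖ := norm_nonneg z
  -- bounds for the multipliers
  have x1 : Real.exp (C * Y) ≤ Real.exp ((C + 1) * Y) := Real.exp_le_exp.2 (by nlinarith)
  have x2 : Real.exp (C * Y) + 1 ≤ Real.exp ((C + 1) * Y) := by
    have e : Real.exp ((C + 1) * Y) = Real.exp (C * Y) * Real.exp Y := by rw [← Real.exp_add]; ring_nf
    have a : 2 ≤ Real.exp Y := by linarith [Real.add_one_le_exp Y]
    have b : 1 ≤ Real.exp (C * Y) := Real.one_le_exp (by positivity)
    rw [e]; nlinarith
  have x0 : 1 ≤ Real.exp ((C + 1) * Y) := Real.one_le_exp (by positivity)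
  have mk : ∀ k (m : ℂ → ℂ), AnalyticAt ℂ (QQ (U k)) z → ‖QQ (U k) z‖ ≤ ‖z‖ → ContinuousAt m z →
      ‖m z‖ ≤ Real.exp ((C + 1) * Y) → (∀ᶠ w in 𝓝[≠] z, QQ (U 0) w = QQ (U k) w * m w) →
      ∃ v, Tendsto (QQ (U 0)) (𝓝[≠] z) (𝓝 v) ∧ ‖v‖ ≤ ‖z‖ * Real.exp ((C + 1) * Y) := by
    intro k m h1 h2 h3 h4 h5
    refine ⟨QQ (U k) z * m z, ?_, ?_⟩
    · refine Tendsto.congr' (EventuallyEq.symm h5) ?_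
      exact ((h1.continuousAt.mul h3).tendsto).mono_left nhdsWithin_le_nhds
    · rw [norm_mul]; exact mul_le_mul h2 h4 (norm_nonneg _) hzn
  by_cases hg : |ζ.im| ≤ Real.pi / 4 ∨ 3 * Real.pi / 4 ≤ |ζ.im|
  · have : ∃ n : ℤ, |ζ.im - Lk 0 - Real.pi * n| ≤ Real.pi / 3 - Real.pi / 12 := by
      rw [L0]
      rcases hg with hg | hg
      · exact ⟨0, by simpa using hg.trans (by linarith)⟩
      · rcases le_total 0 ζ.im with h0 | h0
        · refine ⟨1, ?_⟩
          rw [abs_of_nonneg h0] at hg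
          push_cast; rw [abs_le]; constructor <;> linarith
        · refine ⟨-1, ?_⟩
          rw [abs_of_nonpos h0] at hg
          push_cast; rw [abs_le]; constructor <;> linarith
    obtain ⟨n, hn⟩ := this
    obtain ⟨a1, a2, a3⟩ := p0 ζ n q3 hn
    refine ⟨QQ (U 0) z, a1.continuousAt.tendsto.mono_left nhdsWithin_le_nhds, ?_, fun _ => a3, fun _ => a2⟩
    exact a3.trans (le_mul_of_one_le_right hzn x0)
  · have hg1 := not_or.1 hg
    have g1 := not_le.1 hg1.1
    have g2 := not_le.1 hg1.2
    have hcase : ∃ v, Tendsto (QQ (U 0)) (𝓝[≠] z) (𝓝 v) ∧ ‖v‖ ≤ ‖z‖ * Real.exp ((C + 1) * Y) := by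
      rcases le_total 0 ζ.im with h0 | h0
      · rw [abs_of_nonneg h0] at g1 g2
        obtain ⟨c1, c2⟩ := (hb 1 ζ hre).1 (by rw [L1]; linarith) (by rw [L1]; linarith)
        rw [hY] at c2
        have cc := (h.analyticAt c1).continuousAt
        rcases le_total ζ.im (Real.pi / 2) with h1 | h1
        · obtain ⟨a1, a2, a3⟩ := p2 ζ 1 q5 (by rw [L2]; push_cast; rw [abs_le]; constructor <;> linarith)
          refine mk (-1) (fun w => -U 1 w) a1 a3 cc.neg ?_ ?_
          · rw [norm_neg]; exact c2.trans x1
          · filter_upwards [h.rel3 z] with w hw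
            rw [hw.2.1]; ring
        · obtain ⟨a1, a2, a3⟩ := p1 ζ 0 q4 (by rw [L1]; push_cast; rw [abs_le]; constructor <;> linarith)
          refine mk 1 (fun w => U 1 w - 1) a1 a3 (cc.sub continuousAt_const) ?_ ?_
          · refine (norm_sub_le _ _).trans ?_
            rw [norm_one]; linarith
          · filter_upwards [h.rel3 z] with w hw
            rw [hw.1]
      · rw [abs_of_nonpos h0] at g1 g2
        obtain ⟨c1, c2⟩ := (hb (-1) ζ hre).2 (by rw [L2]; linarith) (by rw [L2]; linarith)
        rw [hY] at c2
        have cc : ContinuousAt (fun w => (U (-1) w)⁻¹) z := (h.analyticAt_inv c1).continuousAt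
        rcases le_total (-(Real.pi / 2)) ζ.im with h1 | h1
        · obtain ⟨a1, a2, a3⟩ := p1 ζ (-1) q4 (by rw [L1]; push_cast; rw [abs_le]; constructor <;> linarith)
          refine mk 1 (fun w => -(U (-1) w)⁻¹) a1 a3 cc.neg ?_ ?_
          · rw [norm_neg]; exact c2.trans x1
          · filter_upwards [h.rel3 z] with w hw
            rw [hw.2.2.1]; ring
        · obtain ⟨a1, a2, a3⟩ := p2 ζ 0 q5 (by rw [L2]; push_cast; rw [abs_le]; constructor <;> linarith)
          refine mk (-1) (fun w => (U (-1) w)⁻¹ - 1) a1 a3 (cc.sub continuousAt_const) ?_ ?_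
          · refine (norm_sub_le _ _).trans ?_
            rw [norm_one]; linarith
          · filter_upwards [h.rel3 z] with w hw
            rw [hw.2.2.2]
    obtain ⟨v, hv1, hv2⟩ := hcase
    exact ⟨v, hv1, hv2, fun h' => absurd h' hg, fun h' => absurd (Or.inl h') hg⟩

end Tri

/-! ### Section 6 - H -/

/-- Phragmen-Lindelof in a sector for entire functions of small growth -/
lemma PL_sector {φ : ℂ → ℂ} (hφ : Differentiable ℂ φ) {C M : ℝ} (hC : 0 ≤ C) (θ : ℝ)
    (hg : ∀ z, ‖φ z‖ ≤ Real.exp (C * (1 + ‖z‖ ^ (7/8:ℝ)))) {a b : ℝ} (hab : a < b) (hba : b - a < 3)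
    (ha : ∀ ζ : ℂ, ζ.im = a → ‖φ (ex θ ζ)‖ ≤ M) (hb : ∀ ζ : ℂ, ζ.im = b → ‖φ (ex θ ζ)‖ ≤ M)
    (ζ : ℂ) (h1 : a ≤ ζ.im) (h2 : ζ.im ≤ b) : ‖φ (ex θ ζ)‖ ≤ M := by
  refine PhragmenLindelof.horizontal_strip (a := a) (b := b) (f := fun ζ => φ (ex θ ζ)) (C := M) (z := ζ) ?_ ?_ ha hb h1 h2
  · exact (hφ.comp (ex_differentiable θ)).diffContOnCl
  · refine ⟨7/8, ?_, 2 * C, ?_⟩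
    · rw [lt_div_iff₀ (by linarith)]; linarith [Real.pi_gt_three]
    · refine Asymptotics.IsBigO.of_bound 1 (Eventually.of_forall fun ζ => ?_)
      rw [one_mul, Real.norm_of_nonneg (Real.exp_pos _).le]
      refine (hg _).trans (Real.exp_le_exp.2 ?_)
      have e3 : ‖ex θ ζ‖ ^ (7/8:ℝ) = Real.exp (7/8 * ζ.re) := by
        rw [norm_ex, ← Real.exp_mul]; ring_nf
      rw [e3]
      have t1 : Real.exp (7/8 * ζ.re) ≤ Real.exp (7/8 * |ζ.re|) := 
        Real.exp_le_exp.2 (by linarith [le_abs_self ζ.re])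
      have t2 : 1 ≤ Real.exp (7/8 * |ζ.re|) := Real.one_le_exp (by positivity)
      nlinarith

namespace Tri
variable {θ : ℝ} {U : ℤ → ℂ → ℂ} {R₀ : ℝ}

theorem case1 (h : Tri θ U R₀) {s₁ : ℝ} (hs : SmallG θ U s₁)
    (hinf : ∀ k, {z | meromorphicOrderAt (U k) z ≠ 0}.Infinite) : False := by
  classical
  obtain ⟨C, hC, R, hR, hQ⟩ := h.Qlim hs hinf
  have hpi := Real.pi_pos
  have hR0 : 0 < R := by linarith
  have hex : ∀ z : ℂ, z ≠ 0 → ∃ ζ, ex θ ζ = z ∧ -Real.pi ≤ ζ.im ∧ ζ.im ≤ Real.pi := by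
    intro z hz
    obtain ⟨ζ, h1, h2, h3, -⟩ := ex_exists θ hz (-Real.pi)
    exact ⟨ζ, h1, h2.le, by linarith⟩
  have hne0 : ∀ z : ℂ, R ≤ ‖z‖ → z ≠ 0 := by
    rintro z hz rfl; simp at hz; linarith
  have hm := h.QQ_mero 0
  -- not identically zero
  have ht : ∀ z, meromorphicOrderAt (QQ (U 0)) z ≠ ⊤ := by
    intro z
    obtain ⟨v, hv, -, -, hv0⟩ := hQ (Real.log R) (by rw [norm_ex, Complex.ofReal_re, Real.exp_log hR0])
      (by simp [hpi.le]) (by simp [hpi.le])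
    have hv0 := hv0 (by simp; positivity)
    refine MeromorphicOn.meromorphicOrderAt_ne_top_of_isPreconnected (U := univ) (x := ex θ (Real.log R)) (y := z) (fun z _ => hm z)
      isPreconnected_univ (mem_univ _) (mem_univ _) ?_
    rw [meromorphicOrderAt_ne_top_iff_eventually_ne_zero (hm _)]
    exact hv.eventually_ne hv0
  have hnn : ∀ z, R ≤ ‖z‖ → 0 ≤ meromorphicOrderAt (QQ (U 0)) z := by
    intro z hz
    obtain ⟨ζ, rfl, h1, h2⟩ := hex z (hne0 z hz)
    obtain ⟨v, hv, -⟩ := hQ ζ hz h1 h2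
    exact (tendsto_nhds_iff_meromorphicOrderAt_nonneg (hm _)).1 ⟨v, hv⟩
  have hone : ∀ z, z ≠ 0 → meromorphicOrderAt (U 0) z ≠ 0 → meromorphicOrderAt (QQ (U 0)) z = 1 := by
    intro z hz ho
    have e1 : meromorphicOrderAt (logDeriv (U 0)) z = -1 :=
      meromorphicOrderAt_logDeriv_eq_neg_one (h.mero 0 z) ho (h.ne_top 0 z)
    have e2 : meromorphicOrderAt (id : ℂ → ℂ) z = 0 := by
      rw [(analyticAt_id.meromorphicNFAt).meromorphicOrderAt_eq_zero_iff]; exact hz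
    have e3 : QQ (U 0) = (id * logDeriv (U 0))⁻¹ := by ext w; simp [QQ]
    rw [e3, meromorphicOrderAt_inv, meromorphicOrderAt_mul (MeromorphicAt.id z) (h.mero 0 z).logDeriv, e1, e2]
    rfl
  set n : ℂ → ℤ := fun u => (meromorphicOrderAt (QQ (U 0)) u).untop₀ with hn
  set s := (finite_ord hm ht R).toFinset with hsd
  obtain ⟨t, ht1, ht2⟩ := ((hinf 0).sdiff (finite_ord (h.mero 0) (h.ne_top 0) R)).exists_subset_card_eq
    (∑ u ∈ s, n u).natAbs.succ.succ
  have htn : ∀ u ∈ t, R < ‖u‖ ∧ n u = 1 := by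
    intro u hu
    obtain ⟨h1, h2⟩ := ht1 hu
    have h1' : meromorphicOrderAt (U 0) u ≠ 0 := h1
    have h3 : R < ‖u‖ := by
      by_contra hc; exact h2 ⟨not_lt.1 hc, h1'⟩
    refine ⟨h3, ?_⟩
    simp only [hn]
    rw [hone u (hne0 u h3.le) h1']; rfl
  have hdisj : Disjoint s t := by
    rw [Finset.disjoint_left]
    intro u hu hu2
    rw [hsd, Set.Finite.mem_toFinset] at hu
    have : ‖u‖ ≤ R := hu.1
    linarith [(htn u hu2).1]
  have hsum : 2 ≤ ∑ u ∈ s ∪ t, n u := by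
    rw [Finset.sum_union hdisj, Finset.sum_congr rfl (fun u hu => (htn u hu).2)]
    simp only [Finset.sum_const, nsmul_eq_mul, mul_one]
    rw [ht2]; push_cast
    have := neg_abs_le (∑ u ∈ s, n u)
    omega
  obtain ⟨φ, hnf, hord0, hord, hev, -⟩ := extract hm ht (s ∪ t)
  have hφan : ∀ z, AnalyticAt ℂ φ z := by
    intro z
    rw [← (hnf z).meromorphicOrderAt_nonneg_iff_analyticAt]
    by_cases hz : z ∈ s ∪ t
    · rw [hord0 z hz]
    · rw [hord z hz]
      rcases le_total ‖z‖ R with hl | hl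
      · by_contra hc
        refine hz (Finset.mem_union_left _ ?_)
        rw [hsd, Set.Finite.mem_toFinset]
        exact ⟨hl, fun h0 => hc h0.ge⟩
      · exact hnn z hl
  have hφd : Differentiable ℂ φ := fun z => (hφan z).differentiableAt
  obtain ⟨A, hA, R', hR', hrb⟩ := rr_bound (s ∪ t) n
  have hval : ∀ ζ : ℂ, max R R' ≤ ‖ex θ ζ‖ → -Real.pi ≤ ζ.im → ζ.im ≤ Real.pi →
      ‖φ (ex θ ζ)‖ ≤ Real.exp (C * ‖ex θ ζ‖ ^ (7/8:ℝ)) * (A * ‖ex θ ζ‖ ^ (-1:ℤ)) ∧ 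
      (|ζ.im| ≤ Real.pi / 4 ∨ 3 * Real.pi / 4 ≤ |ζ.im| → ‖φ (ex θ ζ)‖ ≤ A / ‖ex θ ζ‖) := by
    intro ζ hl h1 h2
    obtain ⟨v, hv, hv1, hv2, -⟩ := hQ ζ ((le_max_left _ _).trans hl) h1 h2
    obtain ⟨hz, hrn⟩ := hrb _ ((le_max_right _ _).trans hl)
    set z := ex θ ζ
    have hz1 : 1 ≤ ‖z‖ := hR.le.trans ((le_max_left _ _).trans hl)
    have hz0 : 0 < ‖z‖ := by linarith
    have e : φ z = v * rr (s ∪ t) n z := by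
      have t1 : Tendsto φ (𝓝[≠] z) (𝓝 (φ z)) := (hφan z).continuousAt.tendsto.mono_left nhdsWithin_le_nhds
      have t2 : Tendsto φ (𝓝[≠] z) (𝓝 (v * rr (s ∪ t) n z)) := by
        refine Tendsto.congr' (EventuallyEq.symm (hev z)) ?_
        exact hv.mul ((rr_analyticAt n hz).continuousAt.tendsto.mono_left nhdsWithin_le_nhds)
      exact tendsto_nhds_unique t1 t2
    have hr2 : ‖rr (s ∪ t) n z‖ ≤ A * ‖z‖ ^ (-2:ℤ) := by
      refine hrn.trans (mul_le_mul_of_nonneg_left ?_ hA.le)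
      exact zpow_le_zpow_right₀ hz1 (by omega)
    have e2 : ‖z‖ * ‖z‖ ^ (-2:ℤ) = ‖z‖ ^ (-1:ℤ) := by
      rw [← zpow_one_add₀ hz0.ne']; norm_num
    rw [e, norm_mul]
    constructor
    · calc _ ≤ (‖z‖ * Real.exp (C * ‖z‖ ^ (7/8:ℝ))) * (A * ‖z‖ ^ (-2:ℤ)) :=
            mul_le_mul hv1 hr2 (norm_nonneg _) (by positivity)
        _ = Real.exp (C * ‖z‖ ^ (7/8:ℝ)) * (A * (‖z‖ * ‖z‖ ^ (-2:ℤ))) := by ring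
        _ = _ := by rw [e2]
    · intro hgd
      calc _ ≤ ‖z‖ * (A * ‖z‖ ^ (-2:ℤ)) := mul_le_mul (hv2 hgd) hr2 (norm_nonneg _) hz0.le
        _ = A * (‖z‖ * ‖z‖ ^ (-2:ℤ)) := by ring
        _ = _ := by rw [e2, zpow_neg_one]; rfl
  obtain ⟨C', hC', hgr⟩ := growth_aux (S := univ) isClosed_univ (φ := φ) (fun z _ => (hφan z).continuousAt)
    (C₁ := C) (C₂ := A) (R := max R R') (-1) (hR.le.trans (le_max_left _ _)) (by
      intro z _ hz
      obtain ⟨ζ, rfl, h1, h2⟩ := hex z (hne0 z ((le_max_left _ _).trans hz))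
      exact (hval ζ hz h1 h2).1)
  have hgr' := fun z => hgr z (mem_univ z)
  obtain ⟨M, hM⟩ := (isCompact_closedBall (0:ℂ) (max R R')).exists_bound_of_continuousOn (f := φ)
    hφd.continuous.continuousOn
  have hgood : ∀ ζ : ℂ, -Real.pi ≤ ζ.im → ζ.im ≤ Real.pi →
      (|ζ.im| ≤ Real.pi / 4 ∨ 3 * Real.pi / 4 ≤ |ζ.im|) → ‖φ (ex θ ζ)‖ ≤ max M A := by
    intro ζ h1 h2 h3
    rcases le_total ‖ex θ ζ‖ (max R R') with hl | hl
    · exact (hM _ (by simpa using hl)).trans (le_max_left _ _)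
    · refine ((hval ζ hl h1 h2).2 h3).trans ((div_le_self hA.le ?_).trans (le_max_right _ _))
      exact hR.le.trans ((le_max_left _ _).trans hl)
  have hbd : ∀ z, ‖φ z‖ ≤ max M A := by
    intro z
    by_cases hz : z = 0
    · rw [hz]
      exact (hM _ (by simp; left; exact hR0.le)).trans (le_max_left _ _)
    obtain ⟨ζ, rfl, h1, h2⟩ := hex z hz
    by_cases hg : |ζ.im| ≤ Real.pi / 4 ∨ 3 * Real.pi / 4 ≤ |ζ.im|
    · exact hgood ζ h1 h2 hg
    have hg1 := not_or.1 hg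
    have g1 := not_le.1 hg1.1
    have g2 := not_le.1 hg1.2
    rcases le_total 0 ζ.im with h0 | h0
    · rw [abs_of_nonneg h0] at g1 g2
      refine PL_sector hφd hC' θ hgr' (a := Real.pi / 4) (b := 3 * Real.pi / 4) (by linarith)
        (by linarith [Real.pi_lt_four]) ?_ ?_ ζ g1.le g2.le
      · intro ξ hξ
        refine hgood ξ (by linarith) (by linarith) (Or.inl ?_)
        rw [hξ, abs_of_pos (by positivity)]
      · intro ξ hξ
        refine hgood ξ (by linarith) (by linarith) (Or.inr ?_)
        rw [hξ, abs_of_pos (by positivity)]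
    · rw [abs_of_nonpos h0] at g1 g2
      refine PL_sector hφd hC' θ hgr' (a := -(3 * Real.pi / 4)) (b := -(Real.pi / 4)) (by linarith)
        (by linarith [Real.pi_lt_four]) ?_ ?_ ζ (by linarith) (by linarith)
      · intro ξ hξ
        refine hgood ξ (by linarith) (by linarith) (Or.inr ?_)
        rw [hξ, abs_neg, abs_of_pos (by positivity)]
      · intro ξ hξ
        refine hgood ξ (by linarith) (by linarith) (Or.inl ?_)
        rw [hξ, abs_neg, abs_of_pos (by positivity)]
  have hcon : ∀ z w, φ z = φ w := by
    refine fun z w => hφd.apply_eq_apply_of_bounded ?_ z w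
    rw [isBounded_iff_forall_norm_le]
    exact ⟨max M A, by rintro _ ⟨z, rfl⟩; exact hbd z⟩
  have hzero : ‖φ 0‖ ≤ 0 := by
    have hlim : Tendsto (fun x : ℝ => A / x) atTop (𝓝 0) := tendsto_const_nhds.div_atTop tendsto_id
    refine ge_of_tendsto hlim ?_
    filter_upwards [eventually_ge_atTop (max R R')] with x hx
    have hx0 : 0 < x := lt_of_lt_of_le hR0 ((le_max_left _ _).trans hx)
    have hn : ‖ex θ (Real.log x)‖ = x := by rw [norm_ex, Complex.ofReal_re, Real.exp_log hx0]
    have := (hval (Real.log x) (by rw [hn]; exact hx) (by simp [hpi.le]) (by simp [hpi.le])).2 (by left; simp; positivity)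
    rw [hn] at this
    rw [hcon 0 (ex θ (Real.log x))]; exact this
  have hφ0 : φ = 0 := by
    ext z; rw [hcon z 0]; simpa using hzero
  have htne : t.Nonempty := by rw [← Finset.card_pos, ht2]; omega
  obtain ⟨u, hu⟩ := htne
  have h0 := hord0 u (Finset.mem_union_right _ hu)
  rw [(hnf u).meromorphicOrderAt_eq_zero_iff] at h0
  exact h0 (by rw [hφ0]; rfl)

end Tri

/-! ### Section 6 - I -/

lemma entire_const_of_re {g : ℂ → ℂ} (hg : Differentiable ℂ g) {C : ℝ} (hC : 0 ≤ C)
    (hb : ∀ z, (g z).re ≤ C * (1 + ‖z‖ ^ (7/8:ℝ))) (z : ℂ) : g z = g 0 := by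
  set a : ℝ := C + ‖g 0‖ + 1 with ha
  have ha0 : 0 < a := by positivity
  have key : ∀ᶠ R : ℝ in atTop, ‖g z - g 0‖ ≤ 4 * ‖z‖ * (a * R⁻¹ + C * R ^ (-(1/8):ℝ)) := by
    filter_upwards [eventually_gt_atTop 0, eventually_ge_atTop (2 * ‖z‖), eventually_gt_atTop ‖z‖]
      with R hR hR2 hR3
    have hM : 0 < a + C * R ^ (7/8:ℝ) := by positivity
    have := Complex.borelCaratheodory_zero (f := fun w => g w - g 0) (M := a + C * R ^ (7/8:ℝ))
      (R := R) (z := z) hM (hg.sub_const _).differentiableOn (by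
        intro w hw
        have hw' : ‖w‖ ≤ R := by simpa using (Metric.ball_subset_closedBall hw)
        have h1 := hb w
        have h2 : ‖w‖ ^ (7/8:ℝ) ≤ R ^ (7/8:ℝ) := Real.rpow_le_rpow (norm_nonneg _) hw' (by norm_num)
        have h3 := Complex.abs_re_le_norm (g 0)
        have h4 := neg_abs_le (g 0).re
        have h5 := mul_le_mul_of_nonneg_left h2 hC
        show (g w - g 0).re ≤ _
        rw [sub_re]; nlinarith) hR (by simpa using hR3) (by simp)
    refine this.trans ?_
    have e : R ^ (7/8:ℝ) = R * R ^ (-(1/8):ℝ) := by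
      rw [← Real.rpow_one_add' hR.le (by norm_num)]; norm_num
    rw [e]
    have h6 : (R - ‖z‖)⁻¹ ≤ 2 * R⁻¹ := by
      rw [← div_eq_mul_inv, inv_eq_one_div, div_le_div_iff₀ (by linarith) hR]; linarith
    have h7 : 0 ≤ 2 * (a + C * (R * R ^ (-(1/8):ℝ))) * ‖z‖ := by positivity
    rw [div_eq_mul_inv]
    refine (mul_le_mul_of_nonneg_left h6 h7).trans (le_of_eq ?_)
    field_simp
    ring
  have lim : Tendsto (fun R : ℝ => 4 * ‖z‖ * (a * R⁻¹ + C * R ^ (-(1/8):ℝ))) atTop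
      (𝓝 (4 * ‖z‖ * (a * 0 + C * 0))) :=
    ((tendsto_inv_atTop_zero.const_mul a).add
      ((tendsto_rpow_neg_atTop (by norm_num : (0:ℝ) < 1/8)).const_mul C)).const_mul _
  have := ge_of_tendsto lim key
  simp at this
  exact sub_eq_zero.1 this

/-- upper bound across a ray by Borel–Carathéodory in logarithmic coordinates -/
lemma bc_step {G : ℂ → ℂ} (hG : Differentiable ℂ G) {A s₁ b : ℝ} (hA : 0 < A)
    (hlow : ∀ ζ, s₁ ≤ ζ.re → b - 2 * Real.pi / 3 + 1/2 ≤ ζ.im → ζ.im ≤ b + 4 * Real.pi / 3 - 1/2 →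
      -(G ζ).re ≤ A * Real.exp (7/8 * ζ.re))
    (hup : ∀ ζ, s₁ ≤ ζ.re → b + 1/2 ≤ ζ.im → ζ.im ≤ b + 2 * Real.pi - 1/2 →
      (G ζ).re ≤ A * Real.exp (7/8 * ζ.re)) :
    ∀ ζ, s₁ + 2 ≤ ζ.re → |ζ.im - b| ≤ 1/2 → (G ζ).re ≤ 1000 * A * Real.exp (7/8 * ζ.re) := by
  intro ζ hs hi
  have hp1 := Real.pi_gt_d2
  have hp2 := Real.pi_lt_d2
  rw [abs_le] at hi
  set c : ℂ := ζ.re + (b + 1 : ℝ) * I with hc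
  have hcre : c.re = ζ.re := by simp [hc]
  have hcim : c.im = b + 1 := by simp [hc]
  set E := Real.exp (7/8 * ζ.re) with hE
  have hE0 : 0 < E := Real.exp_pos _
  have e7 : Real.exp (7/4) ≤ 10 := by
    have h1 : Real.exp (7/4) ≤ Real.exp 2 := Real.exp_le_exp.2 (by norm_num)
    have h2 : Real.exp 2 = Real.exp 1 * Real.exp 1 := by rw [← Real.exp_add]; norm_num
    have := Real.exp_one_lt_d9
    nlinarith [Real.exp_pos 1]
  have hupc : (G c).re ≤ A * E := by
    have := hup c (by rw [hcre]; linarith) (by rw [hcim]; linarith) (by rw [hcim]; linarith)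
    rwa [hcre] at this
  have hM : 0 < 11 * A * E := by positivity
  have hz : ‖ζ - c‖ ≤ 3/2 := by
    have : ζ - c = ((ζ.im - (b + 1) : ℝ) : ℂ) * I := by
      apply Complex.ext <;> simp [hc]
    rw [this, norm_mul, Complex.norm_I, mul_one, Complex.norm_real, Real.norm_eq_abs, abs_le]
    constructor <;> linarith
  have bc := Complex.borelCaratheodory_zero (f := fun w => G c - G (c + w)) (M := 11 * A * E)
      (R := 1.55) (z := ζ - c) hM ((differentiable_const _).sub (hG.comp (by fun_prop))).differentiableOn (by
        intro w hw
        have hw' : ‖w‖ ≤ 1.55 := by simpa using (Metric.ball_subset_closedBall hw)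
        have h1 := abs_le.1 ((Complex.abs_re_le_norm w).trans hw')
        have h2 := abs_le.1 ((Complex.abs_im_le_norm w).trans hw')
        have h3 := hlow (c + w) (by rw [add_re, hcre]; linarith) (by rw [add_im, hcim]; linarith)
          (by rw [add_im, hcim]; linarith)
        have h4 : Real.exp (7/8 * (c + w).re) ≤ 10 * E := by
          calc _ ≤ Real.exp (7/4 + 7/8 * ζ.re) := Real.exp_le_exp.2 (by rw [add_re, hcre]; linarith)
            _ = Real.exp (7/4) * E := Real.exp_add _ _
            _ ≤ _ := mul_le_mul_of_nonneg_right e7 hE0.le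
        show (G c - G (c + w)).re ≤ _
        rw [sub_re]
        nlinarith [mul_le_mul_of_nonneg_left h4 hA.le]) (by norm_num)
      (by simp only [Metric.mem_ball, dist_zero_right]; linarith) (by simp)
  simp only [add_sub_cancel] at bc
  have h5 : 2 * (11 * A * E) * ‖ζ - c‖ / (1.55 - ‖ζ - c‖) ≤ 999 * A * E := by
    rw [div_le_iff₀ (by linarith)]
    nlinarith [mul_pos hA hE0]
  have h6 := (Complex.abs_re_le_norm _).trans (bc.trans h5)
  have h7 := (abs_le.1 h6).1
  rw [sub_re] at h7
  nlinarith [mul_pos hA hE0]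

lemma log_bound_aux {A C₂ x : ℝ} (N : ℤ) (hx : 1 ≤ x) {a b : ℝ} (hb0 : 0 ≤ b) (ha : a ≤ Real.exp (A * x ^ (7/8:ℝ)))
    (hb : b ≤ C₂ * x ^ N) :
    a * b ≤ Real.exp ((|A| + |C₂| + 2 * |(N:ℝ)| + 1) * x ^ (7/8:ℝ)) := by
  have hx1 : 1 ≤ x ^ (7/8:ℝ) := Real.one_le_rpow hx (by norm_num)
  have h1 := pow_absorb N hx
  have hle : C₂ ≤ Real.exp |C₂| := (le_abs_self C₂).trans
    ((by linarith : |C₂| ≤ |C₂| + 1).trans (Real.add_one_le_exp _))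
  have hN : 0 ≤ x ^ N := by positivity
  calc a * b ≤ Real.exp (A * x ^ (7/8:ℝ)) * (Real.exp |C₂| * Real.exp (2 * |(N:ℝ)| * x ^ (7/8:ℝ))) := by
        refine mul_le_mul ha (hb.trans ?_) hb0 (Real.exp_pos _).le
        exact mul_le_mul hle h1 hN (Real.exp_pos _).le
    _ ≤ _ := by
      rw [← Real.exp_add, ← Real.exp_add]
      apply Real.exp_le_exp.2
      nlinarith [le_abs_self A, abs_nonneg C₂, abs_nonneg A]

lemma Tri.case2 {θ : ℝ} {U : ℤ → ℂ → ℂ} {R₀ s₁ : ℝ} (h : Tri θ U R₀) (hs : SmallG θ U s₁) (k : ℤ)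
    (hfin : {z | meromorphicOrderAt (U k) z ≠ 0}.Finite) :
    ∃ (s : Finset ℂ) (n : ℂ → ℤ) (c : ℂ), c ≠ 0 ∧ ∀ z, ∀ᶠ w in 𝓝[≠] z, U k w = c * rr s n w := by
  set s := hfin.toFinset with hsd
  obtain ⟨φ, nf, o1, o2, e1, e2⟩ := extract (fun z => h.mero k z) (fun z => h.ne_top k z) s
  set n := fun u => (meromorphicOrderAt (U k) u).untop₀ with hn
  have o : ∀ z, meromorphicOrderAt φ z = 0 := by
    intro z
    by_cases hz : z ∈ s
    · exact o1 z hz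
    · rw [o2 z hz]; by_contra hc; exact hz (hfin.mem_toFinset.2 hc)
  have han : ∀ z, AnalyticAt ℂ φ z := fun z =>
    (nf z).meromorphicOrderAt_nonneg_iff_analyticAt.1 (o z).ge
  have hne : ∀ z, φ z ≠ 0 := fun z => (nf z).meromorphicOrderAt_eq_zero_iff.1 (o z)
  obtain ⟨g, hg, hge⟩ := exists_log_convex isOpen_univ convex_univ ⟨0, mem_univ 0⟩
    (fun z _ => (han z).differentiableAt.differentiableWithinAt) (fun z _ => hne z)
  have hg : Differentiable ℂ g := differentiableOn_univ.1 hg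
  have hge : ∀ z, cexp (g z) = φ z := fun z => hge z (mem_univ z)
  obtain ⟨C2, hC2, R2, hR2, b2⟩ := rr_bound s n
  obtain ⟨C3, hC3, R3, hR3, b3⟩ := rr_bound s (fun u => -n u)
  obtain ⟨C, hC, hb⟩ := hs.2 (1/2) (by norm_num)
  set N := -∑ u ∈ s, n u
  set N' := -∑ u ∈ s, -n u
  set A := (|C| + |C2| + 2 * |(N:ℝ)| + 1) + (|C| + |C3| + 2 * |(N':ℝ)| + 1) with hA
  have hA1 : 0 ≤ |C| + |C2| + 2 * |(N:ℝ)| + 1 := by positivity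
  have hA2 : 0 ≤ |C| + |C3| + 2 * |(N':ℝ)| + 1 := by positivity
  set s₂ := max s₁ (max (Real.log R2) (Real.log R3))
  have hs2 : 0 ≤ s₂ := hs.1.trans (le_max_left _ _)
  have hnorm : ∀ ζ : ℂ, Real.exp (7/8 * ζ.re) = ‖ex θ ζ‖ ^ (7/8:ℝ) := by
    intro ζ
    rw [norm_ex, ← Real.exp_mul]; ring_nf
  have hz1 : ∀ ζ : ℂ, s₂ ≤ ζ.re → 1 ≤ ‖ex θ ζ‖ ∧ R2 ≤ ‖ex θ ζ‖ ∧ R3 ≤ ‖ex θ ζ‖ := by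
    intro ζ hζ
    rw [norm_ex]
    refine ⟨Real.one_le_exp (hs2.trans hζ), ?_, ?_⟩
    · exact (Real.log_le_iff_le_exp (by linarith)).1 (((le_max_left _ _).trans (le_max_right _ _)).trans hζ)
    · exact (Real.log_le_iff_le_exp (by linarith)).1 (((le_max_right _ _).trans (le_max_right _ _)).trans hζ)
  have hφ : ∀ z ∉ s, φ z = U k z * rr s n z := fun z hz => (e2 z hz (h.nf k z)).self_of_nhds
  have hinv : ∀ z, (rr s n z)⁻¹ = rr s (fun u => -n u) z := fun z => by
    simp [rr, ← Finset.prod_inv_distrib, zpow_neg]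
  have hnre : ∀ z, ‖φ z‖ = Real.exp (g z).re := fun z => by rw [← hge, Complex.norm_exp]
  have up : ∀ ζ : ℂ, s₂ ≤ ζ.re → Lk k - 2 * Real.pi / 3 + 1/2 ≤ ζ.im → ζ.im ≤ Lk k + 4 * Real.pi / 3 - 1/2 →
      (g (ex θ ζ)).re ≤ A * Real.exp (7/8 * ζ.re) := by
    intro ζ hζ i1 i2
    obtain ⟨z1, z2, z3⟩ := hz1 ζ hζ
    have q := ((hb k ζ ((le_max_left _ _).trans hζ)).1 i1 i2).2
    rw [hnorm] at q ⊢
    have := log_bound_aux _ z1 (norm_nonneg _) q (b2 _ z2).2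
    rw [← norm_mul, ← hφ _ (b2 _ z2).1, hnre, Real.exp_le_exp] at this
    refine this.trans (mul_le_mul_of_nonneg_right (by linarith) (by positivity))
  have low : ∀ ζ : ℂ, s₂ ≤ ζ.re → Lk k - 4 * Real.pi / 3 + 1/2 ≤ ζ.im → ζ.im ≤ Lk k + 2 * Real.pi / 3 - 1/2 →
      -(g (ex θ ζ)).re ≤ A * Real.exp (7/8 * ζ.re) := by
    intro ζ hζ i1 i2
    obtain ⟨z1, z2, z3⟩ := hz1 ζ hζ
    have q := ((hb k ζ ((le_max_left _ _).trans hζ)).2 i1 i2).2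
    rw [hnorm] at q ⊢
    have := log_bound_aux _ z1 (norm_nonneg _) q (b3 _ z3).2
    rw [← norm_mul, ← hinv, ← mul_inv, ← hφ _ (b2 _ z2).1, norm_inv, hnre, ← Real.exp_neg, Real.exp_le_exp] at this
    refine this.trans (mul_le_mul_of_nonneg_right (by linarith) (by positivity))
  have hp := Real.pi_gt_three
  have st := bc_step (G := fun ζ => g (ex θ ζ)) (hg.comp (ex_differentiable θ)) (A := A) (s₁ := s₂)
    (b := Lk k - 2 * Real.pi / 3) (by positivity)
    (fun ζ h1 h2 h3 => low ζ h1 (by linarith) (by linarith))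
    (fun ζ h1 h2 h3 => up ζ h1 (by linarith) (by linarith))
  have big : ∀ z, Real.exp (s₂ + 2) ≤ ‖z‖ → (g z).re ≤ 1000 * A * ‖z‖ ^ (7/8:ℝ) := by
    intro z hz
    have hz0 : z ≠ 0 := by rintro rfl; simp at hz; exact absurd hz (not_le.2 (Real.exp_pos _))
    obtain ⟨ζ, hζ, i1, i2, hre⟩ := ex_exists θ hz0 (Lk k - 2 * Real.pi / 3 - 1/2)
    have hre' : s₂ + 2 ≤ ζ.re := by rw [hre]; exact (Real.le_log_iff_exp_le (norm_pos_iff.2 hz0)).2 hz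
    rw [← hζ, ← hnorm]
    rcases le_total ζ.im (Lk k - 2 * Real.pi / 3 + 1/2) with hi | hi
    · exact st ζ hre' (abs_le.2 ⟨by linarith, by linarith⟩)
    · refine (up ζ (by linarith) hi (by linarith)).trans ?_
      have : 0 ≤ A * Real.exp (7/8 * ζ.re) := by positivity
      nlinarith
  obtain ⟨D, hD, hgD⟩ := growth_aux (S := univ) isClosed_univ (φ := φ) (fun z _ => (han z).continuousAt)
    (C₁ := 1000 * A) (C₂ := 1) (R := Real.exp (s₂ + 2)) 0 (Real.one_le_exp (by linarith)) (by
      intro z _ hz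
      rw [hnre]; simpa using big z hz)
  have hc := entire_const_of_re hg hD (fun z => by
    have := hgD z (mem_univ z)
    rwa [hnre, Real.exp_le_exp] at this)
  refine ⟨s, fun u => -n u, φ 0, hne 0, fun z => ?_⟩
  have hns : ∀ᶠ w in 𝓝[≠] z, w ∉ s := by
    have hcl : IsClosed ((s : Set ℂ) \ {z}) := (s.finite_toSet.subset sdiff_subset).isClosed
    have := hcl.isOpen_compl.mem_nhds (show z ∈ ((s : Set ℂ) \ {z})ᶜ by simp)
    filter_upwards [mem_nhdsWithin_of_mem_nhds this, self_mem_nhdsWithin] with w hw hwz hws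
    exact hw ⟨hws, hwz⟩
  filter_upwards [hns] with w hw
  have h1 : φ w = φ 0 := by rw [← hge, ← hge, hc]
  rw [← h1, hφ w hw, ← hinv, mul_inv_cancel_right₀ (rr_ne_zero n hw)]

lemma lin_form (a : Option ℂ) : ∃ a1 a0 : ℂ, (∀ x, lin a x = a1 * x + a0) ∧
    (a = none ∧ a1 = 0 ∧ a0 = 1 ∨ a = some (-a0) ∧ a1 = 1) := by
  cases a with
  | none => exact ⟨0, 1, fun x => by simp [lin], Or.inl ⟨rfl, rfl, rfl⟩⟩
  | some a => exact ⟨1, -a, fun x => by simp [lin]; ring, Or.inr ⟨by simp, rfl⟩⟩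

lemma rational_of_rr {f : ℂ → ℂ} {P : Set ℂ} (hf : MeromOn f P univ) {a b : Option ℂ} (hab : a ≠ b)
    {c c' : ℂ} (hc : c ≠ 0) (hc' : c' ≠ 0) (s : Finset ℂ) (n : ℂ → ℤ)
    (h : ∀ z, ∀ᶠ w in 𝓝[≠] z, c * lin a (f w) / lin b (f w) = c' * rr s n w) : IsRationalFn f P := by
  obtain ⟨a1, a0, ea, ha⟩ := lin_form a
  obtain ⟨b1, b0, eb, hb⟩ := lin_form b
  have hdet : a1 * b0 - a0 * b1 ≠ 0 := by
    rcases ha with ⟨ha, h1, h2⟩ | ⟨ha, h1⟩ <;> rcases hb with ⟨hb, h3, h4⟩ | ⟨hb, h3⟩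
    · exact absurd (ha.trans hb.symm) hab
    · simp [h1, h2, h3]
    · simp [h1, h3, h4]
    · rw [h1, h3]; intro h0; apply hab; rw [ha, hb]
      have : b0 = a0 := by linear_combination h0
      rw [this]
  set p : Polynomial ℂ := ∏ u ∈ s, (Polynomial.X - Polynomial.C u) ^ (-n u).toNat with hp
  set q : Polynomial ℂ := ∏ u ∈ s, (Polynomial.X - Polynomial.C u) ^ (n u).toNat with hq
  have hpe : ∀ w, p.eval w = ∏ u ∈ s, (w - u) ^ (-n u).toNat := fun w => by
    rw [hp, Polynomial.eval_prod]; simp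
  have hqe : ∀ w, q.eval w = ∏ u ∈ s, (w - u) ^ (n u).toNat := fun w => by
    rw [hq, Polynomial.eval_prod]; simp
  have hns : ∀ z : ℂ, ∀ᶠ w in 𝓝[≠] z, w ∉ s := by
    intro z
    have hcl : IsClosed ((s : Set ℂ) \ {z}) := (s.finite_toSet.subset sdiff_subset).isClosed
    have := hcl.isOpen_compl.mem_nhds (show z ∈ ((s : Set ℂ) \ {z})ᶜ by simp)
    filter_upwards [mem_nhdsWithin_of_mem_nhds this, self_mem_nhdsWithin] with w hw hwz hws
    exact hw ⟨hws, hwz⟩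
  have hq0 : ∀ w ∉ s, q.eval w ≠ 0 := by
    intro w hw
    rw [hqe]
    exact Finset.prod_ne_zero_iff.2 fun u hu => pow_ne_zero _ (sub_ne_zero.2 (by rintro rfl; exact hw hu))
  have hp0 : ∀ w ∉ s, p.eval w ≠ 0 := by
    intro w hw
    rw [hpe]
    exact Finset.prod_ne_zero_iff.2 fun u hu => pow_ne_zero _ (sub_ne_zero.2 (by rintro rfl; exact hw hu))
  have hr : ∀ w ∉ s, rr s n w * q.eval w = p.eval w := by
    intro w hw
    rw [hpe, hqe, rr, ← Finset.prod_mul_distrib]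
    refine Finset.prod_congr rfl fun u hu => ?_
    have hne : w - u ≠ 0 := sub_ne_zero.2 (by rintro rfl; exact hw hu)
    rw [← zpow_natCast, ← zpow_natCast, ← zpow_add₀ hne]
    congr 1
    omega
  have h2 : ∀ z, ∀ᶠ w in 𝓝[≠] z, w ∉ s ∧ f w * (c * a1 * q.eval w - c' * b1 * p.eval w) =
      c' * b0 * p.eval w - c * a0 * q.eval w := by
    intro z
    filter_upwards [hns z, h z] with w hw he
    refine ⟨hw, ?_⟩
    have hb0 : lin b (f w) ≠ 0 := by
      intro h0
      rw [h0, div_zero] at he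
      exact mul_ne_zero hc' (rr_ne_zero n hw) he.symm
    rw [div_eq_iff hb0, ea, eb] at he
    linear_combination q.eval w * he + c' * (b1 * f w + b0) * hr w hw
  refine ⟨Polynomial.C (c' * b0) * p - Polynomial.C (c * a0) * q,
    Polynomial.C (c * a1) * q - Polynomial.C (c' * b1) * p, ?_, ?_⟩
  · intro h0
    obtain ⟨w, hw, he⟩ := (h2 0).exists
    have h1 : c * a1 * q.eval w - c' * b1 * p.eval w = 0 := by
      have := congrArg (Polynomial.eval w) h0
      simpa using this
    rw [h1, mul_zero] at he
    have hq1 := hq0 w hw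
    have hp1 := hp0 w hw
    have : c * q.eval w * (a1 * b0 - a0 * b1) = 0 := by
      linear_combination b0 * h1 - b1 * he
    exact (mul_ne_zero (mul_ne_zero hc hq1) hdet) this
  · intro z hz hqz
    rw [eq_div_iff hqz]
    have hcf : ContinuousAt f z := (hf.analyticAt hz).continuousAt
    have t1 : Tendsto (fun w => f w * (c * a1 * q.eval w - c' * b1 * p.eval w) - (c' * b0 * p.eval w - c * a0 * q.eval w))
        (𝓝[≠] z) (𝓝 (f z * (c * a1 * q.eval z - c' * b1 * p.eval z) - (c' * b0 * p.eval z - c * a0 * q.eval z))) := by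
      refine Tendsto.mono_left (ContinuousAt.tendsto (f := fun w => f w * (c * a1 * q.eval w - c' * b1 * p.eval w) - (c' * b0 * p.eval w - c * a0 * q.eval w)) ?_) nhdsWithin_le_nhds
      have := q.continuous
      have := p.continuous
      fun_prop
    have t2 : Tendsto (fun w => f w * (c * a1 * q.eval w - c' * b1 * p.eval w) - (c' * b0 * p.eval w - c * a0 * q.eval w))
        (𝓝[≠] z) (𝓝 0) := by
      refine tendsto_const_nhds.congr' ?_
      filter_upwards [h2 z] with w hw
      rw [hw.2, sub_self]
    have := tendsto_nhds_unique t1 t2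
    simp
    linear_combination this

theorem no_small {θ : ℝ} {f : ℂ → ℂ} {P : Set ℂ} (hf : MeromOn f P univ) (ht : ¬ IsRationalFn f P)
    {U : ℤ → ℂ → ℂ} {R₀ : ℝ} (h : Tri θ U R₀)
    (hU : ∀ k, ∃ a b : Option ℂ, ∃ c, c ≠ 0 ∧ a ≠ b ∧ ∀ z, ∀ᶠ w in 𝓝[≠] z, U k w = c * lin a (f w) / lin b (f w))
    {V : ℤ → ℂ → ℂ} (hL : LogData V (Real.log R₀))
    (hV : ∀ k, ∀ ζ ∈ Dk (Real.log R₀) k, cexp (V k ζ) = U k (ex θ ζ))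
    (hg : ∃ C, ∀ s ≥ Real.log R₀ + 3, mm V s ≤ C * Real.exp (7/8 * s)) : False := by
  have hs := h.smallG hL hV hg
  by_cases hinf : ∀ k, {z | meromorphicOrderAt (U k) z ≠ 0}.Infinite
  · exact h.case1 hs hinf
  · push Not at hinf
    obtain ⟨k, hk⟩ := hinf
    obtain ⟨s, n, c', hc', he⟩ := h.case2 hs k hk
    obtain ⟨a, b, c, hc, hab, hab'⟩ := hU k
    apply ht
    refine rational_of_rr hf hab hc hc' s n fun z => ?_
    filter_upwards [he z, hab' z] with w h1 h2
    rw [← h2, h1]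

/-! ### Section 7 - A -/

open MeasureTheory ValueDistribution in
lemma mProx_eq (f : ℂ → ℂ) (r : ℝ) : mProx f r = proximity f ⊤ r := by
  rw [proximity_top, Real.circleAverage, mProx, smul_eq_mul]
  congr 1
  refine intervalIntegral.integral_congr fun t _ => ?_
  simp only [circleMap, zero_add]
  rw [Real.posLog_eq_log_max_one (norm_nonneg _)]

lemma ind_integral {a r : ℝ} (ha : 0 < a) (har : a ≤ r) :
    IntervalIntegrable (fun t : ℝ => (Ici a).indicator (fun t => t⁻¹) t) MeasureTheory.volume 0 r ∧
    ∫ t in (0:ℝ)..r, (Ici a).indicator (fun t => t⁻¹) t = Real.log (r * a⁻¹) := by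
  have hr : 0 < r := ha.trans_le har
  have e : Ioc 0 r ∩ Ici a = Icc a r := by
    ext t; simp only [mem_inter_iff, mem_Ioc, mem_Ici, mem_Icc]
    constructor
    · rintro ⟨⟨_, h⟩, h'⟩; exact ⟨h', h⟩
    · rintro ⟨h, h'⟩; exact ⟨⟨ha.trans_le h, h'⟩, h⟩
  have hIntg : MeasureTheory.IntegrableOn (fun t : ℝ => t⁻¹) (Icc a r) :=
    (continuousOn_inv₀.mono fun t ht => (ha.trans_le ht.1).ne').integrableOn_Icc
  constructor
  · rw [intervalIntegrable_iff_integrableOn_Ioc_of_le hr.le, MeasureTheory.IntegrableOn,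
      MeasureTheory.integrable_indicator_iff measurableSet_Ici, MeasureTheory.IntegrableOn,
      MeasureTheory.Measure.restrict_restrict measurableSet_Ici, inter_comm, e]
    exact hIntg
  · rw [intervalIntegral.integral_of_le hr.le, MeasureTheory.setIntegral_indicator measurableSet_Ici, e,
      MeasureTheory.integral_Icc_eq_integral_Ioc, ← intervalIntegral.integral_of_le har,
      integral_inv_of_pos ha hr, div_eq_mul_inv]

lemma poleOrder_eq {f : ℂ → ℂ} {P : Set ℂ} (hf : MeromOn f P univ) {z : ℂ} (hz : z ∈ P) :
    meromorphicOrderAt f z = ((-(poleOrder f z : ℤ) : ℤ) : WithTop ℤ) := by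
  have h0 := hf.order_neg hz
  have hm := hf.meromorphicAt z
  obtain ⟨n, hn⟩ := WithTop.ne_top_iff_exists.1 (ne_top_of_lt h0)
  have hn0 : n < 0 := by rw [← hn] at h0; exact_mod_cast h0
  have key : ∀ m : ℕ, (∃ h : ℂ → ℂ, AnalyticAt ℂ h z ∧ h z ≠ 0 ∧
    ∀ᶠ w in 𝓝[≠] z, f w = h w / (w - z) ^ m) ↔ meromorphicOrderAt f z = ((-(m:ℤ) : ℤ) : WithTop ℤ) := by
    intro m
    rw [meromorphicOrderAt_eq_int_iff hm]
    refine exists_congr fun h => and_congr_right fun _ => and_congr_right fun _ => ?_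
    refine eventually_congr (Eventually.of_forall fun w => ?_)
    rw [zpow_neg, zpow_natCast, smul_eq_mul, div_eq_inv_mul]
  have hs : {m : ℕ | ∃ h : ℂ → ℂ, AnalyticAt ℂ h z ∧ h z ≠ 0 ∧
    ∀ᶠ w in 𝓝[≠] z, f w = h w / (w - z) ^ m}.Nonempty := by
    refine ⟨n.natAbs, ?_⟩
    rw [mem_ofPred_eq, key, ← hn]
    congr 1; omega
  have := Nat.sInf_mem hs
  rw [mem_ofPred_eq, key] at this
  exact this

open MeromorphicOn Classical in
lemma negdiv_apply {f : ℂ → ℂ} {P : Set ℂ} (hf : MeromOn f P univ) (z : ℂ) :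
    ((divisor f univ)⁻ z : ℤ) = if z ∈ P then (poleOrder f z : ℤ) else 0 := by
  have hm : MeromorphicOn f univ := fun w _ => hf.meromorphicAt w
  rw [Function.locallyFinsuppWithin.negPart_apply, divisor_apply hm (mem_univ z)]
  split_ifs with h
  · rw [poleOrder_eq hf h, WithTop.untop₀_coe]
    simp
  · have : 0 ≤ meromorphicOrderAt f z := (hf.analyticAt h).meromorphicOrderAt_nonneg
    rw [negPart_eq_zero]
    exact WithTop.untop₀_nonneg.2 this


lemma finite_poles {f : ℂ → ℂ} {P : Set ℂ} (hf : MeromOn f P univ) (r : ℝ) :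
    {z | ‖z‖ ≤ r ∧ z ∈ P}.Finite := by
  have hm : MeromorphicOn f (Metric.closedBall 0 r) := fun z _ => hf.meromorphicAt z
  refine ((MeromorphicOn.divisor f (Metric.closedBall 0 r)).finiteSupport (isCompact_closedBall 0 r)).subset ?_
  rintro z ⟨hz, ho⟩
  have h0 := hf.order_neg ho
  rw [Function.mem_support, MeromorphicOn.divisor_apply hm (by simpa using hz)]
  intro h
  rw [WithTop.untop₀_eq_zero] at h
  rcases h with h | h
  · exact h0.ne h
  · exact (ne_top_of_lt h0) h

open MeromorphicOn Classical in
lemma NPoles_eq {f : ℂ → ℂ} {P : Set ℂ} (hf : MeromOn f P univ) {r : ℝ} (hr : 0 < r) :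
    NPoles f P r = ValueDistribution.logCounting f ⊤ r := by
  set S := (finite_poles hf r).toFinset with hS
  have hmem : ∀ z, z ∈ S ↔ ‖z‖ ≤ r ∧ z ∈ P := fun z => (finite_poles hf r).mem_toFinset
  have hn : ∀ t ≤ r, nPoles f P t = ∑ z ∈ S, if ‖z‖ ≤ t then (poleOrder f z : ℝ) else 0 := by
    intro t ht
    rw [← Finset.sum_filter, nPoles]
    have : {z : ℂ | ‖z‖ ≤ t ∧ z ∈ P} = ((S.filter (fun z => ‖z‖ ≤ t) : Finset ℂ) : Set ℂ) := by
      ext z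
      simp only [mem_ofPred_eq, Finset.coe_filter, hmem]
      constructor
      · rintro ⟨h1, h2⟩; exact ⟨⟨h1.trans ht, h2⟩, h1⟩
      · rintro ⟨⟨_, h2⟩, h1⟩; exact ⟨h1, h2⟩
    rw [this, finsum_mem_coe_finset]
  have hIntg : ∀ z ∈ S, IntervalIntegrable (fun t : ℝ => (poleOrder f z : ℝ) * (if z = 0 then 0 else
      (Ici ‖z‖).indicator (fun t => t⁻¹) t)) MeasureTheory.volume 0 r ∧
      ∫ t in (0:ℝ)..r, (poleOrder f z : ℝ) * (if z = 0 then 0 else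
      (Ici ‖z‖).indicator (fun t => t⁻¹) t) = (poleOrder f z : ℝ) * Real.log (r * ‖z‖⁻¹) := by
    intro z hz
    by_cases h0 : z = 0
    · simp [h0]
    · obtain ⟨i1, i2⟩ := ind_integral (norm_pos_iff.2 h0) ((hmem z).1 hz).1
      simp only [h0, if_false]
      exact ⟨i1.const_mul _, by rw [intervalIntegral.integral_const_mul, i2]⟩
  have e1 : ∫ t in (0:ℝ)..r, (nPoles f P t - nPoles f P 0) / t =
      ∑ z ∈ S, (poleOrder f z : ℝ) * Real.log (r * ‖z‖⁻¹) := by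
    rw [← Finset.sum_congr rfl (fun z hz => (hIntg z hz).2),
      ← intervalIntegral.integral_finsetSum (fun z hz => (hIntg z hz).1)]
    rw [intervalIntegral.integral_of_le hr.le, intervalIntegral.integral_of_le hr.le]
    refine MeasureTheory.setIntegral_congr_fun measurableSet_Ioc fun t ht => ?_
    rw [hn t ht.2, hn 0 hr.le, ← Finset.sum_sub_distrib, Finset.sum_div]
    refine Finset.sum_congr rfl fun z hz => ?_
    by_cases h0 : z = 0
    · simp [h0, ht.1.le]
    · have h1 : ¬ ‖z‖ ≤ 0 := not_le.2 (norm_pos_iff.2 h0)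
      by_cases h2 : ‖z‖ ≤ t
      · rw [if_pos h2, if_neg h1, if_neg h0, indicator_of_mem (show t ∈ Ici ‖z‖ from h2), sub_zero, div_eq_mul_inv]
      · rw [if_neg h2, if_neg h1, if_neg h0, indicator_of_notMem (show t ∉ Ici ‖z‖ from h2)]; simp
  have e0 : nPoles f P 0 = ((divisor f univ)⁻ 0 : ℤ) := by
    rw [negdiv_apply hf, hn 0 hr.le]
    have : ∀ z : ℂ, (if ‖z‖ ≤ 0 then (poleOrder f z : ℝ) else 0) = if z = 0 then (poleOrder f 0 : ℝ) else 0 := by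
      intro z
      by_cases hz : z = 0
      · simp [hz]
      · rw [if_neg hz, if_neg (not_le.2 (norm_pos_iff.2 hz))]
    simp_rw [this]
    rw [Finset.sum_ite_eq']
    have : (0:ℂ) ∈ S ↔ (0:ℂ) ∈ P := by rw [hmem]; simp [hr.le]
    by_cases h0 : (0:ℂ) ∈ P
    · rw [if_pos (this.2 h0), if_pos h0]; simp
    · rw [if_neg (fun h => h0 (this.1 h)), if_neg h0]; simp
  rw [NPoles, e1, e0, ValueDistribution.logCounting_top]
  simp only [Function.locallyFinsuppWithin.logCounting, AddMonoidHom.coe_mk, ZeroHom.coe_mk]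
  congr 1
  have hsup : (Function.support fun z => (((divisor f univ)⁻.toClosedBall r z : ℤ) : ℝ) * Real.log (r * ‖z‖⁻¹)) ⊆ S := by
    intro z hz
    have hz1 : (divisor f univ)⁻.toClosedBall r z ≠ 0 := fun h => hz (by simp [h])
    have hz2 := Function.locallyFinsuppWithin.toClosedBall_support_subset_closedBall _ hz1
    rw [Function.locallyFinsuppWithin.toClosedBall_eval_within _ hz2, negdiv_apply hf] at hz1
    rw [Metric.mem_closedBall, dist_zero_right, abs_of_pos hr] at hz2
    refine (hmem z).2 ⟨hz2, ?_⟩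
    by_contra hc
    exact hz1 (if_neg hc)
  rw [finsum_eq_sum_of_support_subset _ hsup]
  refine Finset.sum_congr rfl fun z hz => ?_
  have hz' := (hmem z).1 hz
  rw [Function.locallyFinsuppWithin.toClosedBall_eval_within _ (by
    rw [Metric.mem_closedBall, dist_zero_right, abs_of_pos hr]; exact hz'.1), negdiv_apply hf, if_pos hz'.2]
  simp

lemma Tchar_eq {f : ℂ → ℂ} {P : Set ℂ} (hf : MeromOn f P univ) {r : ℝ} (hr : 0 < r) :
    Tchar f P r = ValueDistribution.characteristic f ⊤ r := by
  rw [Tchar, mProx_eq, NPoles_eq hf hr]; rfl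

/-! ### Section 7 - B -/

/-- characteristic functions differ by a bounded amount -/
def TEq (F G : ℂ → ℂ) : Prop := ∃ C, ∀ r : ℝ, 1 ≤ r →
  |ValueDistribution.characteristic F ⊤ r - ValueDistribution.characteristic G ⊤ r| ≤ C

namespace TEq
variable {F G H : ℂ → ℂ}
lemma symm (h : TEq F G) : TEq G F := by
  obtain ⟨C, hC⟩ := h
  exact ⟨C, fun r hr => by rw [abs_sub_comm]; exact hC r hr⟩
lemma trans (h : TEq F G) (h' : TEq G H) : TEq F H := by
  obtain ⟨C, hC⟩ := h
  obtain ⟨C', hC'⟩ := h'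
  exact ⟨C + C', fun r hr => (abs_sub_le _ _ _).trans (add_le_add (hC r hr) (hC' r hr))⟩
lemma shift (hF : ∀ z, MeromorphicAt F z) (a : ℂ) : TEq F (fun z => F z - a) :=
  ⟨_, fun _ _ => ValueDistribution.abs_characteristic_sub_characteristic_shift_le hF⟩
lemma inv (hF : ∀ z, MeromorphicAt F z) : TEq F F⁻¹ :=
  ⟨_, fun _ _ => ValueDistribution.characteristic_sub_characteristic_inv_le hF⟩
lemma congr (h : ∀ z, ∀ᶠ w in 𝓝[≠] z, F w = G w) : TEq F G := by
  refine ⟨0, fun r hr => ?_⟩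
  rw [ValueDistribution.characteristic_congr_codiscrete (g := G) _ (by linarith)]
  · simp
  · rw [EventuallyEq, Filter.Eventually, mem_codiscrete]
    intro z
    rw [disjoint_principal_right, compl_compl]
    exact h z
lemma mul_le (hF : ∀ z, MeromorphicAt F z) (ht : ∀ z, meromorphicOrderAt F z ≠ ⊤) {c : ℂ} (hc : c ≠ 0)
    {r : ℝ} (hr : 1 ≤ r) : ValueDistribution.characteristic (fun z => c * F z) ⊤ r ≤
      ValueDistribution.characteristic F ⊤ r + Real.posLog ‖c‖ := by
  have h1 := ValueDistribution.characteristic_mul_top_le (f₁ := fun _ => c) (f₂ := F) hr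
    (fun z => MeromorphicAt.const c z) (fun z => by
      rw [meromorphicOrderAt_const]; simp [hc]) hF ht
  have h2 : ValueDistribution.characteristic (fun _ : ℂ => c) ⊤ r = Real.posLog ‖c‖ := by
    simp [ValueDistribution.characteristic]
  rw [Pi.add_apply, h2] at h1
  linarith [show ValueDistribution.characteristic ((fun _ => c) * F) ⊤ r =
    ValueDistribution.characteristic (fun z => c * F z) ⊤ r from rfl]
lemma mul (hF : ∀ z, MeromorphicAt F z) (ht : ∀ z, meromorphicOrderAt F z ≠ ⊤) {c : ℂ} (hc : c ≠ 0) :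
    TEq F (fun z => c * F z) := by
  refine ⟨Real.posLog ‖c‖ + Real.posLog ‖c⁻¹‖, fun r hr => ?_⟩
  have h1 := mul_le hF ht hc hr
  have hF' : ∀ z, MeromorphicAt (fun z => c * F z) z := fun z => (MeromorphicAt.const c z).mul (hF z)
  have ht' : ∀ z, meromorphicOrderAt (fun z => c * F z) z ≠ ⊤ := fun z => by
    have := meromorphicOrderAt_mul (MeromorphicAt.const c z) (hF z)
    rw [meromorphicOrderAt_const, if_neg hc, zero_add] at this
    exact this ▸ ht z
  have h2 := mul_le hF' ht' (inv_ne_zero hc) hr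
  have e : (fun z => c⁻¹ * (c * F z)) = F := by
    ext z; rw [inv_mul_cancel_left₀ hc]
  rw [e] at h2
  have p1 : 0 ≤ Real.posLog ‖c‖ := Real.posLog_nonneg
  have p2 : 0 ≤ Real.posLog ‖c⁻¹‖ := Real.posLog_nonneg
  rw [abs_le]; constructor <;> linarith
end TEq

lemma TEq_lin {f : ℂ → ℂ} {P : Set ℂ} (hf : MeromOn f P univ) (htrans : ¬ IsRationalFn f P)
    {a b : Option ℂ} (hab : a ≠ b)
    {c : ℂ} (hc : c ≠ 0) {U : ℂ → ℂ} (hU : ∀ z, ∀ᶠ w in 𝓝[≠] z, U w = c * lin a (f w) / lin b (f w)) :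
    TEq f U := by
  have hm := hf.meromorphicAt
  refine TEq.trans ?_ (TEq.congr hU).symm
  rcases a with _ | α
  · rcases b with _ | β
    · exact absurd rfl hab
    · have m1 := hf.lin_mero (some β)
      have t1 := hf.lin_ne_top htrans (some β)
      refine (TEq.shift hm β).trans ((TEq.inv m1).trans ?_)
      refine (TEq.mul (fun z => (m1 z).inv) (fun z => ?_) hc).trans ?_
      · rw [meromorphicOrderAt_inv]; simpa using t1 z
      · refine TEq.congr fun z => Eventually.of_forall fun w => ?_
        simp [lin]; rfl
  · rcases b with _ | β
    · have m1 := hf.lin_mero (some α)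
      have t1 := hf.lin_ne_top htrans (some α)
      refine (TEq.shift hm α).trans ((TEq.mul m1 t1 hc).trans ?_)
      refine TEq.congr fun z => Eventually.of_forall fun w => ?_
      simp [lin]
    · have m1 := hf.lin_mero (some β)
      have t1 := hf.lin_ne_top htrans (some β)
      have hd : c * (β - α) ≠ 0 := mul_ne_zero hc (sub_ne_zero.2 (by rintro rfl; exact hab rfl))
      have m2 : ∀ z, MeromorphicAt (fun w => (lin (some β) (f w))⁻¹) z := fun z => (m1 z).inv
      refine (TEq.shift hm β).trans ((TEq.inv m1).trans ?_)
      refine (TEq.mul (fun z => (m1 z).inv) (fun z => ?_) hd).trans ?_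
      · rw [meromorphicOrderAt_inv]; simpa using t1 z
      · refine (TEq.shift (fun z => (MeromorphicAt.const _ z).mul (m1 z).inv) (-c)).trans ?_
        refine TEq.congr fun z => ?_
        have := (meromorphicOrderAt_ne_top_iff_eventually_ne_zero (m1 z)).1 (t1 z)
        filter_upwards [this] with w hw
        change c * (β - α) * (lin (some β) (f w))⁻¹ - -c = _
        rw [eq_div_iff hw]
        have e1 : lin (some β) (f w) * (lin (some β) (f w))⁻¹ = 1 := mul_inv_cancel₀ hw
        have e2 : lin (some β) (f w) = f w - β := rfl
        have e3 : lin (some α) (f w) = f w - α := rfl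
        linear_combination c * (β - α) * e1 + c * e2 - c * e3

/-! ### Section 7 - C -/

lemma ex_circle (θ s y : ℝ) : ex θ (s + y * I) = circleMap 0 (Real.exp s) (y + θ) := by
  rw [ex, circleMap, zero_add, Complex.ofReal_exp, ← Complex.exp_add]
  congr 1; push_cast; ring

lemma prox_periodic (F : ℂ → ℂ) (θ s : ℝ) :
    Function.Periodic (fun y : ℝ => Real.posLog ‖F (ex θ (s + y * I))‖) (2 * Real.pi) := by
  intro y
  simp only [ex_circle]
  rw [show y + 2 * Real.pi + θ = (y + θ) + 2 * Real.pi by ring, periodic_circleMap]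

lemma prox_int {F : ℂ → ℂ} (hF : ∀ z, MeromorphicAt F z) (θ s a b : ℝ) :
    IntervalIntegrable (fun y : ℝ => Real.posLog ‖F (ex θ (s + y * I))‖) MeasureTheory.volume a b := by
  have h1 : CircleIntegrable (fun z => Real.posLog ‖F z‖) 0 (Real.exp s) :=
    MeromorphicOn.circleIntegrable_posLog_norm (fun z _ => hF z)
  have h2 : IntervalIntegrable (fun y : ℝ => Real.posLog ‖F (circleMap 0 (Real.exp s) y)‖)
      MeasureTheory.volume 0 (2 * Real.pi) := h1
  have h3 : Function.Periodic (fun y : ℝ => Real.posLog ‖F (circleMap 0 (Real.exp s) y)‖) (2 * Real.pi) := by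
    intro y; simp only; rw [periodic_circleMap]
  have h4 := h3.intervalIntegrable₀ Real.two_pi_pos.ne' h2 (a + θ) (b + θ)
  have h5 := h4.comp_add_right θ
  simp only [add_sub_cancel_right] at h5
  simpa only [ex_circle] using h5

lemma prox_ex (F : ℂ → ℂ) (θ s a : ℝ) :
    ValueDistribution.proximity F ⊤ (Real.exp s) =
      (2 * Real.pi)⁻¹ * ∫ y in a..(a + 2 * Real.pi), Real.posLog ‖F (ex θ (s + y * I))‖ := by
  have h3 : Function.Periodic (fun y : ℝ => Real.posLog ‖F (circleMap 0 (Real.exp s) y)‖) (2 * Real.pi) := by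
    intro y; simp only; rw [periodic_circleMap]
  rw [ValueDistribution.proximity_top, Real.circleAverage, smul_eq_mul]
  congr 1
  simp only [ex_circle]
  rw [intervalIntegral.integral_comp_add_right (fun y : ℝ => Real.posLog ‖F (circleMap 0 (Real.exp s) y)‖) θ]
  have := h3.intervalIntegral_add_eq 0 (a + θ)
  rw [zero_add] at this
  rw [this]
  congr 1; ring

lemma prox_lower {F : ℂ → ℂ} (hF : ∀ z, MeromorphicAt F z) (θ s c η M : ℝ) (hη : 0 < η) (hη' : η ≤ Real.pi)
    (hM : ∀ y, |y - c| ≤ η → M ≤ Real.log ‖F (ex θ (s + y * I))‖) :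
    η / Real.pi * M ≤ ValueDistribution.proximity F ⊤ (Real.exp s) := by
  have hpi := Real.pi_pos
  rw [prox_ex F θ s (c - η)]
  have i := prox_int hF θ s
  have h1 : ∫ y in (c - η)..(c - η + 2 * Real.pi), Real.posLog ‖F (ex θ (s + y * I))‖ =
      (∫ y in (c - η)..(c + η), Real.posLog ‖F (ex θ (s + y * I))‖) +
      ∫ y in (c + η)..(c - η + 2 * Real.pi), Real.posLog ‖F (ex θ (s + y * I))‖ :=
    (intervalIntegral.integral_add_adjacent_intervals (i _ _) (i _ _)).symm
  have h2 : 0 ≤ ∫ y in (c + η)..(c - η + 2 * Real.pi), Real.posLog ‖F (ex θ (s + y * I))‖ :=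
    intervalIntegral.integral_nonneg (by linarith) fun y _ => Real.posLog_nonneg
  have h3 : ∫ y in (c - η)..(c + η), M ≤ ∫ y in (c - η)..(c + η), Real.posLog ‖F (ex θ (s + y * I))‖ := by
    refine intervalIntegral.integral_mono_on (by linarith) (by simp) (i _ _) fun y hy => ?_
    exact (hM y (abs_le.2 ⟨by linarith [hy.1], by linarith [hy.2]⟩)).trans (le_max_right _ _)
  rw [intervalIntegral.integral_const, smul_eq_mul] at h3
  calc η / Real.pi * M = (2 * Real.pi)⁻¹ * ((c + η - (c - η)) * M) := by field_simp; ring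
    _ ≤ _ := by
      refine mul_le_mul_of_nonneg_left ?_ (by positivity)
      linarith

lemma mm_pick (V : ℤ → ℂ → ℂ) (s : ℝ) : ∃ k j : ℤ, (0 ≤ j ∧ j ≤ 3) ∧ (j = k ∨ j = k + 1) ∧
    mm V s / 6 - 1 ≤ |(V j (s + ck k * I)).re| := by
  by_contra hc
  push Not at hc
  have h := fun k j a b => (gg_le (V j (s + ck k * I))).trans_lt (by linarith [hc k j a b] : 1 + |(V j (s + ck k * I)).re| < mm V s / 6)
  have a1 := h 0 0 (by norm_num) (by norm_num)
  have a2 := h 0 1 (by norm_num) (by norm_num)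
  have a3 := h 1 1 (by norm_num) (by norm_num)
  have a4 := h 1 2 (by norm_num) (by norm_num)
  have a5 := h 2 2 (by norm_num) (by norm_num)
  have a6 := h 2 3 (by norm_num) (by norm_num)
  have e : mm V s = (gg (V 0 (s + ck 0 * I)) + gg (V 1 (s + ck 0 * I))) +
    (gg (V 1 (s + ck 1 * I)) + gg (V 2 (s + ck 1 * I))) +
    (gg (V 2 (s + ck 2 * I)) + gg (V 3 (s + ck 2 * I))) := rfl
  linarith

theorem T_lower {θ : ℝ} {f : ℂ → ℂ} {P : Set ℂ} (hf : MeromOn f P univ) (ht : ¬ IsRationalFn f P)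
    {U : ℤ → ℂ → ℂ} {R₀ : ℝ} (h : Tri θ U R₀)
    (hU : ∀ k, ∃ a b : Option ℂ, ∃ c, c ≠ 0 ∧ a ≠ b ∧ ∀ z, ∀ᶠ w in 𝓝[≠] z, U k w = c * lin a (f w) / lin b (f w))
    {V : ℤ → ℂ → ℂ} (hL : LogData V (Real.log R₀))
    (hV : ∀ k, ∀ ζ ∈ Dk (Real.log R₀) k, cexp (V k ζ) = U k (ex θ ζ)) :
    ∃ C > 0, ∀ s ≥ Real.log R₀ + 3, mm V s ≤ C * (ValueDistribution.characteristic f ⊤ (Real.exp s) + C) := by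
  have hpi := Real.pi_pos
  have hT : ∀ k, TEq f (U k) := fun k => by
    obtain ⟨a, b, c, hc, hab, he⟩ := hU k
    exact TEq_lin hf ht hab hc he
  have hT' : ∀ k, TEq f (U k)⁻¹ := fun k => (hT k).trans (TEq.inv (h.mero k))
  choose C1 hC1 using hT
  choose C2 hC2 using hT'
  set K : ℝ := ∑ j ∈ Finset.Icc (0:ℤ) 3, (|C1 j| + |C2 j|) with hK
  have hKj : ∀ j : ℤ, 0 ≤ j ∧ j ≤ 3 → C1 j ≤ K ∧ C2 j ≤ K := by
    intro j hj
    have := Finset.single_le_sum (f := fun j => |C1 j| + |C2 j|) (s := Finset.Icc (0:ℤ) 3)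
      (fun i _ => by positivity) (Finset.mem_Icc.2 hj)
    have a1 := le_abs_self (C1 j)
    have a2 := le_abs_self (C2 j)
    have a3 := abs_nonneg (C1 j)
    have a4 := abs_nonneg (C2 j)
    constructor <;> linarith
  have hK0 : 0 ≤ K := Finset.sum_nonneg fun _ _ => by positivity
  obtain ⟨D, hD, hd⟩ := hL.deriv_bound (Real.pi / 6) (by positivity)
  set η := min (Real.pi / 6) (1 / (24 * D)) with hη
  have hη0 : 0 < η := lt_min (by positivity) (by positivity)
  have hη1 : η ≤ Real.pi / 6 := min_le_left _ _
  have hη2 : D * η ≤ 1 / 24 := by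
    have : η ≤ 1 / (24 * D) := min_le_right _ _
    calc D * η ≤ D * (1 / (24 * D)) := mul_le_mul_of_nonneg_left this hD.le
      _ = 1 / 24 := by field_simp
  have key : ∀ s ≥ Real.log R₀ + 3, η / Real.pi * (mm V s / 8 - 1) ≤
      ValueDistribution.characteristic f ⊤ (Real.exp s) + K := by
    intro s hs
    have h1s : 1 ≤ Real.exp s := Real.one_le_exp (by linarith [Real.log_nonneg h.one_le])
    obtain ⟨k, j, hj, hjk, hm⟩ := mm_pick V s
    have hck : |ck k - Lk j| = Real.pi / 3 := by
      rcases hjk with rfl | rfl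
      · rw [ck_eq, add_sub_cancel_left, abs_of_pos (by positivity)]
      · rw [ck_eq', sub_sub_cancel_left, abs_neg, abs_of_pos (by positivity)]
    have him : ∀ y : ℝ, |y - ck k| ≤ η → |y - Lk j| ≤ 2 * Real.pi / 3 - Real.pi / 6 := by
      intro y hy
      have := abs_sub_le y (ck k) (Lk j)
      rw [hck] at this
      linarith
    have hmem : ∀ y : ℝ, |y - ck k| ≤ η → ((s : ℂ) + y * I) ∈ Dk (Real.log R₀) j := by
      intro y hy
      refine ⟨by simp; linarith, ?_⟩
      have := him y hy
      show |((s : ℂ) + y * I).im - Lk j| < _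
      simp only [add_im, ofReal_im, mul_im, ofReal_re, I_im, mul_one, I_re, mul_zero, add_zero, zero_add]
      linarith
    have hdiff : ∀ y : ℝ, |y - ck k| ≤ η → |(V j (s + y * I)).re - (V j (s + ck k * I)).re| ≤ mm V s / 24 := by
      intro y hy
      set S : Set ℂ := {ζ | ζ.re = s ∧ |ζ.im - ck k| ≤ η} with hS
      have hcv : Convex ℝ S := by
        have e : S = {ζ | ζ.re = s} ∩ ({ζ | ck k - η ≤ ζ.im} ∩ {ζ | ζ.im ≤ ck k + η}) := by
          ext ζ
          simp only [hS, mem_inter_iff, mem_ofPred_eq, abs_le]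
          constructor
          · rintro ⟨a, b, c⟩; exact ⟨a, by linarith, by linarith⟩
          · rintro ⟨a, b, c⟩; exact ⟨a, by linarith, by linarith⟩
        rw [e]
        have c1 : Convex ℝ {ζ : ℂ | ζ.re = s} := convex_hyperplane (IsLinearMap.mk add_re (by simp)) s
        exact c1.inter ((convex_halfSpace_ge (IsLinearMap.mk add_im (by simp)) _).inter
          (convex_halfSpace_le (IsLinearMap.mk add_im (by simp)) _))
      have hSy : ∀ ζ ∈ S, ζ = s + (ζ.im : ℝ) * I := by
        rintro ζ ⟨h1, h2⟩
        apply Complex.ext <;> simp [h1]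
      have hb := hcv.norm_image_sub_le_of_norm_deriv_le (𝕜 := ℂ) (f := V j) (C := D * mm V s) (x := s + ck k * I)
        (y := s + y * I)
        (fun ζ hζ => by
          have := hmem ζ.im hζ.2
          rw [← hSy ζ hζ] at this
          exact ((hL.diff j).differentiableAt ((isOpen_Dk _ _).mem_nhds this)))
        (fun ζ hζ => by
          have := hd j ζ (by rw [hζ.1]; exact hs) (him _ hζ.2)
          rwa [hζ.1] at this)
        ⟨by simp, by simp [hη0.le]⟩ ⟨by simp, by simpa using hy⟩
      have hn : ‖((s:ℂ) + y * I) - (s + ck k * I)‖ = |y - ck k| := by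
        rw [show ((s:ℂ) + y * I) - (s + ck k * I) = ((y - ck k : ℝ) : ℂ) * I by push_cast; ring, norm_mul,
          Complex.norm_I, mul_one, Complex.norm_real, Real.norm_eq_abs]
      rw [hn] at hb
      rw [← sub_re]
      refine (abs_re_le_norm _).trans (hb.trans ?_)
      have h6 := LogData.six_le_mm V s
      calc D * mm V s * |y - ck k| ≤ D * mm V s * η := mul_le_mul_of_nonneg_left hy (by positivity)
        _ = (D * η) * mm V s := by ring
        _ ≤ 1 / 24 * mm V s := mul_le_mul_of_nonneg_right hη2 (by linarith)
        _ = _ := by ring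
    have hlog : ∀ y : ℝ, |y - ck k| ≤ η → Real.log ‖U j (ex θ (s + y * I))‖ = (V j (s + y * I)).re := by
      intro y hy
      rw [← hV j _ (hmem y hy), Complex.norm_exp, Real.log_exp]
    rcases le_total 0 (V j (s + ck k * I)).re with h0 | h0
    · rw [abs_of_nonneg h0] at hm
      have hp := prox_lower (h.mero j) θ s (ck k) η (mm V s / 8 - 1) hη0 (by linarith) (by
        intro y hy
        rw [hlog y hy]
        have := (abs_le.1 (hdiff y hy)).1
        linarith)
      have h3 := (abs_le.1 (hC1 j _ h1s)).1
      have h4 : ValueDistribution.proximity (U j) ⊤ (Real.exp s) ≤ ValueDistribution.characteristic (U j) ⊤ (Real.exp s) := by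
        have := ValueDistribution.logCounting_nonneg (f := U j) (e := ⊤) h1s
        rw [ValueDistribution.characteristic, Pi.add_apply]; linarith
      linarith [(hKj j hj).1]
    · rw [abs_of_nonpos h0] at hm
      have hp := prox_lower (F := (U j)⁻¹) (fun z => (h.mero j z).inv) θ s (ck k) η (mm V s / 8 - 1) hη0 (by linarith) (by
        intro y hy
        rw [Pi.inv_apply, norm_inv, Real.log_inv, hlog y hy]
        have := (abs_le.1 (hdiff y hy)).2
        linarith)
      have h3 := (abs_le.1 (hC2 j _ h1s)).1
      have h4 : ValueDistribution.proximity (U j)⁻¹ ⊤ (Real.exp s) ≤ ValueDistribution.characteristic (U j)⁻¹ ⊤ (Real.exp s) := by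
        have := ValueDistribution.logCounting_nonneg (f := (U j)⁻¹) (e := ⊤) h1s
        rw [ValueDistribution.characteristic, Pi.add_apply]; linarith
      linarith [(hKj j hj).2]
  refine ⟨8 * Real.pi / η + K + 1, by positivity, fun s hs => ?_⟩
  have h1 := key s hs
  have h1s : 1 ≤ Real.exp s := Real.one_le_exp (by linarith [Real.log_nonneg h.one_le])
  have hT0 := ValueDistribution.characteristic_nonneg (f := f) (a := ⊤) h1s
  set T := ValueDistribution.characteristic f ⊤ (Real.exp s)
  have h2 : mm V s / 8 - 1 ≤ Real.pi / η * (T + K) := by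
    have := mul_le_mul_of_nonneg_left h1 (show 0 ≤ Real.pi / η by positivity)
    calc mm V s / 8 - 1 = Real.pi / η * (η / Real.pi * (mm V s / 8 - 1)) := by field_simp
      _ ≤ _ := this
  have hx : 1 ≤ Real.pi / η := by rw [le_div_iff₀ hη0]; linarith
  set x := Real.pi / η
  have hx' : 8 * Real.pi / η = 8 * x := by rw [mul_div_assoc]
  rw [hx']
  nlinarith [mul_nonneg hK0 hT0, mul_nonneg hK0 hK0]

/-! ### Section 7 - D -/

lemma posLog_inv_le {x : ℂ} {M : ℝ} (hM : 0 ≤ M) (hx : ‖x‖ ≤ Real.exp M) :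
    Real.posLog ‖x⁻¹‖ ≤ M - Real.log ‖x‖ := by
  by_cases h0 : x = 0
  · simp [h0, hM, Real.posLog]
  have hp : 0 < ‖x‖ := norm_pos_iff.2 h0
  have h1 : Real.log ‖x‖ ≤ M := by rw [Real.log_le_iff_le_exp hp]; exact hx
  rw [Real.posLog, norm_inv, Real.log_inv]
  exact max_le (by linarith) (by linarith)

lemma circleAverage_ge {G : ℂ → ℂ} {c : ℂ} {ρ : ℝ} (hρ : 0 < ρ)
    (hG : AnalyticOnNhd ℂ G (Metric.closedBall c ρ)) (h0 : G c ≠ 0) :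
    Real.log ‖G c‖ ≤ Real.circleAverage (fun z => Real.log ‖G z‖) c ρ := by
  have hG' : AnalyticOnNhd ℂ G (Metric.closedBall c |ρ|) := by rwa [abs_of_pos hρ]
  rw [hG'.circleAverage_log_norm hρ.ne' h0]
  have : 0 ≤ ∑ᶠ u, (MeromorphicOn.divisor G (Metric.closedBall c |ρ|) u : ℝ) * Real.log (ρ * ‖c - u‖⁻¹) := by
    refine finsum_nonneg fun u => ?_
    by_cases hu : u ∈ Metric.closedBall c |ρ|
    · by_cases huc : u = c
      · subst huc; simp
      have : 0 < ‖c - u‖ := norm_pos_iff.2 (sub_ne_zero.2 (Ne.symm huc))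
      have hb : ‖c - u‖ ≤ ρ := by
        rw [abs_of_pos hρ, Metric.mem_closedBall, dist_comm, dist_eq_norm] at hu; exact hu
      refine mul_nonneg ?_ (Real.log_nonneg ?_)
      · exact_mod_cast MeromorphicOn.AnalyticOnNhd.divisor_nonneg hG' u
      · rw [← div_eq_mul_inv, le_div_iff₀ this]; linarith
    · rw [Function.locallyFinsuppWithin.apply_eq_zero_of_notMem _ hu]; simp
  linarith

lemma circ_lint {G : ℂ → ℂ} {c : ℂ} {ρ M : ℝ} (hρ : 0 < ρ) (hM : 0 ≤ M)
    (hG : AnalyticOnNhd ℂ G (Metric.closedBall c ρ)) (h0 : G c ≠ 0)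
    (hb : ∀ z ∈ Metric.closedBall c ρ, ‖G z‖ ≤ Real.exp M) :
    ∫⁻ α in Ioo (-Real.pi) Real.pi, ENNReal.ofReal (Real.posLog ‖(G (circleMap c ρ α))⁻¹‖) ≤
      ENNReal.ofReal (2 * Real.pi * (M - Real.log ‖G c‖)) := by
  have hpi := Real.pi_pos
  have hmem : ∀ α, circleMap c ρ α ∈ Metric.closedBall c ρ := fun α => circleMap_mem_closedBall c hρ.le α
  have hle : ∀ α, Real.posLog ‖(G (circleMap c ρ α))⁻¹‖ ≤ M - Real.log ‖G (circleMap c ρ α)‖ :=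
    fun α => posLog_inv_le hM (hb _ (hmem α))
  have hci : CircleIntegrable (fun z => Real.log ‖G z‖) c ρ :=
    MeromorphicOn.circleIntegrable_log_norm (fun z hz => (hG z (by
      rw [abs_of_pos hρ] at hz; exact Metric.sphere_subset_closedBall hz)).meromorphicAt)
  have hper : Function.Periodic (fun α => Real.log ‖G (circleMap c ρ α)‖) (2 * Real.pi) := fun α => by
    simp only [periodic_circleMap c ρ α]
  have hii : IntervalIntegrable (fun α => Real.log ‖G (circleMap c ρ α)‖) MeasureTheory.volume (-Real.pi) Real.pi :=
    hper.intervalIntegrable₀ (by positivity) hci _ _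
  have hii2 : IntervalIntegrable (fun α => M - Real.log ‖G (circleMap c ρ α)‖) MeasureTheory.volume (-Real.pi) Real.pi :=
    (intervalIntegrable_const).sub hii
  have hIntg : ∫ α in (-Real.pi)..Real.pi, (M - Real.log ‖G (circleMap c ρ α)‖) ≤ 2 * Real.pi * (M - Real.log ‖G c‖) := by
    rw [intervalIntegral.integral_sub intervalIntegrable_const hii, intervalIntegral.integral_const]
    have h1 := circleAverage_ge hρ hG h0
    rw [Real.circleAverage_def] at h1
    have h2 := hper.intervalIntegral_add_eq 0 (-Real.pi)
    rw [zero_add, show -Real.pi + 2 * Real.pi = Real.pi by ring] at h2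
    rw [h2, smul_eq_mul, inv_mul_eq_div, le_div_iff₀ (by positivity)] at h1
    simp only [smul_eq_mul]
    linarith
  calc _ ≤ ∫⁻ α in Ioc (-Real.pi) Real.pi, ENNReal.ofReal (M - Real.log ‖G (circleMap c ρ α)‖) :=
        (MeasureTheory.lintegral_mono_set Ioo_subset_Ioc_self).trans
          (MeasureTheory.lintegral_mono fun α => ENNReal.ofReal_le_ofReal (hle α))
    _ = ENNReal.ofReal (∫ α in Ioc (-Real.pi) Real.pi, (M - Real.log ‖G (circleMap c ρ α)‖)) := by
        rw [MeasureTheory.ofReal_integral_eq_lintegral_ofReal]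
        · exact (intervalIntegrable_iff_integrableOn_Ioc_of_le (by linarith)).1 hii2
        · exact Eventually.of_forall fun α => (Real.posLog_nonneg).trans (hle α)
    _ ≤ _ := by
        rw [← intervalIntegral.integral_of_le (by linarith)]
        exact ENNReal.ofReal_le_ofReal hIntg

lemma area_lint {G : ℂ → ℂ} {c : ℂ} {R M : ℝ} (hR : 0 < R) (hM : 0 ≤ M)
    (hG : AnalyticOnNhd ℂ G (Metric.closedBall c R)) (h0 : G c ≠ 0)
    (hb : ∀ z ∈ Metric.closedBall c R, ‖G z‖ ≤ Real.exp M) :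
    ∫⁻ z, ENNReal.ofReal (Real.posLog ‖((Metric.closedBall c R).indicator G z)⁻¹‖) ≤
      ENNReal.ofReal (R * (R * (2 * Real.pi * (M - Real.log ‖G c‖)))) := by
  have hpi := Real.pi_pos
  set H : ℂ → ENNReal := fun z => ENNReal.ofReal (Real.posLog ‖((Metric.closedBall c R).indicator G z)⁻¹‖) with hH
  have hH0 : ∀ z, z ∉ Metric.closedBall c R → H z = 0 := fun z hz => by
    simp [hH, indicator_of_notMem hz, Real.posLog]
  set K := ENNReal.ofReal (2 * Real.pi * (M - Real.log ‖G c‖)) with hK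
  rw [← MeasureTheory.lintegral_add_left_eq_self H c, ← Complex.lintegral_comp_polarCoord_symm]
  have htar : polarCoord.target = Ioi (0:ℝ) ×ˢ Ioo (-Real.pi) Real.pi := rfl
  rw [htar, MeasureTheory.Measure.volume_eq_prod, ← MeasureTheory.Measure.prod_restrict]
  refine (MeasureTheory.lintegral_prod_le _).trans ?_
  have hin : ∀ ρ ∈ Ioi (0:ℝ), (∫⁻ α in Ioo (-Real.pi) Real.pi, ENNReal.ofReal ρ • H (c + Complex.polarCoord.symm (ρ, α))) ≤
      (Ioc 0 R).indicator (fun _ => ENNReal.ofReal R * K) ρ := by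
    intro ρ hρ
    have hρ' : 0 < ρ := hρ
    have e : ∀ α, c + Complex.polarCoord.symm (ρ, α) = circleMap c ρ α := by
      intro α
      rw [Complex.polarCoord_symm_apply, circleMap, Complex.exp_mul_I]
      simp
    simp only [e]
    by_cases hρR : ρ ≤ R
    · rw [indicator_of_mem (show ρ ∈ Ioc 0 R from ⟨hρ', hρR⟩)]
      have hsub : Metric.closedBall c ρ ⊆ Metric.closedBall c R := Metric.closedBall_subset_closedBall hρR
      have hc := circ_lint hρ' hM (hG.mono hsub) h0 fun z hz => hb z (hsub hz)
      simp only [smul_eq_mul]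
      rw [MeasureTheory.lintegral_const_mul' _ _ ENNReal.ofReal_ne_top]
      refine mul_le_mul' (ENNReal.ofReal_le_ofReal hρR) ?_
      refine le_trans (le_of_eq ?_) hc
      refine MeasureTheory.lintegral_congr fun α => ?_
      simp only [hH]
      rw [indicator_of_mem (hsub (circleMap_mem_closedBall c hρ'.le α))]
    · have : ∀ α, H (circleMap c ρ α) = 0 := fun α => hH0 _ (by
        rw [Metric.mem_closedBall, dist_eq_norm, circleMap_sub_center, norm_circleMap_zero, abs_of_pos hρ']
        exact hρR)
      simp [this]
  refine (MeasureTheory.setLIntegral_mono' measurableSet_Ioi hin).trans ?_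
  refine (MeasureTheory.setLIntegral_le_lintegral _ _).trans ?_
  rw [MeasureTheory.lintegral_indicator measurableSet_Ioc, MeasureTheory.setLIntegral_const, Real.volume_Ioc, sub_zero,
    hK, ← ENNReal.ofReal_mul hR.le, ← ENNReal.ofReal_mul' hR.le]
  exact le_of_eq (by congr 1; ring)

lemma good_line {G : ℂ → ℂ} {c : ℂ} {R M a b y1 y2 : ℝ} (hR : 0 < R) (hM : 0 ≤ M)
    (hG : AnalyticOnNhd ℂ G (Metric.closedBall c R)) (h0 : G c ≠ 0)
    (hb : ∀ z ∈ Metric.closedBall c R, ‖G z‖ ≤ Real.exp M) (hab : a < b) (hy : y1 ≤ y2)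
    (hrect : ∀ x ∈ Icc a b, ∀ y ∈ Icc y1 y2, ((x:ℂ) + y * I) ∈ Metric.closedBall c R) :
    ∃ x ∈ Icc a b, ∀ (_ : IntervalIntegrable (fun y : ℝ => Real.posLog ‖(G (x + y * I))⁻¹‖) MeasureTheory.volume y1 y2),
      ∫ y in y1..y2, Real.posLog ‖(G (x + y * I))⁻¹‖ ≤
      R * (R * (2 * Real.pi * (M - Real.log ‖G c‖))) / (b - a) := by
  have hpi := Real.pi_pos
  have hnn : 0 ≤ M - Real.log ‖G c‖ := (Real.posLog_nonneg).trans (posLog_inv_le hM (hb c (by simp [hR.le])))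
  set H : ℂ → ENNReal := fun z => ENNReal.ofReal (Real.posLog ‖((Metric.closedBall c R).indicator G z)⁻¹‖) with hH
  have hmG : Measurable ((Metric.closedBall c R).indicator G) := by
    classical
    have := ContinuousOn.measurable_piecewise (f := G) (g := fun _ => (0:ℂ)) (s := Metric.closedBall c R) hG.continuousOn
      continuousOn_const Metric.isClosed_closedBall.measurableSet
    convert this using 1
    ext z
    simp [indicator, piecewise]
  have hmH : Measurable H := by
    refine ENNReal.measurable_ofReal.comp ?_
    have : Measurable Real.posLog := by
      unfold Real.posLog
      exact measurable_const.max Real.measurable_log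
    exact this.comp hmG.inv.norm
  have hA := area_lint hR hM hG h0 hb
  rw [← (Complex.volume_preserving_equiv_real_prod.symm).lintegral_comp_emb
    measurableEquivRealProd.symm.measurableEmbedding, MeasureTheory.Measure.volume_eq_prod, MeasureTheory.lintegral_prod] at hA
  swap
  · exact (hmH.comp measurableEquivRealProd.symm.measurable).aemeasurable
  have e : ∀ x y : ℝ, measurableEquivRealProd.symm (x, y) = (x:ℂ) + y * I := fun x y => by
    rw [Complex.measurableEquivRealProd_symm_apply]
    apply Complex.ext <;> simp
  simp only [e] at hA
  set Φ : ℝ → ENNReal := fun x => ∫⁻ y : ℝ, H ((x:ℂ) + y * I) with hΦ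
  have hmΦ : Measurable Φ := by
    have : Measurable fun p : ℝ × ℝ => H ((p.1:ℂ) + p.2 * I) := hmH.comp (by fun_prop)
    exact this.lintegral_prod_right'
  obtain ⟨x, hx, hxle⟩ := MeasureTheory.exists_le_setLAverage (μ := MeasureTheory.volume) (s := Icc a b) (f := Φ)
    (by simp [hab]) (by simp) hmΦ.aemeasurable
  refine ⟨x, hx, fun hI => ?_⟩
  rw [MeasureTheory.setLAverage_eq, Real.volume_Icc] at hxle
  have h2 : Φ x ≤ ENNReal.ofReal (R * (R * (2 * Real.pi * (M - Real.log ‖G c‖)))) / ENNReal.ofReal (b - a) :=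
    hxle.trans (ENNReal.div_le_div_right ((MeasureTheory.setLIntegral_le_lintegral _ _).trans hA) _)
  rw [← ENNReal.ofReal_div_of_pos (by linarith)] at h2
  have h3 : ENNReal.ofReal (∫ y in y1..y2, Real.posLog ‖(G (x + y * I))⁻¹‖) ≤ Φ x := by
    rw [intervalIntegral.integral_of_le hy, MeasureTheory.ofReal_integral_eq_lintegral_ofReal
      ((intervalIntegrable_iff_integrableOn_Ioc_of_le hy).1 hI) (Eventually.of_forall fun _ => Real.posLog_nonneg)]
    refine le_trans ?_ (MeasureTheory.setLIntegral_le_lintegral (Ioc y1 y2) _)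
    refine MeasureTheory.setLIntegral_mono' measurableSet_Ioc fun y hy => ?_
    simp only [hH]
    rw [indicator_of_mem (hrect x hx y ⟨hy.1.le, hy.2⟩)]
  have h4 := h3.trans h2
  rwa [ENNReal.ofReal_le_ofReal_iff (by have : 0 < b - a := by linarith
                                        positivity)] at h4

/-! ### Section 7 - E -/

lemma mm_near {V : ℤ → ℂ → ℂ} {s₀ : ℝ} (hL : LogData V s₀) {s t : ℝ} (hs : s₀ + 5 ≤ s) (h : |t - s| ≤ 2) :
    mm V t ≤ Real.exp 12000 * mm V s := by
  have h6 := LogData.six_le_mm V s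
  rw [abs_le] at h
  refine (hL.mm_le (s := s) (t := t) (by linarith) (by linarith)).trans ?_
  rw [mul_comm]
  refine mul_le_mul_of_nonneg_right (Real.exp_le_exp.2 ?_) (by linarith)
  have : |t - s| ≤ 2 := abs_le.2 h
  linarith

theorem prox_upper {θ : ℝ} {U : ℤ → ℂ → ℂ} {R₀ : ℝ} (h : Tri θ U R₀)
    {V : ℤ → ℂ → ℂ} (hL : LogData V (Real.log R₀))
    (hV : ∀ k, ∀ ζ ∈ Dk (Real.log R₀) k, cexp (V k ζ) = U k (ex θ ζ)) :
    ∃ C > 0, ∀ s ≥ Real.log R₀ + 5, ∃ x ∈ Icc s (s + 1 / 2),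
      ValueDistribution.proximity (U 0) ⊤ (Real.exp x) ≤ C * mm V s := by
  have hpi := Real.pi_gt_three
  have hpi4 := Real.pi_le_four
  obtain ⟨C, hC, hb⟩ := h.ub hL hV (δ := 1 / 4) (by norm_num)
  have hL0 : Lk 0 = 0 := by simp [Lk]
  set y0 : ℝ := -(2 * Real.pi / 3) with hy0
  set E := Real.exp 12000 with hE
  have hE1 : 1 ≤ E := Real.one_le_exp (by norm_num)
  refine ⟨(2 * Real.pi)⁻¹ * (32 * Real.pi * (C * E) + 2 * Real.pi * (C * E)), by positivity, fun s hs => ?_⟩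
  have h6 := LogData.six_le_mm V s
  set G : ℂ → ℂ := fun ζ => (U 0 (ex θ ζ))⁻¹ with hG
  set c : ℂ := s + ((y0 + 1 : ℝ) : ℂ) * I with hc
  have hcre : c.re = s := by simp [hc]
  have hcim : c.im = y0 + 1 := by simp [hc]
  have hball : ∀ ζ ∈ Metric.closedBall c 2, |ζ.re - s| ≤ 2 ∧ |ζ.im - (y0 + 1)| ≤ 2 := by
    intro ζ hζ
    rw [Metric.mem_closedBall, dist_eq_norm] at hζ
    constructor
    · rw [← hcre, ← sub_re]; exact (abs_re_le_norm _).trans hζ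
    · rw [← hcim, ← sub_im]; exact (abs_im_le_norm _).trans hζ
  have hinv : ∀ ζ ∈ Metric.closedBall c 2, meromorphicOrderAt (U 0) (ex θ ζ) ≤ 0 ∧ ‖G ζ‖ ≤ Real.exp (C * E * mm V s) := by
    intro ζ hζ
    obtain ⟨h1, h2⟩ := hball ζ hζ
    have h1' := abs_le.1 h1
    have h2' := abs_le.1 h2
    have := (hb 0 ζ (by linarith)).2 (by rw [hL0]; linarith) (by rw [hL0]; linarith)
    refine ⟨this.1, this.2.trans (Real.exp_le_exp.2 ?_)⟩
    rw [mul_assoc]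
    exact mul_le_mul_of_nonneg_left (mm_near hL hs h1) hC.le
  have hGa : AnalyticOnNhd ℂ G (Metric.closedBall c 2) := fun ζ hζ =>
    (h.analyticAt_inv (hinv ζ hζ).1).comp' ((ex_differentiable θ).analyticAt ζ)
  have hcD : c ∈ Dk (Real.log R₀) 0 := by
    refine ⟨by rw [hcre]; linarith, ?_⟩
    show |c.im - Lk 0| < _
    rw [hcim, hL0, abs_lt]; constructor <;> linarith
  have hGc : G c ≠ 0 := inv_ne_zero (h.ne_zero (h.ord_zero hcD))
  have hlogc : - Real.log ‖G c‖ ≤ C * E * mm V s := by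
    have h1 := ((hb 0 c (by rw [hcre]; linarith)).1 (by rw [hL0, hcim]; linarith) (by rw [hL0, hcim]; linarith)).2
    rw [hcre] at h1
    have h0 : 0 < ‖U 0 (ex θ c)‖ := norm_pos_iff.2 (h.ne_zero (h.ord_zero hcD))
    have h2 : Real.log ‖U 0 (ex θ c)‖ ≤ C * mm V s := (Real.log_le_iff_le_exp h0).2 h1
    simp only [hG, norm_inv, Real.log_inv, neg_neg]
    refine h2.trans ?_
    have : C * mm V s ≤ (C * mm V s) * E := le_mul_of_one_le_right (by positivity) hE1
    linarith
  obtain ⟨x, hx, hxi⟩ := good_line (a := s) (b := s + 1 / 2) (y1 := y0 - 1 / 2) (y2 := y0 + 1 / 2) (M := C * E * mm V s) two_pos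
    (by positivity) hGa hGc (fun ζ hζ => (hinv ζ hζ).2) (by linarith) (by linarith) (by
      intro x hx y hy
      rw [Metric.mem_closedBall, dist_eq_norm]
      refine (norm_le_abs_re_add_abs_im _).trans ?_
      rw [sub_re, sub_im, hcre, hcim]
      simp only [add_re, add_im, ofReal_re, ofReal_im, mul_re, mul_im, I_re, I_im, mul_one, mul_zero, sub_zero, add_zero, zero_add]
      have a1 : |x - s| ≤ 1 / 2 := abs_le.2 ⟨by linarith [hx.1], by linarith [hx.2]⟩
      have a2 : |y - (y0 + 1)| ≤ 3 / 2 := abs_le.2 ⟨by linarith [hy.1], by linarith [hy.2]⟩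
      linarith)
  refine ⟨x, hx, ?_⟩
  have hii := prox_int (h.mero 0) θ x
  have hGi : ∀ ζ, (G ζ)⁻¹ = U 0 (ex θ ζ) := fun ζ => inv_inv _
  simp only [hGi] at hxi
  have h1 := hxi (hii _ _)
  have h1' : ∫ y in (y0 - 1 / 2)..(y0 + 1 / 2), Real.posLog ‖U 0 (ex θ (x + y * I))‖ ≤ 32 * Real.pi * (C * E * mm V s) := by
    refine h1.trans ?_
    rw [show s + 1 / 2 - s = 1 / 2 by ring]
    have : Real.pi * (C * E * mm V s - Real.log ‖G c‖) ≤ Real.pi * (2 * (C * E * mm V s)) :=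
      mul_le_mul_of_nonneg_left (by linarith) Real.pi_pos.le
    linarith
  have hxs : |x - s| ≤ 2 := abs_le.2 ⟨by linarith [hx.1], by linarith [hx.2]⟩
  have h2 : ∫ y in (y0 + 1 / 2)..(y0 - 1 / 2 + 2 * Real.pi), Real.posLog ‖U 0 (ex θ (x + y * I))‖ ≤
      ∫ y in (y0 + 1 / 2)..(y0 - 1 / 2 + 2 * Real.pi), C * E * mm V s := by
    refine intervalIntegral.integral_mono_on (by linarith) (hii _ _) (by simp) fun y hy => ?_
    have hre : ((x:ℂ) + y * I).re = x := by simp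
    have him : ((x:ℂ) + y * I).im = y := by simp
    have := ((hb 0 (x + y * I) (by rw [hre]; linarith [hx.1])).1 (by rw [him, hL0]; linarith [hy.1])
      (by rw [him, hL0]; linarith [hy.2])).2
    rw [hre] at this
    have hnn : 0 ≤ C * E * mm V s := by positivity
    rw [Real.posLog]
    refine max_le hnn ?_
    by_cases hz : ‖U 0 (ex θ (x + y * I))‖ = 0
    · rw [hz, Real.log_zero]; exact hnn
    · refine (Real.log_le_iff_le_exp (lt_of_le_of_ne (norm_nonneg _) (Ne.symm hz))).2 (this.trans (Real.exp_le_exp.2 ?_))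
      rw [mul_assoc]
      exact mul_le_mul_of_nonneg_left (mm_near hL hs hxs) hC.le
  rw [intervalIntegral.integral_const, smul_eq_mul] at h2
  have h2' : (y0 - 1 / 2 + 2 * Real.pi - (y0 + 1 / 2)) * (C * E * mm V s) ≤ 2 * Real.pi * (C * E * mm V s) :=
    mul_le_mul_of_nonneg_right (by linarith) (by positivity)
  rw [prox_ex (U 0) θ x (y0 - 1 / 2), ← intervalIntegral.integral_add_adjacent_intervals (hii _ (y0 + 1 / 2)) (hii _ _),
    mul_assoc ((2 * Real.pi)⁻¹)]
  refine mul_le_mul_of_nonneg_left ?_ (by positivity)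
  linarith

/-! ### Section 7 - F -/

lemma ex_ball {θ : ℝ} {c w : ℂ} (hw : w ∈ Metric.closedBall (ex θ c) (Real.exp c.re / 2)) :
    ∃ ζ, ex θ ζ = w ∧ |ζ.re - c.re| ≤ 2 ∧ |ζ.im - c.im| ≤ Real.pi / 2 := by
  have hpi := Real.pi_pos
  rw [Metric.mem_closedBall, dist_eq_norm] at hw
  have hE := Real.exp_pos c.re
  have hn := norm_ex θ c
  have hlow : Real.exp c.re / 2 ≤ ‖w‖ := by
    have := norm_sub_norm_le (ex θ c) w
    rw [norm_sub_rev, hn] at this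
    linarith
  have hup : ‖w‖ ≤ 3 / 2 * Real.exp c.re := by
    have := norm_sub_norm_le w (ex θ c)
    rw [hn] at this
    linarith
  have hw0 : w ≠ 0 := norm_pos_iff.1 (by linarith)
  obtain ⟨ζ, h1, h2, h3, h4⟩ := ex_exists θ hw0 (c.im - Real.pi)
  refine ⟨ζ, h1, ?_, ?_⟩
  · have hwe : ‖w‖ = Real.exp ζ.re := by rw [← h1, norm_ex]
    rw [hwe] at hlow hup
    have e2 : (2:ℝ) ≤ Real.exp 2 := by linarith [Real.add_one_le_exp (2:ℝ)]
    rw [abs_le]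
    constructor
    · have : Real.exp (c.re - 2) ≤ Real.exp ζ.re := by
        rw [Real.exp_sub]
        refine le_trans ?_ hlow
        exact div_le_div_of_nonneg_left hE.le (by norm_num) e2
      linarith [Real.exp_le_exp.1 this]
    · have : Real.exp ζ.re ≤ Real.exp (c.re + 2) := by
        rw [Real.exp_add]
        nlinarith
      linarith [Real.exp_le_exp.1 this]
  · by_contra hcon
    push Not at hcon
    have habs : |ζ.im - c.im| ≤ Real.pi := abs_le.2 ⟨by linarith, by linarith⟩
    have hcos : Real.cos (ζ.im - c.im) ≤ 0 := by
      rw [← Real.cos_abs]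
      exact Real.cos_nonpos_of_pi_div_two_le_of_le hcon.le (by linarith)
    have hd : w = ex θ c * cexp (ζ - c) := by
      rw [← h1, ex, ex, ← Complex.exp_add]; congr 1; ring
    have hre : (cexp (ζ - c)).re ≤ 0 := by
      rw [Complex.exp_re, sub_im]
      exact mul_nonpos_of_nonneg_of_nonpos (Real.exp_pos _).le hcos
    have : ‖w - ex θ c‖ = Real.exp c.re * ‖cexp (ζ - c) - 1‖ := by
      rw [hd, ← hn, ← norm_mul]; congr 1; ring
    have h5 : 1 ≤ ‖cexp (ζ - c) - 1‖ := by
      have := abs_re_le_norm (cexp (ζ - c) - 1)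
      rw [sub_re, one_re] at this
      have := (neg_le_abs ((cexp (ζ - c)).re - 1)).trans this
      linarith
    rw [this] at hw
    nlinarith

theorem zeros_near {θ : ℝ} {U : ℤ → ℂ → ℂ} {R₀ : ℝ} (h : Tri θ U R₀)
    {V : ℤ → ℂ → ℂ} (hL : LogData V (Real.log R₀))
    (hV : ∀ k, ∀ ζ ∈ Dk (Real.log R₀) k, cexp (V k ζ) = U k (ex θ ζ)) :
    ∃ C > 0, ∀ s ≥ Real.log R₀ + 5,
      AnalyticOnNhd ℂ (U 0)⁻¹ (Metric.closedBall (ex θ (s + ((-(2 * Real.pi / 3) + 1 / 4 : ℝ) : ℂ) * I)) (Real.exp s / 2)) ∧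
      ((∑ᶠ u, MeromorphicOn.divisor (U 0)⁻¹
        (Metric.closedBall (ex θ (s + ((-(2 * Real.pi / 3) + 1 / 4 : ℝ) : ℂ) * I)) |Real.exp s / 3|) u : ℤ) : ℝ) ≤ C * mm V s := by
  have hpi := Real.pi_gt_three
  have hpi4 := Real.pi_le_four
  obtain ⟨C, hC, hb⟩ := h.ub hL hV (δ := 1 / 8) (by norm_num)
  have hL0 : Lk 0 = 0 := by simp [Lk]
  set y0 : ℝ := -(2 * Real.pi / 3) with hy0
  set E := Real.exp 12000 with hE
  have hE1 : 1 ≤ E := Real.one_le_exp (by norm_num)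
  have hl32 : 0 < Real.log (3 / 2) := Real.log_pos (by norm_num)
  refine ⟨2 * (C * E) / Real.log (3 / 2), by positivity, fun s hs => ?_⟩
  have h6 := LogData.six_le_mm V s
  have hEs := Real.exp_pos s
  set c : ℂ := s + ((y0 + 1 / 4 : ℝ) : ℂ) * I with hc
  have hcre : c.re = s := by simp [hc]
  have hcim : c.im = y0 + 1 / 4 := by simp [hc]
  have hinv : ∀ w ∈ Metric.closedBall (ex θ c) (Real.exp s / 2),
      meromorphicOrderAt (U 0) w ≤ 0 ∧ ‖(U 0)⁻¹ w‖ ≤ Real.exp (C * E * mm V s) := by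
    intro w hw
    rw [← hcre] at hw
    obtain ⟨ζ, hζ, h1, h2⟩ := ex_ball hw
    rw [hcre] at h1
    rw [hcim] at h2
    have h1' := abs_le.1 h1
    have h2' := abs_le.1 h2
    have := (hb 0 ζ (by linarith)).2 (by rw [hL0]; linarith) (by rw [hL0]; linarith)
    rw [hζ] at this
    refine ⟨this.1, this.2.trans (Real.exp_le_exp.2 ?_)⟩
    rw [mul_assoc]
    exact mul_le_mul_of_nonneg_left (mm_near hL hs h1) hC.le
  have hGa : AnalyticOnNhd ℂ (U 0)⁻¹ (Metric.closedBall (ex θ c) (Real.exp s / 2)) := fun w hw =>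
    h.analyticAt_inv (hinv w hw).1
  refine ⟨hGa, ?_⟩
  have hcD : c ∈ Dk (Real.log R₀) 0 := by
    refine ⟨by rw [hcre]; linarith, ?_⟩
    show |c.im - Lk 0| < _
    rw [hcim, hL0, abs_lt]; constructor <;> linarith
  have hU0 := h.ne_zero (h.ord_zero hcD)
  have hGc : (U 0)⁻¹ (ex θ c) ≠ 0 := inv_ne_zero hU0
  have habs : |Real.exp s / 2| = Real.exp s / 2 := abs_of_pos (by positivity)
  have key := AnalyticOnNhd.sum_divisor_le (c := ex θ c) (r := Real.exp s / 3) (R := Real.exp s / 2)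
    (M := Real.exp (C * E * mm V s)) (f := (U 0)⁻¹) (by positivity) (by rw [habs, abs_of_pos (by positivity)]; linarith)
    (Real.one_le_exp (by positivity)) (by rwa [habs]) hGc
    (fun z hz => (hinv z (by rw [habs] at hz; exact Metric.sphere_subset_closedBall hz)).2)
  refine key.trans ?_
  have e1 : Real.exp s / 2 / (Real.exp s / 3) = 3 / 2 := by field_simp
  rw [e1, div_mul_eq_mul_div]
  refine div_le_div_of_nonneg_right ?_ hl32.le
  have h1 := ((hb 0 c (by rw [hcre]; linarith)).1 (by rw [hL0, hcim]; linarith) (by rw [hL0, hcim]; linarith)).2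
  rw [hcre] at h1
  have h2 : Real.log ‖U 0 (ex θ c)‖ ≤ C * mm V s := (Real.log_le_iff_le_exp (norm_pos_iff.2 hU0)).2 h1
  rw [Real.log_div (Real.exp_pos _).ne' (norm_ne_zero_iff.2 hGc), Real.log_exp, Pi.inv_apply, norm_inv, Real.log_inv]
  have : C * mm V s ≤ (C * mm V s) * E := le_mul_of_one_le_right (by positivity) hE1
  linarith

lemma ray_ball {θ s y0 : ℝ} {z : ℂ} (hz : z ∈ Ray (θ + y0)) (h1 : Real.exp (s - 1 / 12) ≤ ‖z‖) (h2 : ‖z‖ ≤ Real.exp s) :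
    z ∈ Metric.closedBall (ex θ (s + ((y0 + 1 / 4 : ℝ) : ℂ) * I)) (Real.exp s / 3) := by
  obtain ⟨t, ht, rfl⟩ := hz
  have hE := Real.exp_pos s
  rw [norm_mul, Complex.norm_exp_ofReal_mul_I, mul_one, Complex.norm_real, Real.norm_eq_abs, abs_of_pos ht] at h1 h2
  have h3 : Real.exp s - t ≤ Real.exp s / 12 := by
    rw [Real.exp_sub] at h1
    have : Real.exp s * (1 - 1 / 12) ≤ Real.exp s / Real.exp (1 / 12) := by
      rw [← Real.exp_sub, sub_eq_add_neg s, Real.exp_add]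
      refine mul_le_mul_of_nonneg_left ?_ hE.le
      linarith [Real.add_one_le_exp (-(1 / 12 : ℝ))]
    linarith
  rw [Metric.mem_closedBall, dist_eq_norm]
  have e1 : ex θ (s + ((y0 + 1 / 4 : ℝ) : ℂ) * I) = (Real.exp s : ℂ) * (cexp ((θ + y0 : ℝ) * I) * cexp (I * (1 / 4 : ℝ))) := by
    rw [ex, Complex.ofReal_exp, ← Complex.exp_add, ← Complex.exp_add]
    congr 1; push_cast; ring
  rw [e1]
  have e2 : (t : ℂ) * cexp ((θ + y0 : ℝ) * I) - (Real.exp s : ℂ) * (cexp ((θ + y0 : ℝ) * I) * cexp (I * (1 / 4 : ℝ))) =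
      cexp ((θ + y0 : ℝ) * I) * (((t - Real.exp s : ℝ) : ℂ) - Real.exp s * (cexp (I * (1 / 4 : ℝ)) - 1)) := by
    push_cast; ring
  rw [e2, norm_mul, Complex.norm_exp_ofReal_mul_I, one_mul]
  refine (norm_sub_le _ _).trans ?_
  rw [norm_mul, Complex.norm_real, Complex.norm_real, Real.norm_eq_abs, Real.norm_eq_abs, abs_of_pos hE]
  have h4 := Real.norm_exp_I_mul_ofReal_sub_one_le (x := 1 / 4)
  rw [Real.norm_eq_abs, abs_of_pos (by norm_num : (0:ℝ) < 1 / 4)] at h4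
  have h5 : |t - Real.exp s| ≤ Real.exp s / 12 := abs_le.2 ⟨by linarith, by linarith⟩
  have h6 := mul_le_mul_of_nonneg_left h4 hE.le
  linarith

/-! ### Section 7 - G -/

/-- multiplicity of the pole -/
def pmul (F : ℂ → ℂ) (z : ℂ) : ℤ := (MeromorphicOn.divisor F univ)⁻ z

lemma pmul_eq {F : ℂ → ℂ} (hF : ∀ z, MeromorphicAt F z) (z : ℂ) : pmul F z = (meromorphicOrderAt F z).untop₀⁻ := by
  rw [pmul, Function.locallyFinsuppWithin.negPart_apply, MeromorphicOn.divisor_apply (fun w _ => hF w) (mem_univ z)]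

lemma pmul_nonneg {F : ℂ → ℂ} (hF : ∀ z, MeromorphicAt F z) (z : ℂ) : 0 ≤ pmul F z := by
  rw [pmul_eq hF]; exact negPart_nonneg _

lemma pmul_ne {F : ℂ → ℂ} (hF : ∀ z, MeromorphicAt F z) {z : ℂ} (h : pmul F z ≠ 0) :
    meromorphicOrderAt F z < 0 ∧ pmul F z = - (meromorphicOrderAt F z).untop₀ := by
  rw [pmul_eq hF] at h
  have h1 : (meromorphicOrderAt F z).untop₀ < 0 := by
    by_contra hc; exact h (negPart_eq_zero.2 (not_lt.1 hc))
  refine ⟨?_, ?_⟩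
  · by_contra hc
    exact absurd (WithTop.untop₀_nonneg.2 (not_lt.1 hc)) (not_le.2 h1)
  · rw [pmul_eq hF, negPart_of_nonpos h1.le]

/-- counting function -/
def pcnt {F : ℂ → ℂ} (hF : ∀ z, MeromorphicAt F z) (ht : ∀ z, meromorphicOrderAt F z ≠ ⊤) (ρ : ℝ) : ℝ :=
  ∑ z ∈ (finite_ord hF ht ρ).toFinset, (pmul F z : ℝ)

lemma pcnt_mono {F : ℂ → ℂ} (hF : ∀ z, MeromorphicAt F z) (ht : ∀ z, meromorphicOrderAt F z ≠ ⊤) {a b : ℝ} (hab : a ≤ b) :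
    pcnt hF ht a ≤ pcnt hF ht b := by
  refine Finset.sum_le_sum_of_subset_of_nonneg ?_ fun z _ _ => by exact_mod_cast pmul_nonneg hF z
  intro z hz
  rw [Finite.mem_toFinset] at hz ⊢
  exact ⟨hz.1.trans hab, hz.2⟩

lemma pcnt_nonneg {F : ℂ → ℂ} (hF : ∀ z, MeromorphicAt F z) (ht : ∀ z, meromorphicOrderAt F z ≠ ⊤) (a : ℝ) :
    0 ≤ pcnt hF ht a := Finset.sum_nonneg fun z _ => by exact_mod_cast pmul_nonneg hF z

lemma pmul_le_pcnt {F : ℂ → ℂ} (hF : ∀ z, MeromorphicAt F z) (ht : ∀ z, meromorphicOrderAt F z ≠ ⊤) {a : ℝ} {z : ℂ}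
    (hz : ‖z‖ ≤ a) : (pmul F z : ℝ) ≤ pcnt hF ht a := by
  by_cases h0 : pmul F z = 0
  · rw [h0]; simpa using pcnt_nonneg hF ht a
  · exact Finset.single_le_sum (f := fun z => (pmul F z : ℝ)) (fun z _ => by exact_mod_cast pmul_nonneg hF z)
      ((Finite.mem_toFinset _).2 ⟨hz, (pmul_ne hF h0).1.ne⟩)

lemma lc_bound {F : ℂ → ℂ} (hF : ∀ z, MeromorphicAt F z) (ht : ∀ z, meromorphicOrderAt F z ≠ ⊤) :
    ∃ K ≥ 0, ∀ s ≥ 0, ValueDistribution.logCounting F ⊤ (Real.exp s) ≤ 2 * pcnt hF ht (Real.exp s) * (s + K) := by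
  set T1 := (finite_ord hF ht 1).toFinset with hT1
  set K := ∑ z ∈ T1, |Real.log ‖z‖| with hK
  have hK0 : 0 ≤ K := Finset.sum_nonneg fun _ _ => abs_nonneg _
  refine ⟨K, hK0, fun s hs => ?_⟩
  have hE := Real.exp_pos s
  have hlog : ∀ z, meromorphicOrderAt F z ≠ 0 → -Real.log ‖z‖ ≤ K := by
    intro z hz
    rcases le_total ‖z‖ 1 with h1 | h1
    · exact (neg_le_abs _).trans (Finset.single_le_sum (f := fun z : ℂ => |Real.log ‖z‖|) (fun _ _ => abs_nonneg _)
        ((Finite.mem_toFinset _).2 ⟨h1, hz⟩))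
    · linarith [Real.log_nonneg h1]
  rw [ValueDistribution.logCounting_top]
  show (∑ᶠ z, (Function.locallyFinsuppWithin.toClosedBall (Real.exp s) (MeromorphicOn.divisor F univ)⁻ z : ℝ) *
    Real.log (Real.exp s * ‖z‖⁻¹) + (pmul F 0 : ℝ) * Real.log (Real.exp s)) ≤ _
  have habs : |Real.exp s| = Real.exp s := abs_of_pos hE
  have hsupp : (Function.support fun z => (Function.locallyFinsuppWithin.toClosedBall (Real.exp s) (MeromorphicOn.divisor F univ)⁻ z : ℝ) *
    Real.log (Real.exp s * ‖z‖⁻¹)) ⊆ (finite_ord hF ht (Real.exp s)).toFinset := by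
    intro z hz
    rw [Finite.coe_toFinset]
    have h1 : (Function.locallyFinsuppWithin.toClosedBall (Real.exp s) (MeromorphicOn.divisor F univ)⁻ z) ≠ 0 := by
      intro h0; apply hz; simp [h0]
    by_cases hz2 : z ∈ Metric.closedBall (0:ℂ) |Real.exp s|
    · rw [Function.locallyFinsuppWithin.toClosedBall_eval_within _ hz2] at h1
      refine ⟨by simpa [habs] using hz2, (pmul_ne hF h1).1.ne⟩
    · exact absurd (Function.locallyFinsuppWithin.apply_eq_zero_of_notMem _ hz2) h1
  rw [finsum_eq_sum_of_support_subset _ hsupp, Real.log_exp]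
  have h1 : ∑ z ∈ (finite_ord hF ht (Real.exp s)).toFinset,
      (Function.locallyFinsuppWithin.toClosedBall (Real.exp s) (MeromorphicOn.divisor F univ)⁻ z : ℝ) *
        Real.log (Real.exp s * ‖z‖⁻¹) ≤ pcnt hF ht (Real.exp s) * (s + K) := by
    rw [pcnt, Finset.sum_mul]
    refine Finset.sum_le_sum fun z hz => ?_
    rw [Finite.mem_toFinset] at hz
    rw [Function.locallyFinsuppWithin.toClosedBall_eval_within _ (by simpa using hz.1)]
    refine mul_le_mul_of_nonneg_left ?_ (by exact_mod_cast pmul_nonneg hF z)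
    by_cases hz0 : z = 0
    · simp [hz0]; linarith
    · rw [Real.log_mul hE.ne' (inv_ne_zero (norm_ne_zero_iff.2 hz0)), Real.log_exp, Real.log_inv]
      linarith [hlog z hz.2]
  have h2 : (pmul F 0 : ℝ) * s ≤ pcnt hF ht (Real.exp s) * (s + K) :=
    mul_le_mul (pmul_le_pcnt hF ht (by simp [hE.le])) (by linarith) hs (pcnt_nonneg _ _ _)
  linarith

theorem pcnt_step {θ : ℝ} {U : ℤ → ℂ → ℂ} {R₀ : ℝ} (h : Tri θ U R₀)
    {V : ℤ → ℂ → ℂ} (hL : LogData V (Real.log R₀))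
    (hV : ∀ k, ∀ ζ ∈ Dk (Real.log R₀) k, cexp (V k ζ) = U k (ex θ ζ)) :
    ∃ C > 0, ∀ s ≥ Real.log R₀ + 5,
      pcnt (h.mero 0) (h.ne_top 0) (Real.exp s) ≤ pcnt (h.mero 0) (h.ne_top 0) (Real.exp (s - 1 / 12)) + C * mm V s := by
  classical
  obtain ⟨C, hC, hz⟩ := zeros_near h hL hV
  refine ⟨C, hC, fun s hs => ?_⟩
  obtain ⟨hA, hS⟩ := hz s hs
  set zc := ex θ (s + ((-(2 * Real.pi / 3) + 1 / 4 : ℝ) : ℂ) * I) with hzc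
  have hE := Real.exp_pos s
  have hR := h.one_le
  have hab : |Real.exp s / 3| = Real.exp s / 3 := abs_of_pos (by positivity)
  have hsub : Metric.closedBall zc |Real.exp s / 3| ⊆ Metric.closedBall zc (Real.exp s / 2) :=
    Metric.closedBall_subset_closedBall (by rw [hab]; linarith)
  have hA' := hA.mono hsub
  set D := MeromorphicOn.divisor (U 0)⁻¹ (Metric.closedBall zc |Real.exp s / 3|) with hD
  have hfin : D.support.Finite := D.finiteSupport (isCompact_closedBall _ _)
  set T := (finite_ord (h.mero 0) (h.ne_top 0) (Real.exp s)).toFinset with hT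
  set T' := (finite_ord (h.mero 0) (h.ne_top 0) (Real.exp (s - 1 / 12))).toFinset with hT'
  have hTT : T' ⊆ T := by
    intro z hz
    rw [Finite.mem_toFinset] at hz ⊢
    exact ⟨hz.1.trans (Real.exp_le_exp.2 (by linarith)), hz.2⟩
  have hsum : pcnt (h.mero 0) (h.ne_top 0) (Real.exp s) =
      ∑ z ∈ T \ T', (pmul (U 0) z : ℝ) + pcnt (h.mero 0) (h.ne_top 0) (Real.exp (s - 1 / 12)) :=
    (Finset.sum_sdiff hTT).symm
  have hDn : ∀ z, 0 ≤ D z := MeromorphicOn.AnalyticOnNhd.divisor_nonneg hA'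
  have hkey : ∀ z ∈ T \ T', pmul (U 0) z ≠ 0 → pmul (U 0) z = D z := by
    intro z hz hp
    obtain ⟨h1, h2⟩ := pmul_ne (h.mero 0) hp
    rw [Finset.mem_sdiff, Finite.mem_toFinset, Finite.mem_toFinset] at hz
    have h3 : Real.exp (s - 1 / 12) < ‖z‖ := by
      by_contra hc; exact hz.2 ⟨not_lt.1 hc, hz.1.2⟩
    have hRz : R₀ < ‖z‖ := by
      refine lt_trans ?_ h3
      rw [← Real.log_lt_iff_lt_exp (by linarith)]
      linarith
    have hray := h.pol 0 z hRz h1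
    have hray' : z ∈ Ray (θ + -(2 * Real.pi / 3)) := by
      rw [← Ray_add _ 1]
      convert hray using 2
      simp [Lk]; ring
    have hb := ray_ball hray' h3.le hz.1.1
    rw [hD, MeromorphicOn.divisor_apply hA'.meromorphicOn (by rw [hab]; exact hb), h2, meromorphicOrderAt_inv]
    exact (WithTop.untop₀_neg _).symm
  have hle : ∑ z ∈ T \ T', (pmul (U 0) z : ℝ) ≤ ((∑ᶠ u, D u : ℤ) : ℝ) := by
    rw [finsum_eq_sum_of_support_subset (s := hfin.toFinset) _ (by rw [Finite.coe_toFinset])]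
    have : ∑ z ∈ T \ T', pmul (U 0) z ≤ ∑ u ∈ hfin.toFinset, D u := by
      rw [← Finset.sum_filter_ne_zero]
      have : ∑ z ∈ (T \ T').filter (fun z => pmul (U 0) z ≠ 0), pmul (U 0) z =
          ∑ z ∈ (T \ T').filter (fun z => pmul (U 0) z ≠ 0), D z :=
        Finset.sum_congr rfl fun z hz => hkey z (Finset.mem_filter.1 hz).1 (Finset.mem_filter.1 hz).2
      rw [this]
      refine Finset.sum_le_sum_of_subset_of_nonneg ?_ fun z _ _ => hDn z
      intro z hz
      rw [Finset.mem_filter] at hz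
      rw [Finite.mem_toFinset, Function.mem_support, ← hkey z hz.1 hz.2]
      exact hz.2
    exact_mod_cast this
  linarith

/-! ### Section 7 - H -/

lemma step_bound {q m : ℝ → ℝ} {s1 τ C : ℝ} (hs1 : 0 ≤ s1) (hτ : 0 < τ) (hC : 0 ≤ C)
    (hmono : Monotone q) (hq : ∀ s, 0 ≤ q s)
    (hstep : ∀ s ≥ s1, q s ≤ q (s - 1 / 12) + m s) (hm : ∀ s ≥ s1, m s ≤ C * Real.exp (τ * s)) :
    ∃ A ≥ 0, ∀ s ≥ s1, q s ≤ A * Real.exp (τ * s) := by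
  set κ := 1 - Real.exp (-(τ / 12)) with hκ
  have hκ0 : 0 < κ := by
    have : Real.exp (-(τ / 12)) < 1 := by
      rw [← Real.exp_zero]; exact Real.exp_lt_exp.2 (by linarith)
    linarith
  have hd : 0 ≤ C / κ := by positivity
  refine ⟨q (s1 + 1 / 12) + C / κ, by linarith [hq (s1 + 1 / 12)], ?_⟩
  set A := q (s1 + 1 / 12) + C / κ with hA
  have hA0 : 0 ≤ A := by linarith [hq (s1 + 1 / 12)]
  have key : ∀ n : ℕ, ∀ s ≥ s1, s ≤ s1 + (n + 1) / 12 → q s ≤ A * Real.exp (τ * s) := by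
    intro n
    induction n with
    | zero =>
      intro s h1 h2
      have h3 : q s ≤ A := by
        have := hmono (show s ≤ s1 + 1 / 12 by simpa using h2)
        linarith
      exact h3.trans (le_mul_of_one_le_right hA0 (Real.one_le_exp (by nlinarith)))
    | succ n ih =>
      intro s h1 h2
      push_cast at h2
      rcases le_total s (s1 + (n + 1) / 12) with h3 | h3
      · exact ih s h1 h3
      have h4 : s1 ≤ s - 1 / 12 := by
        have : (0:ℝ) ≤ n := Nat.cast_nonneg n
        linarith
      have h5 := ih (s - 1 / 12) h4 (by linarith)
      have h6 := hstep s h1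
      have h7 := hm s h1
      have e1 : Real.exp (τ * (s - 1 / 12)) = Real.exp (τ * s) * (1 - κ) := by
        rw [hκ, sub_sub_cancel, ← Real.exp_add]; congr 1; ring
      rw [e1] at h5
      have h8 : C ≤ A * κ := by
        rw [← div_le_iff₀ hκ0]; linarith [hq (s1 + 1 / 12)]
      have h9 := mul_le_mul_of_nonneg_right h8 (Real.exp_pos (τ * s)).le
      nlinarith
  intro s hs
  obtain ⟨n, hn⟩ := exists_nat_ge (12 * (s - s1))
  exact key n s hs (by linarith)

theorem T_upper {θ : ℝ} {f : ℂ → ℂ} {P : Set ℂ} (hf : MeromOn f P univ) (ht : ¬ IsRationalFn f P)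
    {U : ℤ → ℂ → ℂ} {R₀ : ℝ} (h : Tri θ U R₀)
    (hU : ∀ k, ∃ a b : Option ℂ, ∃ c, c ≠ 0 ∧ a ≠ b ∧ ∀ z, ∀ᶠ w in 𝓝[≠] z, U k w = c * lin a (f w) / lin b (f w))
    {V : ℤ → ℂ → ℂ} (hL : LogData V (Real.log R₀))
    (hV : ∀ k, ∀ ζ ∈ Dk (Real.log R₀) k, cexp (V k ζ) = U k (ex θ ζ)) {σ : ℝ} (hσ : 3 / 2 < σ) :
    ∃ C > 0, ∀ s ≥ Real.log R₀ + 5, ValueDistribution.characteristic f ⊤ (Real.exp s) ≤ C * Real.exp (σ * s) := by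
  have hlog := Real.log_nonneg h.one_le
  set τ := (σ + 3 / 2) / 2 with hτ
  have hτ1 : 3 / 2 < τ := by linarith
  set ε := σ - τ with hε
  have hε0 : 0 < ε := by linarith
  obtain ⟨C1, hC1⟩ := hL.growth1 hτ1
  have hC10 : 0 ≤ C1 := by
    have h1 := hC1 (Real.log R₀ + 3) le_rfl
    have h2 := LogData.six_le_mm V (Real.log R₀ + 3)
    by_contra hc
    have := mul_neg_of_neg_of_pos (not_le.1 hc) (Real.exp_pos (τ * (Real.log R₀ + 3)))
    linarith
  obtain ⟨C2, hC2, hstep⟩ := pcnt_step h hL hV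
  obtain ⟨A, hA, hpc⟩ := step_bound (q := fun s => pcnt (h.mero 0) (h.ne_top 0) (Real.exp s)) (m := fun s => C2 * mm V s)
    (s1 := Real.log R₀ + 5) (τ := τ) (C := C2 * C1) (by linarith) (by linarith) (by positivity)
    (fun a b hab => pcnt_mono _ _ (Real.exp_le_exp.2 hab)) (fun s => pcnt_nonneg _ _ _) hstep
    (fun s hs => by
      rw [mul_assoc]
      exact mul_le_mul_of_nonneg_left (hC1 s (by linarith)) hC2.le)
  obtain ⟨K, hK, hlc⟩ := lc_bound (h.mero 0) (h.ne_top 0)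
  obtain ⟨C3, hC3, hpx⟩ := prox_upper h hL hV
  obtain ⟨C4, hC4⟩ : TEq f (U 0) := by
    obtain ⟨a, b, c, hc, hab, he⟩ := hU 0
    exact TEq_lin hf ht hab hc he
  set B := C3 * C1 + 2 * A * (1 / ε + K) * Real.exp (σ / 2) + |C4| + 1 with hB
  refine ⟨B, by positivity, fun s hs => ?_⟩
  have hs0 : 0 ≤ s := by linarith
  obtain ⟨x, hx, hxp⟩ := hpx s hs
  have hx0 : 0 ≤ x := by linarith [hx.1]
  have hEs : 1 ≤ Real.exp (σ * s) := Real.one_le_exp (by nlinarith)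
  have hmero : Meromorphic (U 0) := fun z => h.mero 0 z
  have h1 := ValueDistribution.characteristic_monotoneOn hmero (Real.exp_pos s) (Real.exp_pos x) (Real.exp_le_exp.2 hx.1)
  have h2 : ValueDistribution.characteristic (U 0) ⊤ (Real.exp x) =
    ValueDistribution.proximity (U 0) ⊤ (Real.exp x) + ValueDistribution.logCounting (U 0) ⊤ (Real.exp x) := rfl
  have h3 := (abs_le.1 (hC4 (Real.exp s) (Real.one_le_exp hs0))).2
  have h4 := hlc x hx0
  have h5 : pcnt (h.mero 0) (h.ne_top 0) (Real.exp x) ≤ A * Real.exp (τ * x) := hpc x (by linarith [hx.1])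
  have h6 : x + K ≤ (1 / ε + K) * Real.exp (ε * x) := by
    have a1 : x ≤ 1 / ε * Real.exp (ε * x) := by
      have := Real.add_one_le_exp (ε * x)
      rw [div_mul_eq_mul_div, one_mul, le_div_iff₀ hε0]
      linarith
    have a2 : K ≤ K * Real.exp (ε * x) := le_mul_of_one_le_right hK (Real.one_le_exp (by positivity))
    linarith
  have h7 : 2 * pcnt (h.mero 0) (h.ne_top 0) (Real.exp x) * (x + K) ≤
      2 * A * (1 / ε + K) * Real.exp (σ / 2) * Real.exp (σ * s) := by
    calc 2 * pcnt (h.mero 0) (h.ne_top 0) (Real.exp x) * (x + K)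
        ≤ 2 * (A * Real.exp (τ * x)) * ((1 / ε + K) * Real.exp (ε * x)) :=
          mul_le_mul (by linarith) h6 (by positivity) (by positivity)
      _ = 2 * A * (1 / ε + K) * Real.exp (σ * x) := by
          rw [show σ * x = τ * x + ε * x by rw [hε]; ring, Real.exp_add]; ring
      _ ≤ 2 * A * (1 / ε + K) * (Real.exp (σ / 2) * Real.exp (σ * s)) := by
          refine mul_le_mul_of_nonneg_left ?_ (by positivity)
          rw [← Real.exp_add]
          exact Real.exp_le_exp.2 (by nlinarith [hx.2])
      _ = _ := by ring
  have h8 : C3 * mm V s ≤ C3 * C1 * Real.exp (σ * s) := by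
    rw [mul_assoc]
    refine mul_le_mul_of_nonneg_left ((hC1 s (by linarith)).trans (mul_le_mul_of_nonneg_left (Real.exp_le_exp.2 ?_) hC10)) hC3.le
    nlinarith
  have h9 : C4 ≤ (|C4| + 1) * Real.exp (σ * s) := by
    have := le_abs_self C4
    have h0 := abs_nonneg C4
    nlinarith
  rw [hB, add_mul, add_mul, add_mul]
  linarith

/-! ### Section 8 -/

theorem order_eq_three_halves_of_three_radially_distributed_values
    (θ : ℝ) (f : ℂ → ℂ) (P : Set ℂ)
    (hf : MeromOn f P Set.univ) (htrans : ¬ IsRationalFn f P)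
    (a₁ a₂ a₃ : Option ℂ) (h12 : a₁ ≠ a₂) (h13 : a₁ ≠ a₃) (h23 : a₂ ≠ a₃)
    (h1 : (aPoints f P a₁ \ Ray θ).Finite)
    (h2 : (aPoints f P a₂ \ Ray (θ + 2 * Real.pi / 3)).Finite)
    (h3 : (aPoints f P a₃ \ Ray (θ + 4 * Real.pi / 3)).Finite) :
    meromOrder f P = ((3 / 2 : ℝ) : EReal) := by
  obtain ⟨U, R₀, h, hU⟩ := exists_Tri θ f P hf htrans a₁ a₂ a₃ h12 h13 h23 h1 h2 h3
  obtain ⟨V, hL, hV⟩ := h.exists_log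
  have hlog := Real.log_nonneg h.one_le
  have hmero : Meromorphic f := fun z => hf.meromorphicAt z
  have hTe : ∀ r : ℝ, 0 < r → Tchar f P r = ValueDistribution.characteristic f ⊤ r := fun r hr => Tchar_eq hf hr
  have hTn : ∀ r : ℝ, 1 ≤ r → 0 ≤ Tchar f P r := fun r hr => by
    rw [hTe r (by linarith)]; exact ValueDistribution.characteristic_nonneg hr
  apply le_antisymm
  · by_contra hc
    push Not at hc
    obtain ⟨σ, hσ1, hσ2⟩ := EReal.lt_iff_exists_real_btwn.1 hc
    have hσ : 3 / 2 < σ := by exact_mod_cast hσ1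
    refine absurd hσ2 (not_lt.2 ?_)
    unfold meromOrder
    set τ := (σ + 3 / 2) / 2 with hτ
    obtain ⟨C, hC, hT⟩ := T_upper hf htrans h hU hL hV (σ := τ) (by linarith)
    refine limsup_le_of_le (h := ?_)
    have hlt : Tendsto Real.log atTop atTop := Real.tendsto_log_atTop
    filter_upwards [eventually_ge_atTop (1:ℝ), hlt.eventually_ge_atTop (Real.log R₀ + 5),
      hlt.eventually_ge_atTop (Real.log C / (σ - τ))] with r hr1 hr2 hr3
    have hr0 : 0 < r := by linarith
    have hlr : 0 < Real.log r := by linarith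
    have hστ : 0 < σ - τ := by linarith
    refine EReal.coe_le_coe_iff.2 ?_
    rw [div_le_iff₀ hlr]
    rcases (hTn r hr1).eq_or_lt with h0 | h0
    · rw [← h0, Real.log_zero]
      have : 0 < σ := by linarith
      positivity
    · have h4 := hT (Real.log r) hr2
      rw [Real.exp_log hr0, ← hTe r hr0] at h4
      have h5 := Real.log_le_log h0 h4
      rw [Real.log_mul hC.ne' (Real.exp_pos _).ne', Real.log_exp] at h5
      rw [div_le_iff₀ hστ] at hr3
      linarith
  · by_contra hc
    push Not at hc
    obtain ⟨σ, hσ1, hσ2⟩ := EReal.lt_iff_exists_real_btwn.1 hc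
    have hσ : σ < 3 / 2 := by exact_mod_cast hσ2
    have hev := eventually_lt_of_limsup_lt (hσ1 : limsup _ _ < _)
    obtain ⟨r0, hr0⟩ := eventually_atTop.1 hev
    obtain ⟨C, hC, hTl⟩ := T_lower hf htrans h hU hL hV
    set τ := max σ 1 with hτ
    have hτ1 : 1 ≤ τ := le_max_right _ _
    set s2 := max (max (Real.log (max r0 1)) (Real.log R₀ + 3)) 1 with hs2
    have hs21 : 1 ≤ s2 := le_max_right _ _
    have hbig : ∀ s ≥ s2, ValueDistribution.characteristic f ⊤ (Real.exp s) ≤ Real.exp (τ * s) := by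
      intro s hs
      have hs1 : 1 ≤ s := by linarith
      have hge : r0 ≤ Real.exp s := by
        have : Real.log (max r0 1) ≤ s := ((le_max_left _ _).trans (le_max_left _ _)).trans hs
        have := (Real.log_le_iff_le_exp (lt_of_lt_of_le one_pos (le_max_right r0 1))).1 this
        exact (le_max_left _ _).trans this
      have h4 := hr0 (Real.exp s) hge
      have h5 : Real.log (Tchar f P (Real.exp s)) / Real.log (Real.exp s) < σ := by exact_mod_cast h4
      rw [Real.log_exp, div_lt_iff₀ (by linarith)] at h5
      have h6 := hTn (Real.exp s) (Real.one_le_exp (by linarith))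
      rw [← hTe _ (Real.exp_pos s)]
      rcases h6.eq_or_lt with h0 | h0
      · rw [← h0]; positivity
      · rw [← Real.log_le_iff_le_exp h0]
        have : σ * s ≤ τ * s := mul_le_mul_of_nonneg_right (le_max_left _ _) (by linarith)
        linarith
    refine no_small hf htrans h hU hL hV (hL.growth2 (σ := τ) (max_lt hσ (by norm_num)) ?_)
    set K := Real.exp (τ * s2) with hK
    have hK1 : 1 ≤ K := Real.one_le_exp (by positivity)
    refine ⟨C * (K + C), fun s hs => (hTl s hs).trans ?_⟩
    have hs0 : 0 ≤ s := by linarith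
    have hE1 : 1 ≤ Real.exp (τ * s) := Real.one_le_exp (by positivity)
    rw [mul_assoc]
    refine mul_le_mul_of_nonneg_left ?_ hC.le
    have hTK : ValueDistribution.characteristic f ⊤ (Real.exp s) ≤ K * Real.exp (τ * s) := by
      rcases le_total s2 s with h4 | h4
      · exact (hbig s h4).trans (le_mul_of_one_le_left (by positivity) hK1)
      · exact (ValueDistribution.characteristic_monotoneOn hmero (Real.exp_pos s) (Real.exp_pos s2)
          (Real.exp_le_exp.2 h4)).trans ((hbig s2 le_rfl).trans (le_mul_of_one_le_right (by positivity) hE1))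
    rw [add_mul]
    have : C ≤ C * Real.exp (τ * s) := le_mul_of_one_le_right hC.le hE1
    linarith
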